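/- Uniformly on every compact subset of the open unit disk 𝔻, the monic orthogonal polynomials satisfy Φ_n(z) = (D_i(W;0)/D_i(W;z)) · (1/n) · ( Σ_{k=1}^m β_k ϑ_k a_k^{n+1}/(a_k − z) + O(1/n) ) as n → ∞. -/

import Mathlib

open scoped Real
open Filter MeasureTheory Metric Set Polynomial

namespace OPUC

open scoped ComplexConjugate

/-- Monic orthogonal polynomials for a finite measure on the unit circle. -/
structure OPS (ν : Measure ℂ) (Φ : ℕ → ℂ[X]) : Prop where
  finite : IsFiniteMeasure ν
  supp : ∀ᵐ t ∂ν, ‖t‖ = 1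
  nondeg : ∀ p : ℂ[X], (∀ᵐ t ∂ν, p.eval t = 0) → p = 0
  monic : ∀ n, (Φ n).Monic
  natDegree : ∀ n, (Φ n).natDegree = n
  orth : ∀ n, ∀ j < n, ∫ t, (Φ n).eval t * conj t ^ j ∂ν = 0

/-- The inner product of two polynomials in `L²(ν)`. -/
noncomputable def ip (ν : Measure ℂ) (p q : ℂ[X]) : ℂ := ∫ t, p.eval t * conj (q.eval t) ∂ν

/-- The reversed polynomials. -/
noncomputable def rev (Φ : ℕ → ℂ[X]) (n : ℕ) : ℂ[X] := reflect n ((Φ n).map (starRingEnd ℂ))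

/-- The Verblunsky coefficients. -/
noncomputable def verb (Φ : ℕ → ℂ[X]) (n : ℕ) : ℂ := -conj ((Φ (n + 1)).eval 0)

/-- The squared norms of the monic orthogonal polynomials. -/
noncomputable def nsq (ν : Measure ℂ) (Φ : ℕ → ℂ[X]) (n : ℕ) : ℝ := ∫ t, ‖(Φ n).eval t‖ ^ 2 ∂ν

/-- The Christoffel-Darboux kernel. -/
noncomputable def cdk (ν : Measure ℂ) (Φ : ℕ → ℂ[X]) (n : ℕ) (z t : ℂ) : ℂ :=
  ∑ k ∈ Finset.range n, (Φ k).eval z * conj ((Φ k).eval t) / nsq ν Φ k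

section Basic

lemma mul_conj_one {t : ℂ} (ht : ‖t‖ = 1) : t * conj t = 1 := by
  rw [Complex.mul_conj, Complex.normSq_eq_norm_sq, ht]; norm_num

lemma ne_zero_of_norm_one {t : ℂ} (ht : ‖t‖ = 1) : t ≠ 0 := by
  intro h; rw [h, norm_zero] at ht; norm_num at ht

lemma continuous_conj_eval (q : ℂ[X]) : Continuous fun t : ℂ => conj (q.eval t) :=
  Complex.continuous_conj.comp q.continuous

lemma degree_C_mul_le (c : ℂ) (p : ℂ[X]) : (C c * p).degree ≤ p.degree := by
  rw [← smul_eq_C_mul]; exact degree_smul_le c p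

lemma rev_eval_inv (Φ : ℕ → ℂ[X]) {n : ℕ} (hd : (Φ n).natDegree ≤ n) {z : ℂ} (hz : z ≠ 0) :
    (rev Φ n).eval z = z ^ n * conj ((Φ n).eval (conj z)⁻¹) := by
  let _ : Invertible z⁻¹ := ⟨z, mul_inv_cancel₀ hz, inv_mul_cancel₀ hz⟩
  have h := eval₂_reflect_mul_pow (RingHom.id ℂ) z⁻¹ n
    ((Φ n).map (starRingEnd ℂ)) (by rwa [natDegree_map])
  have h1 : (⅟(z⁻¹) : ℂ) = z := rfl
  have h2 : conj ((Φ n).eval (conj z)⁻¹) = ((Φ n).map (starRingEnd ℂ)).eval z⁻¹ := by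
    have h3 : z⁻¹ = conj ((conj z)⁻¹) := by simp
    rw [eval_map, h3, eval₂_at_apply]
  rw [h1] at h
  simp only [eval₂_id] at h
  rw [h2, ← h, rev, mul_comm, mul_assoc, ← mul_pow, inv_mul_cancel₀ hz, one_pow, mul_one]

end Basic

variable {ν : Measure ℂ} {Φ : ℕ → ℂ[X]}

lemma ip_conj (p q : ℂ[X]) : conj (ip ν p q) = ip ν q p := by
  unfold ip
  rw [← integral_conj]
  congr 1; ext t; simp [mul_comm]

lemma ip_C_mul_left (c : ℂ) (p q : ℂ[X]) : ip ν (C c * p) q = c * ip ν p q := by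
  unfold ip
  rw [← integral_const_mul]
  congr 1; ext t; simp [mul_assoc]

lemma ip_C_mul_right (c : ℂ) (p q : ℂ[X]) : ip ν p (C c * q) = conj c * ip ν p q := by
  rw [← ip_conj, ip_C_mul_left, map_mul, ip_conj]

@[simp] lemma ip_zero_left (q : ℂ[X]) : ip ν 0 q = 0 := by simp [ip]

@[simp] lemma ip_zero_right (q : ℂ[X]) : ip ν q 0 = 0 := by simp [ip]

lemma ip_self (p : ℂ[X]) : ip ν p p = ((∫ t, ‖p.eval t‖ ^ 2 ∂ν : ℝ) : ℂ) := by
  unfold ip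
  rw [← integral_complex_ofReal]
  congr 1; ext t
  rw [Complex.mul_conj, Complex.normSq_eq_norm_sq]

lemma nsq_eq_ip (n : ℕ) : ((nsq ν Φ n : ℝ) : ℂ) = ip ν (Φ n) (Φ n) := (ip_self _).symm

namespace OPS

lemma integrable (H : OPS ν Φ) {E : Type*} [NormedAddCommGroup E] {f : ℂ → E}
    (hf : ContinuousOn f (sphere 0 1)) : Integrable f ν := by
  have := H.finite
  have h1 : ν.restrict (sphere 0 1) = ν :=
    Measure.restrict_eq_self_of_ae_mem (H.supp.mono fun t ht => by simpa using ht)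
  have h2 : IntegrableOn f (sphere 0 1) ν := hf.integrableOn_compact (isCompact_sphere _ _)
  rwa [IntegrableOn, h1] at h2

lemma integrable_ip (H : OPS ν Φ) (p q : ℂ[X]) :
    Integrable (fun t => p.eval t * conj (q.eval t)) ν :=
  H.integrable (p.continuous.mul (continuous_conj_eval q)).continuousOn

lemma integrable_nsq (H : OPS ν Φ) (p : ℂ[X]) :
    Integrable (fun t => ‖p.eval t‖ ^ 2) ν :=
  H.integrable (p.continuous.norm.pow 2).continuousOn

lemma ip_add_left (H : OPS ν Φ) (p q r : ℂ[X]) : ip ν (p + q) r = ip ν p r + ip ν q r := by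
  unfold ip
  rw [← integral_add (H.integrable_ip p r) (H.integrable_ip q r)]
  congr 1; ext t; rw [eval_add]; ring

lemma ip_add_right (H : OPS ν Φ) (p q r : ℂ[X]) : ip ν p (q + r) = ip ν p q + ip ν p r := by
  rw [← ip_conj, H.ip_add_left, map_add, ip_conj, ip_conj]

lemma ip_sub_left (H : OPS ν Φ) (p q r : ℂ[X]) : ip ν (p - q) r = ip ν p r - ip ν q r := by
  have h := H.ip_add_left (p - q) q r
  rw [sub_add_cancel] at h
  rw [h]; ring

lemma ip_sub_right (H : OPS ν Φ) (p q r : ℂ[X]) : ip ν p (q - r) = ip ν p q - ip ν p r := by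
  rw [← ip_conj, H.ip_sub_left, map_sub, ip_conj, ip_conj]

lemma ip_sum_left (H : OPS ν Φ) {ι : Type*} (s : Finset ι) (f : ι → ℂ[X]) (q : ℂ[X]) :
    ip ν (∑ i ∈ s, f i) q = ∑ i ∈ s, ip ν (f i) q := by
  classical
  induction s using Finset.induction_on with
  | empty => simp
  | insert i s hi ih => rw [Finset.sum_insert hi, Finset.sum_insert hi, H.ip_add_left, ih]

lemma ip_sum_right (H : OPS ν Φ) {ι : Type*} (s : Finset ι) (f : ι → ℂ[X]) (q : ℂ[X]) :
    ip ν q (∑ i ∈ s, f i) = ∑ i ∈ s, ip ν q (f i) := by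
  rw [← ip_conj, H.ip_sum_left, map_sum]
  simp only [ip_conj]

lemma ip_X_mul_X_mul (H : OPS ν Φ) (p q : ℂ[X]) : ip ν (X * p) (X * q) = ip ν p q := by
  unfold ip
  apply integral_congr_ae
  filter_upwards [H.supp] with t ht
  have := mul_conj_one ht
  simp only [eval_mul, eval_X, map_mul]
  linear_combination (eval t p * conj (eval t q)) * this

lemma eq_zero_of_ip_self (H : OPS ν Φ) {p : ℂ[X]} (h : ip ν p p = 0) : p = 0 := by
  rw [ip_self, Complex.ofReal_eq_zero,
    integral_eq_zero_iff_of_nonneg (fun t => by positivity) (H.integrable_nsq p)] at h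
  refine H.nondeg p (h.mono fun t ht => ?_)
  simpa using ht

lemma nsq_pos (H : OPS ν Φ) (n : ℕ) : 0 < nsq ν Φ n := by
  have h0 : 0 ≤ nsq ν Φ n := integral_nonneg fun t => by positivity
  refine lt_of_le_of_ne h0 fun h => (H.monic n).ne_zero (H.eq_zero_of_ip_self ?_)
  rw [← nsq_eq_ip, ← h, Complex.ofReal_zero]

lemma nsq_ne (H : OPS ν Φ) (n : ℕ) : ((nsq ν Φ n : ℝ) : ℂ) ≠ 0 :=
  Complex.ofReal_ne_zero.2 (H.nsq_pos n).ne'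

lemma ip_X_pow (H : OPS ν Φ) {n j : ℕ} (hj : j < n) : ip ν (Φ n) (X ^ j) = 0 := by
  rw [← H.orth n j hj]; unfold ip; congr 1; ext t; simp

lemma ip_eq_zero_of_degree_lt (H : OPS ν Φ) {n : ℕ} {q : ℂ[X]} (hq : q.degree < n) :
    ip ν (Φ n) q = 0 := by
  rcases eq_or_ne q 0 with rfl | h0
  · simp
  have hn : q.natDegree < n := (natDegree_lt_iff_degree_lt h0).2 hq
  rw [q.as_sum_range_C_mul_X_pow' hn, H.ip_sum_right]
  refine Finset.sum_eq_zero fun j hj => ?_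
  rw [ip_C_mul_right, H.ip_X_pow (Finset.mem_range.1 hj), mul_zero]

lemma degree (H : OPS ν Φ) (n : ℕ) : (Φ n).degree = n := by
  rw [degree_eq_natDegree (H.monic n).ne_zero, H.natDegree]

lemma ip_ne (H : OPS ν Φ) {k n : ℕ} (h : k ≠ n) : ip ν (Φ n) (Φ k) = 0 := by
  rcases lt_or_gt_of_ne h with h | h
  · exact H.ip_eq_zero_of_degree_lt (by rw [H.degree]; exact_mod_cast h)
  · rw [← ip_conj, H.ip_eq_zero_of_degree_lt (by rw [H.degree]; exact_mod_cast h), map_zero]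

lemma zero_eq_one (H : OPS ν Φ) : Φ 0 = 1 := by
  have := H.natDegree 0
  exact (H.monic 0).natDegree_eq_zero.1 this

/-! ### Reversed polynomials and the Szegő recursion -/

lemma rev_eval (H : OPS ν Φ) (n : ℕ) {z : ℂ} (hz : z ≠ 0) :
    (rev Φ n).eval z = z ^ n * conj ((Φ n).eval (conj z)⁻¹) :=
  rev_eval_inv Φ (H.natDegree n).le hz

lemma rev_eval_circle (H : OPS ν Φ) (n : ℕ) {z : ℂ} (hz : ‖z‖ = 1) :
    (rev Φ n).eval z = z ^ n * conj ((Φ n).eval z) := by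
  rw [H.rev_eval n (ne_zero_of_norm_one hz)]
  congr 3
  rw [← Complex.inv_eq_conj hz, inv_inv]

lemma norm_rev_eval (H : OPS ν Φ) (n : ℕ) {z : ℂ} (hz : ‖z‖ = 1) :
    ‖(rev Φ n).eval z‖ = ‖(Φ n).eval z‖ := by
  rw [H.rev_eval_circle n hz, norm_mul, norm_pow, hz, one_pow, one_mul, RCLike.norm_conj]

lemma rev_natDegree_le (H : OPS ν Φ) (n : ℕ) : (rev Φ n).natDegree ≤ n := by
  have := natDegree_reflect_le (p := (Φ n).map (starRingEnd ℂ)) (N := n)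
  rw [natDegree_map, H.natDegree, max_self] at this
  exact this

lemma rev_coeff (Φ : ℕ → ℂ[X]) {n j : ℕ} (hj : j ≤ n) :
    (rev Φ n).coeff j = conj ((Φ n).coeff (n - j)) := by
  rw [rev, coeff_reflect, revAt_le hj, coeff_map]

lemma rev_eval_zero (H : OPS ν Φ) (n : ℕ) : (rev Φ n).eval 0 = 1 := by
  rw [← coeff_zero_eq_eval_zero, rev_coeff Φ (Nat.zero_le n), Nat.sub_zero]
  have := H.monic n
  rw [Monic, leadingCoeff, H.natDegree] at this
  simp [this]

lemma rev_zero (H : OPS ν Φ) : rev Φ 0 = 1 := by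
  rw [rev, H.zero_eq_one]; simp

lemma rev_degree_lt (H : OPS ν Φ) (n : ℕ) : (rev Φ n).degree < (n + 1 : ℕ) :=
  lt_of_le_of_lt (degree_le_of_natDegree_le (H.rev_natDegree_le n)) (by exact_mod_cast n.lt_succ_self)

lemma ip_rev_X_pow (H : OPS ν Φ) {n j : ℕ} (hj : j ≤ n) (h0 : 0 < j) :
    ip ν (rev Φ n) (X ^ j) = 0 := by
  have h := H.ip_X_pow (n := n) (j := n - j) (by omega)
  have h2 : ip ν (rev Φ n) (X ^ j) = ip ν (X ^ (n - j)) (Φ n) := by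
    unfold ip
    apply integral_congr_ae
    filter_upwards [H.supp] with t ht
    have h1 := mul_conj_one ht
    have h3 : t ^ n * conj t ^ j = t ^ (n - j) := by
      conv_lhs => rw [← Nat.sub_add_cancel hj]
      rw [pow_add, mul_assoc, ← mul_pow, h1, one_pow, mul_one]
    rw [H.rev_eval_circle n ht]
    simp only [eval_pow, eval_X, map_pow]
    rw [← h3]; ring
  rw [h2, ← ip_conj, h, map_zero]

lemma ip_rev_X_mul (H : OPS ν Φ) {n : ℕ} {q : ℂ[X]} (hq : q.degree < n) :
    ip ν (rev Φ n) (X * q) = 0 := by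
  rcases eq_or_ne q 0 with rfl | h0
  · simp
  have hn : q.natDegree < n := (natDegree_lt_iff_degree_lt h0).2 hq
  rw [q.as_sum_range_C_mul_X_pow' hn, Finset.mul_sum, H.ip_sum_right]
  refine Finset.sum_eq_zero fun j hj => ?_
  have hj' := Finset.mem_range.1 hj
  rw [show X * (C (q.coeff j) * X ^ j) = C (q.coeff j) * X ^ (j + 1) by ring,
    ip_C_mul_right, H.ip_rev_X_pow (by omega) (by omega), mul_zero]

lemma conj_verb (Φ : ℕ → ℂ[X]) (n : ℕ) : conj (verb Φ n) = -(Φ (n + 1)).eval 0 := by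
  simp [verb]

lemma succ_eq (H : OPS ν Φ) (n : ℕ) :
    Φ (n + 1) = X * Φ n - C (conj (verb Φ n)) * rev Φ n := by
  set Δ := Φ (n + 1) - (X * Φ n - C (conj (verb Φ n)) * rev Φ n) with hΔ
  suffices hz : Δ = 0 from sub_eq_zero.1 hz
  have h0 : Δ.eval 0 = 0 := by
    rw [hΔ]; simp [H.rev_eval_zero, conj_verb]
  obtain ⟨q, hq⟩ : X ∣ Δ := by rwa [X_dvd_iff, coeff_zero_eq_eval_zero]
  have hdeg : Δ.degree < (n + 1 : ℕ) := by
    have h1 : (Φ (n + 1) - X * Φ n).degree < ((n + 1 : ℕ) : WithBot ℕ) := by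
      have h2 : (X * Φ n).Monic := monic_X.mul (H.monic n)
      have h3 : (X * Φ n).degree = ((n + 1 : ℕ) : WithBot ℕ) := by
        rw [degree_mul, degree_X, H.degree]; push_cast; ring
      rw [← H.degree (n + 1)]
      exact degree_sub_lt_left (by rw [h3, H.degree]) (H.monic _).ne_zero
        (by rw [(H.monic _).leadingCoeff, h2.leadingCoeff])
    have h4 : (C (conj (verb Φ n)) * rev Φ n).degree < ((n + 1 : ℕ) : WithBot ℕ) :=
      lt_of_le_of_lt (degree_C_mul_le _ _) (H.rev_degree_lt n)
    rw [hΔ, ← sub_add]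
    exact lt_of_le_of_lt (degree_add_le _ _) (max_lt h1 h4)
  have hqd : q.degree < n := by
    rcases eq_or_ne q 0 with rfl | hq0
    · simp
    rw [hq, degree_mul, degree_X, degree_eq_natDegree hq0] at hdeg
    rw [degree_eq_natDegree hq0]
    have : (1 + q.natDegree : ℕ) < n + 1 := by exact_mod_cast hdeg
    have h5 : q.natDegree < n := by omega
    exact_mod_cast h5
  apply H.eq_zero_of_ip_self
  have e1 : ip ν (Φ (n + 1)) (X * q) = 0 := H.ip_eq_zero_of_degree_lt (hq ▸ hdeg)
  have e2 : ip ν (X * Φ n) (X * q) = 0 := by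
    rw [H.ip_X_mul_X_mul, H.ip_eq_zero_of_degree_lt hqd]
  have e3 := H.ip_rev_X_mul hqd
  nth_rewrite 2 [hq]
  rw [hΔ, H.ip_sub_left, H.ip_sub_left, ip_C_mul_left, e1, e2, e3]
  simp

lemma rev_succ (H : OPS ν Φ) (n : ℕ) :
    rev Φ (n + 1) = rev Φ n - C (verb Φ n) * (X * Φ n) := by
  refine sub_eq_zero.1 (H.nondeg _ ?_)
  filter_upwards [H.supp] with t ht
  have h1 := mul_conj_one ht
  have h2 : conj ((rev Φ n).eval t) * t ^ n = (Φ n).eval t := by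
    rw [H.rev_eval_circle n ht, map_mul, Complex.conj_conj, map_pow, mul_comm _ (t ^ n),
      ← mul_assoc, ← mul_pow, h1, one_pow, one_mul]
  have hr := H.rev_eval_circle n ht
  have h3 := H.rev_eval_circle (n + 1) ht
  rw [H.succ_eq n] at h3
  simp only [eval_sub, eval_mul, eval_C, eval_X, map_sub, map_mul, Complex.conj_conj] at h3 ⊢
  linear_combination h3 + (t ^ n * conj ((Φ n).eval t)) * h1 - hr - (verb Φ n * t) * h2

lemma ip_X_mul_rev (H : OPS ν Φ) (n : ℕ) :
    ip ν (X * Φ n) (rev Φ n) = conj (verb Φ n) * ip ν (rev Φ n) (rev Φ n) := by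
  have h := H.ip_eq_zero_of_degree_lt (H.rev_degree_lt n)
  rw [H.succ_eq, H.ip_sub_left, ip_C_mul_left, sub_eq_zero] at h
  exact h

lemma ip_rev_self (H : OPS ν Φ) (n : ℕ) : ip ν (rev Φ n) (rev Φ n) = nsq ν Φ n := by
  rw [ip_self, nsq]
  congr 1
  apply integral_congr_ae
  filter_upwards [H.supp] with t ht
  simp only [H.norm_rev_eval n ht]

lemma nsq_succ (H : OPS ν Φ) (n : ℕ) :
    nsq ν Φ (n + 1) = nsq ν Φ n * (1 - ‖verb Φ n‖ ^ 2) := by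
  have h1 : ip ν (Φ (n + 1)) (Φ (n + 1)) = ip ν (Φ (n + 1)) (X * Φ n) := by
    conv_lhs => rw [H.succ_eq n, H.ip_sub_right, ← H.succ_eq n, ip_C_mul_right,
      H.ip_eq_zero_of_degree_lt (H.rev_degree_lt n), mul_zero, sub_zero]
  have h2 : ip ν (Φ (n + 1)) (Φ (n + 1))
      = nsq ν Φ n - conj (verb Φ n) * (verb Φ n * nsq ν Φ n) := by
    rw [h1, H.succ_eq n, H.ip_sub_left, H.ip_X_mul_X_mul, ip_C_mul_left, ← nsq_eq_ip,
      ← ip_conj (X * Φ n), H.ip_X_mul_rev, H.ip_rev_self]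
    simp
  rw [← nsq_eq_ip] at h2
  have h3 : (conj (verb Φ n)) * verb Φ n = ((‖verb Φ n‖ ^ 2 : ℝ) : ℂ) := by
    rw [mul_comm, Complex.mul_conj, Complex.normSq_eq_norm_sq]
  have h4 : ((nsq ν Φ (n + 1) : ℝ) : ℂ) = ((nsq ν Φ n * (1 - ‖verb Φ n‖ ^ 2) : ℝ) : ℂ) := by
    rw [h2, ← mul_assoc, h3]; push_cast; ring
  exact_mod_cast h4

lemma norm_verb_lt (H : OPS ν Φ) (n : ℕ) : ‖verb Φ n‖ < 1 := by
  have h1 := H.nsq_pos (n + 1)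
  rw [H.nsq_succ n] at h1
  have h2 := (pos_iff_pos_of_mul_pos h1).1 (H.nsq_pos n)
  have h3 := norm_nonneg (verb Φ n)
  nlinarith

lemma nsq_anti (H : OPS ν Φ) : Antitone (nsq ν Φ) := by
  refine antitone_nat_of_succ_le fun n => ?_
  rw [H.nsq_succ]
  have := H.nsq_pos n
  nlinarith [sq_nonneg ‖verb Φ n‖]

/-! ### Christoffel-Darboux -/

lemma cdk_formula (H : OPS ν Φ) (n : ℕ) (z t : ℂ) :
    (1 - z * conj t) * cdk ν Φ n z t = ((rev Φ n).eval z * conj ((rev Φ n).eval t)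
      - (Φ n).eval z * conj ((Φ n).eval t)) / nsq ν Φ n := by
  induction n with
  | zero => simp [cdk, H.rev_zero, H.zero_eq_one]
  | succ n ih =>
    have h1 := H.nsq_ne n
    have h2 := H.nsq_ne (n + 1)
    rw [cdk, Finset.sum_range_succ, mul_add]
    change (1 - z * conj t) * cdk ν Φ n z t + _ = _
    have h3 : ((nsq ν Φ (n + 1) : ℝ) : ℂ) = nsq ν Φ n * (1 - verb Φ n * conj (verb Φ n)) := by
      rw [H.nsq_succ, Complex.mul_conj, Complex.normSq_eq_norm_sq]; push_cast; ring
    have h4 : (1 - verb Φ n * conj (verb Φ n)) ≠ 0 := by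
      intro h; rw [h3, h, mul_zero] at h2; exact h2 rfl
    rw [ih, h3, H.rev_succ, H.succ_eq]
    simp only [eval_sub, eval_mul, eval_C, eval_X, map_sub, map_mul, Complex.conj_conj]
    field_simp
    ring

lemma norm_le_norm_rev (H : OPS ν Φ) (n : ℕ) {z : ℂ} (hz : ‖z‖ ≤ 1) :
    ‖(Φ n).eval z‖ ≤ ‖(rev Φ n).eval z‖ := by
  have h := H.cdk_formula n z z
  have h1 : cdk ν Φ n z z = ((∑ k ∈ Finset.range n, ‖(Φ k).eval z‖ ^ 2 / nsq ν Φ k : ℝ) : ℂ) := by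
    rw [cdk]; push_cast
    refine Finset.sum_congr rfl fun k _ => ?_
    rw [Complex.mul_conj, Complex.normSq_eq_norm_sq]; push_cast; rfl
  simp only [h1, Complex.mul_conj, Complex.normSq_eq_norm_sq] at h
  have h2 : (1 - ‖z‖ ^ 2) * (∑ k ∈ Finset.range n, ‖(Φ k).eval z‖ ^ 2 / nsq ν Φ k)
      = (‖(rev Φ n).eval z‖ ^ 2 - ‖(Φ n).eval z‖ ^ 2) / nsq ν Φ n := by exact_mod_cast h
  have h3 : 0 ≤ (∑ k ∈ Finset.range n, ‖(Φ k).eval z‖ ^ 2 / nsq ν Φ k) :=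
    Finset.sum_nonneg fun k _ => div_nonneg (by positivity) (H.nsq_pos k).le
  have h4 : 0 ≤ (1 - ‖z‖ ^ 2) := by nlinarith [norm_nonneg z]
  have h5 := mul_nonneg h4 h3
  rw [h2, le_div_iff₀ (H.nsq_pos n), zero_mul, sub_nonneg] at h5
  exact le_of_sq_le_sq h5 (norm_nonneg _)

lemma rev_ne_zero (H : OPS ν Φ) (n : ℕ) {z : ℂ} (hz : ‖z‖ ≤ 1) : (rev Φ n).eval z ≠ 0 := by
  induction n with
  | zero => simp [H.rev_zero]
  | succ n ih =>
    intro h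
    rw [H.rev_succ] at h
    simp only [eval_sub, eval_mul, eval_C, eval_X] at h
    rw [sub_eq_zero] at h
    have h1 : ‖(rev Φ n).eval z‖ ≤ ‖verb Φ n‖ * ‖(rev Φ n).eval z‖ := by
      conv_lhs => rw [h]
      rw [norm_mul, norm_mul]
      refine mul_le_mul_of_nonneg_left ?_ (norm_nonneg _)
      have := H.norm_le_norm_rev n hz
      nlinarith [norm_nonneg ((Φ n).eval z), norm_nonneg z]
    have h2 := norm_pos_iff.2 ih
    nlinarith [H.norm_verb_lt n]

lemma eval_ne_zero (H : OPS ν Φ) (n : ℕ) {z : ℂ} (hz : ‖z‖ = 1) : (Φ n).eval z ≠ 0 := by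
  rw [← norm_pos_iff, ← H.norm_rev_eval n hz, norm_pos_iff]
  exact H.rev_ne_zero n hz.le

/-! ### Reproducing property and extremality -/

lemma eq_sum (H : OPS ν Φ) (n : ℕ) : ∀ p : ℂ[X], p.degree < n →
    p = ∑ k ∈ Finset.range n, C (ip ν p (Φ k) / nsq ν Φ k) * Φ k := by
  induction n with
  | zero =>
    intro p hp
    simp only [Finset.range_zero, Finset.sum_empty]
    exact degree_eq_bot.1 (Nat.WithBot.lt_zero_iff.1 (by simpa using hp))
  | succ n ih =>
    intro p hp
    set c := p.coeff n
    have hd : (p - C c * Φ n).degree < n := by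
      rw [degree_lt_iff_coeff_zero]
      intro k hk
      rcases eq_or_lt_of_le hk with rfl | hk
      · have := H.monic n
        rw [Monic, leadingCoeff, H.natDegree] at this
        simp [c, this]
      · have h1 : p.coeff k = 0 := coeff_eq_zero_of_degree_lt (lt_of_lt_of_le hp (by exact_mod_cast hk))
        have h2 : (Φ n).coeff k = 0 := coeff_eq_zero_of_natDegree_lt (by rw [H.natDegree]; exact hk)
        simp [h1, h2]
    have h1 := ih _ hd
    have h2 : ip ν p (Φ n) = c * nsq ν Φ n := by
      have h3 : ip ν (p - C c * Φ n) (Φ n) = 0 := by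
        rw [← ip_conj, H.ip_eq_zero_of_degree_lt hd, map_zero]
      rw [H.ip_sub_left, ip_C_mul_left, ← nsq_eq_ip, sub_eq_zero] at h3
      exact h3
    rw [Finset.sum_range_succ, h2, mul_div_cancel_right₀ _ (H.nsq_ne n)]
    rw [← sub_eq_iff_eq_add]
    conv_lhs => rw [h1]
    refine Finset.sum_congr rfl fun k hk => ?_
    rw [H.ip_sub_left, ip_C_mul_left, H.ip_ne (Finset.mem_range.1 hk).ne, mul_zero, sub_zero]

lemma continuous_cdk (ν : Measure ℂ) (Φ : ℕ → ℂ[X]) (n : ℕ) (z : ℂ) :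
    Continuous fun t => cdk ν Φ n z t := by
  unfold cdk
  refine continuous_finsetSum _ fun k _ => ?_
  exact (continuous_const.mul (continuous_conj_eval _)).div_const _

lemma reproducing (H : OPS ν Φ) {n : ℕ} {p : ℂ[X]} (hp : p.degree < n) (z : ℂ) :
    ∫ t, p.eval t * cdk ν Φ n z t ∂ν = p.eval z := by
  conv_rhs => rw [H.eq_sum n p hp]
  simp only [eval_finsetSum, eval_mul, eval_C, cdk, Finset.mul_sum]
  rw [integral_finsetSum]
  · refine Finset.sum_congr rfl fun k _ => ?_
    rw [ip, mul_comm, ← mul_div_assoc, ← integral_const_mul, ← integral_div]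
    congr 1; ext t; ring
  · intro k _
    exact H.integrable (p.continuous.mul
      ((continuous_const.mul (continuous_conj_eval _)).div_const _)).continuousOn

lemma ip_eval_cdk (H : OPS ν Φ) {n : ℕ} (z : ℂ) :
    ∫ t, (Φ n).eval t * cdk ν Φ n z t ∂ν = 0 := by
  simp only [cdk, Finset.mul_sum]
  rw [integral_finsetSum]
  · refine Finset.sum_eq_zero fun k hk => ?_
    have h := H.ip_ne (Finset.mem_range.1 hk).ne
    have : ∫ t, (Φ n).eval t * ((Φ k).eval z * conj ((Φ k).eval t) / nsq ν Φ k) ∂ν =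
        ((Φ k).eval z / nsq ν Φ k) * ip ν (Φ n) (Φ k) := by
      rw [ip, ← integral_const_mul]
      congr 1; ext t; ring
    rw [this, h, mul_zero]
  · intro k _
    exact H.integrable ((Φ n).continuous.mul
      ((continuous_const.mul (continuous_conj_eval _)).div_const _)).continuousOn

lemma nsq_le (H : OPS ν Φ) {n : ℕ} {q : ℂ[X]} (hq : q.degree < (n + 1 : ℕ)) (h0 : q.eval 0 = 1) :
    nsq ν Φ n ≤ ∫ t, ‖q.eval t‖ ^ 2 ∂ν := by
  have e0 : (q - rev Φ n).eval 0 = 0 := by rw [eval_sub, h0, H.rev_eval_zero, sub_self]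
  obtain ⟨r, hr⟩ : X ∣ q - rev Φ n := by rwa [X_dvd_iff, coeff_zero_eq_eval_zero]
  have hd : (q - rev Φ n).degree < (n + 1 : ℕ) :=
    lt_of_le_of_lt (degree_sub_le _ _) (max_lt hq (H.rev_degree_lt n))
  have hrd : r.degree < n := by
    rcases eq_or_ne r 0 with rfl | hq0
    · simp
    rw [hr, degree_mul, degree_X, degree_eq_natDegree hq0] at hd
    rw [degree_eq_natDegree hq0]
    have : (1 + r.natDegree : ℕ) < n + 1 := by exact_mod_cast hd
    have h5 : r.natDegree < n := by omega
    exact_mod_cast h5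
  have e1 := H.ip_rev_X_mul hrd
  have e2 : q = rev Φ n + X * r := by rw [← hr]; ring
  have e3 : ip ν q q = nsq ν Φ n + ip ν (X * r) (X * r) := by
    rw [e2, H.ip_add_left, H.ip_add_right, H.ip_add_right, e1, H.ip_rev_self,
      ← ip_conj (rev Φ n) (X * r), e1]
    simp
  rw [ip_self, ip_self] at e3
  have e4 : (∫ t, ‖q.eval t‖ ^ 2 ∂ν) = nsq ν Φ n + ∫ t, ‖(X * r).eval t‖ ^ 2 ∂ν := by
    exact_mod_cast e3
  rw [e4]
  have : 0 ≤ ∫ t, ‖(X * r).eval t‖ ^ 2 ∂ν := integral_nonneg fun t => by positivity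
  linarith

end OPS

end OPUC

namespace OPUC

open scoped ComplexConjugate

variable {ν : Measure ℂ} {Φ : ℕ → ℂ[X]}

/-- The trigonometric moments of `Φₙ conj Φₙ*`. -/
noncomputable def momB (ν : Measure ℂ) (Φ : ℕ → ℂ[X]) (n : ℕ) (i : ℤ) : ℂ :=
  ∫ t, t ^ i * ((Φ n).eval t * conj ((rev Φ n).eval t)) ∂ν

/-- The trigonometric moments of `|Φₙ|²`. -/
noncomputable def momM (ν : Measure ℂ) (Φ : ℕ → ℂ[X]) (n : ℕ) (i : ℤ) : ℂ :=
  ∫ t, t ^ i * ((Φ n).eval t * conj ((Φ n).eval t)) ∂ν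

lemma continuousOn_zpow_sphere (i : ℤ) : ContinuousOn (fun t : ℂ => t ^ i) (sphere 0 1) := by
  intro t ht
  have ht' : ‖t‖ = 1 := by simpa using ht
  exact (continuousAt_zpow₀ t i (Or.inl (ne_zero_of_norm_one ht'))).continuousWithinAt

namespace OPS

lemma integrable_zpow_mul (H : OPS ν Φ) (i : ℤ) (p q : ℂ[X]) :
    Integrable (fun t => t ^ i * (p.eval t * conj (q.eval t))) ν :=
  H.integrable ((continuousOn_zpow_sphere i).mul
    (p.continuous.mul (continuous_conj_eval q)).continuousOn)

lemma norm_zpow_mul_le (H : OPS ν Φ) (i : ℤ) (p q : ℂ[X]) {c : ℝ}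
    (hp : ∫ t, ‖p.eval t‖ ^ 2 ∂ν ≤ c) (hq : ∫ t, ‖q.eval t‖ ^ 2 ∂ν ≤ c) :
    ‖∫ t, t ^ i * (p.eval t * conj (q.eval t)) ∂ν‖ ≤ c := by
  refine (norm_integral_le_integral_norm _).trans ?_
  have h1 : ∫ t, ‖t ^ i * (p.eval t * conj (q.eval t))‖ ∂ν ≤
      ∫ t, (‖p.eval t‖ ^ 2 + ‖q.eval t‖ ^ 2) / 2 ∂ν := by
    refine integral_mono_ae (H.integrable_zpow_mul i p q).norm
      (((H.integrable_nsq p).add (H.integrable_nsq q)).div_const 2) ?_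
    filter_upwards [H.supp] with t ht
    rw [norm_mul, norm_zpow, ht, one_zpow, one_mul, norm_mul, RCLike.norm_conj]
    nlinarith [sq_nonneg (‖p.eval t‖ - ‖q.eval t‖)]
  rw [integral_div, integral_add (H.integrable_nsq p) (H.integrable_nsq q)] at h1
  linarith

lemma nsq_le_zero (H : OPS ν Φ) (n : ℕ) : ∫ t, ‖(Φ n).eval t‖ ^ 2 ∂ν ≤ nsq ν Φ 0 :=
  H.nsq_anti (Nat.zero_le n)

lemma nsq_rev (H : OPS ν Φ) (n : ℕ) : ∫ t, ‖(rev Φ n).eval t‖ ^ 2 ∂ν = nsq ν Φ n := by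
  have := H.ip_rev_self n
  rw [ip_self] at this
  exact_mod_cast this

lemma nsq_rev_le (H : OPS ν Φ) (n : ℕ) : ∫ t, ‖(rev Φ n).eval t‖ ^ 2 ∂ν ≤ nsq ν Φ 0 := by
  rw [H.nsq_rev]; exact H.nsq_anti (Nat.zero_le n)

lemma norm_momB_le (H : OPS ν Φ) (n : ℕ) (i : ℤ) : ‖momB ν Φ n i‖ ≤ nsq ν Φ 0 :=
  H.norm_zpow_mul_le i _ _ (H.nsq_le_zero n) (H.nsq_rev_le n)

lemma norm_momM_le (H : OPS ν Φ) (n : ℕ) (i : ℤ) : ‖momM ν Φ n i‖ ≤ nsq ν Φ 0 :=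
  H.norm_zpow_mul_le i _ _ (H.nsq_le_zero n) (H.nsq_le_zero n)

lemma momM_zero (n : ℕ) : momM ν Φ n 0 = nsq ν Φ n := by
  rw [nsq_eq_ip, momM, ip]; simp

lemma momM_neg (H : OPS ν Φ) (n : ℕ) (i : ℤ) : momM ν Φ n (-i) = conj (momM ν Φ n i) := by
  rw [momM, momM, ← integral_conj]
  apply integral_congr_ae
  filter_upwards [H.supp] with t ht
  simp only [map_mul, Complex.conj_conj, map_zpow₀]
  rw [← Complex.inv_eq_conj ht, inv_zpow', mul_comm (conj _)]

lemma norm_ip_X_pow_mul_le (H : OPS ν Φ) (j : ℕ) (p q : ℂ[X]) {c : ℝ}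
    (hp : ∫ t, ‖p.eval t‖ ^ 2 ∂ν ≤ c) (hq : ∫ t, ‖q.eval t‖ ^ 2 ∂ν ≤ c) :
    ‖ip ν (X ^ j * p) q‖ ≤ c := by
  have h := H.norm_zpow_mul_le j p q hp hq
  refine le_of_eq_of_le ?_ h
  congr 1
  unfold ip
  congr 1; ext t
  simp [mul_assoc]

/-- Moving from `t ^ j Φₙ` to `Φₙ₊ⱼ`. -/
lemma norm_ip_shift_le (H : OPS ν Φ) (q : ℂ[X])
    (hq : ∫ t, ‖q.eval t‖ ^ 2 ∂ν ≤ nsq ν Φ 0) (j : ℕ) : ∀ n : ℕ,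
    ‖ip ν (X ^ j * Φ n) q - ip ν (Φ (n + j)) q‖ ≤
      nsq ν Φ 0 * ∑ k ∈ Finset.Ico n (n + j), ‖verb Φ k‖ := by
  induction j with
  | zero => intro n; simp
  | succ j ih =>
    intro n
    have h1 : X ^ (j + 1) * Φ n =
        X ^ j * Φ (n + 1) + C (conj (verb Φ n)) * (X ^ j * rev Φ n) := by
      rw [H.succ_eq n]; ring
    have h2 := ih (n + 1)
    have h3 := H.norm_ip_X_pow_mul_le j (rev Φ n) q (H.nsq_rev_le n) hq
    rw [h1, H.ip_add_left, ip_C_mul_left, show n + (j + 1) = n + 1 + j by ring,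
      Finset.sum_eq_sum_Ico_succ_bot (by omega), mul_add]
    have h4 : ‖conj (verb Φ n) * ip ν (X ^ j * rev Φ n) q‖ ≤ nsq ν Φ 0 * ‖verb Φ n‖ := by
      rw [norm_mul, RCLike.norm_conj, mul_comm]; gcongr
    calc _ = ‖(ip ν (X ^ j * Φ (n + 1)) q - ip ν (Φ (n + 1 + j)) q) +
          conj (verb Φ n) * ip ν (X ^ j * rev Φ n) q‖ := by congr 1; ring
      _ ≤ _ := by refine (norm_add_le _ _).trans ?_; linarith

/-- Moving from `Φₙ₊ᵢ*` to `Φₙ*`. -/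
lemma norm_ip_rev_shift_le (H : OPS ν Φ) (p : ℂ[X])
    (hp : ∫ t, ‖p.eval t‖ ^ 2 ∂ν ≤ nsq ν Φ 0) (j n i : ℕ) :
    ‖ip ν p (X ^ j * rev Φ (n + i)) - ip ν p (X ^ j * rev Φ n)‖ ≤
      nsq ν Φ 0 * ∑ k ∈ Finset.Ico n (n + i), ‖verb Φ k‖ := by
  induction i with
  | zero => simp
  | succ i ih =>
    have h1 : X ^ j * rev Φ (n + (i + 1)) =
        X ^ j * rev Φ (n + i) - C (verb Φ (n + i)) * (X ^ (j + 1) * Φ (n + i)) := by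
      rw [← add_assoc, H.rev_succ (n + i)]; ring
    have h3 := H.norm_ip_X_pow_mul_le (j + 1) (Φ (n + i)) p (H.nsq_le_zero _) hp
    have h4 : ‖conj (verb Φ (n + i)) * ip ν p (X ^ (j + 1) * Φ (n + i))‖
        ≤ nsq ν Φ 0 * ‖verb Φ (n + i)‖ := by
      rw [norm_mul, RCLike.norm_conj, mul_comm, ← ip_conj, RCLike.norm_conj]; gcongr
    rw [h1, H.ip_sub_right, ip_C_mul_right, ← add_assoc, Finset.sum_Ico_succ_top (by omega),
      mul_add]
    calc _ = ‖(ip ν p (X ^ j * rev Φ (n + i)) - ip ν p (X ^ j * rev Φ n)) -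
          conj (verb Φ (n + i)) * ip ν p (X ^ (j + 1) * Φ (n + i))‖ := by congr 1; ring
      _ ≤ _ := by refine (norm_sub_le _ _).trans ?_; linarith

lemma momB_nat (n j : ℕ) : momB ν Φ n j = ip ν (X ^ j * Φ n) (rev Φ n) := by
  unfold momB ip
  congr 1; ext t; simp [mul_assoc]

lemma momM_nat (n j : ℕ) : momM ν Φ n j = ip ν (X ^ j * Φ n) (Φ n) := by
  unfold momM ip
  congr 1; ext t; simp [mul_assoc]

lemma momB_neg_nat (H : OPS ν Φ) (n j : ℕ) :
    momB ν Φ n (-j) = ip ν (Φ n) (X ^ j * rev Φ n) := by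
  unfold momB ip
  apply integral_congr_ae
  filter_upwards [H.supp] with t ht
  simp only [eval_mul, eval_pow, eval_X, map_mul, map_pow]
  rw [← Complex.inv_eq_conj ht, zpow_neg, zpow_natCast, inv_pow]; ring

lemma norm_momB_pos_le (H : OPS ν Φ) (n j : ℕ) (hj : 0 < j) :
    ‖momB ν Φ n j‖ ≤ nsq ν Φ 0 * ∑ k ∈ Finset.Ico n (n + j), ‖verb Φ k‖ := by
  have h := H.norm_ip_shift_le (rev Φ n) (H.nsq_rev_le n) j n
  have h2 : ip ν (Φ (n + j)) (rev Φ n) = 0 := H.ip_eq_zero_of_degree_lt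
    (lt_of_lt_of_le (H.rev_degree_lt n) (by exact_mod_cast (show n + 1 ≤ n + j by omega)))
  rwa [h2, sub_zero, ← momB_nat] at h

lemma norm_momM_pos_le (H : OPS ν Φ) (n j : ℕ) (hj : 0 < j) :
    ‖momM ν Φ n j‖ ≤ nsq ν Φ 0 * ∑ k ∈ Finset.Ico n (n + j), ‖verb Φ k‖ := by
  have h := H.norm_ip_shift_le (Φ n) (H.nsq_le_zero n) j n
  rwa [H.ip_ne (show n ≠ n + j by omega), sub_zero, ← momM_nat] at h

lemma norm_momB_neg_le (H : OPS ν Φ) (n j : ℕ) (hj : j + 1 ≤ n) :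
    ‖momB ν Φ n (-j)‖ ≤ nsq ν Φ 0 * ∑ k ∈ Finset.Ico (n - (j + 1)) n, ‖verb Φ k‖ := by
  have h := H.norm_ip_rev_shift_le (Φ n) (H.nsq_le_zero n) j (n - (j + 1)) (j + 1)
  rw [Nat.sub_add_cancel hj] at h
  have h2 : ip ν (Φ n) (X ^ j * rev Φ (n - (j + 1))) = 0 := by
    refine H.ip_eq_zero_of_degree_lt ?_
    rw [degree_mul, degree_X_pow]
    have h3 := degree_le_of_natDegree_le (H.rev_natDegree_le (n - (j + 1)))
    refine lt_of_le_of_lt (add_le_add_right h3 _) ?_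
    have : j + (n - (j + 1)) < n := by omega
    exact_mod_cast this
  rwa [h2, sub_zero, ← H.momB_neg_nat] at h

/-- If the Verblunsky coefficients are `O(1/n)`, so are the moments. -/
lemma exists_mom_le (H : OPS ν Φ) {A : ℝ} (hA : ∀ k, ‖verb Φ k‖ ≤ A / (k + 1)) :
    ∃ C : ℝ, 0 ≤ C ∧ ∀ n : ℕ, 0 < n → ∀ i : ℤ, ‖momB ν Φ n i‖ ≤ C / n * (1 + |i|) ∧
      (i ≠ 0 → ‖momM ν Φ n i‖ ≤ C / n * (1 + |i|)) := by
  have hA0 : 0 ≤ A := by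
    have := (norm_nonneg _).trans (hA 0)
    simpa using this
  have hh := (H.nsq_pos 0).le
  set h0 := nsq ν Φ 0
  have pos (n j : ℕ) (hn : 0 < n) : h0 * ∑ k ∈ Finset.Ico n (n + j), ‖verb Φ k‖
      ≤ (h0 * (2 * A + 2)) / n * (1 + j) := by
    have hn' : (0 : ℝ) < n := by exact_mod_cast hn
    have h1 : ∑ k ∈ Finset.Ico n (n + j), ‖verb Φ k‖ ≤ j * (A / n) := by
      have := Finset.sum_le_card_nsmul (Finset.Ico n (n + j)) (fun k => ‖verb Φ k‖) (A / n) ?_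
      · simpa using this
      · intro k hk
        have hk1 : (n : ℝ) ≤ k := by exact_mod_cast (Finset.mem_Ico.1 hk).1
        exact (hA k).trans (div_le_div_of_nonneg_left hA0 hn' (by linarith))
    calc _ ≤ h0 * (j * (A / n)) := by gcongr
      _ = (h0 * A) / n * j := by ring
      _ ≤ _ := by gcongr <;> linarith
  refine ⟨h0 * (2 * A + 2), by positivity, fun n hn i => ?_⟩
  have hn' : (0 : ℝ) < n := by exact_mod_cast hn
  obtain ⟨j, rfl | rfl⟩ := Int.eq_nat_or_neg i
  · rcases Nat.eq_zero_or_pos j with rfl | hj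
    · refine ⟨?_, fun h => absurd rfl h⟩
      have h1 := H.norm_momB_neg_le n 0 (by omega)
      have h2 : Finset.Ico (n - (0 + 1)) n = {n - 1} := by
        ext k; simp; omega
      rw [h2, Finset.sum_singleton] at h1
      have h3 := hA (n - 1)
      have h4 : ((n - 1 : ℕ) : ℝ) + 1 = n := by
        have : n - 1 + 1 = n := by omega
        exact_mod_cast this
      rw [h4] at h3
      simp only [Nat.cast_zero, abs_zero, neg_zero, Int.cast_zero] at h1 ⊢
      calc _ ≤ h0 * (A / n) := h1.trans (by gcongr)
        _ = (h0 * A) / n * (1 + 0) := by ring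
        _ ≤ _ := by gcongr; linarith
    · have e : ((|(j : ℤ)| : ℤ) : ℝ) = j := by simp
      rw [e]
      exact ⟨(H.norm_momB_pos_le n j hj).trans (pos n j hn),
        fun _ => (H.norm_momM_pos_le n j hj).trans (pos n j hn)⟩
  · have e : ((|(-(j : ℤ))| : ℤ) : ℝ) = j := by simp
    rw [e]
    constructor
    · rcases le_or_gt (2 * (j + 1)) n with hj | hj
      · refine (H.norm_momB_neg_le n j (by omega)).trans ?_
        have h1 : ∑ k ∈ Finset.Ico (n - (j + 1)) n, ‖verb Φ k‖ ≤ (j + 1 : ℕ) * (A / (n / 2)) := by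
          have := Finset.sum_le_card_nsmul (Finset.Ico (n - (j + 1)) n)
            (fun k => ‖verb Φ k‖) (A / (n / 2)) ?_
          · rw [Nat.card_Ico, show n - (n - (j + 1)) = j + 1 by omega, nsmul_eq_mul] at this
            exact this
          · intro k hk
            have hk0 := (Finset.mem_Ico.1 hk).1
            have hk1 : (n : ℝ) ≤ 2 * k := by exact_mod_cast (show n ≤ 2 * k by omega)
            exact (hA k).trans (div_le_div_of_nonneg_left hA0 (by positivity) (by linarith))
        calc _ ≤ h0 * ((j + 1 : ℕ) * (A / (n / 2))) := by gcongr
          _ = (h0 * (2 * A)) / n * (1 + j) := by push_cast; field_simp; ring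
          _ ≤ _ := by gcongr; linarith
      · refine (H.norm_momB_le n _).trans ?_
        have h1 : (n : ℝ) ≤ 2 * (1 + j) := by exact_mod_cast (show n ≤ 2 * (1 + j) by omega)
        rw [div_mul_eq_mul_div, le_div_iff₀ hn', mul_assoc]
        refine mul_le_mul_of_nonneg_left ?_ hh
        nlinarith [mul_nonneg hA0 (show (0 : ℝ) ≤ 1 + j by positivity)]
    · intro hi
      rw [H.momM_neg, RCLike.norm_conj]
      exact (H.norm_momM_pos_le n j (by omega)).trans (pos n j hn)

/-! ### Moments of the Christoffel-Darboux kernel -/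

lemma cdk_mul_sub (H : OPS ν Φ) (n : ℕ) (z : ℂ) {t : ℂ} (ht : ‖t‖ = 1) :
    cdk ν Φ n z t * (t - z) = t * (((rev Φ n).eval z * conj ((rev Φ n).eval t)
      - (Φ n).eval z * conj ((Φ n).eval t)) / nsq ν Φ n) := by
  rw [← H.cdk_formula]
  linear_combination (z * cdk ν Φ n z t) * mul_conj_one ht

lemma integrable_zpow_cdk (H : OPS ν Φ) (n : ℕ) (z : ℂ) (i : ℤ) :
    Integrable (fun t => (Φ n).eval t * cdk ν Φ n z t * t ^ i) ν :=
  H.integrable (((Φ n).continuous.mul (continuous_cdk ν Φ n z)).continuousOn.mul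
    (continuousOn_zpow_sphere i))

lemma integral_cdk_mul (H : OPS ν Φ) (n : ℕ) (z : ℂ) (i : ℤ) :
    ∫ t, (Φ n).eval t * cdk ν Φ n z t * ((t - z) * t ^ i) ∂ν =
      ((rev Φ n).eval z * momB ν Φ n (i + 1) - (Φ n).eval z * momM ν Φ n (i + 1)) / nsq ν Φ n := by
  have h : ∀ᵐ t ∂ν, (Φ n).eval t * cdk ν Φ n z t * ((t - z) * t ^ i) =
      (rev Φ n).eval z / nsq ν Φ n * (t ^ (i + 1) * ((Φ n).eval t * conj ((rev Φ n).eval t))) -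
      (Φ n).eval z / nsq ν Φ n * (t ^ (i + 1) * ((Φ n).eval t * conj ((Φ n).eval t))) := by
    filter_upwards [H.supp] with t ht
    have h1 := H.cdk_mul_sub n z ht
    rw [zpow_add_one₀ (ne_zero_of_norm_one ht)]
    linear_combination ((Φ n).eval t * t ^ i) * h1
  rw [integral_congr_ae h, integral_sub ((H.integrable_zpow_mul _ _ _).const_mul _)
    ((H.integrable_zpow_mul _ _ _).const_mul _), integral_const_mul, integral_const_mul]
  unfold momB momM
  ring

lemma integrable_cdk_mul (H : OPS ν Φ) (n : ℕ) (z : ℂ) (i : ℤ) :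
    Integrable (fun t => (Φ n).eval t * cdk ν Φ n z t * ((t - z) * t ^ i)) ν :=
  H.integrable (((Φ n).continuous.mul (continuous_cdk ν Φ n z)).continuousOn.mul
    ((continuous_id.sub continuous_const).continuousOn.mul (continuousOn_zpow_sphere i)))

lemma integral_cdk_pow (H : OPS ν Φ) (n : ℕ) (z : ℂ) (j : ℕ) :
    ∫ t, (Φ n).eval t * cdk ν Φ n z t * t ^ j ∂ν =
      ∑ i ∈ Finset.range j, z ^ (j - 1 - i) * (((rev Φ n).eval z * momB ν Φ n (i + 1)
        - (Φ n).eval z * momM ν Φ n (i + 1)) / nsq ν Φ n) := by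
  have h (t : ℂ) : (Φ n).eval t * cdk ν Φ n z t * t ^ j =
      z ^ j * ((Φ n).eval t * cdk ν Φ n z t) + ∑ i ∈ Finset.range j,
        z ^ (j - 1 - i) * ((Φ n).eval t * cdk ν Φ n z t * ((t - z) * t ^ (i : ℤ))) := by
    have h1 := (Commute.all t z).mul_geom_sum₂ j
    have h2 : ∑ i ∈ Finset.range j,
        z ^ (j - 1 - i) * ((Φ n).eval t * cdk ν Φ n z t * ((t - z) * t ^ (i : ℤ)))
        = (Φ n).eval t * cdk ν Φ n z t * ((t - z) *
          ∑ i ∈ Finset.range j, t ^ i * z ^ (j - 1 - i)) := by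
      rw [Finset.mul_sum, Finset.mul_sum]
      refine Finset.sum_congr rfl fun i _ => ?_
      rw [zpow_natCast]; ring
    rw [h2, h1]; ring
  simp only [h]
  rw [integral_add, integral_const_mul, H.ip_eval_cdk, mul_zero, zero_add, integral_finsetSum]
  · refine Finset.sum_congr rfl fun i _ => ?_
    rw [integral_const_mul, H.integral_cdk_mul]
  · exact fun i _ => (H.integrable_cdk_mul n z i).const_mul _
  · exact (H.integrable ((Φ n).continuous.mul (continuous_cdk ν Φ n z)).continuousOn).const_mul _
  · exact integrable_finsetSum _ fun i _ => (H.integrable_cdk_mul n z i).const_mul _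

lemma integral_cdk_zpow_neg (H : OPS ν Φ) (n : ℕ) {z : ℂ} (hz : z ≠ 0) (l : ℕ) :
    ∫ t, (Φ n).eval t * cdk ν Φ n z t * t ^ (-(l : ℤ)) ∂ν =
      -∑ i ∈ Finset.range l, z⁻¹ ^ (i + 1) * (((rev Φ n).eval z * momB ν Φ n (i + 1 - l)
        - (Φ n).eval z * momM ν Φ n (i + 1 - l)) / nsq ν Φ n) := by
  have h : ∀ᵐ t ∂ν, (Φ n).eval t * cdk ν Φ n z t * t ^ (-(l : ℤ)) =
      z⁻¹ ^ l * ((Φ n).eval t * cdk ν Φ n z t) - ∑ i ∈ Finset.range l,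
        z⁻¹ ^ (i + 1) * ((Φ n).eval t * cdk ν Φ n z t * ((t - z) * t ^ ((i : ℤ) - l))) := by
    filter_upwards [H.supp] with t ht
    have ht0 := ne_zero_of_norm_one ht
    have h1 := (Commute.all t z).mul_geom_sum₂ l
    have h2 : ∑ i ∈ Finset.range l,
        z⁻¹ ^ (i + 1) * ((Φ n).eval t * cdk ν Φ n z t * ((t - z) * t ^ ((i : ℤ) - l)))
        = (Φ n).eval t * cdk ν Φ n z t * (((t - z) *
          ∑ i ∈ Finset.range l, t ^ i * z ^ (l - 1 - i)) * (z⁻¹ ^ l * t⁻¹ ^ l)) := by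
      rw [Finset.mul_sum, Finset.sum_mul, Finset.mul_sum]
      refine Finset.sum_congr rfl fun i hi => ?_
      have hi' := Finset.mem_range.1 hi
      have e1 : z ^ (l - 1 - i) * z⁻¹ ^ l = z⁻¹ ^ (i + 1) := by
        rw [show l = (l - 1 - i) + (i + 1) by omega, pow_add z⁻¹, ← mul_assoc,
          show (l - 1 - i) + (i + 1) - 1 - i = l - 1 - i by omega, ← mul_pow,
          mul_inv_cancel₀ hz, one_pow, one_mul]
      rw [zpow_sub₀ ht0, zpow_natCast, zpow_natCast, ← e1, inv_pow t l]
      ring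
    rw [h2, h1, zpow_neg, zpow_natCast]
    have hz' := pow_ne_zero l hz
    have ht' := pow_ne_zero l ht0
    simp only [inv_pow]
    field_simp
    ring
  rw [integral_congr_ae h, integral_sub, integral_const_mul, H.ip_eval_cdk, mul_zero, zero_sub,
    integral_finsetSum]
  · congr 1
    refine Finset.sum_congr rfl fun i _ => ?_
    rw [integral_const_mul, H.integral_cdk_mul, show (i : ℤ) - l + 1 = i + 1 - l by ring]
  · exact fun i _ => (H.integrable_cdk_mul n z _).const_mul _
  · exact (H.integrable ((Φ n).continuous.mul (continuous_cdk ν Φ n z)).continuousOn).const_mul _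
  · exact integrable_finsetSum _ fun i _ => (H.integrable_cdk_mul n z _).const_mul _

lemma norm_cdk_pow_le (H : OPS ν Φ) {n : ℕ} {B : ℝ} (hB : 0 ≤ B)
    (hb : ∀ i : ℤ, ‖momB ν Φ n i‖ ≤ B * (1 + |i|))
    (hm : ∀ i : ℤ, i ≠ 0 → ‖momM ν Φ n i‖ ≤ B * (1 + |i|))
    {M : ℝ} (hM : 1 ≤ M) {z : ℂ} (hz : ‖z‖ ≤ M) (l : ℕ) :
    ‖∫ t, (Φ n).eval t * cdk ν Φ n z t * t ^ l ∂ν‖ ≤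
      B / nsq ν Φ n * (‖(rev Φ n).eval z‖ + ‖(Φ n).eval z‖) * ((l + 1) ^ 2 * M ^ l) := by
  have hn := H.nsq_pos n
  rw [H.integral_cdk_pow]
  have h1 : ∀ i ∈ Finset.range l, ‖z ^ (l - 1 - i) * (((rev Φ n).eval z * momB ν Φ n (i + 1)
        - (Φ n).eval z * momM ν Φ n (i + 1)) / nsq ν Φ n)‖ ≤
      B / nsq ν Φ n * (‖(rev Φ n).eval z‖ + ‖(Φ n).eval z‖) * ((l + 1) * M ^ l) := by
    intro i hi
    have hi' := Finset.mem_range.1 hi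
    have e1 : ((|(i : ℤ) + 1| : ℤ) : ℝ) = i + 1 := by
      rw [abs_of_nonneg (by positivity)]; push_cast; ring
    have hil : (i : ℝ) + 1 ≤ l := by exact_mod_cast hi'
    have b1 : ‖momB ν Φ n (i + 1)‖ ≤ B * (l + 1) := by
      refine (hb _).trans ?_; rw [e1]; exact mul_le_mul_of_nonneg_left (by linarith) hB
    have b2 : ‖momM ν Φ n (i + 1)‖ ≤ B * (l + 1) := by
      refine (hm _ (by omega)).trans ?_; rw [e1]; exact mul_le_mul_of_nonneg_left (by linarith) hB
    have b3 : ‖z‖ ^ (l - 1 - i) ≤ M ^ l :=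
      (pow_le_pow_left₀ (norm_nonneg _) hz _).trans (pow_le_pow_right₀ hM (by omega))
    rw [norm_mul, norm_div, norm_pow, Complex.norm_of_nonneg hn.le]
    calc _ ≤ M ^ l * ((‖(rev Φ n).eval z‖ * (B * (l + 1)) + ‖(Φ n).eval z‖ * (B * (l + 1)))
          / nsq ν Φ n) := by
          gcongr
          refine (norm_sub_le _ _).trans ?_
          rw [norm_mul, norm_mul]; gcongr
      _ = _ := by ring
  refine (norm_sum_le_of_le _ h1).trans ?_
  rw [Finset.sum_const, Finset.card_range, nsmul_eq_mul]
  have : 0 ≤ B / nsq ν Φ n * (‖(rev Φ n).eval z‖ + ‖(Φ n).eval z‖) := by positivity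
  calc _ = B / nsq ν Φ n * (‖(rev Φ n).eval z‖ + ‖(Φ n).eval z‖) * ((l * (l + 1)) * M ^ l) := by
        ring
    _ ≤ _ := by gcongr; nlinarith

lemma norm_cdk_zpow_neg_le (H : OPS ν Φ) {n : ℕ} {B : ℝ} (hB : 0 ≤ B)
    (hb : ∀ i : ℤ, ‖momB ν Φ n i‖ ≤ B * (1 + |i|))
    (hm : ∀ i : ℤ, i ≠ 0 → ‖momM ν Φ n i‖ ≤ B * (1 + |i|))
    {M : ℝ} (hM : 1 ≤ M) {z : ℂ} (hz0 : z ≠ 0) (hz : ‖z⁻¹‖ ≤ M) (l : ℕ) (hl : 0 < l) :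
    ‖(∫ t, (Φ n).eval t * cdk ν Φ n z t * t ^ (-(l : ℤ)) ∂ν) - z⁻¹ ^ l * (Φ n).eval z‖ ≤
      B / nsq ν Φ n * (‖(rev Φ n).eval z‖ + ‖(Φ n).eval z‖) * ((l + 1) ^ 2 * M ^ l) := by
  have hn := H.nsq_pos n
  have hn' := H.nsq_ne n
  have b0 (i : ℕ) (hi : i < l) :
      ‖z⁻¹ ^ (i + 1) * ((rev Φ n).eval z * momB ν Φ n (i + 1 - l) / nsq ν Φ n)‖ ≤
      B / nsq ν Φ n * (‖(rev Φ n).eval z‖) * ((l + 1) * M ^ l) := by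
    have e1 : ((|(i : ℤ) + 1 - l| : ℤ) : ℝ) = l - (i + 1) := by
      rw [abs_of_nonpos (by omega)]; push_cast; ring
    have b1 : ‖momB ν Φ n (i + 1 - l)‖ ≤ B * (l + 1) := by
      refine (hb _).trans ?_; rw [e1]
      have : (0 : ℝ) ≤ i := by positivity
      exact mul_le_mul_of_nonneg_left (by linarith) hB
    have b3 : ‖z⁻¹‖ ^ (i + 1) ≤ M ^ l :=
      (pow_le_pow_left₀ (norm_nonneg _) hz _).trans (pow_le_pow_right₀ hM (by omega))
    rw [norm_mul, norm_div, norm_pow, Complex.norm_of_nonneg hn.le, norm_mul]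
    calc _ ≤ M ^ l * ((‖(rev Φ n).eval z‖ * (B * (l + 1))) / nsq ν Φ n) := by gcongr
      _ = _ := by ring
  have b0' (i : ℕ) (hi : i + 1 < l) :
      ‖z⁻¹ ^ (i + 1) * ((Φ n).eval z * momM ν Φ n (i + 1 - l) / nsq ν Φ n)‖ ≤
      B / nsq ν Φ n * (‖(Φ n).eval z‖) * ((l + 1) * M ^ l) := by
    have e1 : ((|(i : ℤ) + 1 - l| : ℤ) : ℝ) = l - (i + 1) := by
      rw [abs_of_nonpos (by omega)]; push_cast; ring
    have b1 : ‖momM ν Φ n (i + 1 - l)‖ ≤ B * (l + 1) := by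
      refine (hm _ (by omega)).trans ?_; rw [e1]
      have : (0 : ℝ) ≤ i := by positivity
      exact mul_le_mul_of_nonneg_left (by linarith) hB
    have b3 : ‖z⁻¹‖ ^ (i + 1) ≤ M ^ l :=
      (pow_le_pow_left₀ (norm_nonneg _) hz _).trans (pow_le_pow_right₀ hM (by omega))
    rw [norm_mul, norm_div, norm_pow, Complex.norm_of_nonneg hn.le, norm_mul]
    calc _ ≤ M ^ l * ((‖(Φ n).eval z‖ * (B * (l + 1))) / nsq ν Φ n) := by gcongr
      _ = _ := by ring
  obtain ⟨l, rfl⟩ : ∃ k, l = k + 1 := ⟨l - 1, by omega⟩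
  have key : (∫ t, (Φ n).eval t * cdk ν Φ n z t * t ^ (-((l + 1 : ℕ) : ℤ)) ∂ν)
      - z⁻¹ ^ (l + 1) * (Φ n).eval z =
      -(∑ i ∈ Finset.range (l + 1), z⁻¹ ^ (i + 1) *
          ((rev Φ n).eval z * momB ν Φ n (i + 1 - (l + 1 : ℕ)) / nsq ν Φ n)) +
      ∑ i ∈ Finset.range l, z⁻¹ ^ (i + 1) *
          ((Φ n).eval z * momM ν Φ n (i + 1 - (l + 1 : ℕ)) / nsq ν Φ n) := by
    rw [H.integral_cdk_zpow_neg n hz0]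
    simp only [sub_div, mul_sub, Finset.sum_sub_distrib]
    rw [Finset.sum_range_succ (fun i : ℕ => z⁻¹ ^ (i + 1) *
          ((Φ n).eval z * momM ν Φ n (i + 1 - (l + 1 : ℕ)) / nsq ν Φ n)),
      show ((l : ℤ) + 1 - (l + 1 : ℕ)) = 0 by push_cast; ring, momM_zero,
      mul_div_cancel_right₀ _ hn']
    ring
  rw [key]
  refine (norm_add_le _ _).trans ?_
  rw [norm_neg]
  have s1 := norm_sum_le_of_le (Finset.range (l + 1)) fun i hi => b0 i (Finset.mem_range.1 hi)
  have s2 := norm_sum_le_of_le (Finset.range l) fun i hi =>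
    b0' i (Nat.succ_lt_succ (Finset.mem_range.1 hi))
  rw [Finset.sum_const, Finset.card_range, nsmul_eq_mul] at s1 s2
  refine (add_le_add s1 s2).trans ?_
  push_cast
  have p1 : 0 ≤ B / nsq ν Φ n * ‖(rev Φ n).eval z‖ := by positivity
  have p2 : 0 ≤ B / nsq ν Φ n * ‖(Φ n).eval z‖ := by positivity
  have p3 : 0 ≤ M ^ (l + 1) := by positivity
  have p4 : (0 : ℝ) ≤ l := by positivity
  nlinarith [mul_nonneg (mul_nonneg p1 p3) p4, mul_nonneg (mul_nonneg p2 p3) p4,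
    mul_nonneg p1 p3, mul_nonneg p2 p3]

/-- The integral of `Φₙ K v` for a Laurent series `v`, up to the negative part of `v`. -/
lemma norm_integral_cdk_laurent_le (H : OPS ν Φ) {n : ℕ} {B : ℝ} (hB : 0 ≤ B)
    (hb : ∀ i : ℤ, ‖momB ν Φ n i‖ ≤ B * (1 + |i|))
    (hm : ∀ i : ℤ, i ≠ 0 → ‖momM ν Φ n i‖ ≤ B * (1 + |i|))
    {M : ℝ} (hM : 1 ≤ M) {c d : ℕ → ℂ} (hd0 : d 0 = 0)
    (hs : Summable fun l : ℕ => (‖c l‖ + ‖d l‖) * (((l : ℝ) + 1) ^ 2 * M ^ l))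
    {v : ℂ → ℂ} (hv : ∀ t : ℂ, ‖t‖ = 1 → HasSum (fun l : ℕ => c l * t ^ l + d l * t⁻¹ ^ l) (v t))
    {z : ℂ} (hz0 : z ≠ 0) (hz : ‖z‖ ≤ M) (hz' : ‖z⁻¹‖ ≤ M) :
    ‖(∫ t, (Φ n).eval t * cdk ν Φ n z t * v t ∂ν) - (Φ n).eval z * ∑' l, d l * z⁻¹ ^ l‖ ≤
      B / nsq ν Φ n * (‖(rev Φ n).eval z‖ + ‖(Φ n).eval z‖) *
        ∑' l : ℕ, (‖c l‖ + ‖d l‖) * (((l : ℝ) + 1) ^ 2 * M ^ l) := by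
  have hn := H.nsq_pos n
  have hone (l : ℕ) : (1 : ℝ) ≤ ((l : ℝ) + 1) ^ 2 * M ^ l := by
    have h1 : (1 : ℝ) ≤ M ^ l := one_le_pow₀ hM
    have h2 : (1 : ℝ) ≤ ((l : ℝ) + 1) ^ 2 := one_le_pow₀ (by linarith [Nat.cast_nonneg (α := ℝ) l])
    nlinarith
  have hMl (l : ℕ) : M ^ l ≤ ((l : ℝ) + 1) ^ 2 * M ^ l := by
    have h1 : (0 : ℝ) ≤ M ^ l := by positivity
    have h2 : (1 : ℝ) ≤ ((l : ℝ) + 1) ^ 2 := one_le_pow₀ (by linarith [Nat.cast_nonneg (α := ℝ) l])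
    nlinarith
  have hs1 : Summable fun l : ℕ => ‖c l‖ + ‖d l‖ :=
    hs.of_nonneg_of_le (fun l => by positivity) fun l =>
      le_mul_of_one_le_right (by positivity) (hone l)
  have hsd : Summable fun l : ℕ => d l * z⁻¹ ^ l := by
    refine Summable.of_norm (hs.of_nonneg_of_le (fun l => norm_nonneg _) fun l => ?_)
    rw [norm_mul, norm_pow]
    have h1 : ‖z⁻¹‖ ^ l ≤ M ^ l := pow_le_pow_left₀ (norm_nonneg _) hz' _
    calc ‖d l‖ * ‖z⁻¹‖ ^ l ≤ (‖c l‖ + ‖d l‖) * M ^ l := by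
          gcongr; linarith [norm_nonneg (c l)]
      _ ≤ _ := by gcongr; exact hMl l
  set G : ℂ → ℂ := fun t => (Φ n).eval t * cdk ν Φ n z t with hG
  have hGc : Continuous G := (Φ n).continuous.mul (continuous_cdk ν Φ n z)
  have hF1 (l : ℕ) : Integrable (fun t => G t * t ^ l) ν :=
    H.integrable (hGc.mul (continuous_pow l)).continuousOn
  have hF2 (l : ℕ) : Integrable (fun t => G t * t ^ (-(l : ℤ))) ν := H.integrable_zpow_cdk n z _
  have hF (l : ℕ) : Integrable (fun t => c l * (G t * t ^ l) + d l * (G t * t ^ (-(l : ℤ)))) ν :=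
    ((hF1 l).const_mul _).add ((hF2 l).const_mul _)
  have hGi : Integrable (fun t => ‖G t‖) ν := H.integrable hGc.norm.continuousOn
  have hsum := hasSum_integral_of_summable_integral_norm hF (by
    refine (hs1.mul_right (∫ t, ‖G t‖ ∂ν)).of_nonneg_of_le
      (fun l => integral_nonneg fun t => norm_nonneg _) fun l => ?_
    rw [← integral_const_mul]
    refine integral_mono_ae (hF l).norm (hGi.const_mul _) ?_
    filter_upwards [H.supp] with t ht
    refine (norm_add_le _ _).trans ?_
    simp only [norm_mul, norm_pow, norm_zpow, ht, one_pow, one_zpow, mul_one]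
    linarith)
  have hintg : ∫ t, ∑' l : ℕ, (c l * (G t * t ^ l) + d l * (G t * t ^ (-(l : ℤ)))) ∂ν
      = ∫ t, (Φ n).eval t * cdk ν Φ n z t * v t ∂ν := by
    apply integral_congr_ae
    filter_upwards [H.supp] with t ht
    have h := (hv t ht).mul_left (G t)
    rw [← h.tsum_eq]
    refine tsum_congr fun l => ?_
    rw [zpow_neg, zpow_natCast, inv_pow]; ring
  rw [hintg] at hsum
  have hdiff := hsum.sub (hsd.hasSum.mul_left ((Φ n).eval z))
  rw [← hdiff.tsum_eq, ← tsum_mul_left]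
  refine tsum_of_norm_bounded (hs.mul_left _).hasSum fun l => ?_
  rw [integral_add ((hF1 l).const_mul _) ((hF2 l).const_mul _), integral_const_mul,
    integral_const_mul]
  have b1 := H.norm_cdk_pow_le hB hb hm hM hz l
  have hQ : 0 ≤ B / nsq ν Φ n * (‖(rev Φ n).eval z‖ + ‖(Φ n).eval z‖) := by positivity
  set Q := B / nsq ν Φ n * (‖(rev Φ n).eval z‖ + ‖(Φ n).eval z‖) with hQdef
  calc _ = ‖c l * (∫ t, G t * t ^ l ∂ν) + d l * ((∫ t, G t * t ^ (-(l : ℤ)) ∂ν)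
        - z⁻¹ ^ l * (Φ n).eval z)‖ := by congr 1; ring
    _ ≤ ‖c l‖ * (Q * ((l + 1) ^ 2 * M ^ l)) + ‖d l‖ * (Q * ((l + 1) ^ 2 * M ^ l)) := by
      refine (norm_add_le _ _).trans ?_
      rw [norm_mul, norm_mul]
      refine add_le_add (by gcongr) ?_
      rcases Nat.eq_zero_or_pos l with rfl | hl
      · rw [hd0]; simp
      · gcongr
        exact H.norm_cdk_zpow_neg_le hB hb hm hM hz0 hz' l hl
    _ = _ := by ring

end OPS
end OPUC

namespace OPUC

open scoped ComplexConjugate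

/-- The standard parametrization of the unit circle. -/
noncomputable def e (θ : ℝ) : ℂ := Complex.exp (θ * Complex.I)

lemma norm_e (θ : ℝ) : ‖e θ‖ = 1 := Complex.norm_exp_ofReal_mul_I θ

lemma e_mem (θ : ℝ) : e θ ∈ sphere (0 : ℂ) 1 := by simp [norm_e]

lemma continuous_e : Continuous e := by unfold e; fun_prop

lemma hasDerivAt_e (θ : ℝ) : HasDerivAt e (Complex.I * e θ) θ := by
  have h : HasDerivAt (fun x : ℝ => (x : ℂ) * Complex.I) Complex.I θ := by
    simpa using (Complex.ofRealCLM.hasDerivAt (x := θ)).mul_const Complex.I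
  have := h.cexp
  rwa [mul_comm] at this

lemma e_periodic : Function.Periodic e (2 * π) := by
  intro θ
  unfold e
  push_cast
  rw [add_mul, Complex.exp_add, Complex.exp_two_pi_mul_I, mul_one]

lemma exists_e {t : ℂ} (ht : ‖t‖ = 1) : ∃ θ : ℝ, e θ = t := by
  refine ⟨Complex.arg t, ?_⟩
  have := Complex.norm_mul_exp_arg_mul_I t
  rwa [ht, Complex.ofReal_one, one_mul] at this

lemma norm_e_sub (θ φ : ℝ) : ‖e θ - e φ‖ = 2 * |Real.sin ((θ - φ) / 2)| := by
  have h : e θ - e φ = e ((θ + φ) / 2) * (2 * Complex.I * Real.sin ((θ - φ) / 2)) := by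
    unfold e
    rw [Complex.ofReal_sin, Complex.sin]
    rw [show (θ : ℂ) * Complex.I = (((θ + φ) / 2 : ℝ) : ℂ) * Complex.I
        + (((θ - φ) / 2 : ℝ) : ℂ) * Complex.I by push_cast; ring,
      show (φ : ℂ) * Complex.I = (((θ + φ) / 2 : ℝ) : ℂ) * Complex.I
        + -(((θ - φ) / 2 : ℝ) : ℂ) * Complex.I by push_cast; ring, Complex.exp_add, Complex.exp_add]
    ring_nf
    simp only [Complex.I_sq]
    ring
  rw [h, norm_mul, norm_e, norm_mul, norm_mul, Complex.norm_I, Complex.norm_real, Real.norm_eq_abs]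
  simp

/-- A single power singularity is integrable. -/
lemma intervalIntegrable_rpow_norm_sub {γ : ℝ} (hγ : -1 < γ) (hγ0 : γ ≤ 0) {a : ℂ} (ha : ‖a‖ = 1)
    (x y : ℝ) : IntervalIntegrable (fun θ => ‖e θ - a‖ ^ γ) volume x y := by
  obtain ⟨φ, rfl⟩ := exists_e ha
  have hper : Function.Periodic (fun θ => ‖e θ - e φ‖ ^ γ) (2 * π) := by
    intro θ; simp only [e_periodic θ]
  refine hper.intervalIntegrable (by positivity) (t := φ) ?_ x y
  have hm : Measurable (fun θ => ‖e θ - e φ‖ ^ γ) :=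
    ((continuous_e.sub continuous_const).norm.measurable).pow_const γ
  have i1 : IntervalIntegrable (fun θ : ℝ => ((θ - φ) / π) ^ γ) volume φ (φ + 2 * π) := by
    have h := (intervalIntegral.intervalIntegrable_rpow' (a := 0) (b := 2) hγ)
    have h2 := (h.comp_mul_right (c := π⁻¹)).comp_sub_right φ
    simp only [zero_add, div_inv_eq_mul, zero_mul] at h2
    rw [add_comm φ]
    simpa only [div_eq_mul_inv] using h2
  have i2 : IntervalIntegrable (fun θ : ℝ => ((φ + 2 * π - θ) / π) ^ γ) volume φ (φ + 2 * π) := by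
    have h := (intervalIntegral.intervalIntegrable_rpow' (a := 2) (b := 0) hγ)
    have h2 := (h.comp_mul_right (c := π⁻¹)).comp_sub_left (φ + 2 * π)
    simp only [div_inv_eq_mul, sub_zero, zero_mul] at h2
    rw [show φ + 2 * π - 2 * π = φ by ring] at h2
    simpa only [div_eq_mul_inv] using h2
  refine (i1.add i2).mono_fun hm.aestronglyMeasurable ?_
  rw [uIoc_of_le (by linarith [Real.pi_pos])]
  refine (ae_restrict_iff' measurableSet_Ioc).2 (ae_of_all _ fun θ hθ => ?_)
  have p1 : 0 ≤ (θ - φ) / π := div_nonneg (by linarith [hθ.1]) Real.pi_pos.le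
  have p2 : 0 ≤ (φ + 2 * π - θ) / π := div_nonneg (by linarith [hθ.2]) Real.pi_pos.le
  have q1 := Real.rpow_nonneg p1 γ
  have q2 := Real.rpow_nonneg p2 γ
  beta_reduce
  rw [Real.norm_of_nonneg (by positivity), Real.norm_of_nonneg (by positivity),
    norm_e_sub]
  rcases eq_or_lt_of_le hγ0 with rfl | hγ'
  · simp
  rcases eq_or_lt_of_le hθ.2 with h2 | h2
  · have : (θ - φ) / 2 = π := by rw [h2]; ring
    rw [this]
    simp only [Real.sin_pi, abs_zero, mul_zero]
    rw [Real.zero_rpow hγ'.ne]; positivity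
  have key : ∀ x : ℝ, 0 < x → x ≤ π → (2 * |Real.sin (x / 2)|) ^ γ ≤ (x / π) ^ γ := by
    intro x hx hx'
    have h3 : 2 / π * (x / 2) ≤ Real.sin (x / 2) :=
      Real.mul_le_sin (by linarith) (by linarith)
    have h4 : x / π ≤ 2 * |Real.sin (x / 2)| := by
      have h5 := le_abs_self (Real.sin (x / 2))
      have h6 : 2 / π * (x / 2) = x / π := by ring
      have h7 : 0 < x / π := div_pos hx Real.pi_pos
      linarith
    exact Real.rpow_le_rpow_of_nonpos (div_pos hx Real.pi_pos) h4 hγ0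
  rcases le_total (θ - φ) π with h | h
  · have := key _ (sub_pos.2 hθ.1) h
    linarith
  · have h8 := key (φ + 2 * π - θ) (by linarith) (by linarith)
    have h9 : |Real.sin ((φ + 2 * π - θ) / 2)| = |Real.sin ((θ - φ) / 2)| := by
      rw [show (φ + 2 * π - θ) / 2 = π - (θ - φ) / 2 by ring, Real.sin_pi_sub]
    rw [h9] at h8
    linarith

lemma rpow_le_aux {δ x γ : ℝ} (hδ : 0 < δ) (hδ1 : δ ≤ 1) (hx : 0 ≤ x) (hx2 : x ≤ 2) :
    (δ ≤ x → x ^ γ ≤ (2 / δ) ^ |γ|) ∧ x ^ γ ≤ (2 / δ) ^ |γ| * x ^ (min γ 0) := by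
  have h1 : 1 ≤ 2 / δ := by rw [le_div_iff₀ hδ]; linarith
  rcases le_total 0 γ with h | h
  · rw [abs_of_nonneg h, min_eq_right h, Real.rpow_zero, mul_one]
    have : x ^ γ ≤ (2 / δ) ^ γ := Real.rpow_le_rpow hx (by rw [le_div_iff₀ hδ]; nlinarith) h
    exact ⟨fun _ => this, this⟩
  · rw [abs_of_nonpos h, min_eq_left h]
    constructor
    · intro hd
      rw [Real.rpow_neg (by positivity), ← Real.inv_rpow (by positivity), inv_div]
      exact Real.rpow_le_rpow_of_nonpos (by positivity) (by linarith) h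
    · exact le_mul_of_one_le_left (Real.rpow_nonneg hx _)
        (Real.one_le_rpow h1 (by linarith))

lemma exists_sep {m : ℕ} {a : Fin m → ℂ} (ha : Function.Injective a) :
    ∃ δ : ℝ, 0 < δ ∧ δ ≤ 1 ∧ ∀ j k, j ≠ k → ∀ t : ℂ, δ ≤ ‖t - a j‖ ∨ δ ≤ ‖t - a k‖ := by
  classical
  have h : ∃ δ : ℝ, 0 < δ ∧ ∀ j k, j ≠ k → δ ≤ ‖a j - a k‖ := by
    have : ∀ s : Finset (Fin m × Fin m), ∃ δ : ℝ, 0 < δ ∧ ∀ p ∈ s, p.1 ≠ p.2 →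
        δ ≤ ‖a p.1 - a p.2‖ := by
      intro s
      induction s using Finset.induction_on with
      | empty => exact ⟨1, one_pos, by simp⟩
      | insert p s hp ih =>
        obtain ⟨δ, h0, h⟩ := ih
        by_cases hpp : p.1 = p.2
        · refine ⟨δ, h0, fun q hq hqq => ?_⟩
          rcases Finset.mem_insert.1 hq with rfl | hq
          · exact absurd hpp hqq
          · exact h q hq hqq
        · refine ⟨min δ ‖a p.1 - a p.2‖, lt_min h0 (norm_pos_iff.2 (sub_ne_zero.2
            fun h => hpp (ha h))), fun q hq hqq => ?_⟩
          rcases Finset.mem_insert.1 hq with rfl | hq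
          · exact min_le_right _ _
          · exact (min_le_left _ _).trans (h q hq hqq)
    obtain ⟨δ, h0, h⟩ := this Finset.univ
    exact ⟨δ, h0, fun j k hjk => h (j, k) (Finset.mem_univ _) hjk⟩
  obtain ⟨δ, h0, h⟩ := h
  refine ⟨min (δ / 2) 1, by positivity, min_le_right _ _, fun j k hjk t => ?_⟩
  by_contra! hc
  have h1 := h j k hjk
  have h2 : ‖a j - a k‖ ≤ ‖t - a k‖ + ‖t - a j‖ := by
    rw [show a j - a k = (t - a k) - (t - a j) by ring]; exact norm_sub_le _ _
  have h3 := min_le_left (δ / 2) 1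
  linarith [hc.1, hc.2]

lemma exists_prod_rpow_le {m : ℕ} {a : Fin m → ℂ} (ha : Function.Injective a)
    (hn : ∀ k, ‖a k‖ = 1) (γ : Fin m → ℝ) : ∃ C : ℝ, 0 ≤ C ∧ ∀ t : ℂ, ‖t‖ = 1 →
    ∏ k, ‖t - a k‖ ^ γ k ≤ C * (1 + ∑ k, ‖t - a k‖ ^ (min (γ k) 0)) := by
  classical
  obtain ⟨δ, h0, h1, h⟩ := exists_sep ha
  refine ⟨∏ k, (2 / δ) ^ |γ k|, by positivity, fun t ht => ?_⟩
  have hx (k) : ‖t - a k‖ ≤ 2 := by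
    refine (norm_sub_le _ _).trans ?_; rw [ht, hn]; norm_num
  have hS : 0 ≤ ∑ k, ‖t - a k‖ ^ (min (γ k) 0) := by positivity
  by_cases hk : ∃ k, ‖t - a k‖ < δ
  · obtain ⟨k, hk⟩ := hk
    rw [← Finset.mul_prod_erase _ _ (Finset.mem_univ k),
      ← Finset.mul_prod_erase _ (fun k => (2 / δ) ^ |γ k|) (Finset.mem_univ k)]
    have b1 := (rpow_le_aux (γ := γ k) h0 h1 (norm_nonneg (t - a k)) (hx k)).2
    have b2 : ∏ j ∈ Finset.univ.erase k, ‖t - a j‖ ^ γ j ≤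
        ∏ j ∈ Finset.univ.erase k, (2 / δ) ^ |γ j| := by
      refine Finset.prod_le_prod (fun j _ => by positivity) fun j hj => ?_
      have hjk := (Finset.mem_erase.1 hj).1
      refine (rpow_le_aux h0 h1 (norm_nonneg _) (hx j)).1 ?_
      exact (h j k hjk t).resolve_right (not_le.2 hk)
    have b3 : ‖t - a k‖ ^ (min (γ k) 0) ≤ 1 + ∑ k, ‖t - a k‖ ^ (min (γ k) 0) := by
      have := Finset.single_le_sum (f := fun k => ‖t - a k‖ ^ (min (γ k) 0))
        (fun j _ => by positivity) (Finset.mem_univ k)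
      linarith
    calc _ ≤ ((2 / δ) ^ |γ k| * ‖t - a k‖ ^ (min (γ k) 0)) *
          ∏ j ∈ Finset.univ.erase k, (2 / δ) ^ |γ j| := by gcongr
      _ = ((2 / δ) ^ |γ k| * ∏ j ∈ Finset.univ.erase k, (2 / δ) ^ |γ j|) *
          ‖t - a k‖ ^ (min (γ k) 0) := by ring
      _ ≤ _ := by gcongr
  · push Not at hk
    have b2 : ∏ j, ‖t - a j‖ ^ γ j ≤ ∏ j, (2 / δ) ^ |γ j| :=
      Finset.prod_le_prod (fun j _ => by positivity) fun j hj =>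
        (rpow_le_aux h0 h1 (norm_nonneg _) (hx j)).1 (hk j)
    refine b2.trans (le_mul_of_one_le_right (by positivity) (by linarith))

lemma intervalIntegrable_prod_rpow {m : ℕ} {a : Fin m → ℂ} (ha : Function.Injective a)
    (hn : ∀ k, ‖a k‖ = 1) {γ : Fin m → ℝ} (hγ : ∀ k, -1 < γ k) (x y : ℝ) :
    IntervalIntegrable (fun θ => ∏ k, ‖e θ - a k‖ ^ γ k) volume x y := by
  obtain ⟨C, hC, h⟩ := exists_prod_rpow_le ha hn γ
  have hm : Measurable (fun θ => ∏ k, ‖e θ - a k‖ ^ γ k) :=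
    Finset.measurable_prod _ fun k _ =>
      ((continuous_e.sub continuous_const).norm.measurable).pow_const _
  have hi : IntervalIntegrable (fun θ => C * (1 + ∑ k, ‖e θ - a k‖ ^ (min (γ k) 0))) volume x y := by
    refine IntervalIntegrable.const_mul (intervalIntegrable_const.add ?_) C
    have := IntervalIntegrable.sum (μ := volume) (a := x) (b := y) Finset.univ
      (f := fun k θ => ‖e θ - a k‖ ^ (min (γ k) 0)) fun k _ =>
      intervalIntegrable_rpow_norm_sub (lt_min (hγ k) (by norm_num)) (min_le_right _ _) (hn k) x y
    rw [Finset.sum_fn] at this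
    exact this
  refine hi.mono_fun hm.aestronglyMeasurable (ae_of_all _ fun θ => ?_)
  beta_reduce
  rw [Real.norm_of_nonneg (by positivity), Real.norm_of_nonneg (by positivity)]
  exact h _ (norm_e θ)

end OPUC

namespace OPUC

open scoped ComplexConjugate

lemma hasSum_of_eq {ι E : Type*} [AddCommMonoid E] [TopologicalSpace E] {f g : ι → E} {s : E}
    (h : HasSum f s) (hfg : ∀ i, f i = g i) : HasSum g s := (funext hfg : f = g) ▸ h

/-- Data of a Fisher-Hartwig weight `exp (2 Re ℓ) ∏ |t - a k| ^ (2 β k)` on the unit circle, the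
function `ℓ` being holomorphic in the disk of radius `R > 1`. -/
structure SData (m : ℕ) where
  /-- The singular points. -/
  a : Fin m → ℂ
  /-- The exponents. -/
  β : Fin m → ℝ
  /-- The Taylor coefficients of `ℓ`. -/
  L : ℕ → ℂ
  /-- The radius. -/
  R : ℝ
  norm_a : ∀ k, ‖a k‖ = 1
  inj : Function.Injective a
  hβ : ∀ k, -(1 / 2) < β k
  one_lt_R : 1 < R
  L_zero : (L 0).im = 0
  bound : ∃ C, ∀ j, ‖L j‖ * R ^ j ≤ C

namespace SData

variable {m : ℕ} (S : SData m)

lemma R_pos : 0 < S.R := one_pos.trans S.one_lt_R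

/-- The holomorphic function `ℓ`. -/
noncomputable def ell (z : ℂ) : ℂ := ∑' j, S.L j * z ^ j

lemma exists_coeff_le : ∃ C, 0 ≤ C ∧ ∀ j, ‖S.L j‖ ≤ C * S.R⁻¹ ^ j := by
  obtain ⟨C, hC⟩ := S.bound
  have hR := S.R_pos
  refine ⟨C, (by positivity : 0 ≤ ‖S.L 0‖ * S.R ^ 0).trans (hC 0), fun j => ?_⟩
  rw [inv_pow, ← div_eq_mul_inv, le_div_iff₀ (by positivity)]
  exact hC j

/-- Summability of the coefficients against polynomially weighted powers. -/
lemma summable_mul_pow (p : ℕ) {r : ℝ} (hr0 : 0 ≤ r) (hr : r < S.R) :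
    Summable fun l : ℕ => ‖S.L l‖ * ((l : ℝ) ^ p * r ^ l) := by
  obtain ⟨C, hC, h⟩ := S.exists_coeff_le
  have hR := S.R_pos
  have h1 : Summable fun l : ℕ => C * ((l : ℝ) ^ p * (r / S.R) ^ l) := by
    refine Summable.mul_left C ?_
    exact summable_pow_mul_geometric_of_norm_lt_one p (by
      rw [Real.norm_of_nonneg (by positivity), div_lt_one hR]; exact hr)
  refine Summable.of_nonneg_of_le (fun l => by positivity) (fun l => ?_) h1
  calc _ ≤ (C * S.R⁻¹ ^ l) * ((l : ℝ) ^ p * r ^ l) := by gcongr; exact h l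
    _ = _ := by rw [div_eq_mul_inv, mul_pow]; ring

lemma summable_norm_pow {r : ℝ} (hr0 : 0 ≤ r) (hr : r < S.R) :
    Summable fun l : ℕ => ‖S.L l‖ * r ^ l := by simpa using S.summable_mul_pow 0 hr0 hr

lemma hasSum_ell {z : ℂ} (hz : ‖z‖ < S.R) : HasSum (fun j => S.L j * z ^ j) (S.ell z) := by
  refine (Summable.of_norm ?_).hasSum
  simpa using S.summable_norm_pow (norm_nonneg z) hz

lemma differentiableOn_ell : DifferentiableOn ℂ S.ell (ball 0 S.R) := by
  intro z hz
  rw [mem_ball_zero_iff] at hz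
  obtain ⟨r, hr1, hr2⟩ := exists_between hz
  have h := Complex.differentiableOn_tsum_of_summable_norm (U := ball (0 : ℂ) r)
    (F := fun j z => S.L j * z ^ j) (S.summable_norm_pow ((norm_nonneg z).trans hr1.le) hr2)
    (fun j => by fun_prop) isOpen_ball (fun j w hw => by
      rw [mem_ball_zero_iff] at hw
      rw [norm_mul, norm_pow]; gcongr)
  exact ((h z (by simpa using hr1)).differentiableAt
    (isOpen_ball.mem_nhds (by simpa using hr1))).differentiableWithinAt

lemma differentiableAt_ell {z : ℂ} (hz : ‖z‖ < S.R) : DifferentiableAt ℂ S.ell z :=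
  S.differentiableOn_ell.differentiableAt (isOpen_ball.mem_nhds (by simpa using hz))

lemma hasDerivAt_ell {z : ℂ} (hz : ‖z‖ < S.R) : HasDerivAt S.ell (deriv S.ell z) z :=
  (S.differentiableAt_ell hz).hasDerivAt

lemma continuousOn_ell : ContinuousOn S.ell (ball 0 S.R) := S.differentiableOn_ell.continuousOn

lemma continuousOn_deriv_ell : ContinuousOn (deriv S.ell) (ball 0 S.R) :=
  (S.differentiableOn_ell.deriv isOpen_ball).continuousOn

lemma hasSum_mul_deriv_ell {z : ℂ} (hz : ‖z‖ < S.R) :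
    HasSum (fun l : ℕ => (l * S.L l) * z ^ l) (z * deriv S.ell z) := by
  obtain ⟨r, hr1, hr2⟩ := exists_between hz
  have h := Complex.hasSum_deriv_of_summable_norm (U := ball (0 : ℂ) r)
    (F := fun j z => S.L j * z ^ j) (S.summable_norm_pow ((norm_nonneg z).trans hr1.le) hr2)
    (fun j => by fun_prop) isOpen_ball (fun j w hw => by
      rw [mem_ball_zero_iff] at hw
      rw [norm_mul, norm_pow]; gcongr) (z := z) (by simpa using hr1)
  have h2 := h.mul_left z
  refine hasSum_of_eq h2 fun l => ?_
  rw [deriv_const_mul _ (by fun_prop)]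
  rcases l with _ | l
  · simp
  · simp; ring

/-- The logarithmic derivative of the smooth part of the weight. -/
noncomputable def v (t : ℂ) : ℂ :=
  Complex.I * (t * deriv S.ell t) + conj (Complex.I * (t * deriv S.ell t))

/-- The weight. -/
noncomputable def W (t : ℂ) : ℝ :=
  Real.exp (2 * (S.ell t).re) * ∏ k, ‖t - S.a k‖ ^ (2 * S.β k)

lemma sphere_subset : sphere (0 : ℂ) 1 ⊆ ball 0 S.R := fun t ht => by
  rw [mem_sphere_zero_iff_norm] at ht
  rw [mem_ball_zero_iff, ht]; exact S.one_lt_R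

lemma norm_e_lt (θ : ℝ) : ‖e θ‖ < S.R := by rw [norm_e]; exact S.one_lt_R

lemma continuousOn_v : ContinuousOn S.v (sphere 0 1) := by
  have h : ContinuousOn (fun t => Complex.I * (t * deriv S.ell t)) (sphere 0 1) :=
    continuousOn_const.mul (continuousOn_id.mul (S.continuousOn_deriv_ell.mono S.sphere_subset))
  exact h.add (Complex.continuous_conj.comp_continuousOn h)

lemma hasSum_v {t : ℂ} (ht : ‖t‖ = 1) :
    HasSum (fun l : ℕ => (Complex.I * l * S.L l) * t ^ l
      + (-(Complex.I * l * conj (S.L l))) * t⁻¹ ^ l) (S.v t) := by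
  have h := (S.hasSum_mul_deriv_ell (ht ▸ S.one_lt_R)).mul_left Complex.I
  have h2 := (Complex.hasSum_conj'.2 h)
  refine hasSum_of_eq (h.add h2) fun l => ?_
  have : t⁻¹ = conj t := by rw [Complex.inv_def, Complex.normSq_eq_norm_sq, ht]; simp
  rw [this]
  simp
  ring

lemma W_nonneg (t : ℂ) : 0 ≤ S.W t := by unfold W; positivity

lemma W_pos {t : ℂ} (ht : ∀ k, t ≠ S.a k) : 0 < S.W t := by
  unfold W
  refine mul_pos (Real.exp_pos _) (Finset.prod_pos fun k _ => Real.rpow_pos_of_pos ?_ _)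
  exact norm_pos_iff.2 (sub_ne_zero.2 (ht k))

lemma continuous_ell_e : Continuous fun θ => S.ell (e θ) :=
  S.continuousOn_ell.comp_continuous continuous_e fun θ => by
    simpa using S.norm_e_lt θ

lemma measurable_W_e : Measurable fun θ => S.W (e θ) := by
  unfold W
  refine Measurable.mul ?_ ?_
  · exact (Complex.continuous_re.comp S.continuous_ell_e).measurable.const_mul 2 |>.exp
  · exact Finset.measurable_prod _ fun k _ =>
      ((continuous_e.sub continuous_const).norm.measurable).pow_const _

lemma intervalIntegrable_W (x y : ℝ) :
    IntervalIntegrable (fun θ => S.W (e θ)) volume x y := by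
  have h := intervalIntegrable_prod_rpow S.inj S.norm_a (γ := fun k => 2 * S.β k)
    (fun k => by linarith [S.hβ k]) x y
  refine h.continuousOn_mul (g := fun θ => Real.exp (2 * (S.ell (e θ)).re)) ?_
  exact (Real.continuous_exp.comp (continuous_const.mul
    (Complex.continuous_re.comp S.continuous_ell_e))).continuousOn

/-- The measure on the circle with density `W`. -/
noncomputable def meas : Measure ℂ :=
  Measure.map e ((volume.restrict (Ioc 0 (2 * π))).withDensity
    fun θ => ENNReal.ofReal (S.W (e θ)))

instance : IsFiniteMeasure S.meas := by
  have h : IsFiniteMeasure ((volume.restrict (Ioc 0 (2 * π))).withDensity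
    fun θ => ENNReal.ofReal (S.W (e θ))) := by
    refine isFiniteMeasure_withDensity_ofReal ?_
    have := S.intervalIntegrable_W 0 (2 * π)
    rw [intervalIntegrable_iff_integrableOn_Ioc_of_le (by positivity)] at this
    exact this.2
  exact Measure.isFiniteMeasure_map _ _

lemma ae_meas : ∀ᵐ t ∂S.meas, ‖t‖ = 1 := by
  unfold meas
  rw [ae_map_iff continuous_e.aemeasurable (measurableSet_eq_fun (by fun_prop) (by fun_prop))]
  exact ae_of_all _ norm_e

lemma integral_meas {E : Type*} [NormedAddCommGroup E] [NormedSpace ℝ E] {f : ℂ → E}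
    (hf : AEStronglyMeasurable f S.meas) :
    ∫ t, f t ∂S.meas = ∫ θ in (0 : ℝ)..(2 * π), S.W (e θ) • f (e θ) := by
  unfold meas at hf ⊢
  rw [integral_map continuous_e.aemeasurable hf,
    integral_withDensity_eq_integral_toReal_smul S.measurable_W_e.ennreal_ofReal
      (ae_of_all _ fun _ => ENNReal.ofReal_lt_top),
    intervalIntegral.integral_of_le (by positivity)]
  refine integral_congr_ae (ae_of_all _ fun θ => ?_)
  beta_reduce
  rw [ENNReal.toReal_ofReal (S.W_nonneg _)]

lemma restrict_meas : S.meas.restrict (sphere 0 1) = S.meas :=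
  Measure.restrict_eq_self_of_ae_mem (S.ae_meas.mono fun t ht => by simpa using ht)

lemma aestronglyMeasurable {E : Type*} [NormedAddCommGroup E] {f : ℂ → E}
    (hf : ContinuousOn f (sphere 0 1)) : AEStronglyMeasurable f S.meas := by
  rw [← S.restrict_meas]
  exact hf.aestronglyMeasurable_of_isCompact (isCompact_sphere _ _)
    (isCompact_sphere _ _).measurableSet

lemma countable_preimage_e (t : ℂ) : {θ | e θ = t}.Countable := by
  by_cases h : ∃ φ, e φ = t
  · obtain ⟨φ, rfl⟩ := h
    refine (countable_range fun n : ℤ => φ + n * (2 * π)).mono fun θ hθ => ?_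
    obtain ⟨n, hn⟩ := Complex.exp_eq_exp_iff_exists_int.1 (show e θ = e φ from hθ)
    refine ⟨n, ?_⟩
    have h : (θ : ℂ) * Complex.I = (φ + n * (2 * π)) * Complex.I := by rw [hn]; ring
    have h2 := mul_right_cancel₀ Complex.I_ne_zero h
    exact_mod_cast h2.symm
  · convert countable_empty (α := ℝ)
    ext θ; simp only [mem_ofPred_eq, mem_empty_iff_false, iff_false]
    exact fun hθ => h ⟨θ, hθ⟩

lemma countable_sing : {θ | ∃ k, e θ = S.a k}.Countable := by
  rw [ofPred_exists]
  exact countable_iUnion fun k => countable_preimage_e _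

lemma meas_nondeg (p : ℂ[X]) (h : ∀ᵐ t ∂S.meas, p.eval t = 0) : p = 0 := by
  by_contra hp
  unfold meas at h
  rw [ae_map_iff continuous_e.aemeasurable (measurableSet_eq_fun p.continuous.measurable
    measurable_const), ae_withDensity_iff S.measurable_W_e.ennreal_ofReal] at h
  have hc : {θ | p.eval (e θ) = 0}.Countable := by
    have : {θ | p.eval (e θ) = 0} ⊆ ⋃ t ∈ (p.roots.toFinset : Set ℂ), {θ | e θ = t} := by
      intro θ hθ
      simp only [mem_iUnion]
      refine ⟨e θ, ?_, rfl⟩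
      simpa [hp] using hθ
    exact ((Set.Finite.countable (Finset.finite_toSet _)).biUnion
      fun t _ => countable_preimage_e t).mono this
  have h1 : ∀ᵐ θ ∂(volume.restrict (Ioc 0 (2 * π))), False := by
    have a1 := ae_restrict_of_ae (s := Ioc 0 (2 * π)) (measure_eq_zero_iff_ae_notMem.1
      (hc.measure_zero volume))
    have a2 := ae_restrict_of_ae (s := Ioc 0 (2 * π)) (measure_eq_zero_iff_ae_notMem.1
      (S.countable_sing.measure_zero volume))
    filter_upwards [h, a1, a2] with θ h h1 h2
    refine h1 (h ?_)
    refine (ENNReal.ofReal_pos.2 (S.W_pos fun k hk => h2 ⟨k, hk⟩)).ne'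
  rw [ae_iff] at h1
  simp [Real.pi_pos.not_ge] at h1

end SData

end OPUC

namespace OPUC

open scoped ComplexConjugate

/-- The real part of the kernel `i (t + a) / (t - a)`, which is real on the circle. -/
noncomputable def cre (t a : ℂ) : ℝ := (Complex.I * (t + a) / (t - a)).re

lemma conj_eq_inv {t : ℂ} (ht : ‖t‖ = 1) : conj t = t⁻¹ := by
  rw [Complex.inv_def, Complex.normSq_eq_norm_sq, ht]; simp

lemma cre_eq {t a : ℂ} (ht : ‖t‖ = 1) (ha : ‖a‖ = 1) :
    (cre t a : ℂ) = Complex.I * (t + a) / (t - a) := by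
  by_cases h : t = a
  · simp [h, cre]
  unfold cre
  rw [← Complex.conj_eq_iff_re]
  have h0 := ne_zero_of_norm_one ht
  have h1 := ne_zero_of_norm_one ha
  have h2 : t - a ≠ 0 := sub_ne_zero.2 h
  have h3 : a - t ≠ 0 := sub_ne_zero.2 (Ne.symm h)
  have h4 : t⁻¹ - a⁻¹ ≠ 0 := sub_ne_zero.2 (fun h' => h (inv_injective h'))
  simp only [map_div₀, map_mul, map_add, map_sub, conj_eq_inv ht, conj_eq_inv ha, Complex.conj_I]
  rw [div_eq_div_iff h4 h2]
  field_simp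
  ring

lemma hasDerivAt_rpow_norm {a : ℂ} (ha : ‖a‖ = 1) (β : ℝ) {θ : ℝ} (h : e θ ≠ a) :
    HasDerivAt (fun θ => ‖e θ - a‖ ^ (2 * β)) (‖e θ - a‖ ^ (2 * β) * (β * cre (e θ) a)) θ := by
  have h0 : 0 < ‖e θ - a‖ := norm_pos_iff.2 (sub_ne_zero.2 h)
  have h1 := ((hasDerivAt_e θ).sub_const a).norm_sq
  have h2 := h1.rpow_const (p := β) (Or.inl (by positivity))
  have e1 : ∀ x : ℝ, 0 ≤ x → (x ^ 2) ^ β = x ^ (2 * β) := fun x hx => by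
    rw [Real.rpow_mul hx]; norm_num
  have e2 : (fun θ => (‖e θ - a‖ ^ 2) ^ β) = fun θ => ‖e θ - a‖ ^ (2 * β) :=
    funext fun θ => e1 _ (norm_nonneg _)
  rw [e2] at h2
  convert h2 using 1
  have e3 : 2 * inner ℝ (e θ - a) (Complex.I * e θ) = cre (e θ) a * ‖e θ - a‖ ^ 2 := by
    have : (((2 * inner ℝ (e θ - a) (Complex.I * e θ) : ℝ)) : ℂ) =
        ((cre (e θ) a * ‖e θ - a‖ ^ 2 : ℝ) : ℂ) := by
      push_cast
      rw [cre_eq (norm_e θ) ha, ← Complex.mul_conj' , Complex.inner]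
      have q : ∀ z : ℂ, (2 : ℂ) * (z.re : ℂ) = z + conj z := fun z => by
        rw [Complex.add_conj]; push_cast; ring
      rw [q]
      have h00 := ne_zero_of_norm_one (norm_e θ)
      have h01 := ne_zero_of_norm_one ha
      have h02 : e θ - a ≠ 0 := sub_ne_zero.2 h
      simp only [map_mul, map_sub, map_inv₀, conj_eq_inv ha, conj_eq_inv (norm_e θ),
        Complex.conj_I]
      field_simp
      ring
    exact_mod_cast this
  rw [e3, ← e1 _ h0.le, Real.rpow_sub_one (by positivity)]
  field_simp

namespace SData

variable {m : ℕ} (S : SData m)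

lemma hasDerivAt_prod {θ : ℝ} (h : ∀ k, e θ ≠ S.a k) (s : Finset (Fin m)) :
    HasDerivAt (fun θ => ∏ k ∈ s, ‖e θ - S.a k‖ ^ (2 * S.β k))
      ((∏ k ∈ s, ‖e θ - S.a k‖ ^ (2 * S.β k)) * ∑ k ∈ s, S.β k * cre (e θ) (S.a k)) θ := by
  classical
  induction s using Finset.induction_on with
  | empty => simpa using hasDerivAt_const θ (1 : ℝ)
  | insert k s hk ih =>
    simp only [Finset.prod_insert hk, Finset.sum_insert hk]
    exact ((hasDerivAt_rpow_norm (S.norm_a k) (S.β k) (h k)).mul ih).congr_deriv (by ring)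

lemma hasDerivAt_ell_e (θ : ℝ) :
    HasDerivAt (fun θ => S.ell (e θ)) (Complex.I * (e θ * deriv S.ell (e θ))) θ := by
  have := (S.hasDerivAt_ell (S.norm_e_lt θ)).comp_of_eq θ (hasDerivAt_e θ) rfl
  exact this.congr_deriv (by ring)

lemma ofReal_re_v (t : ℂ) : ((2 * (Complex.I * (t * deriv S.ell t)).re : ℝ) : ℂ) = S.v t := by
  unfold v
  rw [Complex.add_conj]

lemma v_eq_re (t : ℂ) : S.v t = ((S.v t).re : ℂ) := by
  rw [← ofReal_re_v, Complex.ofReal_re]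

lemma hasDerivAt_W {θ : ℝ} (h : ∀ k, e θ ≠ S.a k) :
    HasDerivAt (fun θ => S.W (e θ))
      (S.W (e θ) * ((S.v (e θ)).re + ∑ k, S.β k * cre (e θ) (S.a k))) θ := by
  unfold W
  have h1 : HasDerivAt (fun θ => Real.exp (2 * (S.ell (e θ)).re))
      (Real.exp (2 * (S.ell (e θ)).re) * (S.v (e θ)).re) θ := by
    have := ((Complex.reCLM.hasFDerivAt.comp_hasDerivAt θ (S.hasDerivAt_ell_e θ)).const_mul 2).exp
    rw [← ofReal_re_v, Complex.ofReal_re]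
    exact this
  exact (h1.mul (S.hasDerivAt_prod h Finset.univ)).congr_deriv (by ring)

/-- A function vanishing at the singularities becomes continuous after multiplication by `W`. -/
lemma continuous_mul_W {H : ℂ → ℂ} {G : Fin m → ℂ → ℂ} (hH : ContinuousOn H (sphere 0 1))
    (hG : ∀ k, ContinuousOn (G k) (sphere 0 1))
    (h : ∀ k t, ‖t‖ = 1 → H t = (t - S.a k) * G k t) :
    Continuous fun θ => H (e θ) * (S.W (e θ) : ℂ) := by
  classical
  have cH : Continuous fun θ => H (e θ) := hH.comp_continuous continuous_e e_mem
  have cE : Continuous fun θ => Real.exp (2 * (S.ell (e θ)).re) :=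
    Real.continuous_exp.comp (continuous_const.mul
      (Complex.continuous_re.comp S.continuous_ell_e))
  have cR : ∀ k θ, e θ ≠ S.a k → ContinuousAt (fun θ => ‖e θ - S.a k‖ ^ (2 * S.β k)) θ := by
    intro k θ hk
    refine ContinuousAt.rpow_const (continuous_e.sub continuous_const).norm.continuousAt
      (Or.inl (norm_ne_zero_iff.2 (sub_ne_zero.2 hk)))
  rw [continuous_iff_continuousAt]
  intro θ
  by_cases hk : ∃ k, e θ = S.a k
  · obtain ⟨k, hk⟩ := hk
    have hne : ∀ j ∈ Finset.univ.erase k, e θ ≠ S.a j := fun j hj hj' =>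
      (Finset.mem_erase.1 hj).1 (S.inj (hj'.symm.trans hk))
    have e1 : (fun θ => H (e θ) * (S.W (e θ) : ℂ)) = fun θ =>
        (H (e θ) * ((‖e θ - S.a k‖ ^ (2 * S.β k) : ℝ) : ℂ)) *
        ((Real.exp (2 * (S.ell (e θ)).re) *
          ∏ j ∈ Finset.univ.erase k, ‖e θ - S.a j‖ ^ (2 * S.β j) : ℝ) : ℂ) := by
      funext θ
      unfold W
      rw [← Finset.mul_prod_erase _ _ (Finset.mem_univ k)]
      push_cast; ring
    rw [e1]
    refine ContinuousAt.mul ?_ (Complex.continuous_ofReal.continuousAt.comp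
      (cE.continuousAt.mul (tendsto_finsetProd _ fun j hj => cR j θ (hne j hj))))
    have hH0 : H (e θ) = 0 := by rw [h k _ (norm_e θ), hk]; simp
    unfold ContinuousAt
    beta_reduce
    rw [hH0, zero_mul]
    have cG : Continuous fun θ => G k (e θ) := (hG k).comp_continuous continuous_e e_mem
    have cN : Continuous fun θ => ‖e θ - S.a k‖ ^ (1 + 2 * S.β k) * ‖G k (e θ)‖ :=
      ((continuous_e.sub continuous_const).norm.rpow_const
        fun _ => Or.inr (by linarith [S.hβ k])).mul cG.norm
    have t1 := cN.tendsto θ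
    simp only [hk, sub_self, norm_zero] at t1
    rw [Real.zero_rpow (by linarith [S.hβ k]), zero_mul] at t1
    refine squeeze_zero_norm (fun θ => ?_) t1
    by_cases h0 : e θ = S.a k
    · rw [h k _ (norm_e θ), h0]; simp; positivity
    · have h1 : 0 < ‖e θ - S.a k‖ := norm_pos_iff.2 (sub_ne_zero.2 h0)
      rw [norm_mul, Complex.norm_real, Real.norm_of_nonneg (by positivity), h k _ (norm_e θ),
        norm_mul, Real.rpow_add h1, Real.rpow_one]
      exact le_of_eq (by ring)
  · push Not at hk
    refine cH.continuousAt.mul (Complex.continuous_ofReal.continuousAt.comp ?_)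
    exact cE.continuousAt.mul (tendsto_finsetProd _ fun j _ => cR j θ (hk j))

/-- Integration by parts on the circle. -/
lemma integral_by_parts (F Q : ℂ[X]) {G : Fin m → ℂ → ℂ}
    (hG : ∀ k, ContinuousOn (G k) (sphere 0 1))
    (h : ∀ k t, ‖t‖ = 1 → F.eval t * conj (Q.eval t) = (t - S.a k) * G k t) :
    ∫ t, (Complex.I * (t * (derivative F).eval t) * conj (Q.eval t)
      - Complex.I * F.eval t * conj (t * (derivative Q).eval t)
      + F.eval t * conj (Q.eval t) * S.v t
      + ∑ k, S.β k * (Complex.I * (t + S.a k) * G k t)) ∂S.meas = 0 := by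
  have hc : ContinuousOn (fun t => Complex.I * (t * (derivative F).eval t) * conj (Q.eval t)
      - Complex.I * F.eval t * conj (t * (derivative Q).eval t)
      + F.eval t * conj (Q.eval t) * S.v t
      + ∑ k, S.β k * (Complex.I * (t + S.a k) * G k t)) (sphere 0 1) := by
    have hF := F.continuous.continuousOn (s := sphere (0:ℂ) 1)
    have hF' := (derivative F).continuous.continuousOn (s := sphere (0:ℂ) 1)
    have hQ := (continuous_conj_eval Q).continuousOn (s := sphere (0:ℂ) 1)
    have hQ' : ContinuousOn (fun t => conj (t * (derivative Q).eval t)) (sphere (0:ℂ) 1) :=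
      (Complex.continuous_conj.comp
        (continuous_id.mul (derivative Q).continuous)).continuousOn
    have hv := S.continuousOn_v
    refine (((continuousOn_const.mul (continuousOn_id.mul hF')).mul hQ).sub
      ((continuousOn_const.mul hF).mul hQ')).add ((hF.mul hQ).mul hv) |>.add ?_
    refine continuousOn_finsetSum _ fun k _ => ?_
    exact continuousOn_const.mul ((continuousOn_const.mul
      (continuousOn_id.add continuousOn_const)).mul (hG k))
  rw [S.integral_meas (S.aestronglyMeasurable hc)]
  have cc := S.continuous_mul_W (H := fun t => F.eval t * conj (Q.eval t))
    (F.continuous.mul (continuous_conj_eval Q)).continuousOn hG h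
  have := integral_eq_of_hasDerivAt_off_countable
    (fun θ => (F.eval (e θ) * conj (Q.eval (e θ))) * (S.W (e θ) : ℂ)) (fun θ =>
      S.W (e θ) • (fun t => Complex.I * (t * (derivative F).eval t) * conj (Q.eval t)
      - Complex.I * F.eval t * conj (t * (derivative Q).eval t)
      + F.eval t * conj (Q.eval t) * S.v t
      + ∑ k, S.β k * (Complex.I * (t + S.a k) * G k t)) (e θ)) (a := 0) (b := 2 * π)
      S.countable_sing cc.continuousOn ?_ ?_
  · rw [this]
    have : e (2 * π) = e 0 := by simpa using e_periodic 0
    simp only [this, sub_self]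
  · rintro θ ⟨-, hθ⟩
    simp only [mem_ofPred_eq, not_exists] at hθ
    have hW := (S.hasDerivAt_W hθ).ofReal_comp
    have hp : ∀ p : ℂ[X], HasDerivAt (fun θ => p.eval (e θ))
        (Complex.I * (e θ * (derivative p).eval (e θ))) θ := fun p => by
      have := (p.hasDerivAt (e θ)).comp_of_eq θ (hasDerivAt_e θ) rfl
      exact this.congr_deriv (by ring)
    have hq : HasDerivAt (fun θ => conj (Q.eval (e θ)))
        (conj (Complex.I * (e θ * (derivative Q).eval (e θ)))) θ :=
      Complex.conjCLE.toContinuousLinearMap.hasFDerivAt.comp_hasDerivAt θ (hp Q)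
    refine (((hp F).mul hq).mul hW).congr_deriv ?_
    beta_reduce
    rw [Complex.real_smul]
    have e2 : ∑ k, (S.β k : ℂ) * (Complex.I * (e θ + S.a k) * G k (e θ)) =
        (F.eval (e θ) * conj (Q.eval (e θ))) * ∑ k, (S.β k : ℂ) * cre (e θ) (S.a k) := by
      rw [Finset.mul_sum]
      refine Finset.sum_congr rfl fun k _ => ?_
      rw [h k _ (norm_e θ), cre_eq (norm_e θ) (S.norm_a k)]
      have : e θ - S.a k ≠ 0 := sub_ne_zero.2 (hθ k)
      field_simp
    rw [e2]
    push_cast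
    rw [← S.v_eq_re]
    simp only [map_mul, Complex.conj_I, Pi.mul_apply]
    ring
  · have hcc : Continuous fun θ => (fun t => Complex.I * (t * (derivative F).eval t)
      * conj (Q.eval t)
      - Complex.I * F.eval t * conj (t * (derivative Q).eval t)
      + F.eval t * conj (Q.eval t) * S.v t
      + ∑ k, S.β k * (Complex.I * (t + S.a k) * G k t)) (e θ) :=
      hc.comp_continuous continuous_e e_mem
    exact (S.intervalIntegrable_W 0 (2 * π)).smul_continuousOn hcc.continuousOn

end SData

end OPUC

namespace OPUC

open scoped ComplexConjugate

lemma conj_sub_circle {t a : ℂ} (ht : ‖t‖ = 1) (ha : ‖a‖ = 1) :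
    conj (t - a) = (t - a) * (-(conj a * conj t)) := by
  have h1 := mul_conj_one ht
  have h2 := mul_conj_one ha
  simp only [map_sub]
  linear_combination (conj a) * h1 - (conj t) * h2

lemma mul_conj_add_circle {t a : ℂ} (ht : ‖t‖ = 1) (ha : ‖a‖ = 1) :
    (t + a) * (-(conj a * conj t)) = -conj (t + a) := by
  have h1 := mul_conj_one ht
  have h2 := mul_conj_one ha
  simp only [map_add]
  linear_combination -(conj a) * h1 - (conj t) * h2

lemma exists_eq_X_sub_C_mul {Q : ℂ[X]} {a : ℂ} (h : Q.eval a = 0) :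
    ∃ Q1, Q = (X - C a) * Q1 ∧ ((X + C a) * Q1).degree = Q.degree := by
  obtain ⟨Q1, rfl⟩ := dvd_iff_isRoot.2 h
  exact ⟨Q1, rfl, by rw [degree_mul, degree_mul, degree_X_add_C, degree_X_sub_C]⟩

lemma im_mul_conj_mul {t a : ℂ} (ht : ‖t‖ = 1) (ha : ‖a‖ = 1) :
    (Complex.I * ((t - a) * conj (t + a))).im = 0 := by
  rw [← Complex.conj_eq_iff_im]
  have h1 := mul_conj_one ht
  have h2 := mul_conj_one ha
  simp only [map_mul, map_add, map_sub, Complex.conj_I, Complex.conj_conj]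
  linear_combination (2 * Complex.I) * (h2 - h1)

lemma degree_X_mul_derivative_le (p : ℂ[X]) : (X * derivative p).degree ≤ p.degree := by
  rcases eq_or_ne (derivative p) 0 with h | h
  · simp [h]
  have h0 : p.natDegree ≠ 0 := fun h0 => h (derivative_of_natDegree_zero h0)
  have h1 := natDegree_derivative_lt h0
  rw [degree_le_iff_coeff_zero]
  intro k hk
  have hp : p ≠ 0 := fun hp => h (by rw [hp, derivative_zero])
  rw [degree_eq_natDegree hp] at hk
  have hk' : p.natDegree < k := by exact_mod_cast hk
  exact coeff_eq_zero_of_natDegree_lt (natDegree_mul_le.trans_lt (by simp; omega))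

lemma im_integral_eq_zero {ν : Measure ℂ} {f : ℂ → ℂ} (h : ∀ᵐ t ∂ν, (f t).im = 0) :
    (∫ t, f t ∂ν).im = 0 := by
  have : ∫ t, f t ∂ν = ∫ t, (((f t).re : ℝ) : ℂ) ∂ν := by
    refine integral_congr_ae (h.mono fun t ht => ?_)
    beta_reduce
    rw [Complex.ext_iff]; simp [ht]
  rw [this, integral_complex_ofReal]; simp

namespace SData

variable {m : ℕ} (S : SData m) {Φ : ℕ → ℂ[X]} (H : OPS S.meas Φ)

/-- The Lagrange basis at the singular points. -/
noncomputable def lag (k : Fin m) : ℂ[X] := Lagrange.basis Finset.univ S.a k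

lemma lag_self (k : Fin m) : (S.lag k).eval (S.a k) = 1 :=
  Lagrange.eval_basis_self S.inj.injOn (Finset.mem_univ k)

lemma lag_ne {j k : Fin m} (h : j ≠ k) : (S.lag k).eval (S.a j) = 0 :=
  Lagrange.eval_basis_of_ne h.symm (Finset.mem_univ j)

lemma lag_degree {n : ℕ} (hn : m ≤ n) (k : Fin m) : (S.lag k).degree < n := by
  have : 0 < m := k.pos
  rw [lag, Lagrange.degree_basis S.inj.injOn (Finset.mem_univ k)]
  simp only [Finset.card_univ, Fintype.card_fin]
  exact_mod_cast by omega

/-- The polynomial `z Φ' - n Φ`. -/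
noncomputable def pdef (Φ : ℕ → ℂ[X]) (n : ℕ) : ℂ[X] := X * derivative (Φ n) - C (n : ℂ) * Φ n

/-- The integral `∫ Φ conj Q v`. -/
noncomputable def iv (Φ : ℕ → ℂ[X]) (n : ℕ) (Q : ℂ[X]) : ℂ :=
  ∫ t, (Φ n).eval t * conj (Q.eval t) * S.v t ∂S.meas

/-- The coefficient of the kernel at `a k`. -/
noncomputable def gam (Φ : ℕ → ℂ[X]) (n : ℕ) (k : Fin m) : ℂ :=
  ip S.meas (pdef Φ n) (S.lag k) - Complex.I * S.iv Φ n (S.lag k)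

/-- The normalized coefficient. -/
noncomputable def g (Φ : ℕ → ℂ[X]) (n : ℕ) (k : Fin m) : ℂ :=
  -S.gam Φ n k * conj ((Φ n).eval (S.a k)) / nsq S.meas Φ n

/-- The smooth remainder in the differential equation. -/
noncomputable def rem (Φ : ℕ → ℂ[X]) (n : ℕ) (z : ℂ) : ℂ :=
  Complex.I * ∫ t, (Φ n).eval t * cdk S.meas Φ n z t * S.v t ∂S.meas

include H

lemma integrable_mul_v {f : ℂ → ℂ} (hf : Continuous f) :
    Integrable (fun t => f t * S.v t) S.meas :=
  H.integrable (hf.continuousOn.mul S.continuousOn_v)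

lemma ip_pdef {n : ℕ} {Q : ℂ[X]} (hQ : Q.degree < n) :
    ip S.meas (pdef Φ n) Q = ip S.meas (X * derivative (Φ n)) Q := by
  rw [pdef, H.ip_sub_left, ip_C_mul_left, H.ip_eq_zero_of_degree_lt hQ, mul_zero, sub_zero]

lemma integral_by_parts' (F Q : ℂ[X]) {G : Fin m → ℂ → ℂ}
    (hG : ∀ k, ContinuousOn (G k) (sphere 0 1))
    (h : ∀ k t, ‖t‖ = 1 → F.eval t * conj (Q.eval t) = (t - S.a k) * G k t) :
    Complex.I * ip S.meas (X * derivative F) Q - Complex.I * ip S.meas F (X * derivative Q)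
      + ∫ t, F.eval t * conj (Q.eval t) * S.v t ∂S.meas
      + ∑ k, S.β k * ∫ t, Complex.I * (t + S.a k) * G k t ∂S.meas = 0 := by
  have h0 := S.integral_by_parts F Q hG h
  have i1 := (H.integrable_ip (X * derivative F) Q).const_mul Complex.I
  have i2 := (H.integrable_ip F (X * derivative Q)).const_mul Complex.I
  have i3 : Integrable (fun t => F.eval t * conj (Q.eval t) * S.v t) S.meas :=
    S.integrable_mul_v H (F.continuous.mul (continuous_conj_eval Q))
  have i4 : ∀ k, Integrable (fun t => S.β k * (Complex.I * (t + S.a k) * G k t)) S.meas :=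
    fun k => H.integrable (continuousOn_const.mul ((continuousOn_const.mul
      (continuousOn_id.add continuousOn_const)).mul (hG k)))
  have i12 : Integrable (fun t => Complex.I * ((X * derivative F).eval t * conj (Q.eval t))
      - Complex.I * (F.eval t * conj ((X * derivative Q).eval t))) S.meas := i1.sub i2
  have i123 : Integrable (fun t => Complex.I * ((X * derivative F).eval t * conj (Q.eval t))
      - Complex.I * (F.eval t * conj ((X * derivative Q).eval t))
      + F.eval t * conj (Q.eval t) * S.v t) S.meas := i12.add i3
  have e1 : ∀ t, Complex.I * (t * (derivative F).eval t) * conj (Q.eval t)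
      - Complex.I * F.eval t * conj (t * (derivative Q).eval t)
      + F.eval t * conj (Q.eval t) * S.v t
      + ∑ k, S.β k * (Complex.I * (t + S.a k) * G k t) =
      Complex.I * ((X * derivative F).eval t * conj (Q.eval t))
      - Complex.I * (F.eval t * conj ((X * derivative Q).eval t))
      + F.eval t * conj (Q.eval t) * S.v t
      + ∑ k, S.β k * (Complex.I * (t + S.a k) * G k t) := fun t => by
    simp only [eval_mul, eval_X]; ring
  simp_rw [e1] at h0
  rw [integral_add i123 (integrable_finsetSum _ fun k _ => i4 k), integral_add i12 i3, integral_sub i1 i2, integral_finsetSum _ fun k _ => i4 k,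
    integral_const_mul, integral_const_mul] at h0
  simp_rw [integral_const_mul (S.β _ : ℂ)] at h0
  exact h0

lemma integral_conj_factor (F : ℂ[X]) (Q1 : ℂ[X]) {a : ℂ} (ha : ‖a‖ = 1) :
    ∫ t, Complex.I * (t + a) * (F.eval t * (-(conj a * conj t)) * conj (Q1.eval t)) ∂S.meas =
      -Complex.I * ip S.meas F ((X + C a) * Q1) := by
  rw [ip, ← integral_const_mul]
  refine integral_congr_ae (H.supp.mono fun t ht => ?_)
  have := mul_conj_add_circle ht ha
  simp only [eval_mul, eval_add, eval_X, eval_C, map_mul]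
  linear_combination (Complex.I * F.eval t * conj (Q1.eval t)) * this

/-- Testing the defect polynomial against polynomials vanishing at the singularities. -/
lemma ip_pdef_of_vanish {n : ℕ} {Q : ℂ[X]} (hQ : Q.degree < n) (h : ∀ k, Q.eval (S.a k) = 0) :
    ip S.meas (pdef Φ n) Q = Complex.I * S.iv Φ n Q := by
  choose Q1 h1 h2 using fun k => exists_eq_X_sub_C_mul (h k)
  have := S.integral_by_parts' H (Φ n) Q
    (G := fun k t => (Φ n).eval t * (-(conj (S.a k) * conj t)) * conj ((Q1 k).eval t))
    (fun k => by
      have := (Φ n).continuous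
      have := continuous_conj_eval (Q1 k)
      fun_prop) (fun k t ht => by
      conv_lhs => rw [h1 k]
      have := conj_sub_circle ht (S.norm_a k)
      simp only [eval_mul, eval_sub, eval_X, eval_C, map_mul]
      rw [this]; ring)
  rw [H.ip_eq_zero_of_degree_lt ((degree_X_mul_derivative_le Q).trans_lt hQ)] at this
  simp_rw [S.integral_conj_factor H (Φ n) _ (S.norm_a _)] at this
  rw [Finset.sum_eq_zero] at this
  · rw [S.ip_pdef H hQ, iv]
    have hI := Complex.I_mul_I
    linear_combination -Complex.I * this +
      (ip S.meas (X * derivative (Φ n)) Q) * hI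
  · intro k _
    rw [H.ip_eq_zero_of_degree_lt ((h2 k).trans_lt hQ)]; simp

lemma iv_sub (n : ℕ) (P Q : ℂ[X]) : S.iv Φ n (P - Q) = S.iv Φ n P - S.iv Φ n Q := by
  unfold iv
  rw [← integral_sub]
  · congr 1; ext t; simp only [eval_sub, map_sub]; ring
  · exact S.integrable_mul_v H ((Φ n).continuous.mul (continuous_conj_eval P))
  · exact S.integrable_mul_v H ((Φ n).continuous.mul (continuous_conj_eval Q))

omit H in
lemma iv_C_mul (n : ℕ) (c : ℂ) (Q : ℂ[X]) : S.iv Φ n (C c * Q) = conj c * S.iv Φ n Q := by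
  unfold iv
  rw [← integral_const_mul]
  congr 1; ext t; simp only [eval_mul, eval_C, map_mul]; ring

lemma iv_sum (n : ℕ) {ι : Type*} (s : Finset ι) (f : ι → ℂ[X]) :
    S.iv Φ n (∑ i ∈ s, f i) = ∑ i ∈ s, S.iv Φ n (f i) := by
  unfold iv
  have hi : ∀ i ∈ s, Integrable (fun t => (Φ n).eval t * conj ((f i).eval t) * S.v t) S.meas :=
    fun i _ => S.integrable_mul_v H ((Φ n).continuous.mul (continuous_conj_eval (f i)))
  rw [← integral_finsetSum _ hi]
  congr 1; ext t; simp only [eval_finsetSum, map_sum, Finset.mul_sum, Finset.sum_mul]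

lemma pdef_degree {n : ℕ} (hn : 0 < n) : (pdef Φ n).degree < n := by
  unfold pdef
  rw [degree_lt_iff_coeff_zero]
  intro k hk
  rcases eq_or_lt_of_le hk with rfl | hk
  · have h1 : (Φ n).coeff n = 1 := by
      have := H.monic n
      rwa [Monic, leadingCoeff, H.natDegree] at this
    obtain ⟨l, rfl⟩ := Nat.exists_eq_succ_of_ne_zero hn.ne'
    rw [coeff_sub, coeff_X_mul, coeff_derivative, coeff_C_mul, h1]; simp
  · obtain ⟨l, rfl⟩ := Nat.exists_eq_succ_of_ne_zero (show k ≠ 0 by omega)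
    have : (Φ n).coeff (l + 1) = 0 := coeff_eq_zero_of_natDegree_lt (by rw [H.natDegree]; exact hk)
    rw [coeff_sub, coeff_X_mul, coeff_derivative, coeff_C_mul, this]; simp

lemma pdef_eval_eq {n : ℕ} (hm : m ≤ n) (hn : 0 < n) (z : ℂ) :
    (pdef Φ n).eval z = S.rem Φ n z + ∑ k, S.gam Φ n k * cdk S.meas Φ n z (S.a k) := by
  set K : ℂ[X] := ∑ k ∈ Finset.range n, C (conj ((Φ k).eval z) / nsq S.meas Φ k) * Φ k with hK
  have hKe : ∀ t, conj (K.eval t) = cdk S.meas Φ n z t := by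
    intro t
    simp only [hK, eval_finsetSum, eval_mul, eval_C, map_sum, map_mul, map_div₀, Complex.conj_conj,
      Complex.conj_ofReal, cdk]
    exact Finset.sum_congr rfl fun k _ => by ring
  have hKd : K.degree < n := by
    refine (degree_sum_le _ _).trans_lt ((Finset.sup_lt_iff (WithBot.bot_lt_coe n)).2 fun k hk => ?_)
    refine (degree_C_mul_le _ _).trans_lt ?_
    rw [H.degree]
    exact WithBot.coe_lt_coe.2 (Finset.mem_range.1 hk)
  clear_value K
  set Q : ℂ[X] := K - ∑ k, C (K.eval (S.a k)) * S.lag k with hQ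
  have hsd : (∑ k, C (K.eval (S.a k)) * S.lag k).degree < n :=
    (degree_sum_le _ _).trans_lt ((Finset.sup_lt_iff (WithBot.bot_lt_coe n)).2 fun k hk =>
      (degree_C_mul_le _ _).trans_lt (S.lag_degree hm k))
  have hQd : Q.degree < n := (degree_sub_le _ _).trans_lt (max_lt hKd hsd)
  have hQa : ∀ k, Q.eval (S.a k) = 0 := by
    intro k
    simp only [hQ, eval_sub, eval_finsetSum, eval_mul, eval_C]
    rw [Finset.sum_eq_single k (fun j _ hj => by rw [S.lag_ne hj.symm, mul_zero]) (by simp),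
      S.lag_self, mul_one, sub_self]
  have h := S.ip_pdef_of_vanish H hQd hQa
  have e1 : ip S.meas (pdef Φ n) Q = (pdef Φ n).eval z
      - ∑ k, cdk S.meas Φ n z (S.a k) * ip S.meas (pdef Φ n) (S.lag k) := by
    rw [hQ, H.ip_sub_right, H.ip_sum_right]
    have q1 : ip S.meas (pdef Φ n) K = (pdef Φ n).eval z := by
      rw [← H.reproducing (S.pdef_degree H hn) z, ip]
      simp_rw [hKe]
    rw [q1]
    congr 1
    refine Finset.sum_congr rfl fun k _ => ?_
    rw [ip_C_mul_right, hKe]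
  have e2 : Complex.I * S.iv Φ n Q = S.rem Φ n z
      - ∑ k, cdk S.meas Φ n z (S.a k) * (Complex.I * S.iv Φ n (S.lag k)) := by
    rw [hQ, S.iv_sub H, S.iv_sum H, mul_sub, Finset.mul_sum]
    have q1 : Complex.I * S.iv Φ n K = S.rem Φ n z := by
      rw [rem, iv]; simp_rw [hKe]
    rw [q1]
    congr 1
    refine Finset.sum_congr rfl fun k _ => ?_
    rw [S.iv_C_mul, hKe]; ring
  rw [e1, e2] at h
  have e3 : ∑ k, S.gam Φ n k * cdk S.meas Φ n z (S.a k) =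
      ∑ k, cdk S.meas Φ n z (S.a k) * ip S.meas (pdef Φ n) (S.lag k)
      - ∑ k, cdk S.meas Φ n z (S.a k) * (Complex.I * S.iv Φ n (S.lag k)) := by
    rw [← Finset.sum_sub_distrib]
    exact Finset.sum_congr rfl fun k _ => by rw [gam]; ring
  rw [e3]
  linear_combination h

omit H in
/-- The phase `Φ / Φ*` at a singular point. -/
noncomputable def tau (Φ : ℕ → ℂ[X]) (n : ℕ) (k : Fin m) : ℂ :=
  (Φ n).eval (S.a k) / (rev Φ n).eval (S.a k)

lemma norm_tau (n : ℕ) (k : Fin m) : ‖S.tau Φ n k‖ = 1 := by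
  rw [tau, norm_div, H.norm_rev_eval n (S.norm_a k), div_self]
  exact norm_ne_zero_iff.2 (H.eval_ne_zero n (S.norm_a k))

lemma gam_mul_cdk {n : ℕ} (k : Fin m) (z : ℂ) (hz : 1 - conj (S.a k) * z ≠ 0) :
    S.gam Φ n k * cdk S.meas Φ n z (S.a k) = -(S.g Φ n k *
      (S.tau Φ n k * (rev Φ n).eval z - (Φ n).eval z) / (1 - conj (S.a k) * z)) := by
  have h := H.cdk_formula n z (S.a k)
  have hne : (nsq S.meas Φ n : ℂ) ≠ 0 := H.nsq_ne n
  have hr : (rev Φ n).eval (S.a k) ≠ 0 := H.rev_ne_zero n (S.norm_a k).le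
  have ht : conj ((rev Φ n).eval (S.a k)) = conj ((Φ n).eval (S.a k)) * S.tau Φ n k := by
    rw [tau]
    field_simp
    rw [mul_comm (conj _) ((rev Φ n).eval (S.a k)), Complex.mul_conj',
      mul_comm (conj _) ((Φ n).eval (S.a k)), Complex.mul_conj', H.norm_rev_eval n (S.norm_a k)]
  have h2 : cdk S.meas Φ n z (S.a k) = ((rev Φ n).eval z * conj ((rev Φ n).eval (S.a k))
      - (Φ n).eval z * conj ((Φ n).eval (S.a k))) / nsq S.meas Φ n / (1 - conj (S.a k) * z) := by
    rw [eq_div_iff hz, ← h]; ring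
  rw [h2, ht, g]
  field_simp

/-- The differential equation. -/
lemma ode {n : ℕ} (hm : m ≤ n) (hn : 0 < n) (z : ℂ) (hz : ∀ k, 1 - conj (S.a k) * z ≠ 0) :
    z * (derivative (Φ n)).eval z - n * (Φ n).eval z = S.rem Φ n z -
      ∑ k, S.g Φ n k * (S.tau Φ n k * (rev Φ n).eval z - (Φ n).eval z) /
        (1 - conj (S.a k) * z) := by
  have h := S.pdef_eval_eq H hm hn z
  rw [Finset.sum_congr rfl fun k _ => S.gam_mul_cdk H k z (hz k)] at h
  rw [Finset.sum_neg_distrib] at h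
  simp only [pdef, eval_sub, eval_mul, eval_X, eval_C] at h
  rw [h]; ring

lemma im_ip_factor {P Q1 : ℂ[X]} {a : ℂ} (ha : ‖a‖ = 1) (h : P = (X - C a) * Q1) :
    (-Complex.I * ip S.meas P ((X + C a) * Q1)).im = 0 := by
  rw [ip, ← integral_const_mul]
  refine im_integral_eq_zero (H.supp.mono fun t ht => ?_)
  have h1 := im_mul_conj_mul ht ha
  have : -Complex.I * (P.eval t * conj (((X + C a) * Q1).eval t)) =
      ((-‖Q1.eval t‖ ^ 2 : ℝ) : ℂ) * (Complex.I * ((t - a) * conj (t + a))) := by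
    rw [h]
    simp only [eval_mul, eval_add, eval_sub, eval_X, eval_C, map_mul]
    push_cast
    rw [← Complex.mul_conj']; ring
  rw [this, Complex.im_ofReal_mul, h1, mul_zero]

/-- The real part of the normalized coefficients is exactly `β k`. -/
lemma g_re {n : ℕ} (hm : m ≤ n) (k : Fin m) : (S.g Φ n k).re = S.β k := by
  set c := (Φ n).eval (S.a k) with hc
  set U : ℂ[X] := C c * S.lag k with hU
  have hUd : U.degree < n := (degree_C_mul_le _ _).trans_lt (S.lag_degree hm k)
  set F : ℂ[X] := Φ n - U with hF
  have hUk : U.eval (S.a k) = c := by rw [hU, eval_mul, eval_C, S.lag_self, mul_one]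
  have hUj : ∀ j, j ≠ k → U.eval (S.a j) = 0 := fun j hj => by
    rw [hU, eval_mul, eval_C, S.lag_ne hj, mul_zero]
  have hFk : F.eval (S.a k) = 0 := by rw [hF, eval_sub, hUk, ← hc, sub_self]
  have hmon : F.Monic := by
    refine (H.monic n).sub_of_left ?_
    rw [H.degree]; exact hUd
  have hFn : F.natDegree = n := by
    rw [hF, natDegree_sub_eq_left_of_natDegree_lt, H.natDegree]
    rw [H.natDegree]
    rcases eq_or_ne U 0 with h0 | h0
    · rw [h0, natDegree_zero]
      have := k.pos; omega
    · exact (natDegree_lt_iff_degree_lt h0).2 hUd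
  obtain ⟨F1, hF1, -⟩ := exists_eq_X_sub_C_mul hFk
  have hU1 : ∀ j, ∃ Q1 : ℂ[X], j ≠ k → U = (X - C (S.a j)) * Q1 ∧
      ((X + C (S.a j)) * Q1).degree = U.degree := fun j => by
    by_cases hj : j = k
    · exact ⟨0, fun h => absurd hj h⟩
    · obtain ⟨Q1, h⟩ := exists_eq_X_sub_C_mul (hUj j hj)
      exact ⟨Q1, fun _ => h⟩
  choose U1 hU1 using hU1
  clear_value U
  have hibp := S.integral_by_parts' H F U
    (G := fun j t => if j = k then F1.eval t * conj (U.eval t) else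
      F.eval t * (-(conj (S.a j) * conj t)) * conj ((U1 j).eval t))
    (fun j => by
      have := F.continuous
      have := F1.continuous
      have := continuous_conj_eval (U1 j)
      have := continuous_conj_eval U
      split_ifs <;> fun_prop) (fun j t ht => by
      split_ifs with hj
      · subst hj
        conv_lhs => rw [hF1]
        simp only [eval_mul, eval_sub, eval_X, eval_C]; ring
      · conv_lhs => rw [(hU1 j hj).1]
        have := conj_sub_circle ht (S.norm_a j)
        simp only [eval_mul, eval_sub, eval_X, eval_C, map_mul]
        rw [this]; ring)
  -- the terms with `j ≠ k` are real
  have hj : ∀ j, j ≠ k → (∫ t, Complex.I * (t + S.a j) * (if j = k then F1.eval t * conj (U.eval t)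
      else F.eval t * (-(conj (S.a j) * conj t)) * conj ((U1 j).eval t)) ∂S.meas).im = 0 := by
    intro j hj
    simp only [hj, if_false]
    rw [S.integral_conj_factor H F _ (S.norm_a j), hF, H.ip_sub_left,
      H.ip_eq_zero_of_degree_lt (((hU1 j hj).2).trans_lt hUd), zero_sub, mul_neg, Complex.neg_im,
      S.im_ip_factor H (S.norm_a j) (hU1 j hj).1, neg_zero]
  -- the term with `j = k`
  have hk : (∫ t, Complex.I * (t + S.a k) * (if k = k then F1.eval t * conj (U.eval t)
      else F.eval t * (-(conj (S.a k) * conj t)) * conj ((U1 k).eval t)) ∂S.meas).im =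
      nsq S.meas Φ n := by
    simp only [if_true]
    have e1 : ∫ t, Complex.I * (t + S.a k) * (F1.eval t * conj (U.eval t)) ∂S.meas =
        Complex.I * ip S.meas ((X + C (S.a k)) * F1) (Φ n) -
        Complex.I * ip S.meas ((X + C (S.a k)) * F1) F := by
      rw [← mul_sub, ← H.ip_sub_right, ip, ← integral_const_mul]
      congr 1; ext t
      have : Φ n - F = U := by rw [hF]; ring
      rw [this]; simp only [eval_mul, eval_add, eval_X, eval_C]; ring
    have e2 : ip S.meas ((X + C (S.a k)) * F1) (Φ n) = nsq S.meas Φ n := by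
      have hF1m : F1.Monic := by
        have := hmon
        rw [hF1] at this
        exact (monic_X_sub_C _).of_mul_monic_left this
      have hd : ((X + C (S.a k)) * F1 - Φ n).degree < (n : WithBot ℕ) := by
        have hd1 : ((X + C (S.a k)) * F1).degree = (n : WithBot ℕ) := by
          rw [degree_mul, degree_X_add_C, ← degree_X_sub_C (S.a k), ← degree_mul, ← hF1,
            degree_eq_natDegree hmon.ne_zero, hFn]
        rw [← hd1]
        refine degree_sub_lt_left (by rw [hd1, H.degree]) ?_ ?_
        · exact ((monic_X_add_C _).mul hF1m).ne_zero
        · rw [((monic_X_add_C _).mul hF1m).leadingCoeff, (H.monic n).leadingCoeff]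
      have : (X + C (S.a k)) * F1 = Φ n + ((X + C (S.a k)) * F1 - Φ n) := by ring
      rw [this, H.ip_add_left, ← ip_conj (Φ n), ← ip_conj (Φ n) ((X + C (S.a k)) * F1 - Φ n),
        H.ip_eq_zero_of_degree_lt hd, nsq_eq_ip, map_zero, add_zero, ip_conj]
    have e3 : (Complex.I * ip S.meas ((X + C (S.a k)) * F1) F).im = 0 := by
      have := S.im_ip_factor H (S.norm_a k) hF1
      have q : ip S.meas ((X + C (S.a k)) * F1) F = conj (ip S.meas F ((X + C (S.a k)) * F1)) :=
        (ip_conj _ _).symm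
      rw [q]
      simp only [Complex.mul_im, Complex.neg_re, Complex.neg_im, Complex.I_re, Complex.I_im,
        Complex.conj_re, Complex.conj_im] at this ⊢
      linarith
    rw [e1, Complex.sub_im, e3, e2]; simp
  have him := congrArg Complex.im hibp
  rw [Complex.add_im, Complex.im_sum, Finset.sum_eq_single k ?_ (by simp)] at him
  · rw [Complex.im_ofReal_mul, hk] at him
    have hz : ip S.meas (Φ n) (X * derivative U) = 0 :=
      H.ip_eq_zero_of_degree_lt ((degree_X_mul_derivative_le U).trans_lt hUd)
    have hsplit : (∫ t, F.eval t * conj (U.eval t) * S.v t ∂S.meas) =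
        S.iv Φ n U - ∫ t, U.eval t * conj (U.eval t) * S.v t ∂S.meas := by
      rw [iv, ← integral_sub]
      · congr 1; ext t; rw [hF, eval_sub]; ring
      · exact S.integrable_mul_v H ((Φ n).continuous.mul (continuous_conj_eval U))
      · exact S.integrable_mul_v H (U.continuous.mul (continuous_conj_eval U))
    have hreal : (∫ t, U.eval t * conj (U.eval t) * S.v t ∂S.meas).im = 0 := by
      refine im_integral_eq_zero (Filter.Eventually.of_forall fun t => ?_)
      rw [S.v_eq_re, Complex.mul_conj, ← Complex.ofReal_mul, Complex.ofReal_im]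
    have hg : Complex.I * ip S.meas (X * derivative (Φ n)) U + S.iv Φ n U =
        Complex.I * (S.gam Φ n k * conj c) := by
      rw [← S.ip_pdef H hUd, hU, ip_C_mul_right, S.iv_C_mul, gam]
      linear_combination (conj c * S.iv Φ n (S.lag k)) * Complex.I_mul_I
    have hT : Complex.I * ip S.meas (X * derivative F) U - Complex.I * ip S.meas F (X * derivative U)
        + (∫ t, F.eval t * conj (U.eval t) * S.v t ∂S.meas) =
        Complex.I * (S.gam Φ n k * conj c) - Complex.I * ip S.meas (X * derivative U) U
          + Complex.I * conj (ip S.meas (X * derivative U) U)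
          - ∫ t, U.eval t * conj (U.eval t) * S.v t ∂S.meas := by
      rw [hsplit, ← hg, ip_conj, hF, derivative_sub, mul_sub, H.ip_sub_left, H.ip_sub_left, hz]
      ring
    have hgg : (S.gam Φ n k * conj c) = -(nsq S.meas Φ n : ℂ) * S.g Φ n k := by
      rw [g, ← hc, neg_mul, mul_div_cancel₀ _ (H.nsq_ne n)]; ring
    rw [hT, hgg] at him
    simp only [Complex.sub_im, Complex.add_im, hreal, Complex.zero_im] at him
    simp only [Complex.mul_im, Complex.mul_re, Complex.neg_re, Complex.neg_im, Complex.I_re,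
      Complex.I_im, Complex.conj_re, Complex.conj_im, Complex.ofReal_re, Complex.ofReal_im] at him
    have := H.nsq_pos n
    have h2 : nsq S.meas Φ n * (S.β k - (S.g Φ n k).re) = 0 := by linear_combination him
    rcases mul_eq_zero.1 h2 with h | h
    · exact absurd h this.ne'
    · linarith
  · intro j _ hjk
    rw [Complex.im_ofReal_mul, hj j hjk, mul_zero]

end SData

end OPUC

namespace OPUC

open scoped ComplexConjugate Topology

lemma cauchy_circle {f : ℂ → ℂ} (hf : DiffContOnCl ℂ f (ball 0 1)) {z : ℂ} (hz : ‖z‖ < 1) :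
    ∫ θ in (0 : ℝ)..(2 * π), f (e θ) * (1 - z * conj (e θ))⁻¹ = 2 * π * f z := by
  have h := hf.circleIntegral_sub_inv_smul (w := z) (by simpa using hz)
  simp only [circleIntegral, circleMap, deriv_circleMap, Complex.ofReal_one, one_mul, zero_add,
    smul_eq_mul] at h
  have h2 : ∫ θ in (0 : ℝ)..(2 * π), f (e θ) * (1 - z * conj (e θ))⁻¹ =
      Complex.I⁻¹ * ∫ θ in (0 : ℝ)..(2 * π), Complex.exp (θ * Complex.I) * Complex.I *
        ((Complex.exp (θ * Complex.I) - z)⁻¹ * f (Complex.exp (θ * Complex.I))) := by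
    rw [← intervalIntegral.integral_const_mul]
    refine intervalIntegral.integral_congr fun θ _ => ?_
    have h1 : conj (e θ) = (e θ)⁻¹ := conj_eq_inv (norm_e θ)
    have h0 : e θ ≠ 0 := ne_zero_of_norm_one (norm_e θ)
    have h3 : e θ - z ≠ 0 := fun h3 => by
      rw [sub_eq_zero] at h3; rw [← h3, norm_e] at hz; exact lt_irrefl _ hz
    rw [h1]
    change _ = Complex.I⁻¹ * (e θ * Complex.I * ((e θ - z)⁻¹ * f (e θ)))
    have h4 : 1 - z * (e θ)⁻¹ ≠ 0 := by
      rw [← mul_inv_cancel₀ h0, ← sub_mul]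
      exact mul_ne_zero h3 (inv_ne_zero h0)
    have h5 := Complex.I_ne_zero
    field_simp
  rw [h2, h]
  have h5 := Complex.I_ne_zero
  field_simp

lemma one_sub_conj_re_pos {a z : ℂ} (ha : ‖a‖ = 1) (hz : ‖z‖ ≤ 1) (h : z ≠ a) :
    0 < (1 - conj a * z).re := by
  have h1 : ‖conj a * z‖ ≤ 1 := by rwa [norm_mul, Complex.norm_conj, ha, one_mul]
  have h2 := (Complex.re_le_norm (conj a * z)).trans h1
  rw [Complex.sub_re, Complex.one_re, sub_pos]
  refine lt_of_le_of_ne h2 fun h3 => h ?_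
  have h4 : conj a * z = 1 := by
    have h5 : ‖conj a * z‖ ^ 2 ≤ 1 := by nlinarith [norm_nonneg (conj a * z)]
    rw [Complex.sq_norm, Complex.normSq_apply, h3] at h5
    refine Complex.ext h3 ?_
    simp only [Complex.one_im]
    nlinarith
  calc z = (a * conj a) * z := by rw [mul_conj_one ha, one_mul]
    _ = a := by rw [mul_assoc, h4, mul_one]

lemma norm_one_sub_conj {a z : ℂ} (ha : ‖a‖ = 1) : ‖1 - conj a * z‖ = ‖z - a‖ := by
  have h : z - a = -(a * (1 - conj a * z)) := by
    linear_combination (-z) * mul_conj_one ha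
  rw [h, norm_neg, norm_mul, ha, one_mul]

lemma norm_sub_le_two_mul {a t : ℂ} (ha : ‖a‖ = 1) (ht : ‖t‖ = 1) {r : ℝ} (hr0 : 0 ≤ r)
    (hr1 : r ≤ 1) : ‖t - a‖ ≤ 2 * ‖(r : ℂ) * t - a‖ := by
  have h1 : 1 - r ≤ ‖(r : ℂ) * t - a‖ := by
    have := norm_sub_norm_le a (r * t)
    rw [norm_mul, ha, ht, mul_one, Complex.norm_of_nonneg hr0, norm_sub_rev] at this
    exact this
  have h2 : t - a = (r * t - a) + ((1 - r : ℝ) : ℂ) * t := by push_cast; ring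
  rw [h2]
  refine (norm_add_le _ _).trans ?_
  rw [norm_mul, ht, mul_one, Complex.norm_of_nonneg (by linarith)]
  linarith

namespace SData

variable {m : ℕ} (S : SData m)

/-- The logarithm of the Szegő function. -/
noncomputable def logD (z : ℂ) : ℂ := ∑ k, S.β k * Complex.log (1 - conj (S.a k) * z) + S.ell z

/-- The Szegő function in the closed unit disk. -/
noncomputable def D (z : ℂ) : ℂ := Complex.exp (S.logD z)

lemma D_ne_zero (z : ℂ) : S.D z ≠ 0 := Complex.exp_ne_zero _

lemma ell_zero : S.ell 0 = S.L 0 := by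
  have h := S.hasSum_ell (z := 0) (by simpa using S.R_pos)
  refine (h.unique (hasSum_of_eq (hasSum_ite_eq 0 (S.L 0)) fun j => ?_))
  by_cases hj : j = 0
  · subst hj; simp
  · simp [hj]

lemma logD_zero : S.logD 0 = ((S.L 0).re : ℂ) := by
  rw [logD, S.ell_zero]
  simp only [mul_zero, sub_zero, Complex.log_one, Finset.sum_const_zero, zero_add]
  exact Complex.ext (by simp) (by simp [S.L_zero])

/-- The value of the Szegő function at the origin. -/
noncomputable def D0 : ℝ := Real.exp (S.L 0).re

lemma D0_pos : 0 < S.D0 := Real.exp_pos _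

lemma D_zero : S.D 0 = S.D0 := by rw [D, logD_zero, D0, Complex.ofReal_exp]

lemma ne_a {z : ℂ} (hz : ‖z‖ < 1) (k : Fin m) : z ≠ S.a k := fun h => by
  rw [h, S.norm_a] at hz; exact lt_irrefl _ hz

lemma logD_differentiableAt {z : ℂ} (hz : ‖z‖ ≤ 1) (h : ∀ k, z ≠ S.a k) :
    DifferentiableAt ℂ S.logD z := by
  unfold logD
  refine DifferentiableAt.add (DifferentiableAt.fun_sum fun k _ => ?_)
    (S.differentiableAt_ell (hz.trans_lt S.one_lt_R))
  refine DifferentiableAt.const_mul (DifferentiableAt.clog (by fun_prop) ?_) _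
  exact Or.inl (one_sub_conj_re_pos (S.norm_a k) hz (h k))

lemma D_differentiableAt {z : ℂ} (hz : ‖z‖ ≤ 1) (h : ∀ k, z ≠ S.a k) :
    DifferentiableAt ℂ S.D z := (S.logD_differentiableAt hz h).cexp

lemma D_differentiableOn : DifferentiableOn ℂ S.D (ball 0 1) := fun z hz => by
  rw [mem_ball_zero_iff] at hz
  exact (S.D_differentiableAt hz.le (S.ne_a hz)).differentiableWithinAt

lemma logD_differentiableOn : DifferentiableOn ℂ S.logD (ball 0 1) := fun z hz => by
  rw [mem_ball_zero_iff] at hz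
  exact (S.logD_differentiableAt hz.le (S.ne_a hz)).differentiableWithinAt

lemma re_logD (z : ℂ) :
    (S.logD z).re = ∑ k, S.β k * Real.log ‖z - S.a k‖ + (S.ell z).re := by
  rw [logD, Complex.add_re, Complex.re_sum]
  congr 1
  refine Finset.sum_congr rfl fun k _ => ?_
  rw [Complex.re_ofReal_mul, Complex.log_re, norm_one_sub_conj (S.norm_a k)]

lemma norm_D {z : ℂ} (h : ∀ k, z ≠ S.a k) :
    ‖S.D z‖ = Real.exp (S.ell z).re * ∏ k, ‖z - S.a k‖ ^ S.β k := by
  rw [D, Complex.norm_exp, re_logD, Real.exp_add, Real.exp_sum, mul_comm]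
  congr 1
  refine Finset.prod_congr rfl fun k _ => ?_
  rw [Real.rpow_def_of_pos (norm_pos_iff.2 (sub_ne_zero.2 (h k))), mul_comm]

lemma norm_D_sq {z : ℂ} (h : ∀ k, z ≠ S.a k) : ‖S.D z‖ ^ 2 = S.W z := by
  rw [S.norm_D h, W, mul_pow, ← Real.exp_nat_mul, ← Finset.prod_pow]
  congr 1
  refine Finset.prod_congr rfl fun k _ => ?_
  rw [← Real.rpow_natCast, ← Real.rpow_mul (norm_nonneg _), mul_comm]; norm_num

lemma exists_norm_ell_le : ∃ C, 0 ≤ C ∧ ∀ z : ℂ, ‖z‖ ≤ 1 → ‖S.ell z‖ ≤ C := by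
  obtain ⟨C, hC⟩ := (isCompact_closedBall (0 : ℂ) 1).exists_bound_of_continuousOn
    (S.continuousOn_ell.mono (closedBall_subset_ball S.one_lt_R))
  exact ⟨max C 0, le_max_right _ _, fun z hz => (hC z (by simpa using hz)).trans (le_max_left _ _)⟩

lemma ae_ne : ∀ᵐ θ : ℝ, ∀ k, e θ ≠ S.a k := by
  have h := S.countable_sing.ae_notMem volume
  refine h.mono fun θ hθ k hk => hθ ⟨k, hk⟩

lemma ne_radial {t : ℂ} (ht : ‖t‖ = 1) (h : ∀ k, t ≠ S.a k) {r : ℝ} (hr0 : 0 ≤ r) (hr1 : r ≤ 1)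
    (k : Fin m) : (r : ℂ) * t ≠ S.a k := fun h1 => by
  have := norm_sub_le_two_mul (S.norm_a k) ht hr0 hr1
  rw [h1, sub_self, norm_zero, mul_zero] at this
  exact h k (sub_eq_zero.1 (norm_le_zero_iff.1 this))

lemma norm_radial_le {t : ℂ} (ht : ‖t‖ = 1) {r : ℝ} (hr0 : 0 ≤ r) (hr1 : r ≤ 1) :
    ‖(r : ℂ) * t‖ ≤ 1 := by
  rwa [norm_mul, ht, mul_one, Complex.norm_of_nonneg hr0]

lemma tendsto_radial {f : ℂ → ℂ} {t : ℂ} (hf : ContinuousAt f t) :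
    Tendsto (fun r : ℝ => f (r * t)) (𝓝[<] 1) (𝓝 (f t)) := by
  have h : Tendsto (fun r : ℝ => (r : ℂ) * t) (𝓝[<] 1) (𝓝 t) := by
    have : ContinuousAt (fun r : ℝ => (r : ℂ) * t) 1 := by fun_prop
    have h2 := this.tendsto
    simp only [Complex.ofReal_one, one_mul] at h2
    exact h2.mono_left nhdsWithin_le_nhds
  exact hf.tendsto.comp h

/-- Passage to the boundary in radial means. -/
lemma tendsto_integral_radial {f : ℂ → ℂ} {ψ : ℝ → ℂ} {bd : ℝ → ℝ}
    (hf : ContinuousOn f (ball 0 1)) (hψ : Continuous ψ)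
    (hbd : IntervalIntegrable bd volume 0 (2 * π))
    (h : ∀ᵐ θ : ℝ, ∀ r : ℝ, 0 ≤ r → r < 1 → ‖f (r * e θ)‖ ≤ bd θ)
    (hl : ∀ᵐ θ : ℝ, Tendsto (fun r : ℝ => f (r * e θ)) (𝓝[<] 1) (𝓝 (f (e θ)))) :
    Tendsto (fun r : ℝ => ∫ θ in (0 : ℝ)..(2 * π), f (r * e θ) * ψ θ) (𝓝[<] 1)
      (𝓝 (∫ θ in (0 : ℝ)..(2 * π), f (e θ) * ψ θ)) := by
  have hr : ∀ᶠ r : ℝ in 𝓝[<] 1, 0 ≤ r ∧ r < 1 := by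
    filter_upwards [Ioo_mem_nhdsLT (zero_lt_one' ℝ)] with r hr using ⟨hr.1.le, hr.2⟩
  refine intervalIntegral.tendsto_integral_filter_of_dominated_convergence
    (fun θ => bd θ * ‖ψ θ‖) ?_ ?_ ?_ ?_
  · filter_upwards [hr] with r hr
    refine Continuous.aestronglyMeasurable (Continuous.mul ?_ hψ)
    refine hf.comp_continuous (continuous_const.mul continuous_e) fun θ => ?_
    rw [mem_ball_zero_iff, norm_mul, norm_e, mul_one, Complex.norm_of_nonneg hr.1]
    exact hr.2
  · filter_upwards [hr] with r hr
    filter_upwards [h] with θ hθ _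
    rw [norm_mul]
    exact mul_le_mul_of_nonneg_right (hθ r hr.1 hr.2) (norm_nonneg _)
  · exact hbd.mul_continuousOn hψ.norm.continuousOn
  · filter_upwards [hl] with θ hθ _
    exact hθ.mul_const _

lemma rpow_radial_le {β x y : ℝ} (hx : 0 < x) (hxy : x ≤ 2 * y) (hy : y ≤ 2) :
    y ^ β ≤ 2 ^ |β| * x ^ (min β 0) := by
  have hy0 : 0 < y := by linarith
  rcases le_total 0 β with h | h
  · rw [abs_of_nonneg h, min_eq_right h, Real.rpow_zero, mul_one]
    exact Real.rpow_le_rpow hy0.le hy h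
  · rw [abs_of_nonpos h, min_eq_left h]
    calc y ^ β ≤ (x / 2) ^ β := Real.rpow_le_rpow_of_nonpos (by positivity) (by linarith) h
      _ = _ := by rw [Real.div_rpow hx.le (by norm_num), Real.rpow_neg (by norm_num)]; ring

lemma exists_norm_D_radial_le : ∃ C, 0 ≤ C ∧ ∀ t : ℂ, ‖t‖ = 1 → (∀ k, t ≠ S.a k) → ∀ r : ℝ,
    0 ≤ r → r ≤ 1 → ‖S.D (r * t)‖ ≤ C * ∏ k, ‖t - S.a k‖ ^ (min (S.β k) 0) := by
  obtain ⟨C, hC, h⟩ := S.exists_norm_ell_le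
  refine ⟨Real.exp C * ∏ k, 2 ^ |S.β k|, by positivity, fun t ht hta r hr0 hr1 => ?_⟩
  have hn := norm_radial_le ht hr0 hr1
  rw [S.norm_D (S.ne_radial ht hta hr0 hr1), mul_assoc, ← Finset.prod_mul_distrib]
  gcongr with k
  · exact (Complex.re_le_norm _).trans (h _ hn)
  · refine rpow_radial_le (norm_pos_iff.2 (sub_ne_zero.2 (hta k)))
      (norm_sub_le_two_mul (S.norm_a k) ht hr0 hr1) ?_
    refine (norm_sub_le _ _).trans ?_
    rw [S.norm_a]; linarith

lemma exists_norm_D_div_radial_le : ∃ C, 0 ≤ C ∧ ∀ t : ℂ, ‖t‖ = 1 → (∀ k, t ≠ S.a k) → ∀ r : ℝ,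
    0 ≤ r → r ≤ 1 → ‖S.D t / S.D (r * t)‖ ^ 2 ≤ C * ∏ k, ‖t - S.a k‖ ^ (2 * min (S.β k) 0) := by
  obtain ⟨C, hC, h⟩ := S.exists_norm_ell_le
  refine ⟨(Real.exp (2 * C) * ∏ k, 2 ^ (2 * |S.β k|)) ^ 2, by positivity,
    fun t ht hta r hr0 hr1 => ?_⟩
  have hn := norm_radial_le ht hr0 hr1
  have key : ‖S.D t / S.D (r * t)‖ ≤ (Real.exp (2 * C) * ∏ k, 2 ^ (2 * |S.β k|)) *
      ∏ k, ‖t - S.a k‖ ^ (min (S.β k) 0) := by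
    rw [norm_div, S.norm_D (S.ne_radial ht hta hr0 hr1), S.norm_D hta, mul_div_mul_comm,
      ← Real.exp_sub, mul_assoc, ← Finset.prod_mul_distrib, ← Finset.prod_div_distrib]
    gcongr with k
    · have h1 := (Complex.abs_re_le_norm _).trans (h _ ht.le)
      have h2 := (Complex.abs_re_le_norm _).trans (h _ hn)
      rw [abs_le] at h1 h2
      linarith
    · have hx := norm_pos_iff.2 (sub_ne_zero.2 (hta k))
      have hy := norm_pos_iff.2 (sub_ne_zero.2 (S.ne_radial ht hta hr0 hr1 k))
      have hx2 : ‖t - S.a k‖ ≤ 2 := (norm_sub_le _ _).trans (by rw [S.norm_a, ht]; norm_num)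
      have hy2 : ‖(r : ℂ) * t - S.a k‖ ≤ 2 := (norm_sub_le _ _).trans (by rw [S.norm_a]; linarith)
      have hxy := norm_sub_le_two_mul (S.norm_a k) ht hr0 hr1
      rw [div_le_iff₀ (Real.rpow_pos_of_pos hy _)]
      rcases le_total 0 (S.β k) with hb | hb
      · rw [min_eq_right hb, Real.rpow_zero, mul_one, abs_of_nonneg hb]
        calc _ ≤ (2 * ‖(r : ℂ) * t - S.a k‖) ^ S.β k := Real.rpow_le_rpow hx.le hxy hb
          _ = 2 ^ S.β k * ‖(r : ℂ) * t - S.a k‖ ^ S.β k := Real.mul_rpow (by norm_num) hy.le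
          _ ≤ _ := by
            gcongr
            · norm_num
            · linarith
      · rw [min_eq_left hb, abs_of_nonpos hb]
        have h1 : (2 : ℝ) ^ S.β k ≤ ‖(r : ℂ) * t - S.a k‖ ^ S.β k :=
          Real.rpow_le_rpow_of_nonpos hy hy2 hb
        have h2 : (1 : ℝ) ≤ 2 ^ (2 * -S.β k) * 2 ^ S.β k := by
          rw [← Real.rpow_add (by norm_num)]
          exact Real.one_le_rpow (by norm_num) (by linarith)
        have hp : 0 ≤ ‖t - S.a k‖ ^ S.β k := by positivity
        calc ‖t - S.a k‖ ^ S.β k = ‖t - S.a k‖ ^ S.β k * 1 := by ring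
          _ ≤ ‖t - S.a k‖ ^ S.β k * (2 ^ (2 * -S.β k) * ‖(r : ℂ) * t - S.a k‖ ^ S.β k) := by
            gcongr
            exact h2.trans (by gcongr)
          _ = _ := by ring
  calc _ ≤ _ := pow_le_pow_left₀ (norm_nonneg _) key 2
    _ = _ := by
      rw [mul_pow _ (∏ k, ‖t - S.a k‖ ^ (min (S.β k) 0)), ← Finset.prod_pow]
      congr 1
      refine Finset.prod_congr rfl fun k _ => ?_
      rw [← Real.rpow_natCast, ← Real.rpow_mul (norm_nonneg _), mul_comm]; norm_num

/-- Cauchy's formula for `p D` in the unit disk. -/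
lemma cauchy_mul_D (p : ℂ[X]) {z : ℂ} (hz : ‖z‖ < 1) :
    ∫ θ in (0 : ℝ)..(2 * π), p.eval (e θ) * S.D (e θ) * (1 - z * conj (e θ))⁻¹ =
      2 * π * (p.eval z * S.D z) := by
  obtain ⟨C, hC, h⟩ := S.exists_norm_D_radial_le
  obtain ⟨M, hM⟩ := (isCompact_closedBall (0 : ℂ) 1).exists_bound_of_continuousOn
    p.continuous.continuousOn
  have hM0 : 0 ≤ M := (norm_nonneg _).trans (hM 0 (by simp))
  have hcont : ContinuousOn (fun w => p.eval w * S.D w) (ball 0 1) :=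
    p.continuous.continuousOn.mul S.D_differentiableOn.continuousOn
  have hz1 : ∀ θ, 1 - z * conj (e θ) ≠ 0 := fun θ h0 => by
    have : ‖z * conj (e θ)‖ = 1 := by rw [← sub_eq_zero.1 h0, norm_one]
    rw [norm_mul, Complex.norm_conj, norm_e, mul_one] at this
    linarith
  have h1 := tendsto_integral_radial (f := fun w => p.eval w * S.D w)
    (ψ := fun θ => (1 - z * conj (e θ))⁻¹)
    (bd := fun θ => M * (C * ∏ k, ‖e θ - S.a k‖ ^ (min (S.β k) 0))) hcont
    ((continuous_const.sub (continuous_const.mul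
      (Complex.continuous_conj.comp continuous_e))).inv₀ hz1)
    (((intervalIntegrable_prod_rpow S.inj S.norm_a (fun k => by
      rcases min_choice (S.β k) 0 with h | h <;> rw [h] <;> linarith [S.hβ k]) _ _).const_mul
        C).const_mul M)
    (S.ae_ne.mono fun θ hθ r hr0 hr1 => by
      rw [norm_mul]
      refine mul_le_mul (hM _ ?_) (h _ (norm_e θ) hθ r hr0 hr1.le) (norm_nonneg _) hM0
      simpa using norm_radial_le (norm_e θ) hr0 hr1.le)
    (S.ae_ne.mono fun θ hθ => tendsto_radial
      (p.continuous.continuousAt.mul (S.D_differentiableAt (norm_e θ).le hθ).continuousAt))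
  have h2 : Tendsto (fun r : ℝ => 2 * π * (p.eval (r * z) * S.D (r * z))) (𝓝[<] 1)
      (𝓝 (2 * π * (p.eval z * S.D z))) := by
    refine Tendsto.const_mul _ (tendsto_radial (f := fun w => p.eval w * S.D w) ?_)
    exact hcont.continuousAt (isOpen_ball.mem_nhds (by simpa using hz))
  refine tendsto_nhds_unique h1 (h2.congr' ?_)
  filter_upwards [Ioo_mem_nhdsLT (zero_lt_one' ℝ)] with r hr
  refine (cauchy_circle (f := fun w => p.eval (r * w) * S.D (r * w)) ?_ hz).symm
  refine DifferentiableOn.diffContOnCl (s := ball 0 1) ?_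
  rw [closure_ball _ one_ne_zero]
  intro w hw
  have hw1 : ‖(r : ℂ) * w‖ < 1 := by
    rw [mem_closedBall_zero_iff] at hw
    rw [norm_mul, Complex.norm_of_nonneg hr.1.le]
    nlinarith [hr.1, hr.2, norm_nonneg w]
  have h3 := S.D_differentiableAt hw1.le (S.ne_a hw1)
  have h4 : DifferentiableAt ℂ (fun w : ℂ => S.D (r * w)) w :=
    h3.comp (f := fun w : ℂ => r * w) w (differentiableAt_id.const_mul _)
  have h5 : DifferentiableAt ℂ (fun w : ℂ => p.eval (r * w)) w :=
    p.differentiableAt.comp (f := fun w : ℂ => r * w) w (differentiableAt_id.const_mul _)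
  exact (h5.mul h4).differentiableWithinAt

end SData

end OPUC

namespace OPUC

open scoped ComplexConjugate Topology NNReal ENNReal

namespace SData

variable {m : ℕ} (S : SData m)

lemma intervalIntegrable_norm_mul_D_sq (p : ℂ[X]) :
    IntervalIntegrable (fun θ => ‖p.eval (e θ) * S.D (e θ)‖ ^ 2) volume 0 (2 * π) := by
  have h := (S.intervalIntegrable_W 0 (2 * π)).mul_continuousOn
    (g := fun θ => ‖p.eval (e θ)‖ ^ 2) (by
      have := continuous_e
      have := p.continuous
      fun_prop)
  refine h.congr_ae (ae_restrict_of_ae (S.ae_ne.mono fun θ hθ => ?_))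
  beta_reduce
  rw [norm_mul, mul_pow, S.norm_D_sq hθ, mul_comm]

lemma integral_norm_mul_D_sq (p : ℂ[X]) :
    ∫ θ in (0 : ℝ)..(2 * π), ‖p.eval (e θ) * S.D (e θ)‖ ^ 2 = ∫ t, ‖p.eval t‖ ^ 2 ∂S.meas := by
  rw [S.integral_meas (S.aestronglyMeasurable (by
    have := p.continuous
    fun_prop))]
  refine intervalIntegral.integral_congr_ae (S.ae_ne.mono fun θ hθ _ => ?_)
  rw [norm_mul, mul_pow, S.norm_D_sq hθ, mul_comm, smul_eq_mul]

lemma aestronglyMeasurable_mul_D (p : ℂ[X]) :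
    AEStronglyMeasurable (fun θ => p.eval (e θ) * S.D (e θ)) volume := by
  have h1 : Continuous fun θ => p.eval (e θ) := p.continuous.comp continuous_e
  refine h1.aestronglyMeasurable.mul (Measurable.aestronglyMeasurable ?_)
  unfold D logD
  refine Complex.measurable_exp.comp (Measurable.add (Finset.measurable_sum _ fun k _ => ?_)
    S.continuous_ell_e.measurable)
  refine (Complex.measurable_log.comp ?_).const_mul _
  have := continuous_e
  exact (by fun_prop : Continuous fun θ => 1 - conj (S.a k) * e θ).measurable

lemma intervalIntegrable_mul_D (p : ℂ[X]) :
    IntervalIntegrable (fun θ => p.eval (e θ) * S.D (e θ)) volume 0 (2 * π) := by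
  have h1 : IntervalIntegrable (fun θ => 1 + ‖p.eval (e θ) * S.D (e θ)‖ ^ 2) volume 0 (2 * π) :=
    intervalIntegrable_const.add (S.intervalIntegrable_norm_mul_D_sq p)
  refine h1.mono_fun (S.aestronglyMeasurable_mul_D p).restrict (ae_of_all _ fun θ => ?_)
  beta_reduce
  rw [Real.norm_of_nonneg (by positivity)]
  nlinarith [sq_nonneg (‖p.eval (e θ) * S.D (e θ)‖ - 1)]

lemma integral_norm_sub_sq {p : ℂ[X]} (hp : p.eval 0 = 1) :
    IntervalIntegrable (fun θ => ‖p.eval (e θ) * S.D (e θ) - S.D0‖ ^ 2) volume 0 (2 * π) ∧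
    ∫ θ in (0 : ℝ)..(2 * π), ‖p.eval (e θ) * S.D (e θ) - S.D0‖ ^ 2 =
      (∫ t, ‖p.eval t‖ ^ 2 ∂S.meas) - 2 * π * S.D0 ^ 2 := by
  have h1 := S.cauchy_mul_D p (z := 0) (by simp)
  simp only [zero_mul, sub_zero, inv_one, mul_one, hp, one_mul, S.D_zero] at h1
  have h2 : ∀ θ, ‖p.eval (e θ) * S.D (e θ) - S.D0‖ ^ 2 = ‖p.eval (e θ) * S.D (e θ)‖ ^ 2
      + S.D0 ^ 2 - 2 * S.D0 * (p.eval (e θ) * S.D (e θ)).re := fun θ => by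
    rw [Complex.sq_norm, Complex.sq_norm, Complex.normSq_sub, Complex.normSq_ofReal,
      Complex.conj_ofReal, Complex.re_mul_ofReal]
    ring
  have i0 := S.intervalIntegrable_mul_D p
  have i1 := S.intervalIntegrable_norm_mul_D_sq p
  have i2 : IntervalIntegrable (fun θ => ‖p.eval (e θ) * S.D (e θ)‖ ^ 2 + S.D0 ^ 2) volume 0
      (2 * π) := i1.add intervalIntegrable_const
  have i4 : IntervalIntegrable (fun θ => (p.eval (e θ) * S.D (e θ)).re) volume 0 (2 * π) :=
    ⟨i0.1.re, i0.2.re⟩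
  have i3 : IntervalIntegrable (fun θ => 2 * S.D0 * (p.eval (e θ) * S.D (e θ)).re) volume 0
      (2 * π) := i4.const_mul _
  have h3 : ∫ θ in (0 : ℝ)..(2 * π), (p.eval (e θ) * S.D (e θ)).re = 2 * π * S.D0 := by
    have := intervalIntegral.intervalIntegral_re i0
    rw [h1] at this
    have h4 : RCLike.re (2 * (π : ℂ) * (S.D0 : ℂ)) = 2 * π * S.D0 := by
      rw [show 2 * (π : ℂ) * (S.D0 : ℂ) = ((2 * π * S.D0 : ℝ) : ℂ) by push_cast; ring]
      exact Complex.ofReal_re _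
    rw [h4] at this
    exact this
  simp_rw [h2]
  refine ⟨i2.sub i3, ?_⟩
  rw [intervalIntegral.integral_sub i2 i3, intervalIntegral.integral_add i1 intervalIntegrable_const,
    intervalIntegral.integral_const_mul, h3, S.integral_norm_mul_D_sq]
  simp
  ring

lemma tendsto_integral_ratio :
    Tendsto (fun r : ℝ => ∫ θ in (0 : ℝ)..(2 * π), ‖S.D (e θ) / S.D (r * e θ)‖ ^ 2) (𝓝[<] 1)
      (𝓝 (2 * π)) := by
  obtain ⟨C, hC, h⟩ := S.exists_norm_D_div_radial_le
  have h1 : (2 * π : ℝ) = ∫ θ in (0 : ℝ)..(2 * π), (1 : ℝ) := by simp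
  have hr : ∀ᶠ r : ℝ in 𝓝[<] 1, 0 ≤ r ∧ r < 1 := by
    filter_upwards [Ioo_mem_nhdsLT (zero_lt_one' ℝ)] with r hr using ⟨hr.1.le, hr.2⟩
  nth_rewrite 2 [h1]
  refine intervalIntegral.tendsto_integral_filter_of_dominated_convergence
    (fun θ => C * ∏ k, ‖e θ - S.a k‖ ^ (2 * min (S.β k) 0)) ?_ ?_ ?_ ?_
  · filter_upwards [hr] with r hr
    have h2 := S.aestronglyMeasurable_mul_D 1
    simp only [eval_one, one_mul] at h2
    have h3 : Continuous fun θ => S.D (r * e θ) :=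
      S.D_differentiableOn.continuousOn.comp_continuous (continuous_const.mul continuous_e)
        fun θ => by
          rw [mem_ball_zero_iff, norm_mul, norm_e, mul_one, Complex.norm_of_nonneg hr.1]
          exact hr.2
    exact ((h2.div₀ h3.aestronglyMeasurable).norm.pow 2).restrict
  · filter_upwards [hr] with r hr
    filter_upwards [S.ae_ne] with θ hθ _
    rw [Real.norm_of_nonneg (by positivity)]
    exact h _ (norm_e θ) hθ r hr.1 hr.2.le
  · refine (intervalIntegrable_prod_rpow S.inj S.norm_a (fun k => ?_) _ _).const_mul C
    rcases min_choice (S.β k) 0 with h | h <;> rw [h] <;> linarith [S.hβ k]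
  · filter_upwards [S.ae_ne] with θ hθ _
    have h2 := tendsto_radial (S.D_differentiableAt (norm_e θ).le hθ).continuousAt
    have h3 := ((tendsto_const_nhds (x := S.D (e θ))).div h2 (S.D_ne_zero _)).norm.pow 2
    rw [div_self (S.D_ne_zero _), norm_one, one_pow] at h3
    exact h3

/-- Near-optimal trial polynomials for the Szegő infimum. -/
lemma exists_trial {ε : ℝ} (hε : 0 < ε) :
    ∃ q : ℂ[X], q.eval 0 = 1 ∧ ∫ t, ‖q.eval t‖ ^ 2 ∂S.meas ≤ 2 * π * S.D0 ^ 2 + ε := by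
  have hD0 := S.D0_pos
  have ev : ∀ᶠ r : ℝ in 𝓝[<] 1, (0 < r ∧ r < 1) ∧
      S.D0 ^ 2 * ∫ θ in (0 : ℝ)..(2 * π), ‖S.D (e θ) / S.D (r * e θ)‖ ^ 2 <
        2 * π * S.D0 ^ 2 + ε / 2 := by
    have h1 := S.tendsto_integral_ratio.const_mul (S.D0 ^ 2)
    filter_upwards [Ioo_mem_nhdsLT (zero_lt_one' ℝ),
      h1.eventually_lt_const (show S.D0 ^ 2 * (2 * π) < 2 * π * S.D0 ^ 2 + ε / 2 by linarith)] with r h h'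
    exact ⟨h, h'⟩
  obtain ⟨r, ⟨hr0, hr1⟩, hr⟩ := ev.exists
  set f : ℂ → ℂ := fun z => S.D0 / S.D (r * z) with hf
  obtain ⟨R1, hR1, hR1r⟩ := exists_between ((one_lt_inv₀ hr0).2 hr1)
  obtain ⟨R2, hR2, hR21⟩ := exists_between hR1
  have hR1pos : 0 < R1 := one_pos.trans hR1
  have hdiff : DifferentiableOn ℂ f (closedBall 0 R1) := fun w hw => by
    rw [mem_closedBall_zero_iff] at hw
    have hw1 : ‖(r : ℂ) * w‖ < 1 := by
      rw [norm_mul, Complex.norm_of_nonneg hr0.le]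
      calc r * ‖w‖ ≤ r * R1 := by gcongr
        _ < r * r⁻¹ := by gcongr
        _ = 1 := mul_inv_cancel₀ hr0.ne'
    have h3 := S.D_differentiableAt hw1.le (S.ne_a hw1)
    have h4 : DifferentiableAt ℂ (fun w : ℂ => S.D (r * w)) w :=
      h3.comp (f := fun w : ℂ => r * w) w (differentiableAt_id.const_mul _)
    exact ((differentiableAt_const _).div h4 (S.D_ne_zero _)).differentiableWithinAt
  have hps := DifferentiableOn.hasFPowerSeriesOnBall (R := R1.toNNReal) (c := (0 : ℂ)) (f := f)
    (by rwa [Real.coe_toNNReal _ hR1pos.le]) (Real.toNNReal_pos.2 hR1pos)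
  set P := cauchyPowerSeries f 0 (R1.toNNReal : ℝ)
  have hunif := hps.tendstoUniformlyOn (r' := R2.toNNReal) (by
    exact_mod_cast (Real.toNNReal_lt_toNNReal_iff hR1pos).2 hR21)
  rw [Metric.tendstoUniformlyOn_iff] at hunif
  simp only [zero_add, Real.coe_toNNReal _ (one_pos.trans hR2).le] at hunif
  obtain ⟨M, hM⟩ := (isCompact_sphere (0 : ℂ) 1).exists_bound_of_continuousOn
    (hdiff.continuousOn.mono (sphere_subset_closedBall.trans (closedBall_subset_closedBall hR1.le)))
  have hM0 : 0 ≤ M := (norm_nonneg _).trans (hM 1 (by simp))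
  set V := (S.meas univ).toReal with hV
  have hV0 : 0 ≤ V := ENNReal.toReal_nonneg
  obtain ⟨η, hη0, hη1, hηV⟩ : ∃ η : ℝ, 0 < η ∧ η ≤ 1 ∧ (2 * M + 1) * η * V ≤ ε / 2 := by
    refine ⟨min 1 (ε / 2 / ((2 * M + 1) * V + 1)), ?_, min_le_left _ _, ?_⟩
    · have : 0 < (2 * M + 1) * V + 1 := by positivity
      positivity
    · have h2 : 0 < (2 * M + 1) * V + 1 := by positivity
      have h1 : min 1 (ε / 2 / ((2 * M + 1) * V + 1)) * ((2 * M + 1) * V + 1) ≤ ε / 2 := by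
        rw [← le_div_iff₀ h2]; exact min_le_right _ _
      have h3 : 0 ≤ min 1 (ε / 2 / ((2 * M + 1) * V + 1)) := by positivity
      nlinarith
  obtain ⟨N, hN⟩ := (eventually_atTop.1 (hunif η hη0))
  set q : ℂ[X] := ∑ k ∈ Finset.range (N + 1), C (P.coeff k) * X ^ k with hq
  have hqe : ∀ z, q.eval z = P.partialSum (N + 1) z := fun z => by
    rw [hq, eval_finsetSum, FormalMultilinearSeries.partialSum]
    refine Finset.sum_congr rfl fun k _ => ?_
    simp only [eval_mul, eval_C, eval_pow, eval_X, FormalMultilinearSeries.apply_eq_pow_smul_coeff,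
      smul_eq_mul]
    ring
  have hq0 : q.eval 0 = 1 := by
    have h1 : q.eval 0 = P.coeff 0 := by
      rw [hq, eval_finsetSum, Finset.sum_eq_single 0]
      · simp
      · intro b _ hb; simp [hb]
      · simp
    have h2 : P.coeff 0 = f 0 := hps.coeff_zero 1
    rw [h1, h2, hf]
    simp only [mul_zero, S.D_zero]
    exact div_self (by exact_mod_cast hD0.ne')
  have hfc : ContinuousOn f (sphere 0 1) :=
    hdiff.continuousOn.mono (sphere_subset_closedBall.trans (closedBall_subset_closedBall hR1.le))
  have hle : ∀ t : ℂ, ‖t‖ = 1 → ‖q.eval t‖ ^ 2 ≤ ‖f t‖ ^ 2 + (2 * M + 1) * η := fun t ht => by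
    have h1 := hN (N + 1) (by omega) t (by rw [mem_ball_zero_iff, ht]; exact hR2)
    rw [← hqe, dist_eq_norm] at h1
    have h2 : ‖q.eval t‖ ≤ ‖f t‖ + η := by
      have := norm_sub_norm_le (q.eval t) (f t)
      rw [norm_sub_rev] at this
      linarith
    have h3 := hM t (by simpa using ht)
    calc ‖q.eval t‖ ^ 2 ≤ (‖f t‖ + η) ^ 2 := by gcongr
      _ ≤ _ := by nlinarith [norm_nonneg (f t)]
  have hintg : ∀ {g : ℂ → ℝ}, ContinuousOn g (sphere 0 1) → Integrable g S.meas := fun {g} hg => by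
    have h1 : IntegrableOn g (sphere 0 1) S.meas := hg.integrableOn_compact (isCompact_sphere _ _)
    rwa [IntegrableOn, S.restrict_meas] at h1
  refine ⟨q, hq0, ?_⟩
  have hqc := q.continuous
  calc ∫ t, ‖q.eval t‖ ^ 2 ∂S.meas ≤ ∫ t, (‖f t‖ ^ 2 + (2 * M + 1) * η) ∂S.meas := by
        refine integral_mono_ae (hintg (by fun_prop)) (hintg (by fun_prop)) ?_
        exact S.ae_meas.mono fun t ht => hle t ht
    _ = (∫ t, ‖f t‖ ^ 2 ∂S.meas) + (2 * M + 1) * η * V := by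
        rw [integral_add (hintg (by fun_prop)) (integrable_const _), integral_const, smul_eq_mul,
          measureReal_def]
        ring
    _ ≤ (2 * π * S.D0 ^ 2 + ε / 2) + ε / 2 := by
        refine add_le_add ?_ hηV
        rw [S.integral_meas (S.aestronglyMeasurable (by fun_prop))]
        refine le_of_eq_of_le ?_ hr.le
        rw [← intervalIntegral.integral_const_mul]
        refine intervalIntegral.integral_congr_ae (S.ae_ne.mono fun θ hθ _ => ?_)
        rw [← S.norm_D_sq hθ, hf, norm_div, norm_div, div_pow, div_pow, smul_eq_mul,
          Complex.norm_of_nonneg hD0.le]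
        ring
    _ = _ := by ring

variable {Φ : ℕ → ℂ[X]} (H : OPS S.meas Φ)

include H

lemma nsq_eq_rev (n : ℕ) : nsq S.meas Φ n = ∫ t, ‖(rev Φ n).eval t‖ ^ 2 ∂S.meas := by
  rw [nsq]
  refine integral_congr_ae (S.ae_meas.mono fun t ht => ?_)
  beta_reduce
  rw [H.norm_rev_eval n ht]

lemma le_nsq (n : ℕ) : 2 * π * S.D0 ^ 2 ≤ nsq S.meas Φ n := by
  have h := (S.integral_norm_sub_sq (H.rev_eval_zero n)).2
  rw [← S.nsq_eq_rev H] at h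
  have h2 : 0 ≤ ∫ θ in (0 : ℝ)..(2 * π), ‖(rev Φ n).eval (e θ) * S.D (e θ) - S.D0‖ ^ 2 :=
    intervalIntegral.integral_nonneg (by positivity) fun θ _ => by positivity
  linarith

lemma tendsto_nsq : Tendsto (nsq S.meas Φ) atTop (𝓝 (2 * π * S.D0 ^ 2)) := by
  rw [Metric.tendsto_atTop]
  intro ε hε
  obtain ⟨q, hq0, hq⟩ := S.exists_trial (half_pos hε)
  refine ⟨q.natDegree, fun n hn => ?_⟩
  have h1 := S.le_nsq H n
  have h2 := H.nsq_le (n := n) (q := q) (lt_of_le_of_lt degree_le_natDegree (by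
    exact_mod_cast Nat.lt_succ_of_le hn)) hq0
  rw [Real.dist_eq, abs_of_nonneg (by linarith)]
  linarith

/-- Szegő's theorem, with a uniform error in every smaller disk. -/
lemma exists_norm_rev_mul_D_sub_le : ∃ δ : ℕ → ℝ, Tendsto δ atTop (𝓝 0) ∧ ∀ n, ∀ z : ℂ,
    ‖z‖ < 1 → ‖(rev Φ n).eval z * S.D z - S.D0‖ ≤ δ n / (1 - ‖z‖) := by
  refine ⟨fun n => √(nsq S.meas Φ n - 2 * π * S.D0 ^ 2) + 1 / ((n : ℝ) + 1), ?_, fun n z hz => ?_⟩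
  · have h1 := ((S.tendsto_nsq H).sub_const (2 * π * S.D0 ^ 2)).sqrt
    rw [sub_self, Real.sqrt_zero] at h1
    simpa using h1.add tendsto_one_div_add_atTop_nhds_zero_nat
  · set A := nsq S.meas Φ n - 2 * π * S.D0 ^ 2 with hA
    set η := √A + 1 / ((n : ℝ) + 1) with hη
    have hA0 : 0 ≤ A := by linarith [S.le_nsq H n]
    have hη0 : 0 < η := by positivity
    have hAη : A ≤ η ^ 2 := by
      calc A = √A ^ 2 := (Real.sq_sqrt hA0).symm
        _ ≤ η ^ 2 := by
          have : √A ≤ η := by rw [hη]; linarith [show 0 < 1 / ((n : ℝ) + 1) by positivity]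
          gcongr
    obtain ⟨hi, hv⟩ := S.integral_norm_sub_sq (H.rev_eval_zero n)
    rw [← S.nsq_eq_rev H, ← hA] at hv
    have hz1 : 0 < 1 - ‖z‖ := by linarith
    have hlow : ∀ θ, 1 - ‖z‖ ≤ ‖1 - z * conj (e θ)‖ := fun θ => by
      have := norm_sub_norm_le 1 (z * conj (e θ))
      rwa [norm_one, norm_mul, Complex.norm_conj, norm_e, mul_one] at this
    have hz2 : ∀ θ, 1 - z * conj (e θ) ≠ 0 := fun θ h0 => by
      have := hlow θ
      rw [h0, norm_zero] at this; linarith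
    have hc : Continuous fun θ => (1 - z * conj (e θ))⁻¹ :=
      (continuous_const.sub (continuous_const.mul
        (Complex.continuous_conj.comp continuous_e))).inv₀ hz2
    have h1 := S.cauchy_mul_D (rev Φ n) hz
    have h2 := cauchy_circle (f := fun _ => (S.D0 : ℂ)) diffContOnCl_const hz
    have h3 : 2 * π * ((rev Φ n).eval z * S.D z - S.D0) = ∫ θ in (0 : ℝ)..(2 * π),
        ((rev Φ n).eval (e θ) * S.D (e θ) - S.D0) * (1 - z * conj (e θ))⁻¹ := by
      rw [mul_sub, ← h1, ← h2, ← intervalIntegral.integral_sub]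
      · congr 1; ext θ; ring
      · exact (S.intervalIntegrable_mul_D _).mul_continuousOn hc.continuousOn
      · exact (continuous_const.mul hc).intervalIntegrable _ _
    have h4 : ‖∫ θ in (0 : ℝ)..(2 * π),
        ((rev Φ n).eval (e θ) * S.D (e θ) - S.D0) * (1 - z * conj (e θ))⁻¹‖ ≤
        ∫ θ in (0 : ℝ)..(2 * π), (η / 2 + 1 / (2 * η) *
          ‖(rev Φ n).eval (e θ) * S.D (e θ) - S.D0‖ ^ 2) * (1 - ‖z‖)⁻¹ := by
      refine intervalIntegral.norm_integral_le_of_norm_le (by positivity) (ae_of_all _ fun θ _ => ?_)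
        ((intervalIntegrable_const.add (hi.const_mul _)).mul_const _)
      rw [norm_mul, norm_inv]
      refine mul_le_mul ?_ (inv_anti₀ hz1 (hlow θ)) (by positivity) (by positivity)
      have h5 : η / 2 + 1 / (2 * η) * ‖(rev Φ n).eval (e θ) * S.D (e θ) - S.D0‖ ^ 2 -
          ‖(rev Φ n).eval (e θ) * S.D (e θ) - S.D0‖ =
          1 / (2 * η) * (‖(rev Φ n).eval (e θ) * S.D (e θ) - S.D0‖ - η) ^ 2 := by
        field_simp; ring
      have h6 : 0 ≤ 1 / (2 * η) * (‖(rev Φ n).eval (e θ) * S.D (e θ) - S.D0‖ - η) ^ 2 := by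
        positivity
      linarith
    rw [intervalIntegral.integral_mul_const, intervalIntegral.integral_add intervalIntegrable_const
      (hi.const_mul _), intervalIntegral.integral_const_mul, hv, ← h3, norm_mul] at h4
    have h7 : ‖(2 * π : ℂ)‖ = 2 * π := by
      rw [show (2 * π : ℂ) = ((2 * π : ℝ) : ℂ) by push_cast; ring]
      exact Complex.norm_of_nonneg (by positivity)
    rw [h7, intervalIntegral.integral_const, smul_eq_mul, sub_zero] at h4
    have h8 : 1 / (2 * η) * A ≤ η / 2 := by
      rw [one_div, inv_mul_le_iff₀ (by positivity)]
      nlinarith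
    have hpi := Real.pi_gt_three
    have h9 : 2 * π * ‖(rev Φ n).eval z * S.D z - S.D0‖ ≤ 2 * π * (η * (1 - ‖z‖)⁻¹) := by
      refine h4.trans ?_
      have : 2 * π * (η / 2) + 1 / (2 * η) * A ≤ 2 * π * η := by nlinarith
      calc _ ≤ 2 * π * η * (1 - ‖z‖)⁻¹ := by gcongr
        _ = _ := by ring
    rw [div_eq_mul_inv]
    exact le_of_mul_le_mul_left h9 (by positivity)

lemma tendsto_verb : Tendsto (fun n => ‖verb Φ n‖) atTop (𝓝 0) := by
  have h := S.tendsto_nsq H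
  have h0 : 2 * π * S.D0 ^ 2 ≠ 0 := by have := S.D0_pos; positivity
  have h1 := ((h.comp (tendsto_add_atTop_nat 1)).div h h0).const_sub 1
  rw [div_self h0, sub_self] at h1
  have h2 := h1.sqrt
  rw [Real.sqrt_zero] at h2
  refine h2.congr fun n => ?_
  change √(1 - nsq S.meas Φ (n + 1) / nsq S.meas Φ n) = _
  rw [H.nsq_succ, mul_div_cancel_left₀ _ (H.nsq_pos n).ne', sub_sub_cancel,
    Real.sqrt_sq (norm_nonneg _)]

end SData

end OPUC

namespace OPUC

open scoped ComplexConjugate Topology NNReal ENNReal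

/-- The moments of the orthogonal polynomials are bounded by `B (1 + |i|)`. -/
def MomLE (ν : Measure ℂ) (Φ : ℕ → ℂ[X]) (n : ℕ) (B : ℝ) : Prop :=
  0 ≤ B ∧ (∀ i : ℤ, ‖momB ν Φ n i‖ ≤ B * (1 + |i|)) ∧
    ∀ i : ℤ, i ≠ 0 → ‖momM ν Φ n i‖ ≤ B * (1 + |i|)

lemma OPS.momLE_nsq {ν : Measure ℂ} {Φ : ℕ → ℂ[X]} (H : OPS ν Φ) (n : ℕ) :
    MomLE ν Φ n (nsq ν Φ 0) := by
  have h0 := (H.nsq_pos 0).le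
  have h1 (i : ℤ) : nsq ν Φ 0 ≤ nsq ν Φ 0 * (1 + |i|) :=
    le_mul_of_one_le_right h0 (by have := abs_nonneg (i : ℝ); push_cast; linarith)
  exact ⟨h0, fun i => (H.norm_momB_le n i).trans (h1 i), fun i _ => (H.norm_momM_le n i).trans (h1 i)⟩

/-- Evaluation of the reversed derivative. -/
lemma eval_derivative_rev (Φ : ℕ → ℂ[X]) {n : ℕ} (hd : (Φ n).natDegree ≤ n) {z : ℂ} (hz : z ≠ 0) :
    z * (derivative (rev Φ n)).eval z = -(z ^ n * conj ((SData.pdef Φ n).eval (conj z)⁻¹)) := by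
  have h1 : ((fun _ => SData.pdef Φ n : ℕ → ℂ[X]) n).natDegree ≤ n := by
    refine (natDegree_sub_le _ _).trans (max_le ?_ ((natDegree_C_mul_le _ _).trans hd))
    refine natDegree_le_natDegree (degree_X_mul_derivative_le (Φ n)) |>.trans hd
  have h2 := rev_eval_inv (fun _ => SData.pdef Φ n) h1 hz
  beta_reduce at h2
  rw [← h2]
  suffices h3 : X * derivative (rev Φ n) = -rev (fun _ => SData.pdef Φ n) n by
    simpa using congrArg (eval z) h3
  ext j
  rw [coeff_neg]
  have hc (Φ : ℕ → ℂ[X]) (i : ℕ) (hi : n < i) (h : (Φ n).natDegree ≤ n) : (rev Φ n).coeff i = 0 := by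
    rw [rev, coeff_reflect, revAt_eq_self_of_lt hi, coeff_map,
      coeff_eq_zero_of_natDegree_lt (h.trans_lt hi), map_zero]
  rcases le_or_gt j n with hj | hj
  · rw [OPS.rev_coeff (fun _ => SData.pdef Φ n) hj]
    rcases j with _ | j
    · simp only [Nat.sub_zero, SData.pdef, coeff_sub, coeff_C_mul, mul_coeff_zero, coeff_X_zero, zero_mul]
      rcases n with _ | n
      · simp
      · rw [coeff_X_mul, coeff_derivative]; simp; ring
    · rw [coeff_X_mul, coeff_derivative, OPS.rev_coeff Φ hj]
      simp only [SData.pdef, coeff_sub, coeff_C_mul]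
      obtain ⟨k, hk⟩ := Nat.exists_eq_add_of_le hj
      have hk' : n - (j + 1) = k := by omega
      have hn : (n : ℂ) = j + 1 + k := by rw [hk]; push_cast; ring
      rw [hk', hn]
      rcases k with _ | k
      · simp; ring
      · rw [coeff_X_mul, coeff_derivative]; simp; ring
  · rw [hc (fun _ => SData.pdef Φ n) j hj h1]
    rcases j with _ | j
    · omega
    · rw [coeff_X_mul, coeff_derivative, hc Φ _ hj hd]; simp

namespace SData

variable {m : ℕ} (S : SData m)

lemma exists_interp {r : ℝ} (hr : 0 < r) (hr1 : r < 1) : ∃ C : ℝ, 0 ≤ C ∧ ∀ (c : Fin m → ℂ) (ε : ℝ),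
    (∀ ζ : ℂ, ‖ζ‖ = r → ‖∑ k, c k * (conj (S.a k) * ζ / (1 - conj (S.a k) * ζ))‖ ≤ ε) →
    ∀ k, ‖c k‖ ≤ C * ε := by
  set P : Fin m → ℝ := fun k => ‖∏ j ∈ Finset.univ.erase k, (S.a k - S.a j)‖ with hP
  have hPpos (k) : 0 < P k := norm_pos_iff.2 (Finset.prod_ne_zero_iff.2 fun j hj =>
    sub_ne_zero.2 fun h => (Finset.ne_of_mem_erase hj) (S.inj h).symm)
  have hA : 0 < (1 / r + 1) ^ m := by positivity
  refine ⟨∑ k, (1 / r + 1) ^ m / P k, Finset.sum_nonneg fun k _ => by have := hPpos k; positivity,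
    fun c ε h k => ?_⟩
  have hε : 0 ≤ ε := (norm_nonneg _).trans (h r (by simp [abs_of_pos hr]))
  set Q : ℂ → ℂ := fun z => ∑ k, conj (c k) * S.a k * ∏ j ∈ Finset.univ.erase k, (z - S.a j) with hQ
  have hQd : Differentiable ℂ Q := by rw [hQ]; fun_prop
  have hb : ∀ z ∈ frontier (ball (0 : ℂ) (1 / r)), ‖Q z‖ ≤ ε * (1 / r + 1) ^ m := by
    intro z hz
    rw [frontier_ball _ (by positivity), mem_sphere_zero_iff_norm] at hz
    have hz0 : z ≠ 0 := by rw [← norm_pos_iff, hz]; positivity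
    have hz1 : 1 < ‖z‖ := by rw [hz]; exact (one_lt_div hr).2 hr1
    have hza (j) : z - S.a j ≠ 0 := by
      intro h; rw [sub_eq_zero.1 h, S.norm_a] at hz1; exact lt_irrefl _ hz1
    have h1 := h (conj z)⁻¹ (by simp [hz])
    have h2 : Q z = conj (∑ k, c k * (conj (S.a k) * (conj z)⁻¹ / (1 - conj (S.a k) * (conj z)⁻¹)))
        * ∏ j, (z - S.a j) := by
      rw [map_sum, Finset.sum_mul, hQ]
      refine Finset.sum_congr rfl fun k _ => ?_
      rw [← Finset.mul_prod_erase _ _ (Finset.mem_univ k), ← mul_assoc]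
      congr 1
      simp only [map_mul, map_div₀, map_sub, map_one, map_inv₀, Complex.conj_conj]
      have : 1 - S.a k * z⁻¹ = (z - S.a k) / z := by field_simp
      rw [this]
      have := hza k
      field_simp
    rw [h2, norm_mul, Complex.norm_conj]
    refine mul_le_mul h1 ?_ (norm_nonneg _) hε
    rw [norm_prod]
    refine (Finset.prod_le_prod (g := fun _ => 1 / r + 1) (fun _ _ => norm_nonneg _) fun j _ => ?_).trans
      (by simp)
    refine (norm_sub_le _ _).trans ?_
    rw [hz, S.norm_a]
  have hka : S.a k ∈ closure (ball (0 : ℂ) (1 / r)) := subset_closure (by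
    rw [mem_ball_zero_iff, S.norm_a]; exact (one_lt_div hr).2 hr1)
  have h3 := Complex.norm_le_of_forall_mem_frontier_norm_le isBounded_ball hQd.diffContOnCl hb hka
  have h4 : Q (S.a k) = conj (c k) * S.a k * ∏ j ∈ Finset.univ.erase k, (S.a k - S.a j) := by
    rw [hQ]
    refine Finset.sum_eq_single k (fun j _ hj => ?_) (by simp)
    rw [Finset.prod_eq_zero (Finset.mem_erase.2 ⟨hj.symm, Finset.mem_univ k⟩) (sub_self _), mul_zero]
  rw [h4, norm_mul, norm_mul, Complex.norm_conj, S.norm_a, mul_one] at h3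
  have h5 : ‖c k‖ ≤ (1 / r + 1) ^ m / P k * ε := by
    rw [div_mul_eq_mul_div, le_div_iff₀ (hPpos k)]; linarith
  refine h5.trans (mul_le_mul_of_nonneg_right ?_ hε)
  exact Finset.single_le_sum (f := fun k => (1 / r + 1) ^ m / P k)
    (fun k _ => by have := hPpos k; positivity) (Finset.mem_univ k)

/-- The reversed remainder. -/
noncomputable def remr (Φ : ℕ → ℂ[X]) (n : ℕ) (z : ℂ) : ℂ := z ^ n * conj (S.rem Φ n (conj z)⁻¹)

variable {Φ : ℕ → ℂ[X]} (H : OPS S.meas Φ)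

include H

lemma exists_rem_le {M : ℝ} (hM : 1 ≤ M) (hMR : M < S.R) : ∃ C : ℝ, 0 ≤ C ∧ ∀ (n : ℕ) (B : ℝ),
    MomLE S.meas Φ n B → ∀ z : ℂ, z ≠ 0 → ‖z‖ ≤ M → ‖z⁻¹‖ ≤ M →
    ‖S.rem Φ n z - (Φ n).eval z * conj ((conj z)⁻¹ * deriv S.ell (conj z)⁻¹)‖ ≤
      C * B * (‖(rev Φ n).eval z‖ + ‖(Φ n).eval z‖) := by
  set c : ℕ → ℂ := fun l => Complex.I * l * S.L l with hc
  set d : ℕ → ℂ := fun l => -(Complex.I * l * conj (S.L l)) with hd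
  set T := ∑' l : ℕ, (‖c l‖ + ‖d l‖) * (((l : ℝ) + 1) ^ 2 * M ^ l) with hT
  have hM0 : 0 ≤ M := by linarith
  have hs : Summable fun l : ℕ => (‖c l‖ + ‖d l‖) * (((l : ℝ) + 1) ^ 2 * M ^ l) := by
    have h3 := S.summable_mul_pow 3 hM0 hMR
    have h2 := S.summable_mul_pow 2 hM0 hMR
    have h1 := S.summable_mul_pow 1 hM0 hMR
    refine (((h3.add (h2.mul_left 2)).add h1).mul_left 2).congr fun l => ?_
    simp only [hc, hd, norm_neg, norm_mul, Complex.norm_I, Complex.norm_natCast, Complex.norm_conj]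
    ring
  have hT0 : 0 ≤ T := tsum_nonneg fun l => by positivity
  have hD := S.D0_pos
  refine ⟨T / (2 * π * S.D0 ^ 2), by positivity, fun n B hB z hz0 hz hz' => ?_⟩
  have h := H.norm_integral_cdk_laurent_le hB.1 hB.2.1 hB.2.2 hM (c := c) (d := d) (by simp [hd]) hs
    (fun t ht => S.hasSum_v ht) hz0 hz hz'
  have hv : conj ((conj z)⁻¹ * deriv S.ell (conj z)⁻¹) = Complex.I * ∑' l, d l * z⁻¹ ^ l := by
    have h1 := Complex.hasSum_conj'.2 (S.hasSum_mul_deriv_ell (z := (conj z)⁻¹) (by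
      rw [norm_inv, Complex.norm_conj, ← norm_inv]; exact hz'.trans_lt hMR))
    rw [← h1.tsum_eq, ← tsum_mul_left]
    congr 1; ext l
    simp only [hd, map_mul, map_natCast, map_pow, map_inv₀, Complex.conj_conj]
    linear_combination ((l : ℂ) * conj (S.L l) * z⁻¹ ^ l) * Complex.I_mul_I
  rw [hv, rem]
  have h2 : Complex.I * (∫ t, (Φ n).eval t * cdk S.meas Φ n z t * S.v t ∂S.meas) -
      (Φ n).eval z * (Complex.I * ∑' l, d l * z⁻¹ ^ l) = Complex.I *
      ((∫ t, (Φ n).eval t * cdk S.meas Φ n z t * S.v t ∂S.meas) -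
      (Φ n).eval z * ∑' l, d l * z⁻¹ ^ l) := by ring
  rw [h2, norm_mul, Complex.norm_I, one_mul]
  refine h.trans ?_
  have h3 : B / nsq S.meas Φ n ≤ B / (2 * π * S.D0 ^ 2) :=
    div_le_div_of_nonneg_left hB.1 (by positivity) (S.le_nsq H n)
  calc _ ≤ B / (2 * π * S.D0 ^ 2) * (‖(rev Φ n).eval z‖ + ‖(Φ n).eval z‖) * T := by gcongr
    _ = _ := by ring

lemma rev_eq {n : ℕ} {z : ℂ} (hz : z ≠ 0) : z ^ n * conj ((Φ n).eval (conj z)⁻¹) = (rev Φ n).eval z :=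
  (H.rev_eval n hz).symm

lemma eq_rev {n : ℕ} {z : ℂ} (hz : z ≠ 0) : z ^ n * conj ((rev Φ n).eval (conj z)⁻¹) = (Φ n).eval z := by
  rw [H.rev_eval n (inv_ne_zero ((_root_.map_ne_zero _).2 hz))]
  simp only [map_mul, map_pow, map_inv₀, Complex.conj_conj, inv_inv]
  rw [← mul_assoc, ← mul_pow, mul_inv_cancel₀ hz, one_pow, one_mul]

lemma exists_remr_le {M : ℝ} (hM : 1 ≤ M) (hMR : M < S.R) : ∃ C : ℝ, 0 ≤ C ∧ ∀ (n : ℕ) (B : ℝ),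
    MomLE S.meas Φ n B → ∀ z : ℂ, z ≠ 0 → ‖z‖ ≤ M → ‖z⁻¹‖ ≤ M →
    ‖S.remr Φ n z - (rev Φ n).eval z * (z * deriv S.ell z)‖ ≤
      C * B * (‖(Φ n).eval z‖ + ‖(rev Φ n).eval z‖) := by
  obtain ⟨C, hC, h⟩ := S.exists_rem_le H hM hMR
  refine ⟨C, hC, fun n B hB z hz0 hz hz' => ?_⟩
  have h1 := h n B hB (conj z)⁻¹ (inv_ne_zero ((_root_.map_ne_zero _).2 hz0))
    (by rwa [norm_inv, Complex.norm_conj, ← norm_inv]) (by rwa [inv_inv, Complex.norm_conj])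
  simp only [map_inv₀, Complex.conj_conj, inv_inv] at h1
  rw [← S.eq_rev H hz0, ← S.rev_eq H hz0, remr]
  have h2 : z ^ n * conj (S.rem Φ n (conj z)⁻¹)
      - z ^ n * conj ((Φ n).eval (conj z)⁻¹) * (z * deriv S.ell z)
      = z ^ n * conj (S.rem Φ n (conj z)⁻¹
      - (Φ n).eval (conj z)⁻¹ * conj (z * deriv S.ell z)) := by
    simp only [map_sub, map_mul, Complex.conj_conj]; ring
  rw [h2]
  simp only [norm_mul, Complex.norm_conj] at h1 ⊢
  calc _ ≤ ‖z ^ n‖ * _ := mul_le_mul_of_nonneg_left h1 (norm_nonneg _)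
    _ = _ := by ring

/-- The differential equation of the reversed polynomials. -/
lemma ode_rev {n : ℕ} (hm : m ≤ n) (hn : 0 < n) {z : ℂ} (hz0 : z ≠ 0)
    (hz : ∀ k, 1 - conj (S.a k) * z ≠ 0) :
    z * (derivative (rev Φ n)).eval z = -S.remr Φ n z + ∑ k, conj (S.g Φ n k) *
      (conj (S.a k) * z / (1 - conj (S.a k) * z)) *
      ((rev Φ n).eval z - conj (S.tau Φ n k) * (Φ n).eval z) := by
  have hz1 (k) : 1 - S.a k * z⁻¹ = -S.a k * (1 - conj (S.a k) * z) / z := by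
    have := mul_conj_one (S.norm_a k)
    field_simp
    linear_combination (-z) * this
  have ha (k) : S.a k ≠ 0 := ne_zero_of_norm_one (S.norm_a k)
  rw [eval_derivative_rev Φ (H.natDegree n).le hz0]
  have h := S.ode H hm hn (conj z)⁻¹ (fun k => by
    have h1 := hz1 k
    have h2 : 1 - S.a k * z⁻¹ ≠ 0 := by
      rw [h1]; exact div_ne_zero (mul_ne_zero (neg_ne_zero.2 (ha k)) (hz k)) hz0
    intro h3
    apply h2
    have h4 := congrArg conj h3
    simpa using h4)
  simp only [pdef, eval_sub, eval_mul, eval_X, eval_C]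
  rw [h, map_sub, map_sum, mul_sub, neg_sub, sub_eq_neg_add, Finset.mul_sum]
  congr 1
  refine Finset.sum_congr rfl fun k _ => ?_
  rw [← S.eq_rev H hz0, ← S.rev_eq H hz0]
  simp only [map_div₀, map_mul, map_sub, map_one, map_inv₀, Complex.conj_conj]
  rw [hz1 k]
  have := ha k
  have := hz k
  have hak := mul_conj_one (S.norm_a k)
  field_simp
  linear_combination (conj (S.g Φ n k) * (conj (S.tau Φ n k) *
    conj ((rev Φ n).eval (1 / conj z)) - conj ((Φ n).eval (1 / conj z)))) * hak

end SData

end OPUC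

namespace OPUC

open scoped ComplexConjugate Topology NNReal ENNReal

lemma exists_le_div_of_rec {r C : ℝ} (hr0 : 0 ≤ r) (hr : r < 1) (hC : 0 ≤ C) {u : ℕ → ℝ} (hu0 : ∀ n, 0 ≤ u n)
    (hu : ∀ n : ℕ, u (n + 1) ≤ r * u n + C / (n + 1)) : ∃ C' : ℝ, 0 ≤ C' ∧ ∀ n : ℕ, u n ≤ C' / (n + 1) := by
  obtain ⟨N, hN⟩ := exists_nat_gt (2 / (1 - r))
  have h1r : 0 < 1 - r := by linarith
  rw [div_lt_iff₀ h1r] at hN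
  set T := 2 * C / (1 - r) + ∑ j ∈ Finset.range (N + 1), u j * (j + 1) with hT
  have hS : 0 ≤ ∑ j ∈ Finset.range (N + 1), u j * (j + 1) :=
    Finset.sum_nonneg fun j _ => mul_nonneg (hu0 j) (by positivity)
  have hT0 : 0 ≤ T := by positivity
  refine ⟨T, hT0, fun n => ?_⟩
  have hsmall (n : ℕ) (hn : n ≤ N) : u n ≤ T / (n + 1) := by
    rw [le_div_iff₀ (by positivity)]
    have h1 : u n * (n + 1) ≤ ∑ j ∈ Finset.range (N + 1), u j * (j + 1) :=
      Finset.single_le_sum (f := fun j : ℕ => u j * ((j : ℝ) + 1))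
      (fun j _ => mul_nonneg (hu0 j) (by positivity)) (Finset.mem_range.2 (by omega))
    have : 0 ≤ 2 * C / (1 - r) := by positivity
    linarith
  rcases le_total n N with h | h
  · exact hsmall n h
  induction n, h using Nat.le_induction with
  | base => exact hsmall N le_rfl
  | succ n hn ih =>
    refine (hu n).trans ?_
    have hn1 : (N : ℝ) ≤ n := by exact_mod_cast hn
    have hn0 : (0 : ℝ) < (n : ℝ) + 1 := by positivity
    have hCT : C ≤ (1 - r) / 2 * T := by
      have : (1 - r) / 2 * T = C + (1 - r) / 2 * ∑ j ∈ Finset.range (N + 1), u j * (j + 1) := by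
        rw [hT]; field_simp
      rw [this]
      have : 0 ≤ (1 - r) / 2 * ∑ j ∈ Finset.range (N + 1), u j * (j + 1) := by positivity
      linarith
    calc r * u n + C / (n + 1) ≤ r * (T / (n + 1)) + (1 - r) / 2 * T / (n + 1) := by gcongr
      _ = (1 + r) / 2 * T / (n + 1) := by ring
      _ ≤ T / ((n + 1 : ℕ) + 1) := by
        rw [div_le_div_iff₀ hn0 (by positivity)]
        push_cast
        have : (1 + r) / 2 * ((n : ℝ) + 1 + 1) ≤ n + 1 := by nlinarith
        nlinarith

lemma tendsto_zero_of_rec {r : ℝ} (hr0 : 0 ≤ r) (hr : r < 1) {u b : ℕ → ℝ} (hu0 : ∀ n, 0 ≤ u n)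
    (hb : Tendsto b atTop (𝓝 0)) (hu : ∀ n, u (n + 1) ≤ r * u n + b n) :
    Tendsto u atTop (𝓝 0) := by
  have h1r : 0 < 1 - r := by linarith
  rw [Metric.tendsto_atTop]
  intro ε hε
  obtain ⟨N, hN⟩ := eventually_atTop.1 (hb.eventually_lt_const (show 0 < (1 - r) * (ε / 2) by positivity))
  have h (k : ℕ) : u (N + k) ≤ ε / 2 + r ^ k * u N := by
    induction k with
    | zero => simp; linarith
    | succ k ih =>
      have h1 := hu (N + k)
      have h2 := hN (N + k) (by omega)
      rw [← add_assoc]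
      have h3 : r * u (N + k) ≤ r * (ε / 2 + r ^ k * u N) := mul_le_mul_of_nonneg_left ih hr0
      rw [pow_succ]
      nlinarith
  have h4 : Tendsto (fun k : ℕ => r ^ k * u N) atTop (𝓝 0) := by
    simpa using (tendsto_pow_atTop_nhds_zero_of_lt_one hr0 hr).mul_const (u N)
  obtain ⟨K, hK⟩ := eventually_atTop.1 (h4.eventually_lt_const (half_pos hε))
  refine ⟨N + K, fun n hn => ?_⟩
  obtain ⟨k, rfl⟩ := Nat.exists_eq_add_of_le hn
  rw [Real.dist_eq, sub_zero, abs_of_nonneg (hu0 _), add_assoc]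
  have := h (K + k)
  have := hK (K + k) (by omega)
  linarith

/-- Cauchy's estimate between concentric disks. -/
lemma norm_deriv_le_of_disk {f : ℂ → ℂ} {r r' C : ℝ} (hrr : r < r')
    (hf : DifferentiableOn ℂ f (closedBall 0 r')) (hC : ∀ z, ‖z‖ ≤ r' → ‖f z‖ ≤ C) {z : ℂ} (hz : ‖z‖ ≤ r) :
    ‖deriv f z‖ ≤ C / (r' - r) := by
  have hsub : closedBall z (r' - r) ⊆ closedBall 0 r' := by
    intro w hw
    rw [mem_closedBall_zero_iff]
    rw [mem_closedBall, dist_eq_norm] at hw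
    calc ‖w‖ = ‖(w - z) + z‖ := by ring_nf
      _ ≤ _ := norm_add_le _ _
      _ ≤ _ := by linarith
  refine Complex.norm_deriv_le_of_forall_mem_sphere_norm_le (by linarith) ?_ fun w hw => ?_
  · refine DifferentiableOn.diffContOnCl ?_
    rw [closure_ball _ (by linarith)]
    exact hf.mono hsub
  · exact hC w (by simpa using hsub (sphere_subset_closedBall hw))

namespace SData

variable {m : ℕ} (S : SData m)

lemma exists_D_bounds {r : ℝ} (hr : r < 1) : ∃ C : ℝ, 0 < C ∧ ∀ z : ℂ, ‖z‖ ≤ r →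
    ‖S.D z‖ ≤ C ∧ ‖(S.D z)⁻¹‖ ≤ C := by
  have hsub : closedBall (0 : ℂ) r ⊆ ball 0 1 := closedBall_subset_ball hr
  have h1 : ContinuousOn S.D (closedBall 0 r) := S.D_differentiableOn.continuousOn.mono hsub
  obtain ⟨C1, hC1⟩ := (isCompact_closedBall (0 : ℂ) r).exists_bound_of_continuousOn h1
  obtain ⟨C2, hC2⟩ := (isCompact_closedBall (0 : ℂ) r).exists_bound_of_continuousOn
    (h1.inv₀ fun z _ => S.D_ne_zero z)
  refine ⟨max 1 (max C1 C2), by positivity, fun z hz => ⟨?_, ?_⟩⟩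
  · exact (hC1 z (by simpa using hz)).trans ((le_max_left _ _).trans (le_max_right _ _))
  · exact (hC2 z (by simpa using hz)).trans ((le_max_right _ _).trans (le_max_right _ _))

/-- The limit `D 0 / D` of the reversed polynomials. -/
noncomputable def lim (z : ℂ) : ℂ := S.D0 / S.D z

lemma lim_differentiableOn : DifferentiableOn ℂ S.lim (ball 0 1) :=
  (differentiableOn_const _).div S.D_differentiableOn fun z _ => S.D_ne_zero z

lemma lim_ne_zero (z : ℂ) : S.lim z ≠ 0 :=
  div_ne_zero (Complex.ofReal_ne_zero.2 S.D0_pos.ne') (S.D_ne_zero z)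

lemma mul_deriv_lim {z : ℂ} (hz : ‖z‖ < 1) : z * deriv S.lim z = S.lim z *
    (∑ k, S.β k * (conj (S.a k) * z / (1 - conj (S.a k) * z)) - z * deriv S.ell z) := by
  have hne (k) : 1 - conj (S.a k) * z ≠ 0 := by
    rw [← norm_pos_iff, norm_one_sub_conj (S.norm_a k), norm_pos_iff, sub_ne_zero]
    exact S.ne_a hz k
  have hl : HasDerivAt S.logD (∑ k, S.β k * (-conj (S.a k) / (1 - conj (S.a k) * z))
      + deriv S.ell z) z := by
    refine HasDerivAt.add (HasDerivAt.fun_sum fun k _ => ?_) (S.hasDerivAt_ell (hz.trans S.one_lt_R))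
    have h1 : HasDerivAt (fun z : ℂ => 1 - conj (S.a k) * z) (-conj (S.a k)) z :=
      (((hasDerivAt_id z).const_mul (conj (S.a k))).const_sub 1).congr_deriv (by simp)
    exact (h1.clog (Or.inl (one_sub_conj_re_pos (S.norm_a k) hz.le (S.ne_a hz k)))).const_mul _
  have hD : HasDerivAt S.lim _ z := (hasDerivAt_const z (S.D0 : ℂ)).div hl.cexp (S.D_ne_zero z)
  rw [hD.deriv, lim]
  have h0 : Complex.exp (S.logD z) = S.D z := rfl
  rw [h0]
  have := S.D_ne_zero z
  have e : ∑ k, S.β k * (conj (S.a k) * z / (1 - conj (S.a k) * z)) =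
      -z * ∑ k, S.β k * (-conj (S.a k) / (1 - conj (S.a k) * z)) := by
    rw [Finset.mul_sum]
    exact Finset.sum_congr rfl fun k _ => by ring
  rw [e]
  field_simp
  ring

variable {Φ : ℕ → ℂ[X]} (H : OPS S.meas Φ)

include H

lemma exists_norm_rev_le {r : ℝ} (hr : r < 1) : ∃ C : ℝ, 0 < C ∧
    ∀ n, ∀ z : ℂ, ‖z‖ ≤ r → ‖(rev Φ n).eval z‖ ≤ C := by
  obtain ⟨δ, hδ, h⟩ := S.exists_norm_rev_mul_D_sub_le H
  obtain ⟨Δ, hΔ⟩ := hδ.bddAbove_range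
  obtain ⟨C, hC, hD⟩ := S.exists_D_bounds hr
  have hΔ0 : 0 ≤ Δ := by
    have := (norm_nonneg _).trans (h 0 0 (by simp))
    simp only [norm_zero, sub_zero, div_one] at this
    exact this.trans (hΔ ⟨0, rfl⟩)
  have hD0 := S.D0_pos
  refine ⟨(Δ / (1 - r) + S.D0) * C, by have : 0 < 1 - r := by linarith
                                       positivity, fun n z hz => ?_⟩
  have h1 := h n z (hz.trans_lt hr)
  have h2 : δ n / (1 - ‖z‖) ≤ Δ / (1 - r) :=
    div_le_div₀ hΔ0 (hΔ ⟨n, rfl⟩) (by linarith) (by linarith)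
  have h3 : ‖(rev Φ n).eval z * S.D z‖ ≤ Δ / (1 - r) + S.D0 := by
    calc _ = ‖((rev Φ n).eval z * S.D z - S.D0) + S.D0‖ := by ring_nf
      _ ≤ _ := norm_add_le _ _
      _ ≤ _ := by rw [Complex.norm_of_nonneg hD0.le]; linarith
  calc ‖(rev Φ n).eval z‖ = ‖(rev Φ n).eval z * S.D z‖ * ‖(S.D z)⁻¹‖ := by
        rw [← norm_mul, mul_inv_cancel_right₀ (S.D_ne_zero z)]
    _ ≤ _ := by gcongr; exact (hD z hz).2

lemma exists_norm_rev_inv_le {r : ℝ} (hr : r < 1) : ∃ C : ℝ, 0 < C ∧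
    ∀ᶠ n in atTop, ∀ z : ℂ, ‖z‖ ≤ r → ‖((rev Φ n).eval z)⁻¹‖ ≤ C := by
  obtain ⟨δ, hδ, h⟩ := S.exists_norm_rev_mul_D_sub_le H
  obtain ⟨C, hC, hD⟩ := S.exists_D_bounds hr
  have hD0 := S.D0_pos
  have h1r : 0 < 1 - r := by linarith
  refine ⟨2 / S.D0 * C, by positivity, ?_⟩
  filter_upwards [hδ.eventually_lt_const (show 0 < S.D0 / 2 * (1 - r) by positivity)] with n hn z hz
  have h1 := h n z (hz.trans_lt hr)
  have h2 : δ n / (1 - ‖z‖) ≤ S.D0 / 2 := by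
    rw [div_le_iff₀ (by linarith)]
    nlinarith
  have h3 : S.D0 / 2 ≤ ‖(rev Φ n).eval z * S.D z‖ := by
    have := norm_sub_norm_le (S.D0 : ℂ) ((rev Φ n).eval z * S.D z)
    rw [norm_sub_rev, Complex.norm_of_nonneg hD0.le] at this
    linarith
  have h4 : ‖((rev Φ n).eval z * S.D z)⁻¹‖ ≤ 2 / S.D0 := by
    rw [norm_inv, inv_le_comm₀ (by linarith) (by positivity)]
    simpa using h3
  calc ‖((rev Φ n).eval z)⁻¹‖ = ‖((rev Φ n).eval z * S.D z)⁻¹‖ * ‖S.D z‖ := by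
        rw [← norm_mul, mul_inv, inv_mul_cancel_right₀ (S.D_ne_zero z)]
    _ ≤ _ := by gcongr; exact (hD z hz).1

lemma norm_succ_le {n : ℕ} {z : ℂ} {r C : ℝ} (hz : ‖z‖ ≤ r) (hC : ‖(rev Φ n).eval z‖ ≤ C) :
    ‖(Φ (n + 1)).eval z‖ ≤ r * ‖(Φ n).eval z‖ + ‖verb Φ n‖ * C := by
  rw [H.succ_eq]
  simp only [eval_sub, eval_mul, eval_X, eval_C]
  refine (norm_sub_le _ _).trans ?_
  rw [norm_mul, norm_mul, Complex.norm_conj]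
  gcongr

lemma exists_norm_eval_le_seq {r C : ℝ} (hr0 : 0 ≤ r) (hC : ∀ n, ∀ z : ℂ, ‖z‖ ≤ r → ‖(rev Φ n).eval z‖ ≤ C) :
    ∃ u : ℕ → ℝ, (∀ n, 0 ≤ u n) ∧ (∀ n, u (n + 1) = r * u n + ‖verb Φ n‖ * C) ∧
      ∀ n, ∀ z : ℂ, ‖z‖ ≤ r → ‖(Φ n).eval z‖ ≤ u n := by
  have hC0 : 0 ≤ C := (norm_nonneg _).trans (hC 0 0 (by simpa))
  set u : ℕ → ℝ := fun n => Nat.rec 1 (fun n x => r * x + ‖verb Φ n‖ * C) n with hu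
  have hu1 (n) : u (n + 1) = r * u n + ‖verb Φ n‖ * C := rfl
  have hu0 (n) : 0 ≤ u n := by
    induction n with
    | zero => exact zero_le_one
    | succ n ih => rw [hu1]; positivity
  refine ⟨u, hu0, hu1, fun n => ?_⟩
  induction n with
  | zero => intro z _; rw [H.zero_eq_one]; simp [hu]
  | succ n ih =>
    intro z hz
    rw [hu1]
    refine (S.norm_succ_le H hz (hC n z hz)).trans ?_
    have := ih z hz
    gcongr

lemma exists_norm_eval_tendsto {r : ℝ} (hr0 : 0 ≤ r) (hr : r < 1) : ∃ u : ℕ → ℝ,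
    Tendsto u atTop (𝓝 0) ∧ ∀ n, ∀ z : ℂ, ‖z‖ ≤ r → ‖(Φ n).eval z‖ ≤ u n := by
  obtain ⟨C, hC0, hC⟩ := S.exists_norm_rev_le H hr
  obtain ⟨u, hu0, hu1, hu⟩ := S.exists_norm_eval_le_seq H hr0 hC
  refine ⟨u, tendsto_zero_of_rec hr0 hr hu0 (b := fun n => ‖verb Φ n‖ * C) ?_ fun n => (hu1 n).le, hu⟩
  simpa using (S.tendsto_verb H).mul_const C

lemma exists_norm_eval_le {A r : ℝ} (hA : ∀ k : ℕ, ‖verb Φ k‖ ≤ A / (k + 1)) (hr0 : 0 ≤ r) (hr : r < 1) :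
    ∃ C : ℝ, 0 ≤ C ∧ ∀ n : ℕ, ∀ z : ℂ, ‖z‖ ≤ r → ‖(Φ n).eval z‖ ≤ C / (n + 1) := by
  obtain ⟨C, hC0, hC⟩ := S.exists_norm_rev_le H hr
  obtain ⟨u, hu0, hu1, hu⟩ := S.exists_norm_eval_le_seq H hr0 hC
  have hA0 : 0 ≤ A := by simpa using (norm_nonneg _).trans (hA 0)
  obtain ⟨C', hC'0, hC'⟩ := exists_le_div_of_rec hr0 hr (C := A * C) (by positivity) hu0 (fun n => by
    rw [hu1, mul_div_right_comm]; have := hA n; gcongr)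
  exact ⟨C', hC'0, fun n z hz => (hu n z hz).trans (hC' n)⟩

lemma differentiable_rem {n : ℕ} (hm : m ≤ n) (hn : 0 < n) : Differentiable ℂ (S.rem Φ n) := by
  have h : S.rem Φ n = fun z => (pdef Φ n).eval z - ∑ k, S.gam Φ n k * cdk S.meas Φ n z (S.a k) := by
    ext z; rw [S.pdef_eval_eq H hm hn z]; ring
  rw [h]
  have : ∀ k, Differentiable ℂ fun z => cdk S.meas Φ n z (S.a k) := fun k => by
    unfold cdk; fun_prop
  fun_prop

lemma exists_rem_disk_le {r : ℝ} (hr0 : 0 < r) (hr : r < 1) (hrR : 1 / r < S.R) : ∃ C : ℝ, 0 ≤ C ∧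
    ∀ (n : ℕ) (B φ ψ : ℝ), m ≤ n → 0 < n → MomLE S.meas Φ n B →
      (∀ z : ℂ, ‖z‖ ≤ r → ‖(Φ n).eval z‖ ≤ φ) → (∀ z : ℂ, ‖z‖ ≤ r → ‖(rev Φ n).eval z‖ ≤ ψ) →
      ∀ z : ℂ, ‖z‖ ≤ r → ‖S.rem Φ n z‖ ≤ C * (φ + B * ψ) := by
  have h1r : 1 ≤ 1 / r := (one_le_div hr0).2 hr.le
  obtain ⟨C, hC, h⟩ := S.exists_rem_le H h1r hrR
  have hcont : ContinuousOn (fun z => z * deriv S.ell z) (closedBall 0 (1 / r)) :=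
    continuousOn_id.mul (S.continuousOn_deriv_ell.mono (closedBall_subset_ball hrR))
  obtain ⟨V, hV⟩ := (isCompact_closedBall (0 : ℂ) (1 / r)).exists_bound_of_continuousOn hcont
  have hV0 : 0 ≤ V := (norm_nonneg _).trans (hV 0 (by simp [hr0.le]))
  refine ⟨V + 2 * C, by positivity, fun n B φ ψ hm hn hB hφ hψ z hz => ?_⟩
  have hφ0 : 0 ≤ φ := (norm_nonneg _).trans (hφ 0 (by simpa using hr0.le))
  have hψ0 : 0 ≤ ψ := (norm_nonneg _).trans (hψ 0 (by simpa using hr0.le))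
  have hB0 := hB.1
  refine Complex.norm_le_of_forall_mem_frontier_norm_le (isBounded_ball (x := (0 : ℂ)) (r := r))
    (S.differentiable_rem H hm hn).diffContOnCl (fun w hw => ?_) (by
      rw [closure_ball _ hr0.ne']; simpa using hz)
  rw [frontier_ball _ hr0.ne', mem_sphere_zero_iff_norm] at hw
  have hw0 : w ≠ 0 := by rw [← norm_pos_iff, hw]; exact hr0
  have h2 := h n B hB w hw0 (by rw [hw]; linarith) (by rw [norm_inv, hw, one_div])
  have h3 := hV (conj w)⁻¹ (by simp [hw])
  have h4 : ‖(Φ n).eval w * conj ((conj w)⁻¹ * deriv S.ell (conj w)⁻¹)‖ ≤ φ * V := by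
    rw [norm_mul, Complex.norm_conj]
    exact mul_le_mul (hφ w hw.le) h3 (norm_nonneg _) hφ0
  have h5 : ‖(Φ n).eval w‖ ≤ ψ := (H.norm_le_norm_rev n (by rw [hw]; exact hr.le)).trans (hψ w hw.le)
  have h6 : C * B * (‖(rev Φ n).eval w‖ + ‖(Φ n).eval w‖) ≤ C * B * (ψ + ψ) := by
    gcongr; exact hψ w hw.le
  have h7 := norm_le_norm_add_norm_sub' (S.rem Φ n w) ((Φ n).eval w * conj ((conj w)⁻¹ * deriv S.ell (conj w)⁻¹))
  have : 0 ≤ V * (B * ψ) := by positivity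
  have : 0 ≤ C * φ := by positivity
  nlinarith
end SData

end OPUC

namespace OPUC

open scoped ComplexConjugate Topology NNReal ENNReal

namespace SData

variable {m : ℕ} (S : SData m)

lemma one_sub_ne {z : ℂ} (hz : ‖z‖ < 1) (k : Fin m) : 1 - conj (S.a k) * z ≠ 0 := by
  rw [← norm_pos_iff, norm_one_sub_conj (S.norm_a k), norm_pos_iff, sub_ne_zero]
  exact S.ne_a hz k

lemma norm_kernel_le {r : ℝ} (hr : r < 1) {z : ℂ} (hz : ‖z‖ ≤ r) (k : Fin m) :
    ‖conj (S.a k) * z / (1 - conj (S.a k) * z)‖ ≤ 1 / (1 - r) := by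
  rw [norm_div, norm_one_sub_conj (S.norm_a k), norm_mul, Complex.norm_conj, S.norm_a, one_mul]
  have h1 := norm_sub_norm_le (S.a k) z
  rw [S.norm_a, norm_sub_rev] at h1
  exact div_le_div₀ zero_le_one (hz.trans hr.le) (by linarith) (by linarith)

lemma exists_radius : ∃ r : ℝ, 0 < r ∧ r < 1 ∧ 1 / r < S.R := by
  have h := S.one_lt_R
  refine ⟨2 / (1 + S.R), by positivity, by rw [div_lt_one (by linarith)]; linarith, ?_⟩
  rw [one_div_div]; linarith

lemma exists_norm_deriv_ell_le {r : ℝ} (hr : r < S.R) : ∃ V : ℝ, 0 ≤ V ∧ ∀ z : ℂ, ‖z‖ ≤ r →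
    ‖z * deriv S.ell z‖ ≤ V := by
  have hcont : ContinuousOn (fun z => z * deriv S.ell z) (closedBall 0 r) :=
    continuousOn_id.mul (S.continuousOn_deriv_ell.mono (closedBall_subset_ball hr))
  obtain ⟨V, hV⟩ := (isCompact_closedBall (0 : ℂ) r).exists_bound_of_continuousOn hcont
  exact ⟨max V 0, le_max_right _ _, fun z hz => (hV z (by simpa using hz)).trans (le_max_left _ _)⟩

variable {Φ : ℕ → ℂ[X]} (H : OPS S.meas Φ)

include H

lemma eval_derivative_rev_le {r : ℝ} (hr : r < 1) : ∃ C : ℝ, 0 ≤ C ∧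
    ∀ n, ∀ z : ℂ, ‖z‖ ≤ r → ‖(derivative (rev Φ n)).eval z‖ ≤ C := by
  obtain ⟨C, hC0, hC⟩ := S.exists_norm_rev_le H (r := (1 + r) / 2) (by linarith)
  refine ⟨C / ((1 + r) / 2 - r), div_nonneg hC0.le (by linarith), fun n z hz => ?_⟩
  rw [← Polynomial.deriv]
  exact norm_deriv_le_of_disk (by linarith) (rev Φ n).differentiable.differentiableOn (hC n) hz

lemma exists_g_le : ∃ C : ℝ, 0 ≤ C ∧ ∀ᶠ n in atTop, ∀ k, ‖S.g Φ n k‖ ≤ C := by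
  obtain ⟨r, hr0, hr, hrR⟩ := S.exists_radius
  have h1r : 1 ≤ 1 / r := (one_le_div hr0).2 hr.le
  obtain ⟨Ci, hCi, hintg⟩ := S.exists_interp hr0 hr
  obtain ⟨Cr, hCr, hrem⟩ := S.exists_remr_le H h1r hrR
  obtain ⟨V, hV0, hV⟩ := S.exists_norm_deriv_ell_le (r := r) (by linarith)
  obtain ⟨P, hP0, hP⟩ := S.exists_norm_rev_inv_le H hr
  obtain ⟨Q, hQ0, hQ⟩ := S.eval_derivative_rev_le H hr
  obtain ⟨u, hu, hφ⟩ := S.exists_norm_eval_tendsto H hr0.le hr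
  set B := nsq S.meas Φ 0 with hB
  have hB0 : 0 < B := H.nsq_pos 0
  set C1 := r * Q * P + (V + Cr * B * 2) with hC1
  have hC10 : 0 ≤ C1 := by positivity
  have h1r' : 0 < 1 - r := by linarith
  have hsm : Tendsto (fun n => m * Ci * (u n * P * (1 / (1 - r)))) atTop (𝓝 0) := by
    have := (((hu.mul_const P).mul_const (1 / (1 - r))).const_mul (m * Ci))
    simpa using this
  refine ⟨2 * (m * Ci * C1), by positivity, ?_⟩
  filter_upwards [hP, hsm.eventually_lt_const (show (0 : ℝ) < 1 / 2 by norm_num),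
    eventually_ge_atTop (max m 1)] with n hPn hsmn hn k
  have hm : m ≤ n := (le_max_left _ _).trans hn
  have hn0 : 0 < n := (le_max_right _ _).trans hn
  have hu0 : 0 ≤ u n := (norm_nonneg _).trans (hφ n 0 (by simpa using hr0.le))
  set G := ∑ k, ‖S.g Φ n k‖ with hG
  have hG0 : 0 ≤ G := Finset.sum_nonneg fun _ _ => norm_nonneg _
  have key : ∀ ζ : ℂ, ‖ζ‖ = r →
      ‖∑ k, conj (S.g Φ n k) * (conj (S.a k) * ζ / (1 - conj (S.a k) * ζ))‖ ≤
      C1 + G * (u n * P * (1 / (1 - r))) := by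
    intro ζ hζ
    have hζ0 : ζ ≠ 0 := by rw [← norm_pos_iff, hζ]; exact hr0
    have hΨ := H.rev_ne_zero n (z := ζ) (by rw [hζ]; exact hr.le)
    have h1 := S.ode_rev H hm hn0 hζ0 (S.one_sub_ne (by rw [hζ]; exact hr))
    set w : Fin m → ℂ := fun k => conj (S.a k) * ζ / (1 - conj (S.a k) * ζ) with hw
    have h2 : ∑ k, conj (S.g Φ n k) * w k =
        (ζ * (derivative (rev Φ n)).eval ζ + S.remr Φ n ζ) * ((rev Φ n).eval ζ)⁻¹
        + ∑ k, conj (S.g Φ n k) * (conj (S.tau Φ n k) * (Φ n).eval ζ * ((rev Φ n).eval ζ)⁻¹ * w k) := by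
      rw [h1, neg_add_cancel_comm, Finset.sum_mul, ← Finset.sum_add_distrib]
      refine Finset.sum_congr rfl fun k _ => ?_
      have e1 : ((rev Φ n).eval ζ) * ((rev Φ n).eval ζ)⁻¹ = 1 := mul_inv_cancel₀ hΨ
      linear_combination (-conj (S.g Φ n k) * w k) * e1
    rw [h2]
    refine (norm_add_le _ _).trans (add_le_add ?_ ?_)
    · rw [add_mul]
      refine (norm_add_le _ _).trans (add_le_add ?_ ?_)
      · rw [norm_mul, norm_mul, hζ]
        have := hQ n ζ hζ.le
        have := hPn ζ hζ.le
        gcongr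
      · have h3 := hrem n B (H.momLE_nsq n) ζ hζ0 (by rw [hζ]; linarith) (by rw [norm_inv, hζ, one_div])
        have h4 : ‖(Φ n).eval ζ‖ ≤ ‖(rev Φ n).eval ζ‖ := H.norm_le_norm_rev n (by rw [hζ]; exact hr.le)
        rw [norm_mul, norm_inv]
        have h5 : 0 < ‖(rev Φ n).eval ζ‖ := norm_pos_iff.2 hΨ
        rw [← div_eq_mul_inv, div_le_iff₀ h5]
        have h6 := norm_le_norm_add_norm_sub' (S.remr Φ n ζ) ((rev Φ n).eval ζ * (ζ * deriv S.ell ζ))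
        rw [norm_mul] at h6
        have h7 : ‖(rev Φ n).eval ζ‖ * ‖ζ * deriv S.ell ζ‖ ≤ ‖(rev Φ n).eval ζ‖ * V := by
          gcongr; exact hV ζ hζ.le
        have h8 : Cr * B * (‖(Φ n).eval ζ‖ + ‖(rev Φ n).eval ζ‖) ≤
          Cr * B * (‖(rev Φ n).eval ζ‖ + ‖(rev Φ n).eval ζ‖) := by gcongr
        linarith
    · refine (norm_sum_le _ _).trans ?_
      rw [hG, Finset.sum_mul]
      refine Finset.sum_le_sum fun k _ => ?_
      simp only [norm_mul, Complex.norm_conj, S.norm_tau H, one_mul]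
      have := S.norm_kernel_le hr hζ.le k
      have := hφ n ζ hζ.le
      have := hPn ζ hζ.le
      gcongr
  have h3 (k) : ‖S.g Φ n k‖ ≤ Ci * (C1 + G * (u n * P * (1 / (1 - r)))) := by
    simpa using hintg _ _ key k
  have h4 : G ≤ m * (Ci * (C1 + G * (u n * P * (1 / (1 - r))))) := by
    refine (Finset.sum_le_sum fun k _ => h3 k).trans ?_
    simp
  have h5 : m * (Ci * (C1 + G * (u n * P * (1 / (1 - r))))) =
    m * Ci * C1 + G * (m * Ci * (u n * P * (1 / (1 - r)))) := by ring
  have h6 : G ≤ 2 * (m * Ci * C1) := by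
    rw [h5] at h4
    nlinarith
  exact (Finset.single_le_sum (f := fun k => ‖S.g Φ n k‖) (fun _ _ => norm_nonneg _)
    (Finset.mem_univ k)).trans h6

lemma exists_verb_le : ∃ A : ℝ, 0 ≤ A ∧ ∀ k : ℕ, ‖verb Φ k‖ ≤ A / (k + 1) := by
  obtain ⟨r, hr0, hr, hrR⟩ := S.exists_radius
  obtain ⟨C, hC, hrem⟩ := S.exists_rem_disk_le H hr0 hr hrR
  obtain ⟨P, hP0, hP⟩ := S.exists_norm_rev_le H hr
  obtain ⟨G, hG0, hG⟩ := S.exists_g_le H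
  have hB0 : 0 < nsq S.meas Φ 0 := H.nsq_pos 0
  set A1 := C * (P + nsq S.meas Φ 0 * P) + m * (G * 2) with hA1
  have hA10 : 0 ≤ A1 := by positivity
  obtain ⟨N, hN⟩ := eventually_atTop.1 hG
  have h1 : ∀ n : ℕ, max N (max m 1) ≤ n → n * ‖(Φ n).eval 0‖ ≤ A1 := by
    intro n hn
    have hm : m ≤ n := by omega
    have hn0 : 0 < n := by omega
    have ho := S.ode H hm hn0 0 (fun k => by simp)
    simp only [zero_mul, zero_sub, mul_zero, sub_zero, div_one, H.rev_eval_zero, mul_one] at ho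
    have hφ0 : ‖(Φ n).eval 0‖ ≤ 1 := by
      have := H.norm_le_norm_rev n (z := 0) (by simp)
      rwa [H.rev_eval_zero, norm_one] at this
    have h2 := hrem n _ P P hm hn0 (H.momLE_nsq n)
      (fun z hz => (H.norm_le_norm_rev n (hz.trans hr.le)).trans (hP n z hz)) (hP n) 0 (by simpa using hr0.le)
    have h3 : ‖∑ k, S.g Φ n k * (S.tau Φ n k - (Φ n).eval 0)‖ ≤ m * (G * 2) := by
      refine (norm_sum_le _ _).trans ((Finset.sum_le_sum (g := fun _ => G * 2) fun k _ => ?_).trans (by simp))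
      rw [norm_mul]
      have h4 := hN n (by omega) k
      have h5 : ‖S.tau Φ n k - (Φ n).eval 0‖ ≤ 2 := (norm_sub_le _ _).trans (by
        rw [S.norm_tau H]; linarith)
      gcongr
    calc (n : ℝ) * ‖(Φ n).eval 0‖ = ‖-((n : ℂ) * (Φ n).eval 0)‖ := by simp
      _ = _ := by rw [ho]
      _ ≤ _ := norm_sub_le _ _
      _ ≤ _ := add_le_add h2 h3
  refine ⟨max A1 (max N (max m 1) + 1 : ℕ), hA10.trans (le_max_left _ _), fun k => ?_⟩
  rw [le_div_iff₀ (by positivity)]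
  rcases le_total (max N (max m 1)) k with h | h
  · refine le_trans ?_ (le_max_left _ _)
    have h2 := h1 (k + 1) (by omega)
    rw [verb, norm_neg, Complex.norm_conj, mul_comm]
    exact_mod_cast h2
  · refine le_trans ?_ (le_max_right _ _)
    have h2 := (H.norm_verb_lt k).le
    have h3 : ((k : ℝ) + 1) ≤ ((max N (max m 1) + 1 : ℕ) : ℝ) := by exact_mod_cast by omega
    nlinarith [norm_nonneg (verb Φ k)]

lemma exists_momLE : ∃ C : ℝ, 0 ≤ C ∧ ∀ n : ℕ, 0 < n → MomLE S.meas Φ n (C / n) := by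
  obtain ⟨A, hA0, hA⟩ := S.exists_verb_le H
  obtain ⟨C, hC, h⟩ := H.exists_mom_le hA
  exact ⟨C, hC, fun n hn => ⟨by positivity, fun i => (h n hn i).1, fun i hi => (h n hn i).2 hi⟩⟩

/-- The orthogonal polynomials are `O(1/n)` inside the disk. -/
lemma exists_norm_eval_le_div {r : ℝ} (hr0 : 0 ≤ r) (hr : r < 1) :
    ∃ C : ℝ, 0 ≤ C ∧ ∀ n : ℕ, ∀ z : ℂ, ‖z‖ ≤ r → ‖(Φ n).eval z‖ ≤ C / (n + 1) := by
  obtain ⟨A, _, hA⟩ := S.exists_verb_le H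
  exact S.exists_norm_eval_le H hA hr0 hr

lemma tendsto_rev {z : ℂ} (hz : ‖z‖ < 1) : Tendsto (fun n => (rev Φ n).eval z) atTop (𝓝 (S.lim z)) := by
  obtain ⟨δ, hδ, h⟩ := S.exists_norm_rev_mul_D_sub_le H
  have h1 : Tendsto (fun n => (rev Φ n).eval z * S.D z) atTop (𝓝 S.D0) := by
    rw [tendsto_iff_norm_sub_tendsto_zero]
    refine squeeze_zero (fun n => norm_nonneg ((rev Φ n).eval z * S.D z - S.D0)) (fun n => h n z hz) ?_
    simpa using hδ.div_const (1 - ‖z‖)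
  refine (h1.div_const (S.D z)).congr fun n => ?_
  rw [mul_div_cancel_right₀ _ (S.D_ne_zero z)]

/-- The reversed polynomials converge at rate `1/n` inside the disk. -/
lemma exists_norm_rev_sub_lim_le {r : ℝ} (hr0 : 0 ≤ r) (hr : r < 1) :
    ∃ C : ℝ, 0 ≤ C ∧ ∀ n : ℕ, ∀ z : ℂ, ‖z‖ ≤ r → ‖(rev Φ n).eval z - S.lim z‖ ≤ C / (n + 1) := by
  obtain ⟨A, hA0, hA⟩ := S.exists_verb_le H
  obtain ⟨C, hC0, hC⟩ := S.exists_norm_eval_le_div H hr0 hr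
  have hstep (n : ℕ) (z : ℂ) (hz : ‖z‖ ≤ r) :
      ‖(rev Φ (n + 1)).eval z - (rev Φ n).eval z‖ ≤ 2 * (A * C) * (1 / (n + 1) - 1 / ((n + 1 : ℕ) + 1)) := by
    rw [H.rev_succ]
    simp only [eval_sub, eval_mul, eval_X, eval_C, sub_sub_cancel_left, norm_neg, norm_mul]
    have h1 : ‖verb Φ n‖ * (‖z‖ * ‖(Φ n).eval z‖) ≤ A / (n + 1) * (1 * (C / (n + 1))) := by
      have := hA n
      have := hC n z hz
      have := hz.trans hr.le
      gcongr
    refine h1.trans ?_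
    have e : A / ((n : ℝ) + 1) * (1 * (C / (n + 1))) = A * C * (1 / ((n : ℝ) + 1) ^ 2) := by
      field_simp
    rw [e, mul_comm 2 (A * C), mul_assoc (A * C)]
    refine mul_le_mul_of_nonneg_left ?_ (by positivity : (0 : ℝ) ≤ A * C)
    push_cast
    rw [div_sub_div _ _ (by positivity) (by positivity), mul_div_assoc', div_le_div_iff₀ (by positivity) (by positivity)]
    have : (0 : ℝ) ≤ n := Nat.cast_nonneg n
    nlinarith
  refine ⟨2 * (A * C), by positivity, fun n z hz => ?_⟩
  have hsum (k : ℕ) : ‖(rev Φ n).eval z - (rev Φ (n + k)).eval z‖ ≤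
      2 * (A * C) * (1 / (n + 1) - 1 / ((n + k : ℕ) + 1)) := by
    induction k with
    | zero => simp
    | succ k ih =>
      have h1 := hstep (n + k) z hz
      have h2 := norm_sub_le_norm_sub_add_norm_sub ((rev Φ n).eval z) ((rev Φ (n + k)).eval z)
        ((rev Φ (n + (k + 1))).eval z)
      rw [norm_sub_rev ((rev Φ (n + k)).eval z)] at h2
      rw [← add_assoc] at h2 ⊢
      linarith
  have ht : Tendsto (fun k => ‖(rev Φ n).eval z - (rev Φ (n + k)).eval z‖) atTop
      (𝓝 ‖(rev Φ n).eval z - S.lim z‖) :=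
    (tendsto_const_nhds.sub ((S.tendsto_rev H (hz.trans_lt hr)).comp
      (tendsto_atTop_mono (fun k => Nat.le_add_left k n) tendsto_id))).norm
  refine le_of_tendsto' ht fun k => (hsum k).trans ?_
  have : (0 : ℝ) ≤ 1 / (((n + k : ℕ) : ℝ) + 1) := by positivity
  calc _ ≤ 2 * (A * C) * (1 / ((n : ℝ) + 1)) := by gcongr; linarith
    _ = _ := by ring

lemma exists_norm_derivative_rev_sub_le {r : ℝ} (hr0 : 0 ≤ r) (hr : r < 1) :
    ∃ C : ℝ, 0 ≤ C ∧ ∀ n : ℕ, ∀ z : ℂ, ‖z‖ ≤ r →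
      ‖(derivative (rev Φ n)).eval z - deriv S.lim z‖ ≤ C / (n + 1) := by
  obtain ⟨C, hC0, hC⟩ := S.exists_norm_rev_sub_lim_le H (r := (1 + r) / 2) (by linarith) (by linarith)
  refine ⟨C / ((1 + r) / 2 - r), div_nonneg hC0 (by linarith), fun n z hz => ?_⟩
  have hd : DifferentiableAt ℂ S.lim z := S.lim_differentiableOn.differentiableAt
    (isOpen_ball.mem_nhds (by simpa using hz.trans_lt hr))
  rw [← Polynomial.deriv, ← deriv_fun_sub (rev Φ n).differentiableAt hd]
  refine (norm_deriv_le_of_disk (r' := (1 + r) / 2) (by linarith) ?_ (hC n) hz).trans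
    (le_of_eq (by ring))
  exact (rev Φ n).differentiable.differentiableOn.sub (S.lim_differentiableOn.mono
    (closedBall_subset_ball (by linarith)))

/-- The coefficients in the differential equation converge at rate `1/n`. -/
lemma exists_g_sub_le : ∃ C : ℝ, 0 ≤ C ∧ ∀ᶠ n : ℕ in atTop, ∀ k, ‖S.g Φ n k - S.β k‖ ≤ C / n := by
  obtain ⟨r, hr0, hr, hrR⟩ := S.exists_radius
  have h1r : 1 ≤ 1 / r := (one_le_div hr0).2 hr.le
  have h1r' : 0 < 1 - r := by linarith
  obtain ⟨Ci, hCi, hintg⟩ := S.exists_interp hr0 hr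
  obtain ⟨Cr, hCr, hrem⟩ := S.exists_remr_le H h1r hrR
  obtain ⟨V, hV0, hV⟩ := S.exists_norm_deriv_ell_le (r := r) (by linarith)
  obtain ⟨P, hP0, hP⟩ := S.exists_norm_rev_le H hr
  obtain ⟨G, hG0, hG⟩ := S.exists_g_le H
  obtain ⟨Cm, hCm, hmom⟩ := S.exists_momLE H
  obtain ⟨C1, hC1, h1⟩ := S.exists_norm_derivative_rev_sub_le H hr0.le hr
  obtain ⟨C2, hC2, h2⟩ := S.exists_norm_rev_sub_lim_le H hr0.le hr
  obtain ⟨C3, hC3, h3⟩ := S.exists_norm_eval_le_div H hr0.le hr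
  obtain ⟨Dc, hDc, hD⟩ := S.exists_D_bounds hr
  have hD0 := S.D0_pos
  set K := 1 / (1 - r) with hK
  have hK0 : 0 < K := by positivity
  set X := r * C1 + Cr * Cm * (2 * P) + C2 * V + m * (G * K * C3) + m * (G * K * C2) with hX
  have hX0 : 0 ≤ X := by positivity
  refine ⟨Ci * (X * (Dc / S.D0)), by positivity, ?_⟩
  filter_upwards [hG, eventually_ge_atTop (max m 1)] with n hGn hn k
  have hm : m ≤ n := (le_max_left _ _).trans hn
  have hn0 : 0 < n := (le_max_right _ _).trans hn
  have hn0' : (0 : ℝ) < n := by exact_mod_cast hn0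
  have hdiv {c : ℝ} (hc : 0 ≤ c) : c / (n + 1) ≤ c / n := by gcongr; linarith
  have key : ∀ ζ : ℂ, ‖ζ‖ = r →
      ‖∑ k, (conj (S.g Φ n k) - S.β k) * (conj (S.a k) * ζ / (1 - conj (S.a k) * ζ))‖ ≤
      X * (Dc / S.D0) / n := by
    intro ζ hζ
    have hζ0 : ζ ≠ 0 := by rw [← norm_pos_iff, hζ]; exact hr0
    have hζ1 : ‖ζ‖ < 1 := by rw [hζ]; exact hr
    have e1 := S.ode_rev H hm hn0 hζ0 (S.one_sub_ne hζ1)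
    have e2 := S.mul_deriv_lim hζ1
    set w : Fin m → ℂ := fun k => conj (S.a k) * ζ / (1 - conj (S.a k) * ζ) with hw
    have hwK (k) : ‖w k‖ ≤ K := S.norm_kernel_le hr hζ.le k
    have e3 : S.lim ζ * ∑ k, (conj (S.g Φ n k) - S.β k) * w k =
        ζ * ((derivative (rev Φ n)).eval ζ - deriv S.lim ζ)
        + (S.remr Φ n ζ - (rev Φ n).eval ζ * (ζ * deriv S.ell ζ))
        + ((rev Φ n).eval ζ - S.lim ζ) * (ζ * deriv S.ell ζ)
        + ∑ k, conj (S.g Φ n k) * w k * (conj (S.tau Φ n k) * (Φ n).eval ζ)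
        - ∑ k, conj (S.g Φ n k) * w k * ((rev Φ n).eval ζ - S.lim ζ) := by
      have f1 : ∑ k, (conj (S.g Φ n k) - S.β k) * w k =
        ∑ k, conj (S.g Φ n k) * w k - ∑ k, S.β k * w k := by
        rw [← Finset.sum_sub_distrib]; exact Finset.sum_congr rfl fun k _ => by ring
      have f2 : ∑ k, conj (S.g Φ n k) * w k * ((rev Φ n).eval ζ - conj (S.tau Φ n k) * (Φ n).eval ζ) =
        (∑ k, conj (S.g Φ n k) * w k) * (rev Φ n).eval ζ
        - ∑ k, conj (S.g Φ n k) * w k * (conj (S.tau Φ n k) * (Φ n).eval ζ) := by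
        rw [Finset.sum_mul, ← Finset.sum_sub_distrib]
        exact Finset.sum_congr rfl fun k _ => by ring
      rw [f2] at e1
      rw [f1, ← Finset.sum_mul]
      linear_combination e2 - e1
    have b1 : ‖ζ * ((derivative (rev Φ n)).eval ζ - deriv S.lim ζ)‖ ≤ r * C1 / n := by
      rw [norm_mul, hζ, mul_div_assoc]
      have := (h1 n ζ hζ.le).trans (hdiv hC1)
      gcongr
    have b2 : ‖S.remr Φ n ζ - (rev Φ n).eval ζ * (ζ * deriv S.ell ζ)‖ ≤ Cr * Cm * (2 * P) / n := by
      refine (hrem n _ (hmom n hn0) ζ hζ0 (by rw [hζ]; linarith) (by rw [norm_inv, hζ, one_div])).trans ?_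
      have p1 := hP n ζ hζ.le
      have p2 := (H.norm_le_norm_rev n hζ1.le).trans p1
      calc _ ≤ Cr * (Cm / n) * (P + P) := by gcongr
        _ = _ := by ring
    have b0 := (h2 n ζ hζ.le).trans (hdiv hC2)
    have b3 : ‖((rev Φ n).eval ζ - S.lim ζ) * (ζ * deriv S.ell ζ)‖ ≤ C2 * V / n := by
      rw [norm_mul]
      calc _ ≤ C2 / n * V := by gcongr; exact hV ζ hζ.le
        _ = _ := by ring
    have b4 : ‖∑ k, conj (S.g Φ n k) * w k * (conj (S.tau Φ n k) * (Φ n).eval ζ)‖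
        ≤ m * (G * K * C3) / n := by
      refine (norm_sum_le _ _).trans ((Finset.sum_le_sum (g := fun _ => G * K * (C3 / n)) fun k _ => ?_).trans
        (le_of_eq (by simp; ring)))
      simp only [norm_mul, Complex.norm_conj, S.norm_tau H, one_mul]
      have := hGn k
      have := hwK k
      have := (h3 n ζ hζ.le).trans (hdiv hC3)
      gcongr
    have b5 : ‖∑ k, conj (S.g Φ n k) * w k * ((rev Φ n).eval ζ - S.lim ζ)‖
        ≤ m * (G * K * C2) / n := by
      refine (norm_sum_le _ _).trans ((Finset.sum_le_sum (g := fun _ => G * K * (C2 / n)) fun k _ => ?_).trans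
        (le_of_eq (by simp; ring)))
      simp only [norm_mul, Complex.norm_conj]
      have := hGn k
      have := hwK k
      gcongr
    have b6 : ‖S.lim ζ * ∑ k, (conj (S.g Φ n k) - S.β k) * w k‖ ≤ X / n := by
      rw [e3]
      refine (norm_sub_le _ _).trans ?_
      have q1 := norm_add₃_le (a := ζ * ((derivative (rev Φ n)).eval ζ - deriv S.lim ζ))
        (b := S.remr Φ n ζ - (rev Φ n).eval ζ * (ζ * deriv S.ell ζ))
        (c := ((rev Φ n).eval ζ - S.lim ζ) * (ζ * deriv S.ell ζ))
      have q2 := norm_add_le (ζ * ((derivative (rev Φ n)).eval ζ - deriv S.lim ζ)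
        + (S.remr Φ n ζ - (rev Φ n).eval ζ * (ζ * deriv S.ell ζ))
        + ((rev Φ n).eval ζ - S.lim ζ) * (ζ * deriv S.ell ζ))
        (∑ k, conj (S.g Φ n k) * w k * (conj (S.tau Φ n k) * (Φ n).eval ζ))
      have q3 : X / n = r * C1 / n + Cr * Cm * (2 * P) / n + C2 * V / n + m * (G * K * C3) / n
        + m * (G * K * C2) / n := by rw [hX]; ring
      linarith
    have e4 : ∑ k, (conj (S.g Φ n k) - S.β k) * w k =
        (S.lim ζ * ∑ k, (conj (S.g Φ n k) - S.β k) * w k) * (S.D ζ / S.D0) := by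
      have := S.D_ne_zero ζ
      have : (S.D0 : ℂ) ≠ 0 := Complex.ofReal_ne_zero.2 hD0.ne'
      rw [lim]; field_simp
    rw [e4, norm_mul, norm_div, Complex.norm_of_nonneg hD0.le]
    calc _ ≤ X / n * (Dc / S.D0) := by gcongr; exact (hD ζ hζ.le).1
      _ = _ := by ring
  have h4 := hintg _ _ key k
  have h5 : conj (S.g Φ n k) - S.β k = conj (S.g Φ n k - S.β k) := by simp
  rw [h5, Complex.norm_conj] at h4
  rwa [mul_div_assoc]

end SData

end OPUC

namespace OPUC

open scoped ComplexConjugate Topology NNReal ENNReal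
open Asymptotics

/-- The sequence `1 / (n + 1)`. -/
noncomputable def q (n : ℕ) : ℝ := ((n : ℝ) + 1)⁻¹

lemma q_pos (n : ℕ) : 0 < q n := by unfold q; positivity

lemma q_le_one (n : ℕ) : q n ≤ 1 := by
  unfold q; exact inv_le_one_of_one_le₀ (by linarith [Nat.cast_nonneg (α := ℝ) n])

lemma q_sq_le (n : ℕ) : q n ^ 2 ≤ 2 * (q n - q (n + 1)) := by
  unfold q
  have : (0 : ℝ) ≤ n := Nat.cast_nonneg n
  push_cast
  rw [inv_sub_inv (by positivity) (by positivity), inv_pow, mul_div_assoc', inv_eq_one_div,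
    div_le_div_iff₀ (by positivity) (by positivity)]
  nlinarith

lemma tendsto_q : Tendsto q atTop (𝓝 0) := by
  have := tendsto_one_div_add_atTop_nhds_zero_nat (𝕜 := ℝ)
  exact this.congr fun n => by simp [q]

lemma q_succ_isBigO : (fun n => q (n + 1)) =O[atTop] q := by
  refine .of_norm_le fun n => ?_
  rw [Real.norm_of_nonneg (q_pos _).le]
  unfold q
  gcongr
  simp

lemma q_isBigO_one : q =O[atTop] fun _ => (1 : ℝ) := by
  refine .of_norm_le fun n => ?_
  rw [Real.norm_of_nonneg (q_pos _).le]
  exact q_le_one n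

lemma isBigO_q_of_le {f : ℕ → ℂ} {C : ℝ} (h : ∀ᶠ n : ℕ in atTop, ‖f n‖ ≤ C / n) : f =O[atTop] q := by
  refine IsBigO.of_bound (2 * |C|) ?_
  filter_upwards [h, eventually_ge_atTop 1] with n hn h1
  have h1' : (1 : ℝ) ≤ n := by exact_mod_cast h1
  refine hn.trans ?_
  rw [Real.norm_of_nonneg (q_pos _).le, q, ← div_eq_mul_inv]
  calc C / n ≤ |C| / n := by gcongr; exact le_abs_self C
    _ ≤ _ := by
      rw [div_le_div_iff₀ (by positivity) (by positivity)]
      nlinarith [abs_nonneg C]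

lemma _root_.Asymptotics.IsBigO.conj {f : ℕ → ℂ} {g : ℕ → ℝ} (h : f =O[atTop] g) :
    (fun n => conj (f n)) =O[atTop] g :=
  (h.norm_left.congr_left fun n => by simp).of_norm_left

/-- Sequences which are, up to `O(1/n²)`, differences of a sequence of size `O(1/n)`. -/
def Good (d : ℕ → ℂ) : Prop :=
  ∃ c : ℕ → ℂ, c =O[atTop] q ∧ (fun n => d n - (c (n + 1) - c n)) =O[atTop] fun n => q n ^ 2

lemma Good.add {d d' : ℕ → ℂ} (h : Good d) (h' : Good d') : Good fun n => d n + d' n := by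
  obtain ⟨c, h1, h2⟩ := h
  obtain ⟨c', h1', h2'⟩ := h'
  exact ⟨fun n => c n + c' n, h1.add h1', (h2.add h2').congr_left fun n => by ring⟩

lemma good_of_isBigO {d : ℕ → ℂ} (h : d =O[atTop] fun n => q n ^ 2) : Good d :=
  ⟨fun _ => 0, isBigO_zero _ _, h.congr_left fun n => by ring⟩

lemma good_sum {ι : Type*} (s : Finset ι) {d : ι → ℕ → ℂ} (h : ∀ i ∈ s, Good (d i)) :
    Good fun n => ∑ i ∈ s, d i n := by
  classical
  induction s using Finset.induction_on with
  | empty => simpa using good_of_isBigO (isBigO_zero _ _)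
  | insert i s hi ih =>
    simp only [Finset.sum_insert hi]
    exact (h i (by simp)).add (ih fun j hj => h j (by simp [hj]))

lemma good_pow_mul {ω : ℂ} (hω : ‖ω‖ = 1) (hω1 : ω ≠ 1) {b : ℕ → ℂ} (hb : b =O[atTop] q)
    (hb' : (fun n => b (n + 1) - b n) =O[atTop] fun n => q n ^ 2) : Good fun n => ω ^ n * b n := by
  have h0 : ω - 1 ≠ 0 := sub_ne_zero.2 hω1
  have hp (j : ℕ) : (fun n => ω ^ (n + j) * (ω - 1)⁻¹) =O[atTop] fun _ => (1 : ℝ) := by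
    refine IsBigO.of_bound ‖(ω - 1)⁻¹‖ (Eventually.of_forall fun n => ?_)
    simp [hω]
  refine ⟨fun n => ω ^ n * (ω - 1)⁻¹ * b n, ?_, ?_⟩
  · simpa using (hp 0).mul hb
  · refine (((hp 1).mul hb').neg_left.congr_left fun n => ?_).trans (by simpa using isBigO_refl _ _)
    rw [pow_succ]
    field_simp
    ring

lemma Good.exists_limit {s : ℕ → ℂ} (h : Good fun n => s (n + 1) - s n) :
    ∃ l : ℂ, (fun n => s n - l) =O[atTop] q := by
  obtain ⟨c, h1, h2⟩ := h
  set s' : ℕ → ℂ := fun n => s n - c n with hs'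
  obtain ⟨C, hC, h3⟩ := h2.exists_pos
  obtain ⟨N, hN⟩ := eventually_atTop.1 h3.bound
  have hstep (n : ℕ) (hn : N ≤ n) : ‖s' (n + 1) - s' n‖ ≤ 2 * C * (q n - q (n + 1)) := by
    have h4 := hN n hn
    have e : s' (n + 1) - s' n = s (n + 1) - s n - (c (n + 1) - c n) := by rw [hs']; ring
    rw [e]
    refine h4.trans ?_
    rw [Real.norm_of_nonneg (by positivity)]
    calc _ ≤ C * (2 * (q n - q (n + 1))) := by gcongr; exact q_sq_le n
      _ = _ := by ring
  have hsum (n k : ℕ) (hn : N ≤ n) : ‖s' n - s' (n + k)‖ ≤ 2 * C * (q n - q (n + k)) := by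
    induction k with
    | zero => simp
    | succ k ih =>
      have h4 := hstep (n + k) (by omega)
      have h5 := norm_sub_le_norm_sub_add_norm_sub (s' n) (s' (n + k)) (s' (n + (k + 1)))
      rw [norm_sub_rev (s' (n + k))] at h5
      rw [← add_assoc] at h5 ⊢
      linarith
  have hsum' (n k : ℕ) (hn : N ≤ n) : ‖s' n - s' (n + k)‖ ≤ 2 * C * q n := by
    refine (hsum n k hn).trans ?_
    have := q_pos (n + k)
    gcongr
    linarith
  have hq : Tendsto (fun n => 2 * C * q (n + N)) atTop (𝓝 0) := by
    simpa using ((tendsto_q.comp (tendsto_add_atTop_nat N)).const_mul (2 * C))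
  obtain ⟨l, hl⟩ := cauchySeq_tendsto_of_complete (u := fun n => s' (n + N))
    (cauchySeq_of_le_tendsto_0' (fun n => 2 * C * q (n + N)) (fun n k hnk => by
      obtain ⟨j, rfl⟩ := Nat.exists_eq_add_of_le hnk
      rw [dist_eq_norm]
      have := hsum' (n + N) j (by omega)
      rwa [show n + j + N = n + N + j by ring]) hq)
  have hl' : Tendsto s' atTop (𝓝 l) := (tendsto_add_atTop_iff_nat N).1 hl
  have h6 : (fun n => s' n - l) =O[atTop] q := by
    refine IsBigO.of_bound (2 * C) ?_
    filter_upwards [eventually_ge_atTop N] with n hn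
    rw [Real.norm_of_nonneg (q_pos _).le]
    have ht : Tendsto (fun k => ‖s' n - s' (n + k)‖) atTop (𝓝 ‖s' n - l‖) :=
      (tendsto_const_nhds.sub (hl'.comp (tendsto_atTop_mono (fun k => Nat.le_add_left k n) tendsto_id))).norm
    exact le_of_tendsto' ht fun k => hsum' n k hn
  exact ⟨l, (h6.add h1).congr_left fun n => by rw [hs']; ring⟩

lemma q_succ_sub_isBigO : (fun n => ((q (n + 1) : ℝ) : ℂ) - q n) =O[atTop] fun n => q n ^ 2 := by
  refine .of_norm_le fun n => ?_
  rw [← Complex.ofReal_sub, Complex.norm_real, Real.norm_eq_abs]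
  have : (0 : ℝ) ≤ n := Nat.cast_nonneg n
  unfold q
  push_cast
  rw [inv_sub_inv (by positivity) (by positivity), abs_div, inv_pow, ← one_div,
    abs_of_nonneg (a := _ * _) (by positivity),
    show (n : ℝ) + 1 - (n + 1 + 1) = -1 by ring, abs_neg, abs_one]
  apply one_div_le_one_div_of_le (by positivity)
  nlinarith

lemma q_ofReal_isBigO : (fun n => ((q n : ℝ) : ℂ)) =O[atTop] q :=
  .of_norm_le fun n => by simp [abs_of_pos (q_pos n)]

lemma good_pow_mul_q {ω : ℂ} (hω : ‖ω‖ = 1) (hω1 : ω ≠ 1) (c : ℂ) {p : ℕ → ℂ}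
    (hp : p =O[atTop] fun _ => (1 : ℝ)) (hp' : (fun n => p (n + 1) - p n) =O[atTop] q) :
    Good fun n => ω ^ n * (c * (q n * p n)) := by
  refine good_pow_mul hω hω1 (by simpa using (q_ofReal_isBigO.mul hp).const_mul_left c) ?_
  have h1 := q_succ_sub_isBigO.mul (hp.comp_tendsto (tendsto_add_atTop_nat 1))
  have h2 := q_ofReal_isBigO.mul hp'
  simp only [Function.comp_def, mul_one, ← pow_two] at h1 h2
  exact ((h1.add h2).const_mul_left c).congr_left fun n => by ring

namespace SData

variable {m : ℕ} (S : SData m) {Φ : ℕ → ℂ[X]} (H : OPS S.meas Φ)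

/-- The unwound phase at a singular point. -/
noncomputable def ph (Φ : ℕ → ℂ[X]) (n : ℕ) (k : Fin m) : ℂ := S.tau Φ n k * conj (S.a k) ^ n

lemma tau_eq (n : ℕ) (k : Fin m) : S.tau Φ n k = S.ph Φ n k * S.a k ^ n := by
  rw [ph, mul_assoc, ← mul_pow, mul_comm (conj _), mul_conj_one (S.norm_a k), one_pow, mul_one]

include H

lemma norm_ph (n : ℕ) (k : Fin m) : ‖S.ph Φ n k‖ = 1 := by
  rw [ph, norm_mul, S.norm_tau H, norm_pow, Complex.norm_conj, S.norm_a, one_pow, one_mul]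

lemma ph_isBigO (k : Fin m) : (fun n => S.ph Φ n k) =O[atTop] fun _ => (1 : ℝ) :=
  .of_norm_le fun n => (S.norm_ph H n k).le

lemma tau_isBigO (k : Fin m) : (fun n => S.tau Φ n k) =O[atTop] fun _ => (1 : ℝ) :=
  .of_norm_le fun n => (S.norm_tau H n k).le

lemma verb_isBigO : (fun n => verb Φ n) =O[atTop] q := by
  obtain ⟨A, _, hA⟩ := S.exists_verb_le H
  exact IsBigO.of_bound A (Eventually.of_forall fun n => by
    rw [Real.norm_of_nonneg (q_pos _).le, q, ← div_eq_mul_inv]; exact hA n)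

lemma g_sub_isBigO (k : Fin m) : (fun n => S.g Φ n k - S.β k) =O[atTop] q := by
  obtain ⟨C, _, h⟩ := S.exists_g_sub_le H
  exact isBigO_q_of_le (h.mono fun n hn => hn k)

lemma eval_zero_isBigO : (fun n => (Φ n).eval 0) =O[atTop] q := by
  obtain ⟨C, _, h⟩ := S.exists_norm_eval_le_div H le_rfl zero_lt_one
  refine IsBigO.of_bound C (Eventually.of_forall fun n => ?_)
  rw [Real.norm_of_nonneg (q_pos _).le, q, ← div_eq_mul_inv]
  exact h n 0 (by simp)

/-- The remainder is `O(1/n)` inside the disk. -/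
lemma exists_rem_le_div {r : ℝ} (hr : r < 1) : ∃ C : ℝ, 0 ≤ C ∧
    ∀ᶠ n : ℕ in atTop, ∀ z : ℂ, ‖z‖ ≤ r → ‖S.rem Φ n z‖ ≤ C / n := by
  obtain ⟨r0, hr00, hr01, hr0R⟩ := S.exists_radius
  set r1 := max r r0 with hr1
  have h10 : 0 < r1 := hr00.trans_le (le_max_right _ _)
  have h11 : r1 < 1 := max_lt hr hr01
  have h1R : 1 / r1 < S.R := (one_div_le_one_div_of_le hr00 (le_max_right _ _)).trans_lt hr0R
  obtain ⟨C, hC, hrem⟩ := S.exists_rem_disk_le H h10 h11 h1R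
  obtain ⟨P, hP0, hP⟩ := S.exists_norm_rev_le H h11
  obtain ⟨Cm, hCm, hmom⟩ := S.exists_momLE H
  obtain ⟨C3, hC3, h3⟩ := S.exists_norm_eval_le_div H h10.le h11
  refine ⟨C * (C3 + Cm * P), by positivity, ?_⟩
  filter_upwards [eventually_ge_atTop (max m 1)] with n hn z hz
  have hm : m ≤ n := (le_max_left _ _).trans hn
  have hn0 : 0 < n := (le_max_right _ _).trans hn
  have hn0' : (0 : ℝ) < n := by exact_mod_cast hn0
  refine (hrem n _ (C3 / n) P hm hn0 (hmom n hn0) (fun z hz => (h3 n z hz).trans ?_) (hP n) z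
    (hz.trans (le_max_left _ _))).trans (le_of_eq ?_)
  · gcongr; linarith
  · ring

lemma tau_succ (n : ℕ) (k : Fin m) : S.tau Φ (n + 1) k * (1 - verb Φ n * (S.a k * S.tau Φ n k)) =
    S.a k * S.tau Φ n k * (1 - conj (verb Φ n * (S.a k * S.tau Φ n k))) := by
  have h1 : S.tau Φ n k * (rev Φ n).eval (S.a k) = (Φ n).eval (S.a k) :=
    div_mul_cancel₀ _ (H.rev_ne_zero n (S.norm_a k).le)
  have h2 : S.tau Φ (n + 1) k * (rev Φ (n + 1)).eval (S.a k) = (Φ (n + 1)).eval (S.a k) :=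
    div_mul_cancel₀ _ (H.rev_ne_zero (n + 1) (S.norm_a k).le)
  rw [H.succ_eq, H.rev_succ] at h2
  simp only [eval_sub, eval_mul, eval_X, eval_C] at h2
  rw [← h1] at h2
  have h3 := mul_conj_one (S.norm_a k)
  have h4 := mul_conj_one (S.norm_tau H n k)
  have h5 := H.rev_ne_zero n (S.norm_a k).le
  refine mul_right_cancel₀ h5 ?_
  simp only [map_mul]
  linear_combination h2 + conj (verb Φ n) * (rev Φ n).eval (S.a k) * (h3 * S.tau Φ n k * conj (S.tau Φ n k) + h4)

lemma ph_succ_sub (n : ℕ) (k : Fin m) : S.ph Φ (n + 1) k - S.ph Φ n k = S.ph Φ n k *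
    (verb Φ n * (S.a k * S.tau Φ n k) - conj (verb Φ n * (S.a k * S.tau Φ n k))) *
    (1 - verb Φ n * (S.a k * S.tau Φ n k))⁻¹ := by
  have h := S.tau_succ H n k
  have h3 := mul_conj_one (S.norm_a k)
  have hx : ‖verb Φ n * (S.a k * S.tau Φ n k)‖ < 1 := by
    simpa [S.norm_a, S.norm_tau H] using H.norm_verb_lt n
  set x := verb Φ n * (S.a k * S.tau Φ n k) with hxd
  have h1 : 1 - x ≠ 0 := by
    intro h0
    rw [← sub_eq_zero.1 h0] at hx
    simp at hx
  rw [eq_mul_inv_iff_mul_eq₀ h1]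
  simp only [ph]
  rw [pow_succ]
  linear_combination (conj (S.a k) ^ n * conj (S.a k)) * h + (S.tau Φ n k * conj (S.a k) ^ n * (1 - conj x)) * h3

lemma shift_isBigO (k : Fin m) :
    (fun n => verb Φ n * (S.a k * S.tau Φ n k)) =O[atTop] q := by
  have h : (fun n => S.a k * S.tau Φ n k) =O[atTop] fun _ => (1 : ℝ) :=
    .of_norm_le fun n => by simp [S.norm_a, S.norm_tau H]
  simpa using (S.verb_isBigO H).mul h

lemma one_sub_shift_inv_isBigO (k : Fin m) :
    (fun n => (1 - verb Φ n * (S.a k * S.tau Φ n k))⁻¹) =O[atTop] fun _ => (1 : ℝ) := by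
  have h1 : Tendsto (fun n => verb Φ n * (S.a k * S.tau Φ n k)) atTop (𝓝 0) :=
    (S.shift_isBigO H k).trans_tendsto tendsto_q
  have h2 : Tendsto (fun n => (1 - verb Φ n * (S.a k * S.tau Φ n k))⁻¹) atTop (𝓝 (1 - 0)⁻¹) :=
    (tendsto_const_nhds.sub h1).inv₀ (by simp)
  exact h2.isBigO_one ℝ

lemma ph_succ_sub_isBigO (k : Fin m) :
    (fun n => S.ph Φ (n + 1) k - S.ph Φ n k) =O[atTop] q := by
  have h1 := S.shift_isBigO H k
  have h := ((S.ph_isBigO H k).mul (h1.sub h1.conj)).mul (S.one_sub_shift_inv_isBigO H k)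
  simp only [one_mul, mul_one] at h
  exact h.congr_left fun n => (S.ph_succ_sub H n k).symm

/-- The asymptotics of the Verblunsky coefficients in terms of the phases. -/
lemma verb_add_isBigO : (fun n => verb Φ n + q n * ∑ j, S.β j * conj (S.ph Φ n j * S.a j ^ (n + 1)))
    =O[atTop] fun n => q n ^ 2 := by
  obtain ⟨C, hC, hrem⟩ := S.exists_rem_le_div H zero_lt_one
  have h1 : (fun n => S.rem Φ n 0) =O[atTop] q :=
    isBigO_q_of_le (hrem.mono fun n hn => hn 0 (by simp))
  have h2 : (fun n => -S.rem Φ n 0 + ∑ j, ((S.g Φ n j - S.β j) * S.tau Φ n j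
      - (S.g Φ n j - S.β j + S.β j) * (Φ n).eval 0)) =O[atTop] q := by
    refine h1.neg_left.add (IsBigO.fun_sum fun j _ => ?_)
    have hg := S.g_sub_isBigO H j
    refine IsBigO.sub (by simpa using hg.mul (S.tau_isBigO H j)) ?_
    have hg1 : (fun n => S.g Φ n j - S.β j + S.β j) =O[atTop] fun _ => (1 : ℝ) :=
      (hg.trans q_isBigO_one).add (isBigO_const_const _ one_ne_zero _)
    simpa using hg1.mul (S.eval_zero_isBigO H)
  have h3 : (fun n : ℕ => (n : ℂ) * (Φ n).eval 0 - ∑ j, S.β j * S.tau Φ n j) =O[atTop] q := by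
    refine h2.congr' ?_ EventuallyEq.rfl
    filter_upwards [eventually_ge_atTop (max m 1)] with n hn
    have ho := S.ode H ((le_max_left _ _).trans hn) ((le_max_right _ _).trans hn) 0 (fun k => by simp)
    simp only [zero_mul, zero_sub, mul_zero, sub_zero, div_one, H.rev_eval_zero, mul_one] at ho
    have e : ∑ j, ((S.g Φ n j - S.β j) * S.tau Φ n j - (S.g Φ n j - S.β j + S.β j) * (Φ n).eval 0)
        = ∑ j, S.g Φ n j * (S.tau Φ n j - (Φ n).eval 0) - ∑ j, S.β j * S.tau Φ n j := by
      rw [← Finset.sum_sub_distrib]; exact Finset.sum_congr rfl fun j _ => by ring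
    rw [e]
    linear_combination ho
  have h4 : (fun n : ℕ => (((n + 1 : ℕ) : ℂ) * (Φ (n + 1)).eval 0 - ∑ j, S.β j * S.tau Φ (n + 1) j))
      =O[atTop] q := (h3.comp_tendsto (tendsto_add_atTop_nat 1)).trans q_succ_isBigO
  have h5 : (fun n => ∑ j, S.β j * ((S.ph Φ (n + 1) j - S.ph Φ n j) * S.a j ^ (n + 1))) =O[atTop] q := by
    refine IsBigO.fun_sum fun j _ => IsBigO.const_mul_left ?_ _
    have hp : (fun n => S.a j ^ (n + 1)) =O[atTop] fun _ => (1 : ℝ) :=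
      .of_norm_le fun n => by simp [S.norm_a]
    simpa using (S.ph_succ_sub_isBigO H j).mul hp
  have hq : (fun n => ((q n : ℝ) : ℂ)) =O[atTop] q :=
    .of_norm_le fun n => by simp [abs_of_pos (q_pos n)]
  have h6 := (hq.mul ((h4.add h5).conj)).neg_left
  simp only [← pow_two] at h6
  refine h6.congr_left fun n => ?_
  have hn : ((n : ℂ) + 1) * q n = 1 := by
    have : (n : ℂ) + 1 ≠ 0 := by exact_mod_cast Nat.succ_ne_zero n
    rw [q]; push_cast; field_simp
  have e : ∑ j, S.β j * S.tau Φ (n + 1) j = ∑ j, S.β j * ((S.ph Φ (n + 1) j - S.ph Φ n j) * S.a j ^ (n + 1))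
      + ∑ j, S.β j * (S.ph Φ n j * S.a j ^ (n + 1)) := by
    rw [← Finset.sum_add_distrib]
    exact Finset.sum_congr rfl fun j _ => by rw [S.tau_eq]; ring
  rw [e, verb]
  simp only [map_add, map_sub, map_sum, map_mul, map_pow, Complex.conj_ofReal, map_natCast]
  push_cast
  linear_combination (-conj ((Φ (n + 1)).eval 0)) * hn

lemma ph_mul_isBigO (i j : Fin m) : (fun n => S.ph Φ (n + 1) i * conj (S.ph Φ (n + 1) j)
    - S.ph Φ n i * conj (S.ph Φ n j)) =O[atTop] q := by
  have h1 := (S.ph_succ_sub_isBigO H i).mul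
    ((S.ph_isBigO H j).conj.comp_tendsto (tendsto_add_atTop_nat 1))
  have h2 := (S.ph_isBigO H i).mul (S.ph_succ_sub_isBigO H j).conj
  simp only [Function.comp_def, one_mul, mul_one] at h1 h2
  refine (h1.add h2).congr_left fun n => ?_
  simp only [map_sub]; ring

lemma ph_mul_mul_isBigO (i j l : Fin m) :
    (fun n => S.ph Φ (n + 1) l * (S.ph Φ (n + 1) i * conj (S.ph Φ (n + 1) j))
    - S.ph Φ n l * (S.ph Φ n i * conj (S.ph Φ n j))) =O[atTop] q := by
  have h1 := (S.ph_succ_sub_isBigO H l).mul (((S.ph_isBigO H i).mul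
    (S.ph_isBigO H j).conj).comp_tendsto (tendsto_add_atTop_nat 1))
  have h2 := (S.ph_isBigO H l).mul (S.ph_mul_isBigO H i j)
  simp only [Function.comp_def, one_mul, mul_one] at h1 h2
  exact (h1.add h2).congr_left fun n => by ring

lemma ph_mul_mul_isBigO_one (i j l : Fin m) :
    (fun n => S.ph Φ n l * (S.ph Φ n i * conj (S.ph Φ n j))) =O[atTop] fun _ => (1 : ℝ) :=
  .of_norm_le fun n => by simp [S.norm_ph H]

/-- The phases converge at rate `1/n`. -/
lemma exists_ph_limit (k : Fin m) : ∃ l : ℂ, (fun n => S.ph Φ n k - l) =O[atTop] q := by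
  refine Good.exists_limit ?_
  have hpow : (fun n => S.a k ^ (n + 1)) =O[atTop] fun _ => (1 : ℝ) :=
    .of_norm_le fun n => by simp [S.norm_a]
  have hx := S.shift_isBigO H k
  have h1 := ((S.ph_isBigO H k).mul (hx.sub hx.conj)).mul (hx.mul (S.one_sub_shift_inv_isBigO H k))
  have h2 := (S.verb_add_isBigO H).mul ((S.ph_isBigO H k).mul hpow)
  simp only [mul_one, one_mul] at h1 h2
  have h3 := (S.ph_isBigO H k).mul (h2.sub h2.conj)
  simp only [one_mul, ← pow_two] at h1 h3
  have hgood : Good fun n => ∑ j, (S.ph Φ n k * (conj (q n * (S.β j * conj (S.ph Φ n j * S.a j ^ (n + 1))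
      * (S.ph Φ n k * S.a k ^ (n + 1)))) - (q n * (S.β j * conj (S.ph Φ n j * S.a j ^ (n + 1))
      * (S.ph Φ n k * S.a k ^ (n + 1)))))) := by
    refine good_sum _ fun j _ => ?_
    by_cases hj : j = k
    · subst hj
      have e (n : ℕ) : S.ph Φ n j * (conj (q n * (S.β j * conj (S.ph Φ n j * S.a j ^ (n + 1))
          * (S.ph Φ n j * S.a j ^ (n + 1)))) - (q n * (S.β j * conj (S.ph Φ n j * S.a j ^ (n + 1))
          * (S.ph Φ n j * S.a j ^ (n + 1))))) = 0 := by
        simp only [map_mul, Complex.conj_ofReal, Complex.conj_conj]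
        ring
      simpa only [e] using good_of_isBigO (isBigO_zero _ _)
    · have hω : ‖conj (S.a j) * S.a k‖ = 1 := by simp [S.norm_a]
      have hω1 : conj (S.a j) * S.a k ≠ 1 := by
        intro h
        refine hj (S.inj ?_)
        have := mul_conj_one (S.norm_a j)
        linear_combination (-S.a j) * h + S.a k * this
      have hω' : ‖conj (conj (S.a j) * S.a k)‖ = 1 := by simp [S.norm_a]
      have hω1' : conj (conj (S.a j) * S.a k) ≠ 1 := by
        rwa [Ne, map_eq_one_iff _ (RingHom.injective _)]
      have g1 := good_pow_mul_q hω' hω1' (conj (conj (S.a j) * S.a k) * S.β j)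
        (S.ph_mul_mul_isBigO_one H j k k)
        (S.ph_mul_mul_isBigO H j k k)
      have g2 := good_pow_mul_q hω hω1 (-(conj (S.a j) * S.a k * S.β j))
        (S.ph_mul_mul_isBigO_one H k j k)
        (S.ph_mul_mul_isBigO H k j k)
      convert g1.add g2 using 2 with n
      simp only [map_mul, map_pow, Complex.conj_ofReal, Complex.conj_conj, mul_pow, pow_succ]
      ring
  convert hgood.add (good_of_isBigO (h1.add h3)) using 2 with n
  rw [S.ph_succ_sub H]
  have hx1 : 1 - verb Φ n * (S.a k * S.tau Φ n k) ≠ 0 := by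
    have hx : ‖verb Φ n * (S.a k * S.tau Φ n k)‖ < 1 := by
      simpa [S.norm_a, S.norm_tau H] using H.norm_verb_lt n
    intro h0
    rw [← sub_eq_zero.1 h0] at hx
    simp at hx
  have e1 : (1 - verb Φ n * (S.a k * S.tau Φ n k))⁻¹ = 1 + verb Φ n * (S.a k * S.tau Φ n k) *
      (1 - verb Φ n * (S.a k * S.tau Φ n k))⁻¹ := by
    linear_combination mul_inv_cancel₀ hx1
  have e2 : S.a k * S.tau Φ n k = S.ph Φ n k * S.a k ^ (n + 1) := by rw [S.tau_eq]; ring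
  conv_lhs => rw [e1]
  rw [e2]
  simp only [← Finset.mul_sum, Finset.sum_sub_distrib, ← map_sum, ← Finset.sum_mul]
  simp only [map_mul, map_add, Complex.conj_ofReal]
  ring

end SData

end OPUC

namespace OPUC

open scoped ComplexConjugate Topology NNReal ENNReal
open Asymptotics

lemma hasDerivAt_nonneg_of_max_left {G : ℝ → ℝ} {G' x y : ℝ} (hxy : x < y) (h : HasDerivAt G G' y)
    (hmax : ∀ t ∈ Ioo x y, G t ≤ G y) : 0 ≤ G' := by
  have h1 : Tendsto (slope G y) (𝓝[<] y) (𝓝 G') :=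
    h.tendsto_slope.mono_left (nhdsWithin_mono _ fun t ht => ne_of_lt ht)
  refine ge_of_tendsto h1 ?_
  filter_upwards [Ioo_mem_nhdsLT hxy] with t ht
  rw [slope_def_field]
  exact div_nonneg_of_nonpos (by linarith [hmax t ht]) (by linarith [ht.2])

/-- A maximum principle for a singular differential inequality. -/
lemma sqrt_le_of_singular_deriv_le {F F' : ℝ → ℝ} {s₀ κ C : ℝ} (hκ : κ < 1) (hC : 0 ≤ C)
    (hF : ∀ s ∈ Ioc 0 s₀, HasDerivAt F (F' s) s) (hF0 : F =O[𝓝[>] 0] fun s => s ^ 2)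
    (hpos : ∀ s ∈ Ioc 0 s₀, 0 ≤ F s)
    (hle : ∀ s ∈ Ioc 0 s₀, F' s ≤ 2 * κ * F s / s + 2 * C * √(F s)) :
    ∀ s ∈ Ioc 0 s₀, √(F s) ≤ C * s / (1 - κ) := by
  intro s₁ hs₁
  have hs0 : 0 < s₀ := hs₁.1.trans_le hs₁.2
  have key : ∀ p ∈ Ioo κ 1, F s₁ ≤ (C / (p - κ)) ^ 2 * s₀ ^ (2 - 2 * p) * s₁ ^ (2 * p) := by
    intro p hp
    have hpκ : 0 < p - κ := sub_pos.2 hp.1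
    rcases (hpos s₁ hs₁).eq_or_lt with h0 | h0
    · rw [← h0]
      have := hs₁.1.le
      positivity
    set G : ℝ → ℝ := fun s => F s * s ^ (-(2 * p)) with hG
    have hGpos : 0 < G s₁ := mul_pos h0 (Real.rpow_pos_of_pos hs₁.1 _)
    have hGlim : Tendsto G (𝓝[>] 0) (𝓝 0) := by
      have h1 : G =O[𝓝[>] 0] fun s : ℝ => s ^ 2 * s ^ (-(2 * p)) := hF0.mul (isBigO_refl _ _)
      refine h1.trans_tendsto ?_
      have h2 : Tendsto (fun s : ℝ => s ^ (2 - 2 * p)) (𝓝[>] 0) (𝓝 0) := by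
        have := (Real.continuousAt_rpow_const 0 (2 - 2 * p) (Or.inr (by linarith [hp.2]))).tendsto
        rw [Real.zero_rpow (by linarith [hp.2])] at this
        exact this.mono_left nhdsWithin_le_nhds
      refine h2.congr' ?_
      filter_upwards [self_mem_nhdsWithin] with s hs
      rw [← Real.rpow_natCast, ← Real.rpow_add hs]
      norm_num [sub_eq_add_neg]
    obtain ⟨s₂, hs₂, hs₂'⟩ := ((hGlim.eventually_lt_const hGpos).and
      (Ioo_mem_nhdsGT hs₁.1)).exists
    have hcont : ContinuousOn G (Icc s₂ s₀) := fun s hs => by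
      have hs' : 0 < s := hs₂'.1.trans_le hs.1
      exact ((hF s ⟨hs', hs.2⟩).continuousAt.mul
        (Real.continuousAt_rpow_const _ _ (Or.inl hs'.ne'))).continuousWithinAt
    obtain ⟨t, ht, htmax⟩ := isCompact_Icc.exists_isMaxOn ⟨s₁, hs₂'.2.le, hs₁.2⟩ hcont
    have h1t : G s₁ ≤ G t := htmax ⟨hs₂'.2.le, hs₁.2⟩
    have hst : s₂ < t := lt_of_le_of_ne ht.1 (by rintro rfl; linarith)
    have ht0 : 0 < t := hs₂'.1.trans hst
    have htI : t ∈ Ioc 0 s₀ := ⟨ht0, ht.2⟩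
    have hd : HasDerivAt G (F' t * t ^ (-(2 * p)) + F t * (-(2 * p) * t ^ (-(2 * p) - 1))) t :=
      (hF t htI).mul (Real.hasDerivAt_rpow_const (Or.inl ht0.ne'))
    have hd0 := hasDerivAt_nonneg_of_max_left hst hd fun u hu => htmax ⟨hu.1.le, hu.2.le.trans ht.2⟩
    have htp : 0 < t ^ (-(2 * p)) := Real.rpow_pos_of_pos ht0 _
    rw [Real.rpow_sub_one ht0.ne'] at hd0
    have hd1 : 0 ≤ t ^ (-(2 * p)) * (F' t - 2 * p * F t / t) := by
      convert hd0 using 1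
      ring
    have hd2 : 2 * p * F t / t ≤ F' t := by
      have := nonneg_of_mul_nonneg_right hd1 htp
      linarith
    have h3 := hle t htI
    have hFt : 0 ≤ F t := hpos t htI
    have hFt' : 0 < F t := by
      have : 0 < F t * t ^ (-(2 * p)) := hGpos.trans_le h1t
      exact pos_of_mul_pos_left this htp.le
    have h4 : √(F t) ≤ C / (p - κ) * t := by
      have h5 : (p - κ) * F t / t ≤ C * √(F t) := by
        have e : (p - κ) * F t / t = (2 * p * F t / t - 2 * κ * F t / t) / 2 := by ring
        rw [e]; linarith
      rw [div_le_iff₀ ht0] at h5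
      rw [div_mul_eq_mul_div, le_div_iff₀ hpκ]
      have h6 : 0 < √(F t) := Real.sqrt_pos.2 hFt'
      have h7 := Real.mul_self_sqrt hFt
      refine le_of_mul_le_mul_right ?_ h6
      nlinarith
    have h8 : F t ≤ (C / (p - κ)) ^ 2 * t ^ 2 := by
      rw [← Real.sq_sqrt hFt, ← mul_pow]
      exact pow_le_pow_left₀ (Real.sqrt_nonneg _) h4 2
    have h9 : G t ≤ (C / (p - κ)) ^ 2 * s₀ ^ (2 - 2 * p) := by
      calc G t ≤ (C / (p - κ)) ^ 2 * t ^ 2 * t ^ (-(2 * p)) := by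
            rw [hG]; dsimp only; gcongr
        _ = (C / (p - κ)) ^ 2 * t ^ (2 - 2 * p) := by
            rw [mul_assoc, ← Real.rpow_natCast t 2, ← Real.rpow_add ht0]
            norm_num [sub_eq_add_neg]
        _ ≤ _ := by
            gcongr
            · linarith [hp.2]
            · exact ht.2
    have h10 : F s₁ = G s₁ * s₁ ^ (2 * p) := by
      rw [hG]; dsimp only
      rw [mul_assoc, ← Real.rpow_add hs₁.1]
      simp
    rw [h10]
    exact mul_le_mul_of_nonneg_right (h1t.trans h9) (Real.rpow_nonneg hs₁.1.le _)
  have hlim : Tendsto (fun p : ℝ => (C / (p - κ)) ^ 2 * s₀ ^ (2 - 2 * p) * s₁ ^ (2 * p)) (𝓝[<] 1)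
      (𝓝 ((C / (1 - κ)) ^ 2 * s₀ ^ (2 - 2 * (1 : ℝ)) * s₁ ^ (2 * (1 : ℝ)))) := by
    refine Tendsto.mono_left ?_ nhdsWithin_le_nhds
    have h1 : Tendsto (fun p : ℝ => p) (𝓝 1) (𝓝 1) := tendsto_id
    refine (((tendsto_const_nhds.div (h1.sub tendsto_const_nhds) (by linarith)).pow 2).mul ?_).mul ?_
    · exact (tendsto_const_nhds.rpow (tendsto_const_nhds.sub (h1.const_mul 2)) (Or.inl hs0.ne'))
    · exact (tendsto_const_nhds.rpow (h1.const_mul 2) (Or.inl hs₁.1.ne'))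
  have hfin : F s₁ ≤ (C / (1 - κ)) ^ 2 * s₀ ^ (2 - 2 * (1 : ℝ)) * s₁ ^ (2 * (1 : ℝ)) :=
    ge_of_tendsto hlim (by filter_upwards [Ioo_mem_nhdsLT hκ] with p hp using key p hp)
  have h1κ : 0 < 1 - κ := sub_pos.2 hκ
  have hs₁0 := hs₁.1.le
  refine Real.sqrt_le_iff.2 ⟨by positivity, hfin.trans (le_of_eq ?_)⟩
  norm_num
  ring

namespace SData

variable {m : ℕ} (S : SData m) {Φ : ℕ → ℂ[X]} (H : OPS S.meas Φ)

/-- The ratio of the polynomial and its reverse, normalized to equal `1` at the singular point. -/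
noncomputable def rat (Φ : ℕ → ℂ[X]) (n : ℕ) (k : Fin m) (z : ℂ) : ℂ :=
  conj (S.tau Φ n k) * (Φ n).eval z / (rev Φ n).eval z

lemma one_sub_conj_radial (k : Fin m) (s : ℝ) :
    1 - conj (S.a k) * ((1 - s : ℝ) * S.a k) = s := by
  have := mul_conj_one (S.norm_a k)
  push_cast
  linear_combination (-(1 - s : ℂ)) * this

lemma norm_radial (k : Fin m) {s : ℝ} (hs : s ≤ 1) : ‖((1 - s : ℝ) : ℂ) * S.a k‖ = 1 - s := by
  rw [norm_mul, S.norm_a, mul_one, Complex.norm_real, Real.norm_of_nonneg (by linarith)]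

include H

lemma norm_rat_le (n : ℕ) (k : Fin m) {z : ℂ} (hz : ‖z‖ ≤ 1) : ‖S.rat Φ n k z‖ ≤ 1 := by
  rw [rat, norm_div, norm_mul, Complex.norm_conj, S.norm_tau H, one_mul]
  exact div_le_one_of_le₀ (H.norm_le_norm_rev n hz) (norm_nonneg _)

lemma rat_self (n : ℕ) (k : Fin m) : S.rat Φ n k (S.a k) = 1 := by
  have h : S.tau Φ n k * (rev Φ n).eval (S.a k) = (Φ n).eval (S.a k) :=
    div_mul_cancel₀ _ (H.rev_ne_zero n (S.norm_a k).le)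
  have h1 := mul_conj_one (S.norm_tau H n k)
  rw [rat, div_eq_one_iff_eq (H.rev_ne_zero n (S.norm_a k).le)]
  linear_combination (-conj (S.tau Φ n k)) * h + (rev Φ n).eval (S.a k) * h1

/-- Radial behaviour near a singular point. -/
lemma exists_radial_ode (k : Fin m) : ∃ C : ℝ, 0 ≤ C ∧ ∃ s₀ : ℝ, 0 < s₀ ∧ s₀ ≤ 1 / 2 ∧
    ∀ᶠ n : ℕ in atTop, ∀ s ∈ Ioc 0 s₀, ∀ z : ℂ, z = (1 - s : ℝ) * S.a k →
      ‖z * (derivative (rev Φ n)).eval z - (rev Φ n).eval z * (conj (S.g Φ n k) *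
        ((1 - S.rat Φ n k z) / s))‖ ≤ C * ‖(rev Φ n).eval z‖ ∧
      ‖conj (S.tau Φ n k) * (z * (derivative (Φ n)).eval z) - (rev Φ n).eval z *
        (n * S.rat Φ n k z - S.g Φ n k * ((1 - S.rat Φ n k z) / s))‖ ≤ C * ‖(rev Φ n).eval z‖ := by
  obtain ⟨r0, hr00, hr01, hr0R⟩ := S.exists_radius
  have h1r : 1 ≤ 1 / r0 := (one_le_div hr00).2 hr01.le
  obtain ⟨C1, hC1, hrem⟩ := S.exists_rem_le H h1r hr0R
  obtain ⟨C2, hC2, hremr⟩ := S.exists_remr_le H h1r hr0R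
  obtain ⟨V, hV0, hV⟩ := S.exists_norm_deriv_ell_le hr0R
  obtain ⟨G, hG0, hG⟩ := S.exists_g_le H
  obtain ⟨Cm, hCm, hmom⟩ := S.exists_momLE H
  obtain ⟨d, hd0, hd1, hd⟩ := exists_sep S.inj
  set s₀ := min (1 / 2) (min (d / 2) (1 - r0)) with hs₀
  set C := V + 2 * (C1 + C2) * Cm + 2 * G + m * (G * (2 / d)) with hC
  refine ⟨C, by positivity, s₀, ?_, min_le_left _ _, ?_⟩
  · have : 0 < 1 - r0 := sub_pos.2 hr01
    positivity
  filter_upwards [hG, eventually_ge_atTop (max m 1)] with n hGn hn s hs z hz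
  have hm : m ≤ n := (le_max_left _ _).trans hn
  have hn0 : 0 < n := (le_max_right _ _).trans hn
  have hn1 : (1 : ℝ) ≤ n := by exact_mod_cast hn0
  have hsd : s < d := by
    have := hs.2.trans ((min_le_right _ _).trans (min_le_left _ _)); linarith
  have hsr : s ≤ 1 - r0 := hs.2.trans ((min_le_right _ _).trans (min_le_right _ _))
  have hnz : ‖z‖ = 1 - s := by rw [hz]; exact S.norm_radial k (by linarith)
  have hz1 : ‖z‖ < 1 := by linarith [hs.1]
  have hz0 : z ≠ 0 := norm_pos_iff.1 (by linarith)
  have hzM : ‖z‖ ≤ 1 / r0 := hz1.le.trans h1r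
  have hziM : ‖z⁻¹‖ ≤ 1 / r0 := by
    rw [norm_inv, ← one_div]; exact one_div_le_one_div_of_le hr00 (by linarith)
  have hs' : (s : ℂ) ≠ 0 := by exact_mod_cast hs.1.ne'
  have hP0 : (rev Φ n).eval z ≠ 0 := H.rev_ne_zero n hz1.le
  have hΦP := H.norm_le_norm_rev n hz1.le
  have hone : ∀ j, 1 - conj (S.a j) * z ≠ 0 := S.one_sub_ne hz1
  have hk : 1 - conj (S.a k) * z = s := by rw [hz]; exact S.one_sub_conj_radial k s
  have hk' : conj (S.a k) * z = 1 - s := by rw [← hk]; ring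
  have hsep : ∀ j, j ≠ k → d ≤ ‖1 - conj (S.a j) * z‖ := fun j hj => by
    rw [norm_one_sub_conj (S.norm_a j)]
    refine (hd j k hj z).resolve_right fun h => ?_
    rw [← norm_one_sub_conj (S.norm_a k), hk, Complex.norm_real, Real.norm_of_nonneg hs.1.le] at h
    linarith
  have htt := mul_conj_one (S.norm_tau H n k)
  have hrat : conj (S.tau Φ n k) * (Φ n).eval z = (rev Φ n).eval z * S.rat Φ n k z := by
    rw [rat]; field_simp
  have hratle := S.norm_rat_le H n k hz1.le
  have hB : Cm / n ≤ Cm := div_le_self hCm hn1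
  set P := (rev Φ n).eval z with hP
  set x := S.rat Φ n k z with hx
  have hrem' : ‖S.rem Φ n z‖ ≤ (V + 2 * C1 * Cm) * ‖P‖ := by
    have h1 := hrem n _ (hmom n hn0) z hz0 hzM hziM
    have h2 : ‖(Φ n).eval z * conj ((conj z)⁻¹ * deriv S.ell (conj z)⁻¹)‖ ≤ ‖P‖ * V := by
      rw [norm_mul, Complex.norm_conj]
      exact mul_le_mul hΦP (hV _ (by rwa [norm_inv, Complex.norm_conj, ← norm_inv]))
        (norm_nonneg _) (norm_nonneg _)
    have h3 : C1 * (Cm / n) * (‖P‖ + ‖(Φ n).eval z‖) ≤ C1 * Cm * (‖P‖ + ‖P‖) := by gcongr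
    have h4 := norm_le_norm_sub_add (S.rem Φ n z) ((Φ n).eval z * conj ((conj z)⁻¹ * deriv S.ell (conj z)⁻¹))
    linarith
  have hremr' : ‖S.remr Φ n z‖ ≤ (V + 2 * C2 * Cm) * ‖P‖ := by
    have h1 := hremr n _ (hmom n hn0) z hz0 hzM hziM
    have h2 : ‖P * (z * deriv S.ell z)‖ ≤ ‖P‖ * V := by
      rw [norm_mul]
      exact mul_le_mul_of_nonneg_left (hV _ hzM) (norm_nonneg _)
    have h3 : C2 * (Cm / n) * (‖(Φ n).eval z‖ + ‖P‖) ≤ C2 * Cm * (‖P‖ + ‖P‖) := by gcongr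
    have h4 := norm_le_norm_sub_add (S.remr Φ n z) (P * (z * deriv S.ell z))
    linarith
  have hsum {f : Fin m → ℂ} (hf : ∀ j ≠ k, ‖f j‖ ≤ G * (2 / d) * ‖P‖) :
      ‖∑ j ∈ Finset.univ.erase k, f j‖ ≤ m * (G * (2 / d)) * ‖P‖ := by
    refine (norm_sum_le_of_le _ fun j hj => hf j (Finset.ne_of_mem_erase hj)).trans ?_
    rw [Finset.sum_const, nsmul_eq_mul, mul_assoc (m : ℝ)]
    have : ((Finset.univ.erase k).card : ℝ) ≤ m := by
      exact_mod_cast (Finset.card_erase_le).trans (by simp)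
    gcongr
  have hbig {A B D : ℂ} (a b : ℝ) (hA : ‖A‖ ≤ a * ‖P‖) (hB : ‖B‖ ≤ 2 * G * ‖P‖)
      (hD : ‖D‖ ≤ b * ‖P‖) (hab : a + 2 * G + b ≤ C) : ‖A + B + D‖ ≤ C * ‖P‖ := by
    calc _ ≤ ‖A‖ + ‖B‖ + ‖D‖ := norm_add₃_le
      _ ≤ (a + 2 * G + b) * ‖P‖ := by linarith
      _ ≤ _ := by gcongr
  have hnum (j : Fin m) (u : ℂ) (hu : ‖u‖ = 1) : ‖P - u * (Φ n).eval z‖ ≤ 2 * ‖P‖ := by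
    refine (norm_sub_le _ _).trans ?_
    rw [norm_mul, hu]; linarith
  have hdiv {j : Fin m} (hj : j ≠ k) {A : ℂ} (hA : ‖A‖ ≤ 2 * ‖P‖) :
      ‖S.g Φ n j * A / (1 - conj (S.a j) * z)‖ ≤ G * (2 / d) * ‖P‖ := by
    rw [norm_div, norm_mul, div_le_iff₀ (hd0.trans_le (hsep j hj))]
    calc _ ≤ G * (2 * ‖P‖) := mul_le_mul (hGn j) hA (norm_nonneg _) hG0
      _ = G * (2 / d) * ‖P‖ * d := by field_simp
      _ ≤ _ := by gcongr; exact hsep j hj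
  constructor
  · have ho := S.ode_rev H hm hn0 hz0 hone
    rw [← Finset.add_sum_erase _ _ (Finset.mem_univ k), hk, hk', ← hP, hrat] at ho
    have e : z * (derivative (rev Φ n)).eval z - P * (conj (S.g Φ n k) * ((1 - x) / s)) =
        -S.remr Φ n z + -(conj (S.g Φ n k) * (P * (1 - x))) + ∑ j ∈ Finset.univ.erase k,
          conj (S.g Φ n j) * (conj (S.a j) * z / (1 - conj (S.a j) * z)) *
          (P - conj (S.tau Φ n j) * (Φ n).eval z) := by
      rw [ho]
      generalize (Finset.sum (Finset.univ.erase k) _ : ℂ) = T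
      field_simp
      ring
    rw [e]
    refine hbig (V + 2 * C2 * Cm) (m * (G * (2 / d))) (by rwa [norm_neg]) ?_ (hsum fun j hj => ?_) ?_
    · rw [norm_neg, norm_mul, norm_mul, Complex.norm_conj]
      have h2 : ‖1 - x‖ ≤ 2 := (norm_sub_le _ _).trans (by rw [norm_one]; linarith)
      calc _ ≤ G * (‖P‖ * 2) := by gcongr; exact hGn k
        _ = _ := by ring
    · have h1 := hnum j (conj (S.tau Φ n j)) (by rw [Complex.norm_conj, S.norm_tau H])
      have h2 := hdiv hj (A := z * (P - conj (S.tau Φ n j) * (Φ n).eval z)) (by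
        rw [norm_mul]
        exact (mul_le_of_le_one_left (norm_nonneg _) hz1.le).trans h1)
      refine le_of_eq_of_le ?_ h2
      simp only [norm_mul, norm_div, Complex.norm_conj, S.norm_a]
      ring
    · rw [hC]; nlinarith [mul_nonneg hC1 hCm]
  · have ho := S.ode H hm hn0 z hone
    rw [← Finset.add_sum_erase _ _ (Finset.mem_univ k), hk, ← hP] at ho
    have e : conj (S.tau Φ n k) * (z * (derivative (Φ n)).eval z) - P * (n * x - S.g Φ n k * ((1 - x) / s)) =
        conj (S.tau Φ n k) * S.rem Φ n z + 0 + -(conj (S.tau Φ n k) * ∑ j ∈ Finset.univ.erase k,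
          S.g Φ n j * (S.tau Φ n j * P - (Φ n).eval z) / (1 - conj (S.a j) * z)) := by
      rw [sub_eq_iff_eq_add] at ho
      rw [ho]
      generalize (Finset.sum (Finset.univ.erase k) _ : ℂ) = T
      field_simp
      linear_combination (-S.g Φ n k * P) * htt + (s * n + S.g Φ n k) * hrat
    rw [e]
    refine hbig (V + 2 * C1 * Cm) (m * (G * (2 / d))) ?_ (by simp; positivity) ?_ ?_
    · rwa [norm_mul, Complex.norm_conj, S.norm_tau H, one_mul]
    · rw [norm_neg, norm_mul, Complex.norm_conj, S.norm_tau H, one_mul]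
      refine hsum fun j hj => hdiv hj ((norm_sub_le _ _).trans ?_)
      rw [norm_mul, S.norm_tau H]; linarith
    · rw [hC]; nlinarith [mul_nonneg hC2 hCm]

end SData

end OPUC

namespace OPUC

open scoped ComplexConjugate Topology NNReal ENNReal
open Asymptotics

namespace SData

variable {m : ℕ} (S : SData m) {Φ : ℕ → ℂ[X]} (H : OPS S.meas Φ)

/-- The normalized ratio along a radius. -/
noncomputable def radRat (Φ : ℕ → ℂ[X]) (n : ℕ) (k : Fin m) (s : ℝ) : ℂ :=
  S.rat Φ n k ((1 - s : ℝ) * S.a k)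

lemma hasDerivAt_radial (k : Fin m) (p : ℂ[X]) (s : ℝ) :
    HasDerivAt (fun s : ℝ => p.eval (((1 - s : ℝ) : ℂ) * S.a k))
      (-(S.a k * (derivative p).eval (((1 - s : ℝ) : ℂ) * S.a k))) s := by
  have h1 : HasDerivAt (fun s : ℝ => ((1 - s : ℝ) : ℂ) * S.a k) (-S.a k) s := by
    have := (((hasDerivAt_id s).const_sub 1).ofReal_comp).mul_const (S.a k)
    exact this.congr_deriv (by push_cast; ring)
  exact ((p.hasDerivAt _).comp s h1).congr_deriv (by ring)

include H

lemma norm_radRat_le (n : ℕ) (k : Fin m) {s : ℝ} (hs0 : 0 ≤ s) (hs : s ≤ 1) :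
    ‖S.radRat Φ n k s‖ ≤ 1 :=
  S.norm_rat_le H n k (by rw [S.norm_radial k hs]; linarith)

lemma radRat_zero (n : ℕ) (k : Fin m) : S.radRat Φ n k 0 = 1 := by
  rw [radRat]; simpa using S.rat_self H n k

lemma rev_radial_ne_zero (n : ℕ) (k : Fin m) {s : ℝ} (hs0 : 0 ≤ s) (hs : s ≤ 1) :
    (rev Φ n).eval (((1 - s : ℝ) : ℂ) * S.a k) ≠ 0 :=
  H.rev_ne_zero n (by rw [S.norm_radial k hs]; linarith)

lemma differentiableAt_radRat (n : ℕ) (k : Fin m) {s : ℝ} (hs0 : 0 ≤ s) (hs : s ≤ 1) :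
    DifferentiableAt ℝ (S.radRat Φ n k) s := by
  have h1 := (S.hasDerivAt_radial k (Φ n) s).differentiableAt
  have h2 := (S.hasDerivAt_radial k (rev Φ n) s).differentiableAt
  exact (h1.const_mul (conj (S.tau Φ n k))).div h2 (S.rev_radial_ne_zero H n k hs0 hs)

lemma exists_hasDerivAt_radRat (k : Fin m) : ∃ C : ℝ, 0 ≤ C ∧ ∃ s₀ : ℝ, 0 < s₀ ∧ s₀ ≤ 1 / 2 ∧
    ∀ᶠ n : ℕ in atTop, ∀ s ∈ Ioc 0 s₀, ∃ e : ℂ, ‖e‖ ≤ C ∧ HasDerivAt (S.radRat Φ n k)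
      (-((n / (1 - s) : ℝ) * S.radRat Φ n k s) + (1 - S.radRat Φ n k s) *
        (S.g Φ n k + conj (S.g Φ n k) * S.radRat Φ n k s) / s + e) s := by
  obtain ⟨C, hC, s₀, hs0, hs2, h⟩ := S.exists_radial_ode H k
  obtain ⟨G, hG0, hG⟩ := S.exists_g_le H
  refine ⟨2 * (4 * G + 2 * C), by positivity, s₀, hs0, hs2, ?_⟩
  filter_upwards [h, hG] with n hn hGn s hs
  have hs1 : s ≤ 1 := by linarith [hs.2]
  set z : ℂ := ((1 - s : ℝ) : ℂ) * S.a k with hz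
  obtain ⟨h1, h2⟩ := hn s hs z rfl
  have hP0 := S.rev_radial_ne_zero H n k hs.1.le hs1
  have hx1 := S.norm_radRat_le H n k hs.1.le hs1
  have hxd : S.radRat Φ n k s = S.rat Φ n k z := rfl
  rw [← hz] at hP0
  rw [hxd] at hx1 ⊢
  set x := S.rat Φ n k z with hx
  set P := (rev Φ n).eval z with hP
  set g := S.g Φ n k
  set A := z * (derivative (rev Φ n)).eval z
  set B := conj (S.tau Φ n k) * (z * (derivative (Φ n)).eval z)
  have hs' : (s : ℂ) ≠ 0 := by exact_mod_cast hs.1.ne'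
  have hs'' : (1 - s : ℂ) ≠ 0 := by
    have : (1 - s : ℝ) ≠ 0 := by linarith [hs.2]
    exact_mod_cast this
  have hPn : 0 < ‖P‖ := norm_pos_iff.2 hP0
  set e1 := (A - P * (conj g * ((1 - x) / s))) / P with he1
  set e2 := (B - P * (n * x - g * ((1 - x) / s))) / P with he2
  have he1' : ‖e1‖ ≤ C := by rw [he1, norm_div, div_le_iff₀ hPn]; exact h1
  have he2' : ‖e2‖ ≤ C := by rw [he2, norm_div, div_le_iff₀ hPn]; exact h2
  refine ⟨((1 - x) * (g + conj g * x) - (e2 - x * e1)) / (1 - s), ?_, ?_⟩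
  · rw [norm_div]
    have hns : ‖(1 - s : ℂ)‖ = 1 - s := by
      rw [← Complex.ofReal_one, ← Complex.ofReal_sub, Complex.norm_real, Real.norm_of_nonneg (by linarith)]
    rw [hns, div_le_iff₀ (by linarith [hs.2])]
    have i1 : ‖1 - x‖ ≤ 2 := (norm_sub_le _ _).trans (by rw [norm_one]; linarith)
    have i2 : ‖g + conj g * x‖ ≤ 2 * G := by
      refine (norm_add_le _ _).trans ?_
      rw [norm_mul, Complex.norm_conj]
      have := hGn k
      nlinarith [norm_nonneg g]
    have i3 : ‖e2 - x * e1‖ ≤ 2 * C := by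
      refine (norm_sub_le _ _).trans ?_
      rw [norm_mul]
      nlinarith [norm_nonneg e1]
    have i4 : ‖(1 - x) * (g + conj g * x)‖ ≤ 2 * (2 * G) := by
      rw [norm_mul]; gcongr
    have i5 := norm_sub_le ((1 - x) * (g + conj g * x)) (e2 - x * e1)
    nlinarith [hs.2]
  · have hd := ((S.hasDerivAt_radial k (Φ n) s).const_mul (conj (S.tau Φ n k))).div
      (S.hasDerivAt_radial k (rev Φ n) s) hP0
    refine hd.congr_deriv ?_
    rw [← hz, ← hP]
    have hz' : z = (1 - s) * S.a k := by rw [hz]; push_cast; ring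
    have hA : S.a k * (derivative (rev Φ n)).eval z = A / (1 - s) := by
      rw [eq_div_iff hs'']
      simp only [A]
      linear_combination (-(derivative (rev Φ n)).eval z) * hz'
    have hB : conj (S.tau Φ n k) * (S.a k * (derivative (Φ n)).eval z) = B / (1 - s) := by
      rw [eq_div_iff hs'']
      simp only [B]
      linear_combination (-conj (S.tau Φ n k) * (derivative (Φ n)).eval z) * hz'
    have hΦ : conj (S.tau Φ n k) * (Φ n).eval z = P * x := by
      rw [hx, rat, ← hP]; field_simp
    have hA' : A = P * (conj g * ((1 - x) / s) + e1) := by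
      rw [he1]; field_simp; ring
    have hB' : B = P * (n * x - g * ((1 - x) / s) + e2) := by
      rw [he2]; field_simp; ring
    rw [mul_neg, hB, hA, hΦ, hA', hB']
    push_cast
    field_simp
    ring

lemma isBigO_one_sub_radRat (n : ℕ) (k : Fin m) :
    (fun s => 1 - S.radRat Φ n k s) =O[𝓝[>] 0] fun s => s := by
  have h := (S.differentiableAt_radRat H n k le_rfl zero_le_one).isBigO_sub
  rw [S.radRat_zero H] at h
  exact ((h.neg_left.congr_left fun s => by ring).congr_right fun s => by ring).mono
    nhdsWithin_le_nhds

/-- Schwarz-type bound near a singular point. -/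
lemma exists_one_sub_radRat_le (k : Fin m) : ∃ C : ℝ, 0 ≤ C ∧ ∃ s₀ : ℝ, 0 < s₀ ∧ s₀ ≤ 1 / 2 ∧
    ∀ᶠ n : ℕ in atTop, ∀ s ∈ Ioc 0 s₀, ‖1 - S.radRat Φ n k s‖ ≤ C * n * s := by
  obtain ⟨C, hC, s₀, hs0, hs2, h⟩ := S.exists_hasDerivAt_radRat H k
  obtain ⟨Cg, hCg, hg⟩ := S.exists_g_sub_le H
  set b := max (-S.β k) 0 with hb
  have hb1 : 2 * b < 1 := by
    have := S.hβ k
    rw [hb, mul_max_of_nonneg _ _ (by norm_num)]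
    exact max_lt (by linarith) (by norm_num)
  have hbβ : -b ≤ S.β k := by linarith [le_max_left (-S.β k) 0]
  have hb0 : 0 ≤ b := le_max_right _ _
  set κ := (1 + 2 * b) / 2 with hκ
  have hκ1 : κ < 1 := by rw [hκ]; linarith
  have hκ1' : 0 < 1 - κ := sub_pos.2 hκ1
  refine ⟨(2 + C) / (1 - κ), by positivity, s₀, hs0, hs2, ?_⟩
  have hsmall : ∀ᶠ n : ℕ in atTop, Cg / n < (1 - 2 * b) / 2 :=
    (tendsto_const_div_atTop_nhds_zero_nat Cg).eventually_lt_const (by linarith)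
  filter_upwards [h, hg, eventually_ge_atTop (max m 1), hsmall] with n hn hgn hnm hgs
  have hm : m ≤ n := (le_max_left _ _).trans hnm
  have hn1 : (1 : ℝ) ≤ n := by exact_mod_cast (le_max_right _ _).trans hnm
  choose! e he hd using hn
  have hF (s : ℝ) (hs : s ∈ Ioc 0 s₀) := ((hd s hs).const_sub 1).norm_sq
  have hmain := sqrt_le_of_singular_deriv_le (κ := κ) (C := 2 * n + C) hκ1 (by positivity) hF ?_
    (fun s _ => by positivity) ?_
  · intro s hs
    have := hmain s hs
    rw [Real.sqrt_sq (norm_nonneg _)] at this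
    refine this.trans ?_
    have hs0 := hs.1
    rw [div_mul_eq_mul_div, div_mul_eq_mul_div]
    gcongr
    nlinarith
  · have := (S.isBigO_one_sub_radRat H n k).norm_left
    exact this.pow 2
  · intro s hs
    have hs1 : s ≤ 1 := by linarith [hs.2]
    have hx1 := S.norm_radRat_le H n k hs.1.le hs1
    set x := S.radRat Φ n k s with hx
    set g := S.g Φ n k with hgd
    have hgre : g.re = S.β k := S.g_re H hm k
    have hgim : |g.im| ≤ Cg / n := by
      refine le_trans ?_ (hgn k)
      have := Complex.abs_im_le_norm (g - S.β k)
      simpa using this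
    have hre : -κ ≤ (g + conj g * x).re := by
      simp only [Complex.add_re, Complex.mul_re, Complex.conj_re, Complex.conj_im, hgre]
      have hX := abs_le.1 ((Complex.abs_re_le_norm x).trans hx1)
      have hY := (Complex.abs_im_le_norm x).trans hx1
      have h1 : |g.im * x.im| ≤ (1 - 2 * b) / 2 := by
        rw [abs_mul]
        calc _ ≤ Cg / n * 1 := mul_le_mul hgim hY (abs_nonneg _) (by positivity)
          _ ≤ _ := by rw [mul_one]; exact hgs.le
      have h2 := abs_le.1 h1
      have h3 : -b * (1 + x.re) ≤ S.β k * (1 + x.re) :=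
        mul_le_mul_of_nonneg_right hbβ (by linarith)
      rw [hκ]
      nlinarith
    rw [Complex.inner, Real.sqrt_sq (norm_nonneg _)]
    have hns : ‖((n / (1 - s) : ℝ) : ℂ) * x‖ ≤ 2 * n := by
      rw [norm_mul, Complex.norm_real, Real.norm_of_nonneg (by
        apply div_nonneg <;> linarith)]
      have : n / (1 - s) ≤ 2 * n := by
        rw [div_le_iff₀ (by linarith [hs.2])]
        nlinarith [hs.2]
      nlinarith [norm_nonneg x, norm_nonneg x]
    have hsplit : -(-(((n / (1 - s) : ℝ) : ℂ) * x) + (1 - x) * (g + conj g * x) / s + e s) * conj (1 - x) =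
        conj (1 - x) * (((n / (1 - s) : ℝ) : ℂ) * x - e s) -
          ((‖1 - x‖ ^ 2 / s : ℝ) : ℂ) * (g + conj g * x) := by
      have hv := Complex.mul_conj' (1 - x)
      push_cast
      rw [← hv]
      ring
    rw [hsplit, Complex.sub_re, Complex.re_ofReal_mul]
    have i1 : (conj (1 - x) * (((n / (1 - s) : ℝ) : ℂ) * x - e s)).re ≤ ‖1 - x‖ * (2 * n + C) := by
      refine (Complex.re_le_norm _).trans ?_
      rw [norm_mul, Complex.norm_conj]
      gcongr
      exact (norm_sub_le _ _).trans (add_le_add hns (he s hs))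
    have i2 : -κ * (‖1 - x‖ ^ 2 / s) ≤ ‖1 - x‖ ^ 2 / s * (g + conj g * x).re := by
      rw [mul_comm]
      exact mul_le_mul_of_nonneg_left hre (div_nonneg (by positivity) hs.1.le)
    have e1 : 2 * κ * ‖1 - x‖ ^ 2 / s = 2 * (κ * (‖1 - x‖ ^ 2 / s)) := by ring
    rw [e1]
    linarith

end SData

end OPUC

namespace OPUC

open scoped ComplexConjugate Topology NNReal ENNReal
open Asymptotics

namespace SData

variable {m : ℕ} (S : SData m) {Φ : ℕ → ℂ[X]} (H : OPS S.meas Φ)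

include H

/-- The Riccati equation along a radius, with the limiting real coefficient. -/
lemma exists_hasDerivAt_radRat_real (k : Fin m) : ∃ C : ℝ, 0 ≤ C ∧ ∃ s₀ : ℝ, 0 < s₀ ∧ s₀ ≤ 1 / 2 ∧
    ∀ᶠ n : ℕ in atTop, ∀ s ∈ Ioc 0 s₀, ∃ e : ℂ, ‖e‖ ≤ C ∧ HasDerivAt (S.radRat Φ n k)
      (-((n / (1 - s) : ℝ) * S.radRat Φ n k s) +
        ((S.β k / s : ℝ) : ℂ) * (1 - S.radRat Φ n k s ^ 2) + e) s := by
  obtain ⟨C, hC, s₀, hs0, hs2, h⟩ := S.exists_hasDerivAt_radRat H k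
  obtain ⟨C', hC', s₁, hs1, hs3, h'⟩ := S.exists_one_sub_radRat_le H k
  obtain ⟨Cg, hCg, hg⟩ := S.exists_g_sub_le H
  refine ⟨C + Cg * C' * 2, by positivity, min s₀ s₁, lt_min hs0 hs1, (min_le_left _ _).trans hs2, ?_⟩
  filter_upwards [h, h', hg, eventually_ge_atTop (max m 1)] with n hn hn' hgn hnm s hs
  have hm : m ≤ n := (le_max_left _ _).trans hnm
  have hn1 : (0 : ℝ) < n := by exact_mod_cast (le_max_right _ _).trans hnm
  obtain ⟨e, he, hd⟩ := hn s ⟨hs.1, hs.2.trans (min_le_left _ _)⟩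
  have hx := hn' s ⟨hs.1, hs.2.trans (min_le_right _ _)⟩
  have hxn := S.norm_radRat_le H n k hs.1.le (by linarith [hs.2.trans (min_le_left _ _)])
  set x := S.radRat Φ n k s
  set d := S.g Φ n k - S.β k with hdd
  have hgd : S.g Φ n k = S.β k + d := by rw [hdd]; ring
  have hdr : conj d = -d := by
    apply Complex.ext <;> simp [hdd, S.g_re H hm k]
  have hs' : (s : ℂ) ≠ 0 := by exact_mod_cast hs.1.ne'
  refine ⟨e + d * (1 - x) * ((1 - x) / s), ?_, hd.congr_deriv ?_⟩
  · refine (norm_add_le _ _).trans (add_le_add he ?_)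
    rw [norm_mul, norm_mul, norm_div, Complex.norm_real, Real.norm_of_nonneg hs.1.le]
    have i1 : ‖1 - x‖ / s ≤ C' * n := by rw [div_le_iff₀ hs.1]; exact hx
    have i2 : ‖1 - x‖ ≤ 2 := (norm_sub_le _ _).trans (by rw [norm_one]; linarith)
    have := hs.1
    calc ‖d‖ * ‖1 - x‖ * (‖1 - x‖ / s) ≤ Cg / n * 2 * (C' * n) := by
          gcongr
          exact hgn k
      _ = Cg * C' * 2 := by field_simp
  · rw [hgd, map_add, Complex.conj_ofReal, hdr]
    push_cast
    field_simp
    ring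

lemma exists_re_radRat_nonneg (k : Fin m) (hβ : 0 < S.β k) : ∃ s₀ : ℝ, 0 < s₀ ∧ s₀ ≤ 1 / 2 ∧
    ∀ᶠ n : ℕ in atTop, ∀ s ∈ Ioc 0 s₀, 0 ≤ (S.radRat Φ n k s).re := by
  obtain ⟨C, hC, s₀, hs0, hs2, h⟩ := S.exists_hasDerivAt_radRat_real H k
  set s₁ := min s₀ (S.β k / (2 * (C + 1))) with hs₁
  have hs10 : 0 < s₁ := lt_min hs0 (by positivity)
  refine ⟨s₁, hs10, (min_le_left _ _).trans hs2, ?_⟩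
  filter_upwards [h, eventually_gt_atTop ⌈2 * C⌉₊] with n hn hnC
  have hnC' : 2 * C < n := (Nat.le_ceil _).trans_lt (by exact_mod_cast hnC)
  have hcont : ContinuousOn (fun s => (S.radRat Φ n k s).re) (Icc 0 s₁) := fun s hs =>
    (Complex.continuous_re.continuousAt.comp (S.differentiableAt_radRat H n k hs.1
      (by linarith [hs.2.trans (min_le_left _ _)])).continuousAt).continuousWithinAt
  obtain ⟨t, ht, htmin⟩ := isCompact_Icc.exists_isMinOn ⟨0, le_rfl, hs10.le⟩ hcont
  intro s hs
  refine le_trans ?_ (htmin ⟨hs.1.le, hs.2⟩)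
  by_contra! hneg
  have ht0 : 0 < t := by
    refine lt_of_le_of_ne ht.1 ?_
    rintro rfl
    rw [S.radRat_zero H] at hneg
    norm_num at hneg
  have hts : t ≤ s₀ := ht.2.trans (min_le_left _ _)
  have htβ : t ≤ S.β k / (2 * (C + 1)) := ht.2.trans (min_le_right _ _)
  obtain ⟨e, he, hd⟩ := hn t ⟨ht0, hts⟩
  have hdre := (Complex.reCLM.hasFDerivAt.comp_hasDerivAt t hd).neg
  have hge := hasDerivAt_nonneg_of_max_left ht0 hdre fun r hr => by
    have := htmin ⟨hr.1.le, hr.2.le.trans ht.2⟩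
    simpa using this
  have hxn := S.norm_radRat_le H n k ht0.le (by linarith)
  set x := S.radRat Φ n k t
  have hX := abs_le.1 ((Complex.abs_re_le_norm x).trans hxn)
  have her := abs_le.1 ((Complex.abs_re_le_norm e).trans he)
  have hval : Complex.reCLM (-((n / (1 - t) : ℝ) * x) + ((S.β k / t : ℝ) : ℂ) * (1 - x ^ 2) + e)
      = -(n / (1 - t) * x.re) + S.β k / t * (1 - x.re ^ 2 + x.im ^ 2) + e.re := by
    rw [Complex.reCLM_apply]
    simp only [Complex.add_re, Complex.neg_re, Complex.sub_re, pow_two,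
      Complex.mul_re, Complex.one_re, Complex.sub_im, Complex.mul_im, Complex.one_im,
      Complex.ofReal_re, Complex.ofReal_im]
    ring
  rw [hval] at hge
  have hq : (n : ℝ) ≤ n / (1 - t) := by
    rw [le_div_iff₀ (by linarith)]
    nlinarith
  have hβt : 0 < S.β k / t := div_pos hβ ht0
  have hβt' : 2 * (C + 1) ≤ S.β k / t := by
    rw [le_div_iff₀ ht0]
    rw [le_div_iff₀ (by positivity)] at htβ
    linarith
  have hsq : 0 ≤ 1 - x.re ^ 2 + x.im ^ 2 := by nlinarith [sq_nonneg x.im]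
  change x.re < 0 at hneg
  rcases le_or_gt x.re (-(1 / 2)) with hx | hx
  · have := mul_nonneg hβt.le hsq
    nlinarith
  · have h34 : 3 / 4 ≤ 1 - x.re ^ 2 + x.im ^ 2 := by nlinarith [sq_nonneg x.im]
    have := mul_le_mul hβt' h34 (by norm_num) hβt.le
    nlinarith

lemma exists_im_radRat_le (k : Fin m) : ∃ C : ℝ, 0 ≤ C ∧ ∃ s₀ : ℝ, 0 < s₀ ∧ s₀ ≤ 1 / 2 ∧
    ∀ᶠ n : ℕ in atTop, ∀ s ∈ Ioc 0 s₀, |(S.radRat Φ n k s).im| ≤ C * s := by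
  obtain ⟨C, hC, s₀, hs0, hs2, h⟩ := S.exists_hasDerivAt_radRat_real H k
  obtain ⟨s₁, hs1, hs3, h'⟩ : ∃ s₁ : ℝ, 0 < s₁ ∧ s₁ ≤ 1 / 2 ∧ ∀ᶠ n : ℕ in atTop, ∀ s ∈ Ioc 0 s₁,
      0 < S.β k → 0 ≤ (S.radRat Φ n k s).re := by
    by_cases hβ : 0 < S.β k
    · obtain ⟨s₁, hs1, hs3, h'⟩ := S.exists_re_radRat_nonneg H k hβ
      exact ⟨s₁, hs1, hs3, h'.mono fun n hn s hs _ => hn s hs⟩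
    · exact ⟨1 / 2, by norm_num, le_rfl, Eventually.of_forall fun n s hs hb => (hβ hb).elim⟩
  set κ := 2 * max (-S.β k) 0 with hκ
  have hκ1 : κ < 1 := by
    have := S.hβ k
    rw [hκ, mul_max_of_nonneg _ _ (by norm_num)]
    exact max_lt (by linarith) (by norm_num)
  have hκ0 : 0 ≤ κ := by rw [hκ]; positivity
  have hκβ : -(2 * S.β k) ≤ κ := by rw [hκ]; linarith [le_max_left (-S.β k) 0]
  have hκ1' : 0 < 1 - κ := sub_pos.2 hκ1
  have hC2 : 0 ≤ C := hC
  refine ⟨C / (1 - κ), by positivity, min s₀ s₁, lt_min hs0 hs1, (min_le_left _ _).trans hs2, ?_⟩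
  filter_upwards [h, h'] with n hn hn'
  choose! e he hd using hn
  have hF (s : ℝ) (hs : s ∈ Ioc 0 (min s₀ s₁)) :=
    (Complex.imCLM.hasFDerivAt.comp_hasDerivAt s
      (hd s ⟨hs.1, hs.2.trans (min_le_left _ _)⟩)).pow 2
  have hmain := sqrt_le_of_singular_deriv_le (κ := κ) (C := C) hκ1 hC2 hF ?_
    (fun s _ => by simp only [Pi.pow_apply]; positivity) ?_
  · intro s hs
    have := hmain s hs
    simp only [Pi.pow_apply, Function.comp_apply, Real.sqrt_sq_eq_abs] at this
    refine this.trans (le_of_eq (by ring))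
  · refine IsBigO.pow ?_ 2
    refine IsBigO.trans ?_ (S.isBigO_one_sub_radRat H n k)
    refine IsBigO.of_bound 1 (Eventually.of_forall fun s => ?_)
    have := Complex.abs_im_le_norm (1 - S.radRat Φ n k s)
    simpa using this
  · intro s hs
    have hs1 : s ≤ 1 := by linarith [hs.2.trans (min_le_left _ _)]
    have hxn := S.norm_radRat_le H n k hs.1.le hs1
    have hpos := hn' s ⟨hs.1, hs.2.trans (min_le_right _ _)⟩
    have hei := (Complex.abs_im_le_norm (e s)).trans (he s ⟨hs.1, hs.2.trans (min_le_left _ _)⟩)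
    simp only [Pi.pow_apply, Function.comp_apply, Real.sqrt_sq_eq_abs, Complex.imCLM_apply]
    set x := S.radRat Φ n k s
    have hX := abs_le.1 ((Complex.abs_re_le_norm x).trans hxn)
    have hval : (-((n / (1 - s) : ℝ) * x) + ((S.β k / s : ℝ) : ℂ) * (1 - x ^ 2) + e s).im
        = -(n / (1 - s) * x.im) + S.β k / s * (-(2 * x.re * x.im)) + (e s).im := by
      simp only [Complex.add_im, Complex.neg_im, Complex.sub_im, pow_two,
        Complex.mul_im, Complex.one_im, Complex.ofReal_re, Complex.ofReal_im, Complex.sub_re,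
        Complex.mul_re, Complex.one_re]
      ring
    rw [hval]
    have hq : 0 ≤ (n : ℝ) / (1 - s) := div_nonneg (by positivity) (by linarith)
    have hkey : -(2 * S.β k * x.re) ≤ κ := by
      by_cases hb : 0 < S.β k
      · have := mul_nonneg hb.le (hpos hb); linarith
      · nlinarith
    have i1 : (-(2 * S.β k * x.re)) * (x.im ^ 2 / s) ≤ κ * (x.im ^ 2 / s) :=
      mul_le_mul_of_nonneg_right hkey (div_nonneg (sq_nonneg _) hs.1.le)
    have i2 : x.im * (e s).im ≤ C * |x.im| := by
      refine (le_abs_self _).trans ?_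
      rw [abs_mul, mul_comm]
      exact mul_le_mul_of_nonneg_right hei (abs_nonneg _)
    have i3 : 0 ≤ (n : ℝ) / (1 - s) * x.im ^ 2 := mul_nonneg hq (sq_nonneg _)
    have e1 : ((2 : ℕ) : ℝ) * x.im ^ (2 - 1) * (-(n / (1 - s) * x.im) +
        S.β k / s * (-(2 * x.re * x.im)) + (e s).im) = 2 * (-(n / (1 - s) * x.im ^ 2) +
        (-(2 * S.β k * x.re)) * (x.im ^ 2 / s) + x.im * (e s).im) := by
      push_cast
      ring
    rw [e1]
    have e2 : 2 * κ * x.im ^ 2 / s = 2 * (κ * (x.im ^ 2 / s)) := by ring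
    rw [e2]
    linarith

end SData

end OPUC

namespace OPUC

open scoped ComplexConjugate Topology NNReal ENNReal
open Asymptotics

namespace SData

variable {m : ℕ} (S : SData m) {Φ : ℕ → ℂ[X]} (H : OPS S.meas Φ)

include H

lemma ph_eq_phase (n : ℕ) (k : Fin m) :
    S.ph Φ n k = conj ((rev Φ n).eval (S.a k)) / (rev Φ n).eval (S.a k) := by
  have h : conj ((rev Φ n).eval (S.a k)) = conj (S.a k) ^ n * (Φ n).eval (S.a k) := by
    rw [H.rev_eval_circle n (S.norm_a k), map_mul, map_pow, Complex.conj_conj]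
  rw [ph, tau, h]
  ring

lemma exists_ph_sub_phase_le (k : Fin m) : ∃ C : ℝ, 0 ≤ C ∧ ∃ s₀ : ℝ, 0 < s₀ ∧ s₀ ≤ 1 / 2 ∧
    ∀ᶠ n : ℕ in atTop, ∀ s ∈ Ioc 0 s₀, ‖S.ph Φ n k -
      conj ((rev Φ n).eval (((1 - s : ℝ) : ℂ) * S.a k)) /
        (rev Φ n).eval (((1 - s : ℝ) : ℂ) * S.a k)‖ ≤ C * s := by
  obtain ⟨C₁, hC₁, s₁, hs1, hs1', h₁⟩ := S.exists_radial_ode H k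
  obtain ⟨C₂, hC₂, s₂, hs2, hs2', h₂⟩ := S.exists_one_sub_radRat_le H k
  obtain ⟨C₃, hC₃, s₃, hs3, hs3', h₃⟩ := S.exists_im_radRat_le H k
  obtain ⟨Cg, hCg, hg⟩ := S.exists_g_sub_le H
  set M := |S.β k| * C₃ + Cg * C₂ + C₁ with hM
  have hM0 : 0 ≤ M := by positivity
  set s₀ := min s₁ (min s₂ s₃) with hs₀
  have hs01 : s₀ ≤ s₁ := min_le_left _ _
  have hs02 : s₀ ≤ s₂ := (min_le_right _ _).trans (min_le_left _ _)
  have hs03 : s₀ ≤ s₃ := (min_le_right _ _).trans (min_le_right _ _)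
  refine ⟨4 * M, by positivity, s₀, lt_min hs1 (lt_min hs2 hs3), hs01.trans hs1', ?_⟩
  filter_upwards [h₁, h₂, h₃, hg, eventually_ge_atTop 1] with n hn₁ hn₂ hn₃ hgn hn1
  have hn0 : (0 : ℝ) < n := by exact_mod_cast hn1
  set P : ℝ → ℂ := fun s => (rev Φ n).eval (((1 - s : ℝ) : ℂ) * S.a k) with hP
  set P' : ℝ → ℂ := fun s => -(S.a k * (derivative (rev Φ n)).eval (((1 - s : ℝ) : ℂ) * S.a k))
  have hPd (s : ℝ) : HasDerivAt P (P' s) s := S.hasDerivAt_radial k (rev Φ n) s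
  have hP0 {s : ℝ} (h0 : 0 ≤ s) (h1 : s ≤ s₀) : P s ≠ 0 :=
    S.rev_radial_ne_zero H n k h0 (by linarith)
  set y : ℝ → ℂ := fun s => conj (P s) / P s with hy
  have hyd (s : ℝ) (h0 : 0 ≤ s) (h1 : s ≤ s₀) :
      HasDerivAt y ((conj (P' s) * P s - conj (P s) * P' s) / P s ^ 2) s := by
    have hc : HasDerivAt (fun s => conj (P s)) (conj (P' s)) s := by
      have := Complex.conjCLE.toContinuousLinearMap.hasFDerivAt.comp_hasDerivAt s (hPd s)
      exact this
    exact hc.div (hPd s) (hP0 h0 h1)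
  have hbd : ∀ s ∈ Ioc 0 s₀, ‖(conj (P' s) * P s - conj (P s) * P' s) / P s ^ 2‖ ≤ 4 * M := by
    intro s hs
    have hPs := hP0 hs.1.le hs.2
    obtain ⟨ho, -⟩ := hn₁ s ⟨hs.1, hs.2.trans hs01⟩ _ rfl
    have hx := hn₂ s ⟨hs.1, hs.2.trans hs02⟩
    have hxi := hn₃ s ⟨hs.1, hs.2.trans hs03⟩
    have hd := hgn k
    change ‖_ - P s * (conj (S.g Φ n k) * ((1 - S.radRat Φ n k s) / s))‖ ≤ C₁ * ‖P s‖ at ho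
    set x := S.radRat Φ n k s
    set g := S.g Φ n k
    have hs' : (s : ℂ) ≠ 0 := by exact_mod_cast hs.1.ne'
    have hs1' : (0 : ℝ) < 1 - s := by linarith [hs.2]
    have hs'' : ((1 - s : ℝ) : ℂ) ≠ 0 := by exact_mod_cast hs1'.ne'
    set q := P' s / P s with hq
    have hPn : 0 < ‖P s‖ := norm_pos_iff.2 hPs
    have ho' : ‖((1 - s : ℝ) : ℂ) * q + conj g * ((1 - x) / s)‖ ≤ C₁ := by
      have : ((1 - s : ℝ) : ℂ) * q + conj g * ((1 - x) / s) = -((((1 - s : ℝ) : ℂ) * S.a k *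
          (derivative (rev Φ n)).eval (((1 - s : ℝ) : ℂ) * S.a k) -
          P s * (conj g * ((1 - x) / s))) / P s) := by
        rw [hq]
        simp only [P']
        field_simp
        ring
      rw [this, norm_neg, norm_div, div_le_iff₀ hPn]
      exact ho
    have him : |(((1 - s : ℝ) : ℂ) * q).im| ≤ M := by
      have hsplit : ((1 - s : ℝ) : ℂ) * q = (((1 - s : ℝ) : ℂ) * q + conj g * ((1 - x) / s)) -
          ((S.β k / s : ℝ) : ℂ) * (1 - x) - conj (g - S.β k) * ((1 - x) / s) := by
        simp only [map_sub, Complex.conj_ofReal]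
        push_cast
        ring
      rw [hsplit, Complex.sub_im, Complex.sub_im, Complex.im_ofReal_mul]
      have j1 := (Complex.abs_im_le_norm _).trans ho'
      have j2 : |S.β k / s * (1 - x).im| ≤ |S.β k| * C₃ := by
        rw [abs_mul, abs_div, abs_of_pos hs.1, Complex.sub_im, Complex.one_im, zero_sub, abs_neg,
          div_mul_eq_mul_div, div_le_iff₀ hs.1, mul_assoc]
        gcongr
      have j3 : |(conj (g - S.β k) * ((1 - x) / s)).im| ≤ Cg * C₂ := by
        refine (Complex.abs_im_le_norm _).trans ?_
        rw [norm_mul, Complex.norm_conj, norm_div, Complex.norm_real, Real.norm_of_nonneg hs.1.le]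
        calc _ ≤ Cg / n * (C₂ * n) := by
              have := hs.1
              gcongr
              rw [div_le_iff₀ hs.1]
              exact hx
          _ = _ := by field_simp
      rw [abs_le] at *
      constructor <;> linarith [j1.1, j1.2, j2.1, j2.2, j3.1, j3.2]
    have hqi : |q.im| ≤ 2 * M := by
      rw [Complex.im_ofReal_mul, abs_mul, abs_of_pos hs1'] at him
      nlinarith [abs_nonneg q.im, hs.2]
    have e1 : (conj (P' s) * P s - conj (P s) * P' s) / P s ^ 2 =
        conj (P s) / P s * (conj q - q) := by
      have : conj (P s) ≠ 0 := (_root_.map_ne_zero _).2 hPs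
      rw [hq, map_div₀]
      field_simp
    rw [e1, norm_mul, norm_div, Complex.norm_conj, div_self hPn.ne', one_mul, ← norm_neg, neg_sub,
      Complex.sub_conj]
    rw [norm_mul, Complex.norm_I, mul_one, Complex.norm_real, Real.norm_eq_abs, abs_mul]
    norm_num
    linarith
  intro s hs
  have hlip : ∀ t ∈ Ioc 0 s₀, ‖y t - y s‖ ≤ 4 * M * ‖t - s‖ := fun t ht =>
    (convex_Ioc 0 s₀).norm_image_sub_le_of_norm_hasDerivWithin_le
      (fun r hr => (hyd r hr.1.le hr.2).hasDerivWithinAt) hbd hs ht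
  have hy0 : y 0 = S.ph Φ n k := by
    rw [S.ph_eq_phase H]
    simp [hy, hP]
  have hl1 : Tendsto (fun t => ‖y t - y s‖) (𝓝[>] 0) (𝓝 ‖y 0 - y s‖) :=
    (((hyd 0 le_rfl (hs.1.le.trans hs.2)).continuousAt.sub continuousAt_const).norm).tendsto.mono_left
      nhdsWithin_le_nhds
  have hl2 : Tendsto (fun t : ℝ => 4 * M * ‖t - s‖) (𝓝[>] 0) (𝓝 (4 * M * ‖(0 : ℝ) - s‖)) := by
    have : Continuous fun t : ℝ => 4 * M * ‖t - s‖ := by fun_prop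
    exact this.continuousAt.tendsto.mono_left nhdsWithin_le_nhds
  have hfin := le_of_tendsto_of_tendsto hl1 hl2 (by
    filter_upwards [Ioc_mem_nhdsGT (hs.1.trans_le hs.2)] with t ht using hlip t ht)
  rw [hy0, zero_sub, norm_neg, Real.norm_of_nonneg hs.1.le] at hfin
  exact hfin

/-- The phases at the singular points converge with rate `1/n`, and the limit is a radial limit. -/
lemma exists_ph_limit_radial (k : Fin m) : ∃ l : ℂ,
    (fun n => S.ph Φ n k - l) =O[atTop] q ∧
    Tendsto (fun s : ℝ => S.D (((1 - s : ℝ) : ℂ) * S.a k) / conj (S.D (((1 - s : ℝ) : ℂ) * S.a k)))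
      (𝓝[>] 0) (𝓝 l) := by
  obtain ⟨l, hl⟩ := S.exists_ph_limit H k
  refine ⟨l, hl, ?_⟩
  obtain ⟨C, hC, s₀, hs0, hs2, h⟩ := S.exists_ph_sub_phase_le H k
  have hlt : Tendsto (fun n => S.ph Φ n k) atTop (𝓝 l) := by
    have := (hl.trans_tendsto tendsto_q).add_const l
    simpa using this
  have hle : ∀ s ∈ Ioc 0 s₀, ‖S.D (((1 - s : ℝ) : ℂ) * S.a k) /
      conj (S.D (((1 - s : ℝ) : ℂ) * S.a k)) - l‖ ≤ C * s := by
    intro s hs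
    set z := ((1 - s : ℝ) : ℂ) * S.a k with hz
    have hzn : ‖z‖ < 1 := by
      rw [hz, S.norm_radial k (by linarith [hs.2])]
      linarith [hs.1]
    have ht := S.tendsto_rev H hzn
    have h0 := S.lim_ne_zero z
    have hphase : conj (S.lim z) / S.lim z = S.D z / conj (S.D z) := by
      have hD := S.D_ne_zero z
      have hD' : conj (S.D z) ≠ 0 := (_root_.map_ne_zero _).2 hD
      have hD0 : ((S.D0 : ℝ) : ℂ) ≠ 0 := by exact_mod_cast S.D0_pos.ne'
      rw [lim, map_div₀, Complex.conj_ofReal]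
      field_simp
    have ht2 : Tendsto (fun n => S.ph Φ n k - conj ((rev Φ n).eval z) / (rev Φ n).eval z) atTop
        (𝓝 (l - S.D z / conj (S.D z))) := by
      rw [← hphase]
      exact hlt.sub (((Complex.continuous_conj.tendsto _).comp ht).div ht h0)
    rw [norm_sub_rev]
    exact le_of_tendsto ht2.norm (h.mono fun n hn => hn s hs)
  rw [tendsto_iff_norm_sub_tendsto_zero]
  refine squeeze_zero' (Eventually.of_forall fun s => norm_nonneg _) ?_ (g := fun s => C * s) ?_
  · filter_upwards [Ioc_mem_nhdsGT hs0] with s hs using hle s hs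
  · have : Continuous fun s : ℝ => C * s := by fun_prop
    simpa using this.continuousAt.tendsto.mono_left (nhdsWithin_le_nhds (a := (0 : ℝ)))

end SData

end OPUC

namespace OPUC

open scoped ComplexConjugate Topology NNReal ENNReal
open Asymptotics

namespace SData

variable {m : ℕ} (S : SData m) {Φ : ℕ → ℂ[X]} (H : OPS S.meas Φ)

include H

/-- Interior asymptotics, in terms of the limiting phases. -/
lemma exists_norm_mul_eval_sub_le {l : Fin m → ℂ}
    (hl : ∀ k, (fun n => S.ph Φ n k - l k) =O[atTop] q) {r : ℝ} (hr0 : 0 ≤ r) (hr : r < 1) :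
    ∃ C : ℝ, 0 ≤ C ∧ ∀ᶠ n : ℕ in atTop, ∀ z : ℂ, ‖z‖ ≤ r →
      ‖n * (Φ n).eval z - S.lim z * ∑ k, S.β k * l k * S.a k ^ (n + 1) / (S.a k - z)‖ ≤ C / n := by
  set r' := (r + 1) / 2 with hr'
  have hrr' : r < r' := by rw [hr']; linarith
  have hr'1 : r' < 1 := by rw [hr']; linarith
  have hr1 : 0 < 1 - r := sub_pos.2 hr
  obtain ⟨C₁, hC₁, h₁⟩ := S.exists_norm_eval_le_div H (hr0.trans hrr'.le) hr'1
  obtain ⟨C₂, hC₂, h₂⟩ := S.exists_norm_rev_sub_lim_le H hr0 hr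
  obtain ⟨C₃, hC₃, h₃⟩ := S.exists_rem_le_div H hr
  obtain ⟨C₄, hC₄, h₄⟩ := S.exists_g_sub_le H
  obtain ⟨G, hG0, hG⟩ := S.exists_g_le H
  obtain ⟨C₅, hC₅, h₅⟩ := S.exists_norm_rev_le H hr
  choose A hA0 hA using fun k => (hl k).exists_nonneg
  have hA' : ∀ᶠ n : ℕ in atTop, ∀ k, ‖S.ph Φ n k - l k‖ ≤ A k / n := by
    rw [eventually_all]
    intro k
    filter_upwards [(hA k).bound, eventually_ge_atTop 1] with n hn hn1
    have hn0 : (0 : ℝ) < n := by exact_mod_cast hn1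
    refine hn.trans ?_
    rw [Real.norm_of_nonneg (q_pos n).le, q, div_eq_mul_inv]
    gcongr
    · exact hA0 k
    · linarith
  have hd : 0 < r' - r := sub_pos.2 hrr'
  set B : Fin m → ℝ := fun k => ((C₄ * C₅ + |S.β k| * A k * C₅ + |S.β k| * ‖l k‖ * C₂) + G * C₁) / (1 - r)
    with hB
  have hB0 (k : Fin m) : 0 ≤ B k := by have := hA0 k; positivity
  refine ⟨C₁ / (r' - r) + C₃ + ∑ k, B k, add_nonneg (by positivity)
    (Finset.sum_nonneg fun k _ => hB0 k), ?_⟩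
  filter_upwards [h₃, h₄, hG, hA', eventually_ge_atTop (max m 1)] with n hn₃ hn₄ hGn hAn hnm z hz
  have hm : m ≤ n := (le_max_left _ _).trans hnm
  have hn1 : 0 < n := (le_max_right _ _).trans hnm
  have hn0 : (0 : ℝ) < n := by exact_mod_cast hn1
  have hle {c : ℝ} (hc : 0 ≤ c) : c / (n + 1) ≤ c / n := by
    gcongr
    linarith
  have hz1 : ‖z‖ < 1 := hz.trans_lt hr
  have hne := S.one_sub_ne hz1
  have hode := S.ode H hm hn1 z hne
  have hΦ : ‖(Φ n).eval z‖ ≤ C₁ / n := (h₁ n z (hz.trans hrr'.le)).trans (hle hC₁)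
  have hΦ' : ‖z * (derivative (Φ n)).eval z‖ ≤ C₁ / (r' - r) / n := by
    have := norm_deriv_le_of_disk hrr' (Φ n).differentiable.differentiableOn (h₁ n) hz
    rw [Polynomial.deriv] at this
    rw [norm_mul]
    calc _ ≤ 1 * (C₁ / (n + 1) / (r' - r)) := mul_le_mul hz1.le this (norm_nonneg _) zero_le_one
      _ ≤ C₁ / n / (r' - r) := by
        rw [one_mul]
        exact div_le_div_of_nonneg_right (hle hC₁) hd.le
      _ = _ := by ring
  have hΨ := h₅ n z hz
  have hΨl : ‖(rev Φ n).eval z - S.lim z‖ ≤ C₂ / n := (h₂ n z hz).trans (hle hC₂)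
  have hrem := hn₃ z hz
  have hT (k : Fin m) : ‖S.g Φ n k * (S.tau Φ n k * (rev Φ n).eval z - (Φ n).eval z) /
      (1 - conj (S.a k) * z) - S.lim z * (S.β k * l k * S.a k ^ (n + 1) / (S.a k - z))‖ ≤ B k / n := by
    have hk := hne k
    have haz : S.a k - z = S.a k * (1 - conj (S.a k) * z) := by
      linear_combination z * mul_conj_one (S.norm_a k)
    have ha0 := ne_zero_of_norm_one (S.norm_a k)
    have hnk : 1 - r ≤ ‖1 - conj (S.a k) * z‖ := by
      rw [norm_one_sub_conj (S.norm_a k), norm_sub_rev]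
      have := norm_sub_norm_le (S.a k) z
      rw [S.norm_a] at this
      linarith
    have e1 : S.g Φ n k * (S.tau Φ n k * (rev Φ n).eval z - (Φ n).eval z) /
      (1 - conj (S.a k) * z) - S.lim z * (S.β k * l k * S.a k ^ (n + 1) / (S.a k - z)) =
      (S.a k ^ n * ((S.g Φ n k - S.β k) * S.ph Φ n k * (rev Φ n).eval z +
        S.β k * (S.ph Φ n k - l k) * (rev Φ n).eval z +
        S.β k * l k * ((rev Φ n).eval z - S.lim z)) - S.g Φ n k * (Φ n).eval z) /
        (1 - conj (S.a k) * z) := by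
      rw [S.tau_eq, haz, pow_succ]
      field_simp
      ring
    rw [e1, norm_div, div_le_iff₀ (by linarith)]
    have hβn : ‖(S.β k : ℂ)‖ = |S.β k| := by rw [Complex.norm_real, Real.norm_eq_abs]
    have i1 : ‖(S.g Φ n k - S.β k) * S.ph Φ n k * (rev Φ n).eval z‖ ≤ C₄ / n * C₅ := by
      rw [norm_mul, norm_mul, S.norm_ph H, mul_one]
      gcongr
      exact hn₄ k
    have i2 : ‖S.β k * (S.ph Φ n k - l k) * (rev Φ n).eval z‖ ≤ |S.β k| * (A k / n) * C₅ := by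
      rw [norm_mul, norm_mul, hβn]
      have := hA0 k
      gcongr
      exact hAn k
    have i3 : ‖S.β k * l k * ((rev Φ n).eval z - S.lim z)‖ ≤ |S.β k| * ‖l k‖ * (C₂ / n) := by
      rw [norm_mul, norm_mul, hβn]
      gcongr
    have i4 : ‖S.g Φ n k * (Φ n).eval z‖ ≤ G * (C₁ / n) := by
      rw [norm_mul]
      gcongr
      exact hGn k
    calc _ ≤ (C₄ / n * C₅ + |S.β k| * (A k / n) * C₅ + |S.β k| * ‖l k‖ * (C₂ / n)) + G * (C₁ / n) := by
          refine (norm_sub_le _ _).trans (add_le_add ?_ i4)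
          rw [norm_mul, norm_pow, S.norm_a, one_pow, one_mul]
          exact norm_add_le_of_le (norm_add_le_of_le i1 i2) i3
      _ = B k / n * (1 - r) := by
        rw [hB]
        field_simp
      _ ≤ _ := mul_le_mul_of_nonneg_left hnk (div_nonneg (hB0 k) hn0.le)
  have e2 : n * (Φ n).eval z - S.lim z * ∑ k, S.β k * l k * S.a k ^ (n + 1) / (S.a k - z) =
      z * (derivative (Φ n)).eval z - S.rem Φ n z +
      ∑ k, (S.g Φ n k * (S.tau Φ n k * (rev Φ n).eval z - (Φ n).eval z) /
      (1 - conj (S.a k) * z) - S.lim z * (S.β k * l k * S.a k ^ (n + 1) / (S.a k - z))) := by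
    rw [Finset.sum_sub_distrib, ← Finset.mul_sum]
    linear_combination -hode
  rw [e2]
  calc _ ≤ (C₁ / (r' - r) / n + C₃ / n) + ∑ k, B k / n :=
        norm_add_le_of_le ((norm_sub_le _ _).trans (add_le_add hΦ' hrem))
          ((norm_sum_le _ _).trans (Finset.sum_le_sum fun k _ => hT k))
    _ = _ := by
      rw [← Finset.sum_div]
      ring

end SData

end OPUC

namespace OPUC

open scoped ComplexConjugate Topology NNReal ENNReal
open Asymptotics

/-- The `j`-th Fourier coefficient of a function of the angle. -/
noncomputable def fcoef (h : ℝ → ℝ) (j : ℕ) : ℂ :=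
  (2 * π : ℝ)⁻¹ * ∫ θ in (0 : ℝ)..2 * π, conj (e θ) ^ j * (h θ : ℂ)

lemma fourier_natCast (j : ℕ) (θ : ℝ) : fourier (j : ℤ) (θ : AddCircle (2 * π)) = e θ ^ j := by
  have hπ : (π : ℂ) ≠ 0 := by exact_mod_cast Real.pi_ne_zero
  rw [fourier_coe_apply, e, ← Complex.exp_nat_mul]
  congr 1
  push_cast
  field_simp

lemma im_fcoef_zero (h : ℝ → ℝ) : (fcoef h 0).im = 0 := by
  rw [fcoef]
  simp only [pow_zero, one_mul]
  rw [intervalIntegral.integral_ofReal, ← Complex.ofReal_mul, Complex.ofReal_im]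

set_option maxHeartbeats 1000000 in
/-- A continuous periodic real function with summable Fourier coefficients is twice the real part
of a power series. -/
lemma eq_two_re_tsum {h : ℝ → ℝ} (hc : Continuous h) (hp : Function.Periodic h (2 * π))
    (hs : Summable fun j => ‖fcoef h j‖) {L : ℕ → ℂ} (hL0 : L 0 = fcoef h 0 / 2)
    (hL : ∀ j, L (j + 1) = fcoef h (j + 1)) (θ : ℝ) : h θ = 2 * (∑' j, L j * e θ ^ j).re := by
  have : Fact (0 < 2 * π) := ⟨by positivity⟩
  have hp' : Function.Periodic (fun θ => (h θ : ℂ)) (2 * π) := fun θ => by simp only [hp θ]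
  obtain ⟨F, hF⟩ : ∃ F : C(AddCircle (2 * π), ℂ), ∀ θ : ℝ, F (θ : AddCircle (2 * π)) = h θ :=
    ⟨⟨hp'.lift, continuous_coinduced_dom.2 (Complex.continuous_ofReal.comp hc)⟩,
      fun θ => hp'.lift_coe θ⟩
  have hpos (j : ℕ) : fourierCoeff F (j : ℤ) = fcoef h j := by
    rw [fourierCoeff_eq_intervalIntegral F _ 0, fcoef, zero_add, Complex.real_smul, one_div]
    congr 1
    refine intervalIntegral.integral_congr fun θ _ => ?_
    rw [hF, fourier_neg, fourier_natCast, map_pow, smul_eq_mul]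
  have hneg (j : ℕ) : fourierCoeff F (-(j : ℤ)) = conj (fcoef h j) := by
    rw [fourierCoeff_eq_intervalIntegral F _ 0, fcoef, zero_add, Complex.real_smul, one_div, map_mul,
      Complex.conj_ofReal, ← intervalIntegral.intervalIntegral_conj]
    congr 1
    refine intervalIntegral.integral_congr fun θ _ => ?_
    rw [hF, neg_neg, fourier_natCast, smul_eq_mul, map_mul, map_pow, Complex.conj_conj,
      Complex.conj_ofReal]
  have hsum1 : Summable fun j : ℕ => ‖fourierCoeff F (j : ℤ)‖ := by simpa only [hpos] using hs
  have hsum2 : Summable fun j : ℕ => ‖fourierCoeff F (-(j : ℤ))‖ := by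
    simpa only [hneg, Complex.norm_conj] using hs
  have hsum : Summable (fourierCoeff F) :=
    (Summable.of_nat_of_neg hsum1 hsum2).of_norm
  have key := has_pointwise_sum_fourier_series_of_summable hsum (θ : AddCircle (2 * π))
  rw [hF] at key
  have hen (j : ℕ) : ‖e θ ^ j‖ = 1 := by rw [norm_pow, norm_e, one_pow]
  have hS : Summable fun j => fcoef h j * e θ ^ j :=
    Summable.of_norm (by simpa only [norm_mul, hen, mul_one] using hs)
  have h1 : HasSum (fun j : ℕ => fourierCoeff F (j : ℤ) • fourier (j : ℤ) (θ : AddCircle (2 * π)))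
      (∑' j, fcoef h j * e θ ^ j) := by
    simp only [hpos, fourier_natCast, smul_eq_mul]
    exact hS.hasSum
  have h2 : HasSum (fun j : ℕ => fourierCoeff F (-((j : ℤ) + 1)) •
      fourier (-((j : ℤ) + 1)) (θ : AddCircle (2 * π)))
      (conj (∑' j, fcoef h (j + 1) * e θ ^ (j + 1))) := by
    have h3 := ((summable_nat_add_iff 1).2 hS).hasSum.mapL Complex.conjCLE.toContinuousLinearMap
    refine hasSum_of_eq h3 fun j => ?_
    rw [fourier_neg]
    have := hneg (j + 1)
    push_cast at this
    rw [this]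
    have := fourier_natCast (j + 1) θ
    push_cast at this
    rw [this, smul_eq_mul]
    simp
  have huniq := key.unique (HasSum.of_nat_of_neg_add_one h1 h2)
  have hLs : Summable fun j => L j * e θ ^ j := by
    rw [← summable_nat_add_iff 1]
    simpa only [hL] using (summable_nat_add_iff 1).2 hS
  have e1 := hS.tsum_eq_zero_add
  have e2 := hLs.tsum_eq_zero_add
  simp only [hL, hL0, pow_zero, mul_one] at e1 e2
  rw [e1] at huniq
  rw [e2]
  have h3 := congrArg Complex.re huniq
  simp only [Complex.add_re, Complex.conj_re, Complex.ofReal_re] at h3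
  rw [h3, Complex.add_re]
  have : (fcoef h 0 / 2).re = (fcoef h 0).re / 2 := by simp
  rw [this]
  ring

lemma integral_conj_e_pow_mul {h : ℝ → ℝ} {h' : ℝ → ℂ} (hp : Function.Periodic h (2 * π))
    (hd : ∀ θ, HasDerivAt (fun θ => (h θ : ℂ)) (h' θ) θ) (hc : Continuous h') {j : ℕ} (hj : j ≠ 0) :
    ∫ θ in (0 : ℝ)..2 * π, conj (e θ) ^ j * (h θ : ℂ) =
      (Complex.I * j)⁻¹ * ∫ θ in (0 : ℝ)..2 * π, conj (e θ) ^ j * h' θ := by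
  have hj' : (Complex.I * j : ℂ) ≠ 0 := mul_ne_zero Complex.I_ne_zero (by exact_mod_cast hj)
  have hu (θ : ℝ) : HasDerivAt (fun θ => conj (e θ) ^ j) (-(Complex.I * j) * conj (e θ) ^ j) θ := by
    have h1 : HasDerivAt (fun θ => conj (e θ)) (conj (Complex.I * e θ)) θ :=
      Complex.conjCLE.toContinuousLinearMap.hasFDerivAt.comp_hasDerivAt θ (hasDerivAt_e θ)
    refine (h1.pow j).congr_deriv ?_
    obtain ⟨i, rfl⟩ := Nat.exists_eq_succ_of_ne_zero hj
    simp only [map_mul, Complex.conj_I, Nat.succ_eq_add_one, Nat.add_sub_cancel]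
    ring
  have hce : Continuous fun θ => conj (e θ) ^ j := (Complex.continuous_conj.comp continuous_e).pow j
  have := intervalIntegral.integral_mul_deriv_eq_deriv_mul (a := 0) (b := 2 * π) (fun θ _ => hu θ)
    (fun θ _ => hd θ) (by apply Continuous.intervalIntegrable; fun_prop) (hc.intervalIntegrable _ _)
  have hp0 := hp 0
  have he0 := e_periodic 0
  rw [zero_add] at hp0 he0
  rw [hp0, he0, sub_self, zero_sub] at this
  rw [this, ← intervalIntegral.integral_neg, ← intervalIntegral.integral_const_mul]
  refine intervalIntegral.integral_congr fun θ _ => ?_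
  field_simp

/-- The logarithm of a positive function on the circle which extends to a nonvanishing analytic
function in an annulus is twice the real part of an analytic function in a larger disk. -/
lemma exists_log_eq {w : ℂ → ℂ} {R R' : ℝ} (hR : 1 < R) (hR' : R < R')
    (hw : ∀ z : ℂ, 1 ≤ ‖z‖ → ‖z‖ < R' → AnalyticAt ℂ w z)
    (hne : ∀ z : ℂ, 1 ≤ ‖z‖ → ‖z‖ < R' → w z ≠ 0)
    (hpos : ∀ z : ℂ, ‖z‖ = 1 → 0 < (w z).re ∧ (w z).im = 0) :
    ∃ L : ℕ → ℂ, (L 0).im = 0 ∧ (∃ C, ∀ j, ‖L j‖ * R ^ j ≤ C) ∧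
      ∀ t : ℂ, ‖t‖ = 1 → Real.log (w t).re = 2 * (∑' j, L j * t ^ j).re := by
  have hR0 : 0 < R := by linarith
  have hwe (θ : ℝ) : w (e θ) = ((w (e θ)).re : ℂ) := by
    apply Complex.ext <;> simp [(hpos _ (norm_e θ)).2]
  have han (θ : ℝ) : AnalyticAt ℂ w (e θ) := hw _ (norm_e θ).ge ((norm_e θ).trans_lt (hR.trans hR'))
  set h : ℝ → ℝ := fun θ => Real.log (w (e θ)).re with hh
  have hlog (θ : ℝ) : (h θ : ℂ) = Complex.log (w (e θ)) := by
    rw [hwe θ, ← Complex.ofReal_log (hpos _ (norm_e θ)).1.le]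
  set f : ℂ → ℂ := fun z => deriv w z / w z with hf
  have hfan : ∀ z : ℂ, 1 ≤ ‖z‖ → ‖z‖ < R' → AnalyticAt ℂ f z := fun z h1 h2 =>
    (hw z h1 h2).deriv.div (hw z h1 h2) (hne z h1 h2)
  have hd (θ : ℝ) : HasDerivAt (fun θ => (h θ : ℂ)) (Complex.I * e θ * f (e θ)) θ := by
    simp only [hlog]
    have h1 := (han θ).differentiableAt.hasDerivAt.comp θ (hasDerivAt_e θ)
    have h2 : w (e θ) ∈ Complex.slitPlane := Or.inl (hpos _ (norm_e θ)).1
    refine (h1.clog_real h2).congr_deriv ?_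
    rw [hf]
    simp only [Function.comp_apply]
    ring
  have hfe : Continuous fun θ => f (e θ) := continuous_iff_continuousAt.2 fun θ =>
    (hfan _ (norm_e θ).ge ((norm_e θ).trans_lt (hR.trans hR'))).continuousAt.comp
      continuous_e.continuousAt
  have hhc : Continuous h := by
    have : Continuous fun θ => (h θ : ℂ) := continuous_iff_continuousAt.2 fun θ => (hd θ).continuousAt
    exact Complex.continuous_re.comp this
  have hp : Function.Periodic h (2 * π) := fun θ => by simp only [hh, e_periodic θ]
  obtain ⟨M, hM⟩ := (isCompact_sphere (0 : ℂ) R).exists_bound_of_continuousOn (f := f) fun z hz => by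
    rw [mem_sphere_zero_iff_norm] at hz
    exact (hfan z (by linarith) (by linarith)).continuousAt.continuousWithinAt
  have hM0 : 0 ≤ M := (norm_nonneg _).trans (hM (R : ℂ) (by simp [abs_of_pos hR0]))
  have hcirc (j : ℕ) : ∫ θ in (0 : ℝ)..2 * π, conj (e θ) ^ j * (Complex.I * e θ * f (e θ)) =
      ∮ z in C(0, R), z⁻¹ ^ j * f z := by
    rw [Complex.circleIntegral_eq_of_differentiable_on_annulus_off_countable one_pos hR.le
      countable_empty]
    · rw [circleIntegral]
      refine intervalIntegral.integral_congr fun θ _ => ?_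
      have : circleMap 0 1 θ = e θ := by simp [circleMap, e]
      rw [deriv_circleMap, this, conj_eq_inv (norm_e θ), smul_eq_mul]
      ring
    · intro z hz
      have h1 : 1 ≤ ‖z‖ := by simpa using hz.2
      have h2 : ‖z‖ ≤ R := by simpa using hz.1
      have h0 : z ≠ 0 := norm_pos_iff.1 (by linarith)
      exact (((continuousAt_inv₀ h0).pow j).mul
        (hfan z h1 (by linarith)).continuousAt).continuousWithinAt
    · intro z hz
      have h1 : 1 < ‖z‖ := by simpa using hz.1.2
      have h2 : ‖z‖ < R := by simpa using hz.1.1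
      have h0 : z ≠ 0 := norm_pos_iff.1 (by linarith)
      exact ((differentiableAt_inv h0).pow j).mul (hfan z h1.le (by linarith)).differentiableAt
  have hbd (j : ℕ) : ‖fcoef h (j + 1)‖ * R ^ (j + 1) ≤ R * M := by
    have hj : j + 1 ≠ 0 := Nat.succ_ne_zero j
    rw [fcoef, integral_conj_e_pow_mul hp hd ((continuous_const.mul continuous_e).mul hfe) hj, hcirc]
    have hI := circleIntegral.norm_integral_le_of_norm_le_const (c := 0) (R := R)
      (f := fun z => z⁻¹ ^ (j + 1) * f z) (C := R⁻¹ ^ (j + 1) * M) hR0.le fun z hz => by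
        have hz' : ‖z‖ = R := by simpa using hz
        rw [norm_mul, norm_pow, norm_inv, hz']
        have := hM z hz
        gcongr
    rw [norm_mul, norm_mul, norm_inv, norm_mul, Complex.norm_I, one_mul, Complex.norm_real,
      Complex.norm_natCast, Real.norm_of_nonneg (by positivity : 0 ≤ (2 * π)⁻¹)]
    have hj1 : ((j + 1 : ℕ) : ℝ)⁻¹ ≤ 1 := inv_le_one_of_one_le₀ (by push_cast; linarith [Nat.cast_nonneg (α := ℝ) j])
    calc _ ≤ (2 * π)⁻¹ * (1 * (2 * π * R * (R⁻¹ ^ (j + 1) * M))) * R ^ (j + 1) := by gcongr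
      _ = R * M := by
        rw [inv_pow]
        field_simp
  set L : ℕ → ℂ := fun j => if j = 0 then fcoef h 0 / 2 else fcoef h j with hL
  have hL0 : L 0 = fcoef h 0 / 2 := by simp [hL]
  have hL1 (j : ℕ) : L (j + 1) = fcoef h (j + 1) := by simp [hL]
  refine ⟨L, ?_, ⟨max ‖L 0‖ (R * M), ?_⟩, ?_⟩
  · rw [hL0, Complex.div_im]
    simp [im_fcoef_zero]
  · rintro (_ | j)
    · simp
    · rw [hL1]
      exact (hbd j).trans (le_max_right _ _)
  · intro t ht
    obtain ⟨θ, rfl⟩ := exists_e ht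
    refine eq_two_re_tsum hhc hp ?_ hL0 hL1 θ
    rw [← summable_nat_add_iff 1]
    have hRinv : R⁻¹ < 1 := inv_lt_one_of_one_lt₀ hR
    refine Summable.of_nonneg_of_le (fun j => norm_nonneg _) (fun j => ?_)
      (((summable_geometric_of_lt_one (by positivity) hRinv).mul_left M))
    have := hbd j
    rw [← le_div_iff₀ (by positivity)] at this
    refine this.trans (le_of_eq ?_)
    rw [pow_succ, inv_pow]
    field_simp

end OPUC

namespace OPUC

open scoped ComplexConjugate Topology NNReal ENNReal
open Asymptotics

lemma abs_log_le {y : ℝ} (hy : 0 < y) (hy2 : y ≤ 2) : |Real.log y| ≤ 2 + 2 * y ^ (-(1 / 2) : ℝ) := by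
  have h0 : 0 < y ^ (-(1 / 2) : ℝ) := Real.rpow_pos_of_pos hy _
  rw [abs_le]
  constructor
  · have := Real.log_le_rpow_div (inv_nonneg.2 hy.le) (by norm_num : (0 : ℝ) < 1 / 2)
    rw [Real.log_inv, Real.inv_rpow hy.le, ← Real.rpow_neg hy.le] at this
    linarith
  · have := Real.log_le_sub_one_of_pos hy
    linarith

namespace SData

variable {m : ℕ} (S : SData m)

lemma norm_log_radial_le {t : ℂ} (ht : ‖t‖ = 1) {k : Fin m} (hk : t ≠ S.a k) {r : ℝ} (hr0 : 0 ≤ r)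
    (hr1 : r ≤ 1) : ‖Complex.log (1 - conj (S.a k) * (r * t))‖ ≤
      2 + π + 4 * ‖t - S.a k‖ ^ (-(1 / 2) : ℝ) := by
  have h1 := norm_sub_le_two_mul (S.norm_a k) ht hr0 hr1
  have hpos : 0 < ‖t - S.a k‖ := norm_pos_iff.2 (sub_ne_zero.2 hk)
  set y := ‖(r : ℂ) * t - S.a k‖ with hy
  have hy0 : 0 < y := by linarith
  have hy2 : y ≤ 2 := by
    refine (norm_sub_le _ _).trans ?_
    rw [S.norm_a]
    linarith [norm_radial_le ht hr0 hr1]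
  have h2 := Complex.norm_le_abs_re_add_abs_im (Complex.log (1 - conj (S.a k) * (r * t)))
  rw [Complex.log_re, Complex.log_im, norm_one_sub_conj (S.norm_a k), ← hy] at h2
  have h3 := abs_log_le hy0 hy2
  have h4 := Complex.abs_arg_le_pi (1 - conj (S.a k) * (r * t))
  have h5 : y ^ (-(1 / 2) : ℝ) ≤ 2 * ‖t - S.a k‖ ^ (-(1 / 2) : ℝ) := by
    have h6 : (‖t - S.a k‖ / 2) ^ (-(1 / 2) : ℝ) = (2 : ℝ) ^ (1 / 2 : ℝ) * ‖t - S.a k‖ ^ (-(1 / 2) : ℝ) := by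
      rw [Real.div_rpow hpos.le (by norm_num), Real.rpow_neg (by norm_num : (0 : ℝ) ≤ 2), div_inv_eq_mul, mul_comm]
    have h7 : (2 : ℝ) ^ (1 / 2 : ℝ) ≤ 2 ^ (1 : ℝ) :=
      Real.rpow_le_rpow_of_exponent_le (by norm_num) (by norm_num)
    rw [Real.rpow_one] at h7
    calc y ^ (-(1 / 2) : ℝ) ≤ (‖t - S.a k‖ / 2) ^ (-(1 / 2) : ℝ) :=
          Real.rpow_le_rpow_of_nonpos (by positivity) (by linarith) (by norm_num)
      _ ≤ _ := by rw [h6]; gcongr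
  linarith

lemma exists_norm_logD_radial_le : ∃ bd : ℝ → ℝ, IntervalIntegrable bd volume 0 (2 * π) ∧
    ∀ θ : ℝ, (∀ k, e θ ≠ S.a k) → ∀ r : ℝ, 0 ≤ r → r ≤ 1 → ‖S.logD (r * e θ)‖ ≤ bd θ := by
  obtain ⟨C, hC0, hC⟩ := S.exists_norm_ell_le
  refine ⟨fun θ => ∑ k, |S.β k| * (2 + π + 4 * ‖e θ - S.a k‖ ^ (-(1 / 2) : ℝ)) + C, ?_, ?_⟩
  · have := IntervalIntegrable.sum (μ := volume) (a := 0) (b := 2 * π) Finset.univ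
      (f := fun k θ => |S.β k| * (2 + π + 4 * ‖e θ - S.a k‖ ^ (-(1 / 2) : ℝ))) fun k _ =>
      ((by simp : IntervalIntegrable (fun _ : ℝ => 2 + π) volume 0 (2 * π)).add
        ((intervalIntegrable_rpow_norm_sub (by norm_num) (by norm_num) (S.norm_a k) _ _).const_mul
          4)).const_mul _
    simp only [Finset.sum_fn] at this
    exact this.add (by simp)
  · intro θ hθ r hr0 hr1
    refine norm_add_le_of_le ?_ (hC _ (norm_radial_le (norm_e θ) hr0 hr1))
    refine norm_sum_le_of_le _ fun k _ => ?_
    rw [norm_mul, Complex.norm_real, Real.norm_eq_abs]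
    exact mul_le_mul_of_nonneg_left (S.norm_log_radial_le (norm_e θ) (hθ k) hr0 hr1) (abs_nonneg _)

lemma log_W {t : ℂ} (h : ∀ k, t ≠ S.a k) :
    (Real.log (S.W t) : ℂ) = S.logD t + conj (S.logD t) := by
  rw [Complex.add_conj, re_logD, W, Real.log_mul (Real.exp_pos _).ne', Real.log_exp,
    Real.log_prod]
  · have (k : Fin m) : Real.log (‖t - S.a k‖ ^ (2 * S.β k)) = 2 * (S.β k * Real.log ‖t - S.a k‖) := by
      rw [Real.log_rpow (norm_pos_iff.2 (sub_ne_zero.2 (h k)))]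
      ring
    simp only [this, ← Finset.mul_sum]
    congr 1
    ring
  · exact fun k _ => (Real.rpow_pos_of_pos (norm_pos_iff.2 (sub_ne_zero.2 (h k))) _).ne'
  · exact Finset.prod_ne_zero_iff.2 fun k _ =>
      (Real.rpow_pos_of_pos (norm_pos_iff.2 (sub_ne_zero.2 (h k))) _).ne'

/-- Schwarz's formula for the Szegő function. -/
lemma integral_log_W {z : ℂ} (hz : ‖z‖ < 1) :
    ∫ θ in (0 : ℝ)..2 * π, (Real.log (S.W (e θ)) : ℂ) * ((e θ + z) / (e θ - z)) =
      4 * π * S.logD z := by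
  obtain ⟨bd, hbd, hle⟩ := S.exists_norm_logD_radial_le
  set ψ : ℝ → ℂ := fun θ => 2 * (1 - z * conj (e θ))⁻¹ - 1 with hψ
  have hne (θ : ℝ) : 1 - z * conj (e θ) ≠ 0 := fun h => by
    have : ‖z * conj (e θ)‖ = 1 := by rw [← sub_eq_zero.1 h, norm_one]
    rw [norm_mul, Complex.norm_conj, norm_e, mul_one] at this
    linarith
  have hψc : Continuous ψ := (continuous_const.mul ((continuous_const.sub (continuous_const.mul
      (Complex.continuous_conj.comp continuous_e))).inv₀ hne)).sub continuous_const
  have hψc' : Continuous fun θ => conj (ψ θ) := Complex.continuous_conj.comp hψc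
  have hker (θ : ℝ) : (e θ + z) / (e θ - z) = ψ θ := by
    have h0 := ne_zero_of_norm_one (norm_e θ)
    have h1 : e θ - z ≠ 0 := fun h => by
      rw [← sub_eq_zero.1 h, norm_e] at hz; exact lt_irrefl _ hz
    have h2 := hne θ
    have h3 : 1 - z * conj (e θ) = (e θ - z) / e θ := by
      rw [conj_eq_inv (norm_e θ)]; field_simp
    rw [hψ]
    beta_reduce
    rw [h3]
    field_simp
    ring
  have hlim : ∀ᵐ θ : ℝ, Tendsto (fun r : ℝ => S.logD (r * e θ)) (𝓝[<] 1) (𝓝 (S.logD (e θ))) :=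
    S.ae_ne.mono fun θ hθ =>
      tendsto_radial (S.logD_differentiableAt (norm_e θ).le hθ).continuousAt
  have hbd' : ∀ᵐ θ : ℝ, ∀ r : ℝ, 0 ≤ r → r < 1 → ‖S.logD (r * e θ)‖ ≤ bd θ :=
    S.ae_ne.mono fun θ hθ r h0 h1 => hle θ hθ r h0 h1.le
  have hcont := S.logD_differentiableOn.continuousOn
  have t1 := tendsto_integral_radial hcont hψc hbd hbd' hlim
  have t2 := tendsto_integral_radial hcont hψc' hbd hbd' hlim
  have hdil {r : ℝ} (hr0 : 0 ≤ r) (hr1 : r < 1) :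
      DifferentiableOn ℂ (fun w : ℂ => S.logD (r * w)) (closedBall 0 1) := by
    intro w hw
    have hw' : ‖w‖ ≤ 1 := by simpa using hw
    have hrw : ‖(r : ℂ) * w‖ < 1 := by
      rw [norm_mul, Complex.norm_of_nonneg hr0]
      nlinarith [norm_nonneg w]
    have h1 := S.logD_differentiableAt hrw.le (S.ne_a hrw)
    have h2 : DifferentiableAt ℂ (fun w : ℂ => (r : ℂ) * w) w := by fun_prop
    exact (DifferentiableAt.comp w h1 h2).differentiableWithinAt
  have hr : ∀ᶠ r : ℝ in 𝓝[<] 1, 0 ≤ r ∧ r < 1 := by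
    filter_upwards [Ioo_mem_nhdsLT (zero_lt_one' ℝ)] with r hr using ⟨hr.1.le, hr.2⟩
  have hcirc {f : ℂ → ℂ} (hf : DifferentiableOn ℂ f (closedBall 0 1)) : DiffContOnCl ℂ f (ball 0 1) :=
    ⟨hf.mono ball_subset_closedBall, by rw [closure_ball _ one_ne_zero]; exact hf.continuousOn⟩
  have hmean {f : ℂ → ℂ} (hf : DifferentiableOn ℂ f (closedBall 0 1)) :
      ∫ θ in (0 : ℝ)..2 * π, f (e θ) = 2 * π * f 0 := by
    have := cauchy_circle (hcirc hf) (z := 0) (by simp)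
    simpa using this
  have v1 : ∫ θ in (0 : ℝ)..2 * π, S.logD (e θ) * ψ θ = 2 * (2 * π * S.logD z) - 2 * π * S.logD 0 := by
    refine tendsto_nhds_unique t1 ?_
    have h2 : Tendsto (fun r : ℝ => 2 * (2 * π * S.logD (r * z)) - 2 * π * S.logD 0) (𝓝[<] 1)
        (𝓝 (2 * (2 * π * S.logD z) - 2 * π * S.logD 0)) :=
      (((tendsto_radial (S.logD_differentiableAt hz.le (S.ne_a hz)).continuousAt).const_mul _).const_mul
        _).sub tendsto_const_nhds
    refine h2.congr' ?_
    filter_upwards [hr] with r hr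
    have hd := hdil hr.1 hr.2
    have c1 := cauchy_circle (hcirc hd) hz
    have c2 := hmean hd
    rw [mul_zero] at c2
    rw [← c1, ← c2, ← intervalIntegral.integral_const_mul, ← intervalIntegral.integral_sub]
    · refine intervalIntegral.integral_congr fun θ _ => ?_
      rw [hψ]
      ring
    · refine Continuous.intervalIntegrable ?_ _ _
      have : Continuous fun θ => S.logD (r * e θ) := hd.continuousOn.comp_continuous continuous_e
        fun θ => by simp [norm_e]
      exact continuous_const.mul (this.mul ((continuous_const.sub (continuous_const.mul
        (Complex.continuous_conj.comp continuous_e))).inv₀ hne))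
    · refine Continuous.intervalIntegrable ?_ _ _
      exact hd.continuousOn.comp_continuous continuous_e fun θ => by simp [norm_e]
  have v2 : ∫ θ in (0 : ℝ)..2 * π, S.logD (e θ) * conj (ψ θ) = 2 * π * S.logD 0 := by
    refine tendsto_nhds_unique t2 (tendsto_const_nhds.congr' ?_)
    filter_upwards [hr] with r hr
    have hd := hdil hr.1 hr.2
    have hk : DifferentiableOn ℂ (fun w : ℂ => S.logD (r * w) * (2 * (1 - conj z * w)⁻¹ - 1))
        (closedBall 0 1) := by
      refine hd.mul ?_
      refine ((DifferentiableOn.inv (by fun_prop) fun w hw h => ?_).const_mul 2).sub_const 1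
      have hw' : ‖w‖ ≤ 1 := by simpa using hw
      have : ‖conj z * w‖ = 1 := by rw [← sub_eq_zero.1 h, norm_one]
      rw [norm_mul, Complex.norm_conj] at this
      nlinarith [norm_nonneg w, norm_nonneg z]
    have c := hmean hk
    simp only [mul_zero, sub_zero, inv_one, mul_one] at c
    have e3 : (2 : ℂ) - 1 = 1 := by norm_num
    rw [e3, mul_one] at c
    rw [← c]
    refine intervalIntegral.integral_congr fun θ _ => ?_
    simp [hψ, Complex.conj_ofNat]
  have v2' : ∫ θ in (0 : ℝ)..2 * π, conj (S.logD (e θ)) * ψ θ = 2 * π * S.logD 0 := by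
    have := congrArg conj v2
    rw [← intervalIntegral.intervalIntegral_conj] at this
    simp only [map_mul, Complex.conj_conj] at this
    rw [this, S.logD_zero]
    simp [Complex.conj_ofNat]
  have hintg : IntervalIntegrable (fun θ => S.logD (e θ)) volume 0 (2 * π) := by
    refine hbd.mono_fun ?_ ?_
    · refine Measurable.aestronglyMeasurable ?_
      refine Measurable.add (Finset.measurable_fun_sum _ fun k _ => ?_) S.continuous_ell_e.measurable
      exact (Complex.measurable_log.comp (continuous_const.sub
        (continuous_const.mul continuous_e)).measurable).const_mul _
    · refine ae_restrict_of_ae (S.ae_ne.mono fun θ hθ => ?_)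
      have := hle θ hθ 1 zero_le_one le_rfl
      rw [Complex.ofReal_one, one_mul] at this
      exact this.trans (le_abs_self _)
  have hintg' : IntervalIntegrable (fun θ => conj (S.logD (e θ))) volume 0 (2 * π) :=
    ⟨Complex.conjCLE.toContinuousLinearMap.integrable_comp hintg.1,
      Complex.conjCLE.toContinuousLinearMap.integrable_comp hintg.2⟩
  have hsum : ∫ θ in (0 : ℝ)..2 * π, (Real.log (S.W (e θ)) : ℂ) * ((e θ + z) / (e θ - z)) =
      ∫ θ in (0 : ℝ)..2 * π, (S.logD (e θ) * ψ θ + conj (S.logD (e θ)) * ψ θ) := by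
    refine intervalIntegral.integral_congr_ae (S.ae_ne.mono fun θ hθ _ => ?_)
    rw [S.log_W hθ, hker, add_mul]
  rw [hsum, intervalIntegral.integral_add (hintg.mul_continuousOn hψc.continuousOn)
    (hintg'.mul_continuousOn hψc.continuousOn), v1, v2']
  ring

end SData

end OPUC

namespace OPUC

open scoped ComplexConjugate Topology NNReal ENNReal
open Asymptotics

lemma arg_one_sub_e {x : ℝ} (hx0 : 0 < x) (hx : x < π) : Complex.arg (1 - e x) = (x - π) / 2 := by
  have h : 1 - e x = ((2 * Real.sin (x / 2) : ℝ) : ℂ) *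
      (Complex.cos (((x - π) / 2 : ℝ) : ℂ) + Complex.sin (((x - π) / 2 : ℝ) : ℂ) * Complex.I) := by
    have h1 : (x - π) / 2 = x / 2 - π / 2 := by ring
    have h2 : (x : ℝ) = 2 * (x / 2) := by ring
    rw [h1, ← Complex.ofReal_cos, ← Complex.ofReal_sin, Real.cos_sub_pi_div_two,
      Real.sin_sub_pi_div_two, e, Complex.exp_mul_I, ← Complex.ofReal_cos, ← Complex.ofReal_sin]
    nth_rewrite 1 [h2]
    nth_rewrite 2 [h2]
    rw [Real.cos_two_mul, Real.sin_two_mul]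
    have h3 := Complex.sin_sq_add_cos_sq ((x / 2 : ℝ) : ℂ)
    push_cast at h3 ⊢
    linear_combination (-2 : ℂ) * h3
  rw [h, Complex.arg_mul_cos_add_sin_mul_I]
  · exact mul_pos two_pos (Real.sin_pos_of_pos_of_lt_pi (by linarith) (by linarith))
  · constructor <;> linarith

namespace SData

variable {m : ℕ} (S : SData m)

/-- The logarithm of the Szegő function without the factor belonging to `a k`. -/
noncomputable def logF (k : Fin m) (z : ℂ) : ℂ :=
  ∑ j ∈ Finset.univ.erase k, S.β j * Complex.log (1 - conj (S.a j) * z) + S.ell z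

lemma logD_eq_logF (k : Fin m) (z : ℂ) :
    S.logD z = S.β k * Complex.log (1 - conj (S.a k) * z) + S.logF k z := by
  rw [logD, logF, ← Finset.add_sum_erase _ _ (Finset.mem_univ k), add_assoc]

lemma continuousAt_logF (k : Fin m) : ContinuousAt (S.logF k) (S.a k) := by
  unfold logF
  refine ContinuousAt.add (tendsto_finsetSum _ fun j hj => ?_) ?_
  · have hne : S.a k ≠ S.a j := fun h => (Finset.ne_of_mem_erase hj) (S.inj h).symm
    have h1 : ContinuousAt (fun z : ℂ => 1 - conj (S.a j) * z) (S.a k) := by fun_prop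
    exact (h1.clog (Or.inl (one_sub_conj_re_pos (S.norm_a j) (S.norm_a k).le hne))).const_mul _
  · refine (S.differentiableAt_ell ?_).continuousAt
    rw [S.norm_a]; exact S.one_lt_R

lemma D_div_conj (k : Fin m) (z : ℂ) : S.D z / conj (S.D z) =
    Complex.exp (2 * S.β k * Complex.arg (1 - conj (S.a k) * z) * Complex.I) *
      Complex.exp (S.logF k z - conj (S.logF k z)) := by
  rw [D, ← Complex.exp_conj, ← Complex.exp_sub, ← Complex.exp_add, S.logD_eq_logF k, map_add,
    map_mul, Complex.conj_ofReal]
  congr 1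
  have h := Complex.sub_conj (Complex.log (1 - conj (S.a k) * z))
  rw [Complex.log_im] at h
  push_cast at h
  linear_combination (S.β k : ℂ) * h

lemma tendsto_D_div_conj_radial (k : Fin m) :
    Tendsto (fun s : ℝ => S.D (((1 - s : ℝ) : ℂ) * S.a k) / conj (S.D (((1 - s : ℝ) : ℂ) * S.a k)))
      (𝓝[>] 0) (𝓝 (Complex.exp (S.logF k (S.a k) - conj (S.logF k (S.a k))))) := by
  have h1 : Tendsto (fun s : ℝ => ((1 - s : ℝ) : ℂ) * S.a k) (𝓝[>] 0) (𝓝 (S.a k)) := by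
    have : ContinuousAt (fun s : ℝ => ((1 - s : ℝ) : ℂ) * S.a k) 0 := by fun_prop
    have h := this.tendsto
    simp only [sub_zero, Complex.ofReal_one, one_mul] at h
    exact h.mono_left nhdsWithin_le_nhds
  have h2 := (S.continuousAt_logF k).tendsto.comp h1
  have h3 := (Complex.continuous_exp.tendsto _).comp
    (h2.sub ((Complex.continuous_conj.tendsto _).comp h2))
  refine h3.congr' ?_
  filter_upwards [self_mem_nhdsWithin] with s hs
  have h4 : 1 - conj (S.a k) * (((1 - s : ℝ) : ℂ) * S.a k) = (s : ℂ) := by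
    have := mul_conj_one (S.norm_a k)
    push_cast
    linear_combination (s - 1 : ℂ) * this
  rw [S.D_div_conj k, h4, Complex.arg_ofReal_of_nonneg (le_of_lt hs)]
  simp

lemma tendsto_circle (k : Fin m) : Tendsto (fun x : ℝ => S.a k * e x) (𝓝[>] 0) (𝓝 (S.a k)) := by
  have : Continuous (fun x : ℝ => S.a k * e x) := continuous_const.mul continuous_e
  have h := this.tendsto 0
  have he : e 0 = 1 := by simp [e]
  rw [he, mul_one] at h
  exact h.mono_left nhdsWithin_le_nhds

lemma tendsto_D_div_conj_circle (k : Fin m) :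
    Tendsto (fun x : ℝ => Complex.exp (((π * S.β k : ℝ) : ℂ) * Complex.I) *
      (S.D (S.a k * e x) / conj (S.D (S.a k * e x))))
      (𝓝[>] 0) (𝓝 (Complex.exp (S.logF k (S.a k) - conj (S.logF k (S.a k))))) := by
  have h1 := S.tendsto_circle k
  have h2 := (S.continuousAt_logF k).tendsto.comp h1
  have h3 := (Complex.continuous_exp.tendsto _).comp
    (h2.sub ((Complex.continuous_conj.tendsto _).comp h2))
  have h4 : Tendsto (fun x : ℝ => Complex.exp (S.β k * x * Complex.I)) (𝓝[>] 0) (𝓝 1) := by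
    have : Continuous (fun x : ℝ => Complex.exp (S.β k * x * Complex.I)) := by fun_prop
    have h := this.tendsto 0
    simp only [Complex.ofReal_zero, mul_zero, zero_mul, Complex.exp_zero] at h
    exact h.mono_left nhdsWithin_le_nhds
  have h5 := h4.mul h3
  rw [one_mul] at h5
  refine h5.congr' ?_
  filter_upwards [Ioo_mem_nhdsGT Real.pi_pos] with x hx
  have h6 : 1 - conj (S.a k) * (S.a k * e x) = 1 - e x := by
    have := mul_conj_one (S.norm_a k)
    linear_combination -e x * this
  rw [S.D_div_conj k, h6, arg_one_sub_e hx.1 hx.2, ← mul_assoc, ← Complex.exp_add]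
  refine congrArg₂ _ (congrArg _ ?_) rfl
  push_cast
  ring

lemma eq_of_eventuallyEq_phase {k : Fin m} {f : ℂ → ℂ} (hf : ContinuousAt f (S.a k)) {l : ℂ}
    (hfe : ∀ᶠ x : ℝ in 𝓝[>] 0, f (S.a k * e x) = Complex.exp (((π * S.β k : ℝ) : ℂ) * Complex.I) *
      (S.D (S.a k * e x) / conj (S.D (S.a k * e x))))
    (hl : Tendsto (fun s : ℝ => S.D (((1 - s : ℝ) : ℂ) * S.a k) /
      conj (S.D (((1 - s : ℝ) : ℂ) * S.a k))) (𝓝[>] 0) (𝓝 l)) : f (S.a k) = l := by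
  have h1 := S.tendsto_circle k
  rw [tendsto_nhds_unique hl (S.tendsto_D_div_conj_radial k)]
  exact tendsto_nhds_unique ((hf.tendsto.comp h1).congr' hfe) (S.tendsto_D_div_conj_circle k)

end SData

end OPUC

namespace OPUC

open scoped ComplexConjugate Topology NNReal ENNReal
open Asymptotics

namespace SData

variable {m : ℕ} (S : SData m)

lemma ops_meas {Φ : ℕ → ℂ[X]} (hm : ∀ n, (Φ n).Monic) (hd : ∀ n, (Φ n).natDegree = n)
    (ho : ∀ n, ∀ j < n, ∫ θ in (0 : ℝ)..2 * π, (Φ n).eval (e θ) * conj (e θ) ^ j * (S.W (e θ) : ℂ) = 0) :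
    OPS S.meas Φ where
  finite := inferInstance
  supp := S.ae_meas
  nondeg := S.meas_nondeg
  monic := hm
  natDegree := hd
  orth n j hj := by
    have hc : Continuous fun t : ℂ => (Φ n).eval t * conj t ^ j :=
      (Φ n).continuous.mul (Complex.continuous_conj.pow j)
    rw [S.integral_meas (S.aestronglyMeasurable hc.continuousOn), ← ho n j hj]
    refine intervalIntegral.integral_congr fun θ _ => ?_
    rw [Complex.real_smul, mul_comm]

/-- Schwarz's formula outside the disk. -/
lemma integral_log_W_exterior {z : ℂ} (hz : 1 < ‖z‖) :
    ∫ θ in (0 : ℝ)..2 * π, (Real.log (S.W (e θ)) : ℂ) * ((e θ + z) / (e θ - z)) =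
      -(4 * π * conj (S.logD (conj z)⁻¹)) := by
  have hz0 : z ≠ 0 := norm_pos_iff.1 (zero_lt_one.trans hz)
  have hz' : ‖(conj z)⁻¹‖ < 1 := by
    rw [norm_inv, Complex.norm_conj]
    exact inv_lt_one_of_one_lt₀ hz
  have h := congrArg conj (S.integral_log_W hz')
  rw [← intervalIntegral.intervalIntegral_conj] at h
  simp only [map_mul, Complex.conj_ofReal, Complex.conj_ofNat] at h
  rw [← h, ← intervalIntegral.integral_neg]
  refine intervalIntegral.integral_congr fun θ _ => ?_
  rw [← mul_neg]
  congr 1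
  have h0 := ne_zero_of_norm_one (norm_e θ)
  have h1 : e θ - z ≠ 0 := fun h => by
    rw [← sub_eq_zero.1 h, norm_e] at hz; exact lt_irrefl _ hz
  have h2 : z - e θ ≠ 0 := fun h => h1 (by rw [← neg_sub, h, neg_zero])
  simp only [map_div₀, map_add, map_sub, map_inv₀, Complex.conj_conj]
  rw [conj_eq_inv (norm_e θ)]
  have h3 : (e θ)⁻¹ + z⁻¹ = (e θ + z) / (e θ * z) := by field_simp; ring
  have h4 : (e θ)⁻¹ - z⁻¹ = -(e θ - z) / (e θ * z) := by field_simp; ring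
  rw [h3, h4, div_div_div_cancel_right₀ (mul_ne_zero h0 hz0), div_neg, neg_neg]

lemma exp_integral_log_W {z : ℂ} (hz : ‖z‖ < 1) :
    Complex.exp (((4 * π : ℝ)⁻¹ : ℂ) * ∫ θ in (0 : ℝ)..2 * π,
      (Real.log (S.W (e θ)) : ℂ) * ((e θ + z) / (e θ - z))) = S.D z := by
  have hp : (π : ℂ) ≠ 0 := Complex.ofReal_ne_zero.2 Real.pi_ne_zero
  rw [S.integral_log_W hz, D]
  congr 1
  push_cast
  field_simp

lemma exp_integral_log_W_exterior {z : ℂ} (hz : 1 < ‖z‖) :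
    Complex.exp (((4 * π : ℝ)⁻¹ : ℂ) * ∫ θ in (0 : ℝ)..2 * π,
      (Real.log (S.W (e θ)) : ℂ) * ((e θ + z) / (e θ - z))) = (conj (S.D (conj z)⁻¹))⁻¹ := by
  have hp : (π : ℂ) ≠ 0 := Complex.ofReal_ne_zero.2 Real.pi_ne_zero
  rw [S.integral_log_W_exterior hz, D, ← Complex.exp_conj, ← Complex.exp_neg]
  congr 1
  push_cast
  field_simp

lemma eq_D_of_continuousWithinAt {f : ℂ → ℂ} {U : Set ℂ} {t : ℂ} (ht : ‖t‖ = 1)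
    (hta : ∀ k, t ≠ S.a k) (hU : ball 0 1 ⊆ U) (hf : ContinuousWithinAt f U t)
    (hfD : ∀ z : ℂ, ‖z‖ < 1 → f z = S.D z) : f t = S.D t := by
  have hlt : ∀ᶠ r : ℝ in 𝓝[<] 1, ‖(r : ℂ) * t‖ < 1 := by
    filter_upwards [Ioo_mem_nhdsLT (zero_lt_one' ℝ)] with r hr
    rw [norm_mul, ht, mul_one, Complex.norm_of_nonneg hr.1.le]
    exact hr.2
  have h1 : Tendsto (fun r : ℝ => (r : ℂ) * t) (𝓝[<] 1) (𝓝[U] t) :=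
    tendsto_nhdsWithin_iff.2 ⟨tendsto_radial continuousAt_id,
      hlt.mono fun r hr => hU (mem_ball_zero_iff.2 hr)⟩
  refine tendsto_nhds_unique (hf.tendsto.comp h1) ((tendsto_radial
    (S.D_differentiableAt ht.le hta).continuousAt).congr' ?_)
  filter_upwards [hlt] with r hr using (hfD _ hr).symm

lemma eq_inv_conj_D_of_continuousWithinAt {f : ℂ → ℂ} {U : Set ℂ} {t : ℂ} (ht : ‖t‖ = 1)
    (hta : ∀ k, t ≠ S.a k) (hU : {z : ℂ | 1 < ‖z‖} ⊆ U) (hf : ContinuousWithinAt f U t)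
    (hfD : ∀ z : ℂ, 1 < ‖z‖ → f z = (conj (S.D (conj z)⁻¹))⁻¹) : f t = (conj (S.D t))⁻¹ := by
  have hlt : ∀ᶠ r : ℝ in 𝓝[<] 1, 1 < ‖((r : ℂ) * conj t)⁻¹‖ := by
    filter_upwards [Ioo_mem_nhdsLT (zero_lt_one' ℝ)] with r hr
    rw [norm_inv, norm_mul, Complex.norm_conj, ht, mul_one, Complex.norm_of_nonneg hr.1.le]
    exact (one_lt_inv₀ hr.1).2 hr.2
  have ht' : ‖conj t‖ = 1 := by rw [Complex.norm_conj, ht]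
  have hct : (conj t)⁻¹ = t := by rw [conj_eq_inv ht, inv_inv]
  have h1 : Tendsto (fun r : ℝ => ((r : ℂ) * conj t)⁻¹) (𝓝[<] 1) (𝓝[U] t) := by
    refine tendsto_nhdsWithin_iff.2 ⟨?_, hlt.mono fun r hr => hU hr⟩
    have := tendsto_radial (continuousAt_inv₀ (ne_zero_of_norm_one ht'))
    rwa [hct] at this
  have hD := S.D_differentiableAt ht.le hta |>.continuousAt
  have h2 := ((Complex.continuous_conj.tendsto _).comp (tendsto_radial hD)).inv₀
    ((_root_.map_ne_zero _).2 (S.D_ne_zero t))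
  refine tendsto_nhds_unique (hf.tendsto.comp h1) (h2.congr' ?_)
  filter_upwards [hlt] with r hr
  simp only [Function.comp_apply]
  rw [hfD _ hr]
  simp [Complex.conj_ofReal]

end SData

end OPUC

namespace OPUC

open scoped ComplexConjugate Topology NNReal ENNReal
open Asymptotics

lemma arg_e {x : ℝ} (hx : x ∈ Ioo 0 π) : Complex.arg (e x) = x := by
  rw [e, Complex.arg_exp_mul_I, toIocMod_eq_self]
  constructor <;> linarith [hx.1, hx.2]

namespace SData

variable {m : ℕ} (S : SData m)

lemma eventually_circle_ne (k : Fin m) : ∀ᶠ x : ℝ in 𝓝[>] 0, ∀ j, S.a k * e x ≠ S.a j := by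
  rw [eventually_all]
  intro j
  by_cases hjk : j = k
  · subst hjk
    filter_upwards [Ioo_mem_nhdsGT Real.pi_pos] with x hx h
    have h2 : e x = 1 := mul_left_cancel₀ (ne_zero_of_norm_one (S.norm_a j)) (h.trans (mul_one _).symm)
    have h3 := arg_e hx
    rw [h2, Complex.arg_one] at h3
    exact hx.1.ne h3
  · exact (S.tendsto_circle k).eventually_ne fun h => hjk (S.inj h).symm

end SData

lemma image_Ico_norm_ge {a : ℂ} (ha : ‖a‖ = 1) {z : ℂ} {c : ℝ}
    (h : z ∈ (fun t : ℝ => (t : ℂ) * a) '' Set.Ico 1 c) : 1 ≤ ‖z‖ ∧ (‖z‖ = 1 → z = a) := by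
  obtain ⟨t, ht, rfl⟩ := h
  have h1 : ‖(t : ℂ) * a‖ = t := by
    rw [norm_mul, ha, mul_one, Complex.norm_of_nonneg (by linarith [ht.1])]
  beta_reduce
  rw [h1]
  exact ⟨ht.1, fun h => by rw [h, Complex.ofReal_one, one_mul]⟩

lemma image_Ioc_norm_le {a : ℂ} (ha : ‖a‖ = 1) {z : ℂ} {c : ℝ} (hc : 0 < c)
    (h : z ∈ (fun t : ℝ => (t : ℂ) * a) '' Set.Ioc c 1) : ‖z‖ ≤ 1 ∧ (‖z‖ = 1 → z = a) := by
  obtain ⟨t, ht, rfl⟩ := h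
  have h1 : ‖(t : ℂ) * a‖ = t := by
    rw [norm_mul, ha, mul_one, Complex.norm_of_nonneg (by linarith [ht.1])]
  beta_reduce
  rw [h1]
  exact ⟨ht.2, fun h => by rw [h, Complex.ofReal_one, one_mul]⟩

end OPUC

theorem stmt0
    (ρ : ℝ) (hρ0 : 0 < ρ) (hρ1 : ρ < 1)
    (m : ℕ) (hm : 0 < m)
    (a : Fin m → ℂ) (ha : ∀ k, ‖a k‖ = 1) (ha' : Function.Injective a)
    (β : Fin m → ℝ) (hβ : ∀ k, -(1/2 : ℝ) < β k)
    (w : ℂ → ℂ)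
    (hw_an : AnalyticOn ℂ w {z : ℂ | ρ < ‖z‖ ∧ ‖z‖ < 1/ρ})
    (hw_ne : ∀ z : ℂ, ρ < ‖z‖ → ‖z‖ < 1/ρ → w z ≠ 0)
    (hw_pos : ∀ z : ℂ, ‖z‖ = 1 → 0 < (w z).re ∧ (w z).im = 0)
    (W : ℂ → ℝ)
    (hW : ∀ z : ℂ, ‖z‖ = 1 → W z = (w z).re * ∏ k, ‖z - a k‖ ^ (2 * β k))
    (Φ : ℕ → Polynomial ℂ)
    (hΦmonic : ∀ n, (Φ n).Monic) (hΦdeg : ∀ n, (Φ n).natDegree = n)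
    (hΦorth : ∀ n : ℕ, ∀ j < n,
      (∫ θ in (0:ℝ)..(2 * π),
        (Φ n).eval (Complex.exp (θ * Complex.I)) *
          (starRingEnd ℂ) (Complex.exp (θ * Complex.I)) ^ j *
          (W (Complex.exp (θ * Complex.I)) : ℂ)) = 0)
    (Di De : ℂ → ℂ)
    (hDi_def : ∀ z : ℂ, ‖z‖ < 1 → Di z =
      Complex.exp (((4 * π : ℝ)⁻¹ : ℂ) * ∫ θ in (0:ℝ)..(2 * π),
        (Real.log (W (Complex.exp (θ * Complex.I))) : ℂ) *
          ((Complex.exp (θ * Complex.I) + z) / (Complex.exp (θ * Complex.I) - z))))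
    (hDe_def : ∀ z : ℂ, 1 < ‖z‖ → De z =
      Complex.exp (((4 * π : ℝ)⁻¹ : ℂ) * ∫ θ in (0:ℝ)..(2 * π),
        (Real.log (W (Complex.exp (θ * Complex.I))) : ℂ) *
          ((Complex.exp (θ * Complex.I) + z) / (Complex.exp (θ * Complex.I) - z))))
    (hDi_an : AnalyticOn ℂ Di
      ({z : ℂ | ‖z‖ < 1/ρ} \ ⋃ k, (fun t : ℝ => (t : ℂ) * a k) '' Set.Ico 1 (1/ρ)))
    (hDe_an : AnalyticOn ℂ De
      ({z : ℂ | ρ < ‖z‖} \ ⋃ k, (fun t : ℝ => (t : ℂ) * a k) '' Set.Ioc ρ 1))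
    (δ : ℝ) (hδ0 : 0 < δ) (hδρ : δ < 1 - ρ)
    (hδa : ∀ i j : Fin m, i ≠ j → 3 * δ < ‖a i - a j‖)
    (Sk : Fin m → ℂ → ℂ)
    (hSk_an : ∀ k, AnalyticOn ℂ (Sk k) (Metric.ball (a k) δ))
    (hSk_plus : ∀ k, ∀ z ∈ Metric.ball (a k) δ, 0 < Complex.arg (z / a k) →
      Sk k z = Complex.exp (((π * β k : ℝ) : ℂ) * Complex.I) * (Di z * De z))
    (hSk_minus : ∀ k, ∀ z ∈ Metric.ball (a k) δ, Complex.arg (z / a k) < 0 →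
      Sk k z = Complex.exp (-((π * β k : ℝ) : ℂ) * Complex.I) * (Di z * De z))
    (ϑ : Fin m → ℂ) (hϑ : ∀ k, ϑ k = Sk k (a k))
    :
    ∀ K : Set ℂ, IsCompact K → K ⊆ Metric.ball (0 : ℂ) 1 →
      ∃ C : ℝ, 0 < C ∧ ∃ N : ℕ, ∃ E : ℕ → ℂ → ℂ,
        (∀ n : ℕ, N ≤ n → ∀ z ∈ K, ‖E n z‖ ≤ C / (n : ℝ)) ∧
        (∀ n : ℕ, N ≤ n → ∀ z ∈ K,
          (Φ n).eval z = (Di 0 / Di z) * ((n : ℂ))⁻¹ *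
            ((∑ k, (β k : ℂ) * ϑ k * (a k) ^ (n + 1) / (a k - z)) + E n z)) := by

  have hρ' : 1 < 1 / ρ := by rw [lt_div_iff₀ hρ0]; linarith
  have hopen : IsOpen {z : ℂ | ρ < ‖z‖ ∧ ‖z‖ < 1/ρ} :=
    (isOpen_lt continuous_const continuous_norm).inter (isOpen_lt continuous_norm continuous_const)
  obtain ⟨R, hR1, hR2⟩ := exists_between hρ'
  obtain ⟨L, hL0, hLb, hL⟩ := OPUC.exists_log_eq hR1 hR2
    (fun z h1 h2 => (hopen.analyticOn_iff_analyticOnNhd.1 hw_an) z ⟨hρ1.trans_le h1, h2⟩)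
    (fun z h1 h2 => hw_ne z (hρ1.trans_le h1) h2) hw_pos
  let S : OPUC.SData m := ⟨a, β, L, R, ha, ha', hβ, hR1, hL0, hLb⟩
  have hWS (t : ℂ) (ht : ‖t‖ = 1) : W t = S.W t := by
    rw [hW t ht, OPUC.SData.W]
    congr 1
    rw [← Real.exp_log (hw_pos t ht).1, hL t ht]
    rfl
  have hWe (θ : ℝ) : W (Complex.exp (θ * Complex.I)) = S.W (OPUC.e θ) := hWS _ (OPUC.norm_e θ)
  have H : OPUC.OPS S.meas Φ := S.ops_meas hΦmonic hΦdeg fun n j hj => by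
    rw [← hΦorth n j hj]
    simp only [hWe]
    rfl
  have hDi (z : ℂ) (hz : ‖z‖ < 1) : Di z = S.D z := by
    rw [hDi_def z hz, ← S.exp_integral_log_W hz]
    simp only [hWe]
    rfl
  have hDe (z : ℂ) (hz : 1 < ‖z‖) : De z = (starRingEnd ℂ (S.D (starRingEnd ℂ z)⁻¹))⁻¹ := by
    rw [hDe_def z hz, ← S.exp_integral_log_W_exterior hz]
    simp only [hWe]
    rfl
  have hcirc (t : ℂ) (ht : ‖t‖ = 1) (hta : ∀ k, t ≠ a k) :
      Di t * De t = S.D t / starRingEnd ℂ (S.D t) := by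
    have h1 : Di t = S.D t := by
      refine S.eq_D_of_continuousWithinAt ht hta ?_ (hDi_an t ?_).continuousWithinAt hDi
      · intro z hz
        rw [mem_ball_zero_iff] at hz
        refine ⟨hz.trans hρ', fun hz' => ?_⟩
        obtain ⟨k, hk⟩ := mem_iUnion.1 hz'
        exact absurd hz (OPUC.image_Ico_norm_ge (ha k) hk).1.not_gt
      · refine ⟨ht.trans_lt hρ', fun hz' => ?_⟩
        obtain ⟨k, hk⟩ := mem_iUnion.1 hz'
        exact hta k ((OPUC.image_Ico_norm_ge (ha k) hk).2 ht)
    have h2 : De t = (starRingEnd ℂ (S.D t))⁻¹ := by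
      refine S.eq_inv_conj_D_of_continuousWithinAt ht hta ?_ (hDe_an t ?_).continuousWithinAt hDe
      · intro z hz
        refine ⟨hρ1.trans hz, fun hz' => ?_⟩
        obtain ⟨k, hk⟩ := mem_iUnion.1 hz'
        exact absurd hz (OPUC.image_Ioc_norm_le (ha k) hρ0 hk).1.not_gt
      · refine ⟨hρ1.trans_eq ht.symm, fun hz' => ?_⟩
        obtain ⟨k, hk⟩ := mem_iUnion.1 hz'
        exact hta k ((OPUC.image_Ioc_norm_le (ha k) hρ0 hk).2 ht)
    rw [h1, h2, div_eq_mul_inv]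
  choose l hl hlt using S.exists_ph_limit_radial H
  have hϑl (k : Fin m) : ϑ k = l k := by
    rw [hϑ k]
    have hball : Metric.ball (a k) δ ∈ nhds (a k) := Metric.ball_mem_nhds _ hδ0
    have hcont : ContinuousAt (Sk k) (a k) :=
      ((hSk_an k).continuousOn.continuousAt hball)
    refine S.eq_of_eventuallyEq_phase (k := k) hcont ?_ (hlt k)
    filter_upwards [S.eventually_circle_ne k, S.tendsto_circle k hball,
      Ioo_mem_nhdsGT Real.pi_pos] with x hx1 hx2 hx3
    have hn : ‖S.a k * OPUC.e x‖ = 1 := by rw [norm_mul, S.norm_a, OPUC.norm_e, one_mul]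
    have ha0 : a k ≠ 0 := OPUC.ne_zero_of_norm_one (ha k)
    have harg : 0 < Complex.arg (S.a k * OPUC.e x / a k) := by
      rw [show S.a k * OPUC.e x / a k = OPUC.e x from mul_div_cancel_left₀ _ ha0, OPUC.arg_e hx3]
      exact hx3.1
    rw [hSk_plus k _ hx2 harg, hcirc _ hn hx1]
  intro K hK hK1
  obtain ⟨r, hr0, hr1, hKr⟩ : ∃ r : ℝ, 0 ≤ r ∧ r < 1 ∧ ∀ z ∈ K, ‖z‖ ≤ r := by
    rcases K.eq_empty_or_nonempty with rfl | hne
    · exact ⟨0, le_rfl, one_pos, fun z hz => absurd hz (notMem_empty z)⟩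
    · obtain ⟨z₀, hz₀, hmax⟩ := hK.exists_isMaxOn hne continuous_norm.continuousOn
      exact ⟨‖z₀‖, norm_nonneg _, mem_ball_zero_iff.1 (hK1 hz₀), fun z hz => hmax hz⟩
  obtain ⟨C, hC0, hC⟩ := S.exists_norm_mul_eval_sub_le H hl hr0 hr1
  obtain ⟨M, hM0, hM⟩ := S.exists_D_bounds hr1
  obtain ⟨N, hN⟩ := eventually_atTop.1 (hC.and (eventually_ge_atTop 1))
  have hD0 := S.D0_pos
  have hDi0 : Di 0 = (S.D0 : ℂ) := by rw [hDi 0 (by simp), S.D_zero]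
  have hD0' : (S.D0 : ℂ) ≠ 0 := Complex.ofReal_ne_zero.2 hD0.ne'
  refine ⟨M / S.D0 * (C + 1), by positivity, N, fun n z => S.D z / S.D0 * (n * (Φ n).eval z) -
    ∑ k, (β k : ℂ) * ϑ k * (a k) ^ (n + 1) / (a k - z), ?_, ?_⟩
  · intro n hn z hz
    have h1 := (hN n hn).1 z (hKr z hz)
    have h2 : S.D z / S.D0 * (n * (Φ n).eval z) -
        ∑ k, (β k : ℂ) * ϑ k * (a k) ^ (n + 1) / (a k - z) = S.D z / S.D0 *
        (n * (Φ n).eval z - S.lim z * ∑ k, S.β k * l k * S.a k ^ (n + 1) / (S.a k - z)) := by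
      have h3 := S.D_ne_zero z
      have h4 : S.D z / S.D0 * S.lim z = 1 := by
        rw [OPUC.SData.lim]
        field_simp
      simp only [hϑl]
      rw [mul_sub, ← mul_assoc _ (S.lim z), h4, one_mul]
    beta_reduce
    rw [h2, norm_mul, norm_div, Complex.norm_of_nonneg hD0.le, mul_div_assoc]
    have h5 := (hM z (hKr z hz)).1
    have h6 : C / n ≤ (C + 1) / n := by gcongr; linarith
    exact mul_le_mul (div_le_div_of_nonneg_right h5 hD0.le) (h1.trans h6) (norm_nonneg _)
      (by positivity)
  · intro n hn z hz
    have hn0 : (n : ℂ) ≠ 0 := Nat.cast_ne_zero.2 (Nat.one_le_iff_ne_zero.1 (hN n hn).2)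
    have h3 := S.D_ne_zero z
    rw [hDi0, hDi z ((hKr z hz).trans_lt hr1)]
    beta_reduce
    rw [add_sub_cancel]
    field_simp
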